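/- Every compact connected real surface is homeomorphic to either the 2-sphere, a connected sum of finitely many tori, or a connected sum of finitely many real projective planes. -/

import Mathlib

noncomputable section
open Metric Set Topology

/-- The model plane. -/
abbrev E2 := EuclideanSpace ℝ (Fin 2)

/-- The closed unit disc in the plane. -/
def Disc : Set E2 := Metric.closedBall 0 1

/-- A (compact connected) real surface: a compact connected Hausdorff space which is
locally homeomorphic to the plane. -/
def IsSurface (X : Type*) [TopologicalSpace X] : Prop :=
  T2Space X ∧ CompactSpace X ∧ ConnectedSpace X ∧
    ∀ x : X, ∃ U : Set X, IsOpen U ∧ x ∈ U ∧ Nonempty (U ≃ₜ E2)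

/-- The complement in `X` of the image of the open unit disc under a parametrized disc
`f : Disc → X`. -/
def discCompl {X : Type*} (f : Disc → X) : Set X :=
  {x | x ∉ f '' {d : Disc | dist (d : E2) 0 < 1}}

/-- The gluing relation for the connected sum: a boundary point of the disc removed from `X`
is identified with the corresponding boundary point of the disc removed from `Y`. -/
def glueRel {X Y : Type*} (f : Disc → X) (g : Disc → Y) :
    (discCompl f ⊕ discCompl g) → (discCompl f ⊕ discCompl g) → Prop :=
  fun a b => ∃ s : Disc, dist (s : E2) 0 = 1 ∧
    Sum.elim (fun x : discCompl f => (x : X) = f s) (fun _ : discCompl g => False) a ∧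
    Sum.elim (fun _ : discCompl f => False) (fun y : discCompl g => (y : Y) = g s) b

/-- The connected sum of `X` and `Y` along embedded discs `f`, `g`: remove the open discs
and glue the boundary circles. -/
def ConnSumSpace {X Y : Type*} [TopologicalSpace X] [TopologicalSpace Y]
    (f : Disc → X) (g : Disc → Y) : Type _ :=
  Quot (glueRel f g)

instance {X Y : Type*} [TopologicalSpace X] [TopologicalSpace Y]
    (f : Disc → X) (g : Disc → Y) : TopologicalSpace (ConnSumSpace f g) := by
  unfold ConnSumSpace; infer_instance

/-- The 2-sphere. -/
def Sphere2 : Type := Metric.sphere (0 : EuclideanSpace ℝ (Fin 3)) 1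

instance : TopologicalSpace Sphere2 := by unfold Sphere2; infer_instance

/-- The real projective plane. -/
def RP2 : Type := Projectivization ℝ (EuclideanSpace ℝ (Fin 3))

instance : TopologicalSpace RP2 := by
  unfold RP2 Projectivization; infer_instance

/-- The torus `S¹ × S¹`. -/
def Torus : Type := Circle × Circle

instance : TopologicalSpace Torus := by unfold Torus; infer_instance

/-- `Z` is a connected sum of `X` and `Y`: there are embedded discs in `X` and `Y` such that
`Z` is homeomorphic to the result of removing the open discs and gluing the boundaries. -/
def IsConnSum (Z X Y : Type) [TopologicalSpace Z] [TopologicalSpace X] [TopologicalSpace Y] :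
    Prop :=
  ∃ (f : Disc → X) (g : Disc → Y), IsEmbedding f ∧ IsEmbedding g ∧
    Nonempty (Z ≃ₜ ConnSumSpace f g)

/-- `Z` is a connected sum of `n` copies of `B` (for `n ≥ 1`). -/
def IsConnSumOfCopies (B : Type) [TopologicalSpace B] :
    ℕ → (Z : Type) → TopologicalSpace Z → Prop
  | 0, _, _ => False
  | 1, Z, tZ => Nonempty (@Homeomorph Z B tZ _)
  | (n + 2), Z, tZ => ∃ (W : Type) (tW : TopologicalSpace W),
      IsConnSumOfCopies B (n + 1) W tW ∧ @IsConnSum Z W B tZ tW _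

namespace CS
open Complex Bornology Relation Function
open scoped Real ComplexConjugate
set_option linter.unusedSectionVars false

/-! ### Part A: logarithms and separation in the plane -/

theorem frontier_comp_subset {Y : Type*} [TopologicalSpace Y] [LocallyConnectedSpace Y]
    {U : Set Y} (hU : IsOpen U) (p : Y) : frontier (connectedComponentIn U p) ⊆ Uᶜ := by
  intro x hx hxU
  have h1 : connectedComponentIn U x ∈ 𝓝 x := connectedComponentIn_mem_nhds (hU.mem_nhds hxU)
  have hcl : x ∈ closure (connectedComponentIn U p) := frontier_subset_closure hx
  obtain ⟨y, hy1, hy2⟩ := mem_closure_iff_nhds.1 hcl _ h1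
  have e1 := connectedComponentIn_eq hy1
  have e2 := connectedComponentIn_eq hy2
  have hmem : x ∈ connectedComponentIn U p := by
    rw [e2, ← e1]; exact mem_connectedComponentIn hxU
  have : IsOpen (connectedComponentIn U p) := hU.connectedComponentIn
  rw [this.frontier_eq] at hx
  exact hx.2 hmem

theorem preconn_subset_of_frontier {Y : Type*} [TopologicalSpace Y] {S W : Set Y}
    (hS : IsPreconnected S) (hW : IsOpen W) (hne : (S ∩ W).Nonempty)
    (hd : ∀ x ∈ S, x ∉ frontier W) : S ⊆ W := by
  have h := hS W (closure W)ᶜ hW isClosed_closure.isOpen_compl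
  intro x hx
  by_contra hxW
  have hsub : S ⊆ W ∪ (closure W)ᶜ := by
    intro y hy
    by_cases h1 : y ∈ W
    · exact Or.inl h1
    · right; intro h2; exact hd y hy (by rw [hW.frontier_eq]; exact ⟨h2, h1⟩)
  obtain ⟨y, -, hy1, hy2⟩ := h hsub hne ⟨x, hx, (hsub hx).resolve_left hxW⟩
  exact hy2 (subset_closure hy1)

theorem comp_eq_of_preconn {Y : Type*} [TopologicalSpace Y] {S F : Set Y} {p q : Y}
    (hS : IsPreconnected S) (hF : S ⊆ F) (hp : p ∈ S) (hq : q ∈ S) :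
    q ∈ connectedComponentIn F p :=
  hS.subset_connectedComponentIn hp hF hq

/-- A continuous logarithm of `f` on `A`. -/
def HasLog {Y : Type*} [TopologicalSpace Y] (A : Set Y) (f : Y → ℂ) : Prop :=
  ∃ l : Y → ℂ, ContinuousOn l A ∧ ∀ z ∈ A, exp (l z) = f z

theorem HasLog.mono {Y : Type*} [TopologicalSpace Y] {A B : Set Y} {f : Y → ℂ}
    (h : HasLog B f) (hAB : A ⊆ B) : HasLog A f := by
  obtain ⟨l, h1, h2⟩ := h
  exact ⟨l, h1.mono hAB, fun z hz => h2 z (hAB hz)⟩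

theorem HasLog.congr {Y : Type*} [TopologicalSpace Y] {A : Set Y} {f g : Y → ℂ}
    (h : HasLog A f) (hfg : ∀ z ∈ A, f z = g z) : HasLog A g := by
  obtain ⟨l, h1, h2⟩ := h
  exact ⟨l, h1, fun z hz => (h2 z hz).trans (hfg z hz)⟩

theorem HasLog.mul {Y : Type*} [TopologicalSpace Y] {A : Set Y} {f g : Y → ℂ}
    (hf : HasLog A f) (hg : HasLog A g) : HasLog A (fun z => f z * g z) := by
  obtain ⟨l, h1, h2⟩ := hf
  obtain ⟨m, h3, h4⟩ := hg
  exact ⟨fun z => l z + m z, h1.add h3, fun z hz => by rw [exp_add, h2 z hz, h4 z hz]⟩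

theorem HasLog.inv {Y : Type*} [TopologicalSpace Y] {A : Set Y} {f : Y → ℂ}
    (hf : HasLog A f) : HasLog A (fun z => (f z)⁻¹) := by
  obtain ⟨l, h1, h2⟩ := hf
  exact ⟨fun z => - l z, h1.neg, fun z hz => by rw [exp_neg, h2 z hz]⟩

theorem HasLog.comp {Y Z : Type*} [TopologicalSpace Y] [TopologicalSpace Z] {A : Set Y}
    {B : Set Z} {f : Z → ℂ} {g : Y → Z} (hf : HasLog B f) (hg : ContinuousOn g A)
    (hm : MapsTo g A B) : HasLog A (fun z => f (g z)) := by
  obtain ⟨l, h1, h2⟩ := hf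
  exact ⟨fun z => l (g z), h1.comp hg hm, fun z hz => h2 _ (hm hz)⟩

theorem hasLog_of_slit {Y : Type*} [TopologicalSpace Y] {A : Set Y} {f : Y → ℂ}
    (hf : ContinuousOn f A) (h : ∀ z ∈ A, ‖f z - 1‖ < 1) : HasLog A f := by
  have hs : ∀ z ∈ A, f z ∈ slitPlane := fun z hz => by
    have := mem_slitPlane_of_norm_lt_one (h z hz)
    simpa using this
  refine ⟨fun z => log (f z), hf.clog hs, fun z hz => exp_log ?_⟩
  exact slitPlane_ne_zero (hs z hz)

theorem hasLog_const {Y : Type*} [TopologicalSpace Y] {A : Set Y} {c : ℂ} (hc : c ≠ 0) :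
    HasLog A (fun _ => c) :=
  ⟨fun _ => log c, continuousOn_const, fun _ _ => exp_log hc⟩

theorem log_diff_const {Y : Type*} [TopologicalSpace Y] {S : Set Y} (hS : IsPreconnected S)
    {l m : Y → ℂ} (hl : ContinuousOn l S) (hm : ContinuousOn m S)
    (h : ∀ z ∈ S, exp (l z) = exp (m z)) {a b : Y} (ha : a ∈ S) (hb : b ∈ S) :
    l a - m a = l b - m b := by
  have key := isCoveringMap_exp.eqOn_of_comp_eqOn hS
    (g₁ := fun z => l z) (g₂ := fun z => m z + (l a - m a)) hl (hm.add continuousOn_const)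
    (by
      intro z hz
      simp only [Function.comp, Subtype.mk.injEq]
      rw [exp_add, exp_sub, h z hz, h a ha,
        div_self (exp_ne_zero _), mul_one]) ha (by simp)
  have := key hb
  simp only at this
  rw [this]; ring

theorem no_log_circle (p : ℂ) {R : ℝ} (hR : 0 < R) :
    ¬ HasLog (sphere p R) (fun z => z - p) := by
  rintro ⟨l, h1, h2⟩
  let γ : ℝ → ℂ := fun t => p + R * exp (t * I)
  have hγ : Continuous γ := by fun_prop
  have hγm : ∀ t, γ t ∈ sphere p R := fun t => by
    simp [γ, norm_exp_ofReal_mul_I, abs_of_pos hR]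
  have := log_diff_const (S := (univ : Set ℝ)) isPreconnected_univ
    (l := fun t => l (γ t)) (m := fun t => (Real.log R : ℂ) + t * I)
    ((h1.comp hγ.continuousOn (fun t _ => hγm t))) (by fun_prop)
    (by
      intro t _
      rw [h2 _ (hγm t), exp_add, ← ofReal_exp, Real.exp_log hR]
      simp [γ]) (mem_univ (0 : ℝ)) (mem_univ (2 * π))
  have e : γ (2 * π) = γ 0 := by
    simp [γ]
  simp only [e] at this
  have h3 : (2 * π : ℂ) * I = 0 := by
    push_cast at this
    linear_combination this
  have := two_pi_I_ne_zero
  exact this h3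

theorem hasLog_ratio_of_preconn {A S : Set ℂ} (hA : IsClosed A) (hS : IsPreconnected S)
    (hSA : S ⊆ Aᶜ) {p q : ℂ} (hp : p ∈ S) (hq : q ∈ S) :
    HasLog A (fun z => (z - p) / (z - q)) := by
  have near : ∀ x ∈ S, ∃ r > 0, ∀ y, dist y x < r → HasLog A (fun z => (z - x) / (z - y)) ∧
      HasLog A (fun z => (z - y) / (z - x)) := by
    intro x hx
    obtain ⟨r, hr, hrA⟩ := isOpen_iff.1 hA.isOpen_compl x (hSA hx)
    have hz : ∀ z ∈ A, r ≤ ‖z - x‖ := fun z hz => by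
      by_contra hlt
      exact hrA (by rw [mem_ball, dist_eq_norm]; exact not_le.1 hlt) hz
    refine ⟨r, hr, fun y hy => ?_⟩
    have h2 : HasLog A (fun z => (z - y) / (z - x)) := by
      apply hasLog_of_slit
      · refine ContinuousOn.div (by fun_prop) (by fun_prop) fun z hzA h0 => ?_
        have := hz z hzA
        rw [h0, norm_zero] at this; linarith
      · intro z hzA
        have h3 := hz z hzA
        have h0 : z - x ≠ 0 := by
          intro h0; rw [h0, norm_zero] at h3; linarith
        have : (z - y) / (z - x) - 1 = (x - y) / (z - x) := by field_simp; ring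
        rw [this, norm_div, div_lt_one (by linarith)]
        rw [dist_comm, dist_eq_norm] at hy; linarith
    refine ⟨h2.inv.congr fun z _ => by simp, h2⟩
  refine hS.induction₂' (fun x y => HasLog A (fun z => (z - x) / (z - y))) ?_ ?_ hp hq
  · intro x hx
    obtain ⟨r, hr, h⟩ := near x hx
    filter_upwards [mem_nhdsWithin_of_mem_nhds (ball_mem_nhds x hr)] with y hy
    exact h y hy
  · intro x y z hx hy hz h1 h2
    refine (h1.mul h2).congr fun w hw => ?_
    have : w - y ≠ 0 := sub_ne_zero.2 fun h => hSA hy (h ▸ hw)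
    field_simp

theorem hasLog_sub_of_unbounded {A S : Set ℂ} (hA : IsCompact A) (hS : IsPreconnected S)
    (hSA : S ⊆ Aᶜ) {p : ℂ} (hp : p ∈ S) (hu : ¬ IsBounded S) :
    HasLog A (fun z => z - p) := by
  obtain ⟨R, hR⟩ := hA.isBounded.subset_closedBall 0
  have : ∃ q ∈ S, max R 0 < ‖q‖ := by
    by_contra hcon
    push Not at hcon
    exact hu ((isBounded_closedBall (x := (0 : ℂ)) (r := max R 0)).subset
      (fun q hq => by simpa using hcon q hq))
  obtain ⟨q, hqS, hq⟩ := this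
  have hq0 : q ≠ 0 := by
    rintro rfl; simp at hq
  have h1 := hasLog_ratio_of_preconn hA.isClosed hS hSA hp hqS
  have h2 : HasLog A (fun z => 1 - z / q) := by
    apply hasLog_of_slit (by fun_prop)
    intro z hz
    have := hR hz
    rw [mem_closedBall_zero_iff] at this
    simp only [sub_sub_cancel_left, norm_neg, norm_div]
    rw [div_lt_one (by positivity)]
    grind
  have h3 : HasLog A (fun _ => -q) := hasLog_const (neg_ne_zero.2 hq0)
  refine ((h1.mul h2).mul h3).congr fun z hz => ?_
  have : z - q ≠ 0 := sub_ne_zero.2 fun h => hSA hqS (h ▸ hz)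
  field_simp
  ring

theorem hasLog_of_continuous {f : ℂ → ℂ} (hf : Continuous f) (h0 : ∀ z, f z ≠ 0) :
    HasLog univ f := by
  have hs : IsSimplyConnected (univ : Set ℂ) := by
    have : ContractibleSpace (univ : Set ℂ) := (Homeomorph.Set.univ ℂ).contractibleSpace
    exact (inferInstance : SimplyConnectedSpace (univ : Set ℂ))
  obtain ⟨l, h1, h2⟩ := exists_continuousOn_eqOn_exp_comp hs isOpen_univ
    hf.continuousOn (by rintro ⟨z, -, hz⟩; exact h0 z hz)
  exact ⟨l, h1, h2⟩

theorem no_log_bdd {W A : Set ℂ} (hb : IsBounded W) {p : ℂ}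
    (hp : p ∈ W) (hA : frontier W ⊆ A) {k : ℂ → ℂ} (hk : ContinuousOn k (closure W))
    (hk0 : ∀ z ∈ closure W, k z ≠ 0) : ¬ HasLog A (fun z => (z - p) * k z) := by
  intro hlog
  obtain ⟨l, h1, h2⟩ := hlog.mono hA
  obtain ⟨L, hL⟩ := ContinuousMap.exists_restrict_eq (isClosed_frontier (s := W))
    (⟨_, continuousOn_iff_continuous_domRestrict.1 h1⟩ : C(frontier W, ℂ))
  have hL' : ∀ z ∈ frontier W, L z = l z := fun z hz => by
    have := congrArg (fun F => F ⟨z, hz⟩) hL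
    simpa using this
  classical
  let Φ : ℂ → ℂ := W.piecewise (fun z => exp (L z) / k z) (fun z => z - p)
  have hΦ : Continuous Φ := by
    apply continuous_piecewise
    · intro z hz
      rw [hL' z hz, h2 z hz, mul_div_cancel_right₀ _ (hk0 z (frontier_subset_closure hz))]
    all_goals fun_prop
  have hΦ0 : ∀ z, Φ z ≠ 0 := by
    intro z
    by_cases hz : z ∈ W
    · simp only [Φ, piecewise_eq_of_mem _ _ _ hz]
      exact div_ne_zero (exp_ne_zero _) (hk0 z (subset_closure hz))
    · simp only [Φ, piecewise_eq_of_notMem _ _ _ hz]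
      exact sub_ne_zero.2 fun h => hz (h ▸ hp)
  obtain ⟨R, hR⟩ := hb.subset_ball p
  have hR0 : 0 < R := dist_nonneg.trans_lt (hR hp)
  refine no_log_circle p hR0 (((hasLog_of_continuous hΦ hΦ0).mono (subset_univ _)).congr ?_)
  intro z hz
  have : z ∉ W := fun h => by
    have h1 := hR h
    rw [mem_sphere] at hz; rw [mem_ball, hz] at h1; exact lt_irrefl _ h1
  simp only [Φ, piecewise_eq_of_notMem _ _ _ this]

theorem isPreconnected_exterior {R : ℝ} (hR : 0 < R) : IsPreconnected {z : ℂ | R < ‖z‖} := by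
  have h1 : IsPreconnected {z : ℂ | Real.log R < z.re} :=
    (convex_halfSpace_re_gt _).isPreconnected
  have := h1.image exp continuous_exp.continuousOn
  convert this using 1
  ext z
  constructor
  · intro hz
    have hz' : R < ‖z‖ := hz
    have h0 : z ≠ 0 := by rintro rfl; simp at hz'; linarith
    refine ⟨log z, ?_, exp_log h0⟩
    simp only [mem_ofPred_eq, log_re]
    exact Real.log_lt_log hR hz'
  · rintro ⟨w, hw, rfl⟩
    simp only [mem_ofPred_eq, norm_exp]
    rw [← Real.exp_log hR]
    exact Real.exp_lt_exp.2 hw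

theorem unbounded_comp_unique {A : Set ℂ} (hA : IsCompact A) {p q : ℂ}
    (h1 : ¬ IsBounded (connectedComponentIn Aᶜ p))
    (h2 : ¬ IsBounded (connectedComponentIn Aᶜ q)) :
    q ∈ connectedComponentIn Aᶜ p := by
  obtain ⟨R, hR⟩ := hA.isBounded.subset_closedBall 0
  have hE : IsPreconnected {z : ℂ | max R 1 < ‖z‖} := isPreconnected_exterior (by positivity)
  have hEA : {z : ℂ | max R 1 < ‖z‖} ⊆ Aᶜ := fun z hz hzA => by
    have := hR hzA
    rw [mem_closedBall_zero_iff] at this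
    grind
  have meet : ∀ p, ¬ IsBounded (connectedComponentIn Aᶜ p) →
      ∃ z ∈ connectedComponentIn Aᶜ p, max R 1 < ‖z‖ := by
    intro p hp
    by_contra hcon
    push Not at hcon
    exact hp ((isBounded_closedBall (x := (0 : ℂ)) (r := max R 1)).subset
      (fun q hq => by simpa using hcon q hq))
  obtain ⟨z, hz1, hz2⟩ := meet p h1
  obtain ⟨w, hw1, hw2⟩ := meet q h2
  have hzw := comp_eq_of_preconn hE hEA hz2 hw2
  have e1 := connectedComponentIn_eq hz1
  have e2 := connectedComponentIn_eq hw1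
  have e3 := connectedComponentIn_eq hzw
  rw [e1, e3, ← e2]
  apply mem_connectedComponentIn
  by_contra hqA
  rw [connectedComponentIn_eq_empty hqA] at hw1
  exact hw1

theorem same_comp_of_hasLog {A : Set ℂ} (hA : IsCompact A) {p q : ℂ} (hp : p ∉ A) (hq : q ∉ A)
    (h : HasLog A (fun z => (z - p) / (z - q))) : q ∈ connectedComponentIn Aᶜ p := by
  have aux : ∀ p q : ℂ, p ∉ A → q ∉ A → HasLog A (fun z => (z - p) / (z - q)) →
      IsBounded (connectedComponentIn Aᶜ p) → q ∈ connectedComponentIn Aᶜ p := by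
    intro p q hp hq h hb
    by_contra hqW
    have hfr := frontier_comp_subset hA.isClosed.isOpen_compl p
    rw [compl_compl] at hfr
    have hqc : ∀ z ∈ closure (connectedComponentIn Aᶜ p), z - q ≠ 0 := by
      intro z hz
      refine sub_ne_zero.2 ?_
      rintro rfl
      rw [closure_eq_self_union_frontier] at hz
      exact hz.elim hqW (fun h => hq (hfr h))
    exact no_log_bdd hb
      (mem_connectedComponentIn hp) hfr (k := fun z => (z - q)⁻¹)
      (ContinuousOn.inv₀ (by fun_prop) hqc) (fun z hz => inv_ne_zero (hqc z hz))
      (h.congr fun z _ => by simp [div_eq_mul_inv])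
  by_cases hb : IsBounded (connectedComponentIn Aᶜ p)
  · exact aux p q hp hq h hb
  by_cases hb2 : IsBounded (connectedComponentIn Aᶜ q)
  · have := aux q p hq hp (h.inv.congr fun z _ => by simp) hb2
    rw [← connectedComponentIn_eq this]
    exact mem_connectedComponentIn hq
  exact unbounded_comp_unique hA hb hb2

theorem HasLog.union {Y : Type*} [TopologicalSpace Y] {K L : Set Y} (hK : IsClosed K)
    (hL : IsClosed L) (hKL : IsPreconnected (K ∩ L)) {f : Y → ℂ} (h1 : HasLog K f)
    (h2 : HasLog L f) : HasLog (K ∪ L) f := by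
  obtain ⟨l, hl1, hl2⟩ := h1
  obtain ⟨m, hm1, hm2⟩ := h2
  obtain ⟨c, hc1, hc2⟩ : ∃ c : ℂ, exp c = 1 ∧ ∀ z ∈ K ∩ L, l z = m z + c := by
    by_cases hne : (K ∩ L).Nonempty
    · obtain ⟨a, ha⟩ := hne
      refine ⟨l a - m a, ?_, fun z hz => ?_⟩
      · rw [exp_sub, hl2 a ha.1, hm2 a ha.2, ← hl2 a ha.1,
          div_self (exp_ne_zero _)]
      · rw [log_diff_const hKL (hl1.mono inter_subset_left) (hm1.mono inter_subset_right)
          (fun z hz => by rw [hl2 z hz.1, hm2 z hz.2]) ha hz]; ring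
    · exact ⟨0, by simp, fun z hz => (hne ⟨z, hz⟩).elim⟩
  classical
  refine ⟨K.piecewise l (fun z => m z + c), ?_, ?_⟩
  · refine ContinuousOn.union_of_isClosed ?_ ?_ hK hL
    · exact hl1.congr fun z hz => piecewise_eq_of_mem _ _ _ hz
    · refine ContinuousOn.congr (f := fun z => m z + c) (hm1.add continuousOn_const) fun z hz => ?_
      by_cases hzK : z ∈ K <;> simp_all
  · intro z hz
    by_cases hzK : z ∈ K
    · rw [piecewise_eq_of_mem _ _ _ hzK, hl2 z hzK]
    · rw [piecewise_eq_of_notMem _ _ _ hzK, exp_add, hc1, mul_one,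
        hm2 z (hz.resolve_left hzK)]

/-- Janiszewski's theorem. -/
theorem janiszewski {K L : Set ℂ} (hK : IsCompact K) (hL : IsCompact L)
    (hKL : IsPreconnected (K ∩ L)) {p q : ℂ} (hpL : p ∉ L)
    (hqK : q ∉ K) (hqL : q ∉ L) (h1 : q ∈ connectedComponentIn Kᶜ p)
    (h2 : q ∈ connectedComponentIn Lᶜ p) : q ∈ connectedComponentIn (K ∪ L)ᶜ p := by
  have hpK : p ∉ K := by
    intro h; rw [connectedComponentIn_eq_empty (by simpa using h)] at h1; exact h1
  refine same_comp_of_hasLog (hK.union hL) (by simp [hpK, hpL]) (by simp [hqK, hqL]) ?_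
  refine HasLog.union hK.isClosed hL.isClosed hKL ?_ ?_
  · exact hasLog_ratio_of_preconn hK.isClosed isPreconnected_connectedComponentIn
      (connectedComponentIn_subset _ _) (mem_connectedComponentIn hpK) h1
  · exact hasLog_ratio_of_preconn hL.isClosed isPreconnected_connectedComponentIn
      (connectedComponentIn_subset _ _) (mem_connectedComponentIn hpL) h2

/-! ### Part B: Riemann mapping -/

/-- `C` has no holes. -/
def Full (C : Set ℂ) : Prop :=
  ∀ W : Set ℂ, IsOpen W → IsBounded W → frontier W ⊆ C → W ⊆ C

theorem Full.hasLog {A : Set ℂ} (hA : IsCompact A) (hF : Full A) {p : ℂ} (hp : p ∉ A) :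
    HasLog A (fun z => z - p) := by
  refine hasLog_sub_of_unbounded hA isPreconnected_connectedComponentIn
    (connectedComponentIn_subset Aᶜ p) (mem_connectedComponentIn hp) fun hb => ?_
  have := frontier_comp_subset hA.isClosed.isOpen_compl p
  rw [compl_compl] at this
  exact hp (hF _ hA.isClosed.isOpen_compl.connectedComponentIn hb this
    (mem_connectedComponentIn hp))

theorem full_of_hasLog {A : Set ℂ} (h : ∀ p ∉ A, HasLog A (fun z => z - p)) : Full A := by
  intro W _ hb hfr p hpW
  by_contra hpA
  exact no_log_bdd hb hpW hfr (k := fun _ => 1) continuousOn_const (by simp)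
    ((h p hpA).congr fun z _ => by simp)

theorem exists_fill {A C : Set ℂ} (hA : IsCompact A) (hAC : A ⊆ C) (hC : Full C) :
    ∃ B, IsCompact B ∧ Full B ∧ A ⊆ B ∧ B ⊆ C := by
  set D : Set ℂ := {z | z ∉ A ∧ ¬ IsBounded (connectedComponentIn Aᶜ z)} with hD
  have hcomp : ∀ z ∈ D, connectedComponentIn Aᶜ z ⊆ D := by
    intro z hz w hw
    refine ⟨connectedComponentIn_subset _ _ hw, ?_⟩
    rw [← connectedComponentIn_eq hw]; exact hz.2
  have hDo : IsOpen D := by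
    rw [isOpen_iff_mem_nhds]
    intro z hz
    exact Filter.mem_of_superset
      (connectedComponentIn_mem_nhds (hA.isClosed.isOpen_compl.mem_nhds hz.1)) (hcomp z hz)
  obtain ⟨R, hR⟩ := hA.isBounded.subset_closedBall 0
  have hE : IsPreconnected {z : ℂ | max R 1 < ‖z‖} := isPreconnected_exterior (by positivity)
  have hEA : {z : ℂ | max R 1 < ‖z‖} ⊆ Aᶜ := fun z hz hzA => by
    have := hR hzA
    rw [mem_closedBall_zero_iff] at this
    grind
  have hbd : Dᶜ ⊆ closedBall 0 (max R 1) := by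
    intro z hz
    by_contra hcon
    rw [mem_closedBall_zero_iff, not_le] at hcon
    apply hz
    refine ⟨hEA hcon, fun hb => ?_⟩
    have hb2 := hb.subset (hE.subset_connectedComponentIn (x := z) hcon hEA)
    obtain ⟨M, hM⟩ := hb2.subset_closedBall 0
    have h3 : ((max R 1 + |M| + 1 : ℝ) : ℂ) ∈ {z : ℂ | max R 1 < ‖z‖} := by
      have : (0:ℝ) < max R 1 := by positivity
      simp only [mem_ofPred_eq, norm_real, Real.norm_eq_abs]
      rw [abs_of_pos (by positivity)]
      have := abs_nonneg M
      linarith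
    have h4 := hM h3
    rw [mem_closedBall_zero_iff, norm_real, Real.norm_eq_abs] at h4
    have h5 := le_abs_self (max R 1 + |M| + 1)
    have h6 := le_abs_self M
    have : (0:ℝ) < max R 1 := by positivity
    linarith
  refine ⟨Dᶜ, ?_, ?_, fun z hz h => h.1 hz, ?_⟩
  · exact (isCompact_closedBall (0 : ℂ) (max R 1)).of_isClosed_subset hDo.isClosed_compl hbd
  · intro W hW hb hfr w hw
    by_contra hwD
    have hwD : w ∈ D := by simpa using hwD
    have := preconn_subset_of_frontier (S := connectedComponentIn Aᶜ w)
      isPreconnected_connectedComponentIn hW ⟨w, mem_connectedComponentIn hwD.1, hw⟩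
      (fun x hx hxf => hfr hxf (hcomp w hwD hx))
    exact hwD.2 (hb.subset this)
  · intro z hz
    by_cases hzA : z ∈ A
    · exact hAC hzA
    have hb : IsBounded (connectedComponentIn Aᶜ z) := by
      by_contra hb; exact hz ⟨hzA, hb⟩
    have := frontier_comp_subset hA.isClosed.isOpen_compl z
    rw [compl_compl] at this
    exact hC _ hA.isClosed.isOpen_compl.connectedComponentIn hb (this.trans hAC)
      (mem_connectedComponentIn hzA)

theorem hasLog_of_compact_conn {C : Set ℂ} (hC : IsOpen C) (hCc : IsPreconnected C) {h : ℂ → ℂ}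
    (H : ∀ A ⊆ C, IsCompact A → HasLog A h) : HasLog C h := by
  rcases C.eq_empty_or_nonempty with rfl | ⟨z0, hz0⟩
  · exact ⟨fun _ => 0, by simp, by simp⟩
  have hpc : IsPathConnected C := (hC.isConnected_iff_isPathConnected).1 ⟨⟨z0, hz0⟩, hCc⟩
  have h0 : h z0 ≠ 0 := by
    obtain ⟨l, -, h2⟩ := H {z0} (by simpa) isCompact_singleton
    rw [← h2 z0 rfl]; exact exp_ne_zero _
  have ex : ∀ z ∈ C, ∃ A ⊆ C, IsCompact A ∧ IsPreconnected A ∧ z0 ∈ A ∧ z ∈ A := by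
    intro z hz
    obtain ⟨γ, hγ⟩ := hpc.joinedIn z0 hz0 z hz
    exact ⟨range γ, by rintro _ ⟨t, rfl⟩; exact hγ t, isCompact_range γ.continuous,
      isPreconnected_range γ.continuous, ⟨0, by simp⟩, ⟨1, by simp⟩⟩
  choose! A hAC hAk hAc hA0 hAz using ex
  choose! l hl1 hl2 using fun z hz => H (A z) (hAC z hz) (hAk z hz)
  let ℓ : ℂ → ℂ := fun z => l z z - l z z0
  have key : ∀ z ∈ C, ∀ B ⊆ C, IsPreconnected B → IsCompact B → ∀ m, ContinuousOn m B →
      (∀ w ∈ B, exp (m w) = h w) → z0 ∈ B → z ∈ B → ℓ z = m z - m z0 := by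
    intro z hz B hBC hBc hBk m hm1 hm2 hB0 hBz
    obtain ⟨M, hM1, hM2⟩ := H (A z ∪ B) (union_subset (hAC z hz) hBC) ((hAk z hz).union hBk)
    have e1 := log_diff_const (hAc z hz) (hl1 z hz) (hM1.mono subset_union_left)
      (fun w hw => by rw [hl2 z hz w hw, hM2 w (Or.inl hw)]) (hAz z hz) (hA0 z hz)
    have e2 := log_diff_const hBc hm1 (hM1.mono subset_union_right)
      (fun w hw => by rw [hm2 w hw, hM2 w (Or.inr hw)]) hBz hB0
    simp only [ℓ]
    linear_combination e1 - e2
  refine ⟨fun z => ℓ z + log (h z0), ?_, ?_⟩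
  · intro z hz
    refine ContinuousWithinAt.add ?_ continuousWithinAt_const
    obtain ⟨r, hr, hrC⟩ := nhds_basis_closedBall.mem_iff.1 (hC.mem_nhds hz)
    have hBc : IsPreconnected (A z ∪ closedBall z r) :=
      IsPreconnected.union z (hAz z hz) (mem_closedBall_self hr.le) (hAc z hz)
        (convex_closedBall z r).isPreconnected
    have hBk := (hAk z hz).union (isCompact_closedBall z r)
    have hBC := union_subset (hAC z hz) hrC
    obtain ⟨M, hM1, hM2⟩ := H _ hBC hBk
    have hc : ContinuousAt (fun w => M w - M z0) z :=
      ((hM1.continuousAt (Filter.mem_of_superset (closedBall_mem_nhds z hr)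
        subset_union_right))).sub continuousAt_const
    refine (hc.congr ?_).continuousWithinAt
    filter_upwards [closedBall_mem_nhds z hr] with w hw
    grind
  · intro z hz
    simp only [ℓ]
    rw [exp_add, exp_sub, hl2 z hz z (hAz z hz), hl2 z hz z0 (hA0 z hz),
      exp_log h0]
    field_simp

/-- A local Hurwitz theorem. -/
theorem hurwitz {ι : Type*} {φ : Filter ι} [φ.NeBot] {F : ι → ℂ → ℂ} {f : ℂ → ℂ} {U : Set ℂ}
    (hU : IsOpen U) (hF : ∀ n, DifferentiableOn ℂ (F n) U)
    (hlim : TendstoLocallyUniformlyOn F f φ U) (hne : ∀ n, ∀ z ∈ U, F n z ≠ 0)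
    {c : ℂ} (hc : c ∈ U) (hf0 : f c = 0) : ∀ᶠ z in 𝓝 c, f z = 0 := by
  have hfd : DifferentiableOn ℂ f U := hlim.differentiableOn (Filter.Eventually.of_forall hF) hU
  have han : AnalyticAt ℂ f c := hfd.analyticAt (hU.mem_nhds hc)
  rcases han.eventually_eq_zero_or_eventually_ne_zero with h | h
  · exact h
  exfalso
  rw [eventually_nhdsWithin_iff] at h
  obtain ⟨r, hr, hrs⟩ := nhds_basis_closedBall.mem_iff.1
    (Filter.inter_mem h (hU.mem_nhds hc))
  have hrU : closedBall c r ⊆ U := fun z hz => (hrs hz).2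
  have hsphere : (sphere c r).Nonempty := ⟨c + r, by simp [abs_of_pos hr]⟩
  obtain ⟨w, hw, hmin⟩ := (isCompact_sphere c r).exists_isMinOn hsphere
    ((hfd.continuousOn.mono (sphere_subset_closedBall.trans hrU)).norm)
  have hm : 0 < ‖f w‖ := by
    rw [norm_pos_iff]
    apply (hrs (sphere_subset_closedBall hw)).1
    rintro rfl
    rw [mem_sphere, dist_self] at hw; exact hr.ne hw
  have hunif : TendstoUniformlyOn F f φ (closedBall c r) :=
    (tendstoLocallyUniformlyOn_iff_tendstoUniformlyOn_of_compact (isCompact_closedBall c r)).1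
      (hlim.mono hrU)
  obtain ⟨n, hn⟩ := (tendstoUniformlyOn_iff.1 hunif (‖f w‖ / 2) (by positivity)).exists
  have h1 : ∀ z ∈ frontier (ball c r), ‖(F n z)⁻¹‖ ≤ (‖f w‖ / 2)⁻¹ := by
    intro z hz
    rw [frontier_ball c hr.ne'] at hz
    rw [norm_inv]
    apply inv_anti₀ (by positivity)
    have h2 := hn z (sphere_subset_closedBall hz)
    have h3 : ‖f w‖ ≤ ‖f z‖ := hmin hz
    rw [dist_eq_norm] at h2
    have h4 := norm_sub_norm_le (f z) (F n z)
    linarith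
  have hdc : DiffContOnCl ℂ (fun z => (F n z)⁻¹) (ball c r) := by
    apply DifferentiableOn.diffContOnCl
    rw [closure_ball c hr.ne']
    exact ((hF n).mono hrU).inv fun z hz => hne n z (hrU hz)
  have h5 := norm_le_of_forall_mem_frontier_norm_le isBounded_ball hdc h1
    (subset_closure (mem_ball_self hr))
  have h6 := hn c (mem_closedBall_self hr.le)
  rw [hf0, dist_zero_left] at h6
  rw [norm_inv, inv_le_inv₀ (norm_pos_iff.2 (hne n c hc)) (by positivity)] at h5
  linarith

/-- The class of functions used in the Riemann mapping theorem. -/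
structure Nice (C : Set ℂ) (g : ℂ → ℂ) : Prop where
  diff : DifferentiableOn ℂ g C
  maps : MapsTo g C (ball 0 1)
  inj : InjOn g C
  der : ∀ z ∈ C, deriv g z ≠ 0
  log : ∀ A ⊆ C, IsCompact A → Full A → ∀ p ∉ g '' A, HasLog A (fun z => g z - p)

/-- Moebius transformation of the disc. -/
def mob (a w : ℂ) : ℂ := (w - a) / (1 - conj a * w)

theorem mob_den {a w : ℂ} (ha : ‖a‖ < 1) (hw : ‖w‖ < 1) : ‖conj a * w‖ < 1 := by
  rw [norm_mul, RCLike.norm_conj]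
  nlinarith [norm_nonneg a, norm_nonneg w]

theorem one_sub_ne {u : ℂ} (hu : ‖u‖ < 1) : 1 - u ≠ 0 := by
  intro h
  have : u = 1 := (sub_eq_zero.1 h).symm
  rw [this, norm_one] at hu; exact lt_irrefl _ hu

theorem mob_norm {a w : ℂ} (ha : ‖a‖ < 1) (hw : ‖w‖ < 1) : ‖mob a w‖ < 1 := by
  have h0 := one_sub_ne (mob_den ha hw)
  rw [mob, norm_div, div_lt_one (norm_pos_iff.2 h0)]
  rw [← sq_lt_sq₀ (norm_nonneg _) (norm_nonneg _), Complex.sq_norm, Complex.sq_norm]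
  have h1 : normSq a < 1 := by
    rw [normSq_eq_norm_sq]; nlinarith [norm_nonneg a]
  have h2 : normSq w < 1 := by
    rw [normSq_eq_norm_sq]; nlinarith [norm_nonneg w]
  simp only [normSq_apply] at *
  simp
  nlinarith [mul_pos (sub_pos.2 h1) (sub_pos.2 h2)]

theorem mob_hasDerivAt {a w : ℂ} (ha : ‖a‖ < 1) (hw : ‖w‖ < 1) :
    HasDerivAt (mob a) ((1 - conj a * a) / (1 - conj a * w) ^ 2) w := by
  have h0 := one_sub_ne (mob_den ha hw)
  have h1 : HasDerivAt (fun w : ℂ => w - a) 1 w := (hasDerivAt_id w).sub_const a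
  have h2 : HasDerivAt (fun w : ℂ => 1 - conj a * w) (-(conj a * 1)) w := by
    simpa using ((hasDerivAt_id w).const_mul (conj a)).const_sub 1
  have := h1.div h2 h0
  unfold mob
  convert! this using 1
  congr 1
  ring

theorem mob_inj {a w w' : ℂ} (ha : ‖a‖ < 1) (hw : ‖w‖ < 1) (hw' : ‖w'‖ < 1)
    (h : mob a w = mob a w') : w = w' := by
  have h0 := one_sub_ne (mob_den ha hw)
  have h0' := one_sub_ne (mob_den ha hw')
  have h1 := one_sub_ne (mob_den ha ha)
  unfold mob at h
  rw [div_eq_div_iff h0 h0'] at h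
  have : (w - w') * (1 - conj a * a) = 0 := by linear_combination h
  rcases mul_eq_zero.1 this with h2 | h2
  · exact sub_eq_zero.1 h2
  · exact absurd h2 h1

theorem Nice.mob {C : Set ℂ} {g : ℂ → ℂ} (hC : IsOpen C) (hg : Nice C g) {a : ℂ} (ha : ‖a‖ < 1) :
    Nice C (fun z => mob a (g z)) := by
  have hn : ∀ z ∈ C, ‖g z‖ < 1 := fun z hz => by simpa using hg.maps hz
  have hd : ∀ z ∈ C, HasDerivAt (fun z => CS.mob a (g z))
      ((1 - conj a * a) / (1 - conj a * g z) ^ 2 * deriv g z) z := by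
    intro z hz
    exact (mob_hasDerivAt ha (hn z hz)).comp z (hg.diff.differentiableAt (hC.mem_nhds hz)).hasDerivAt
  refine ⟨fun z hz => (hd z hz).differentiableAt.differentiableWithinAt, ?_, ?_, ?_, ?_⟩
  · intro z hz; simpa using mob_norm ha (hn z hz)
  · intro z hz w hw h
    exact hg.inj hz hw (mob_inj ha (hn z hz) (hn w hw) h)
  · intro z hz
    rw [(hd z hz).deriv]
    refine mul_ne_zero (div_ne_zero (one_sub_ne (mob_den ha ha)) (pow_ne_zero _ ?_)) (hg.der z hz)
    exact one_sub_ne (mob_den ha (hn z hz))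
  · intro A hAC hAk hAF p hp
    have hgc : ContinuousOn g A := hg.diff.continuousOn.mono hAC
    have h1 : HasLog A (fun z => 1 - conj a * g z) := by
      apply hasLog_of_slit (by fun_prop)
      intro z hz
      simpa using mob_den ha (hn z (hAC hz))
    have h2 : HasLog A (fun z => (1 + p * conj a) * g z - (a + p)) := by
      by_cases h0 : 1 + p * conj a = 0
      · have : -(a + p) ≠ 0 := by
          intro h
          have h3 : p = -a := by linear_combination -h
          rw [h3] at h0
          exact one_sub_ne (mob_den ha ha) (by linear_combination h0)
        refine (hasLog_const this).congr fun z _ => by rw [h0]; ring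
      · refine ((hasLog_const h0).mul (hg.log A hAC hAk hAF ((a + p) / (1 + p * conj a))
          ?_)).congr fun z _ => by field_simp
        rintro ⟨z, hz, hze⟩
        apply hp
        refine ⟨z, hz, ?_⟩
        have h4 := one_sub_ne (mob_den ha (hn z (hAC hz)))
        rw [eq_div_iff h0] at hze
        simp only [CS.mob]
        rw [div_eq_iff h4]
        linear_combination hze
    refine (h2.mul h1.inv).congr fun z hz => ?_
    have h4 := one_sub_ne (mob_den ha (hn z (hAC hz)))
    simp only [CS.mob]
    field_simp
    ring

theorem Nice.full {C : Set ℂ} {g : ℂ → ℂ} (hg : Nice C g) {A : Set ℂ} (hAC : A ⊆ C)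
    (hA : IsCompact A) (hF : Full A) : Full (g '' A) := by
  apply full_of_hasLog
  intro p hp
  obtain ⟨l, h1, h2⟩ := hg.log A hAC hA hF p hp
  have hgc : ContinuousOn g A := hg.diff.continuousOn.mono hAC
  have hinj : InjOn g A := hg.inj.mono hAC
  have hinv : ContinuousOn (invFunOn g A) (g '' A) := by
    have hcl : ContinuousOn (invFunOn g A) (g '' A) := by
      rw [continuousOn_iff_isClosed]
      intro t ht
      refine ⟨g '' (A ∩ t), ((hA.inter_right ht).image_of_continuousOn
        (hgc.mono inter_subset_left)).isClosed, ?_⟩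
      ext w
      constructor
      · rintro ⟨hw, z, hz, rfl⟩
        refine ⟨⟨z, ⟨hz, ?_⟩, rfl⟩, ⟨z, hz, rfl⟩⟩
        have : invFunOn g A (g z) = z := hinj.leftInvOn_invFunOn hz
        rwa [mem_preimage, this] at hw
      · rintro ⟨⟨z, hz, rfl⟩, -⟩
        refine ⟨?_, ⟨z, hz.1, rfl⟩⟩
        rw [mem_preimage, hinj.leftInvOn_invFunOn hz.1]
        exact hz.2
    exact hcl
  refine ⟨fun w => l (invFunOn g A w), h1.comp hinv ?_, ?_⟩
  · intro w hw; exact invFunOn_mem hw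
  · intro w hw
    rw [h2 _ (invFunOn_mem hw)]
    simp only [invFunOn_eq hw]

theorem Nice.sqrt {C : Set ℂ} {h : ℂ → ℂ} (hC : IsOpen C) (hCc : IsPreconnected C) (hCF : Full C)
    (hh : Nice C h) (h0 : ∀ z ∈ C, h z ≠ 0) :
    ∃ s, Nice C s ∧ ∀ z ∈ C, s z ^ 2 = h z := by
  have hlog : HasLog C h := by
    apply hasLog_of_compact_conn hC hCc
    intro A hAC hA
    obtain ⟨B, hB1, hB2, hB3, hB4⟩ := exists_fill hA hAC hCF
    refine ((hh.log B hB4 hB1 hB2 0 ?_).mono hB3).congr fun z _ => by simp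
    rintro ⟨z, hz, hz0⟩
    exact h0 z (hB4 hz) hz0
  obtain ⟨l, hl1, hl2⟩ := hlog
  set s : ℂ → ℂ := fun z => exp (l z / 2) with hs
  have hs2 : ∀ z ∈ C, s z ^ 2 = h z := fun z hz => by
    rw [← hl2 z hz, hs, ← exp_nat_mul]; congr 1; push_cast; ring
  have hs0 : ∀ z, s z ≠ 0 := fun z => exp_ne_zero _
  have hsc : ContinuousOn s C := by
    fun_prop
  have hd : ∀ z ∈ C, HasDerivAt s (deriv h z / (2 * s z)) z := by
    intro z hz
    have hhd := (hh.diff.differentiableAt (hC.mem_nhds hz)).hasDerivAt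
    rw [hasDerivAt_iff_tendsto_slope] at hhd ⊢
    have hsz : Filter.Tendsto (fun w => s w + s z) (𝓝[≠] z) (𝓝 (2 * s z)) := by
      have := ((hsc.continuousAt (hC.mem_nhds hz)).add (continuousAt_const (y := s z)))
      have h3 := this.tendsto.mono_left (nhdsWithin_le_nhds (s := {z}ᶜ))
      have e : (s + fun _ : ℂ => s z) z = 2 * s z := by simp only [Pi.add_apply]; ring
      rw [e] at h3
      exact h3
    have h2 : 2 * s z ≠ 0 := mul_ne_zero two_ne_zero (hs0 z)
    have := hhd.div hsz h2
    refine this.congr' ?_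
    have hev : ∀ᶠ w in 𝓝[≠] z, w ∈ C ∧ s w + s z ≠ 0 := by
      refine Filter.Eventually.and ?_ (hsz.eventually_ne h2)
      exact mem_nhdsWithin_of_mem_nhds (hC.mem_nhds hz)
    filter_upwards [hev] with w hw
    simp only [Pi.div_apply, slope_def_field]
    grind
  have hN : ∀ z ∈ C, ‖s z‖ < 1 := by
    intro z hz
    have h1 : ‖h z‖ < 1 := by simpa using hh.maps hz
    rw [← hs2 z hz, norm_pow] at h1
    by_contra hcon
    push Not at hcon
    nlinarith
  refine ⟨s, ⟨fun z hz => (hd z hz).differentiableAt.differentiableWithinAt, ?_, ?_, ?_, ?_⟩, hs2⟩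
  · intro z hz; simpa using hN z hz
  · intro z hz w hw hzw
    exact hh.inj hz hw (by rw [← hs2 z hz, ← hs2 w hw, hzw])
  · intro z hz
    rw [(hd z hz).deriv]
    exact div_ne_zero (hh.der z hz) (mul_ne_zero two_ne_zero (hs0 z))
  · intro A hAC hA hAF p hp
    have hsA : ContinuousOn s A := hsc.mono hAC
    have hsk : IsCompact (s '' A) := hA.image_of_continuousOn hsA
    have hfull := hh.full hAC hA hAF
    suffices hu : ¬ IsBounded (connectedComponentIn (s '' A)ᶜ p) by
      have := hasLog_sub_of_unbounded hsk isPreconnected_connectedComponentIn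
        (connectedComponentIn_subset _ p) (mem_connectedComponentIn hp) hu
      exact this.comp hsA (mapsTo_image s A)
    intro hb
    set W := connectedComponentIn (s '' A)ᶜ p with hW
    have hWo : IsOpen W := hsk.isClosed.isOpen_compl.connectedComponentIn
    have hpW : p ∈ W := mem_connectedComponentIn hp
    have hfr : frontier W ⊆ s '' A := by
      have := frontier_comp_subset hsk.isClosed.isOpen_compl p
      rwa [compl_compl] at this
    have hWs : ∀ w ∈ W, w ∉ s '' A := fun w hw => connectedComponentIn_subset _ _ hw
    -- the square of W
    set W2 := (fun z : ℂ => z ^ 2) '' W with hW2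
    have hopen : IsOpen W2 := by
      have := (AnalyticOnNhd.is_constant_or_isOpen (g := fun z : ℂ => z ^ 2) (U := univ)
        (fun z _ => by fun_prop) isPreconnected_univ).resolve_left (by
          rintro ⟨w, hw⟩
          have h1 := hw 0 (mem_univ _)
          have h2 := hw 1 (mem_univ _)
          grind)
      exact this W (subset_univ _) hWo
    have hck : IsCompact (closure W) := hb.isCompact_closure
    have hcl : closure W2 ⊆ (fun z : ℂ => z ^ 2) '' closure W :=
      closure_minimal (image_mono subset_closure)
        (hck.image (by fun_prop)).isClosed
    have hfr2 : frontier W2 ⊆ h '' A := by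
      intro x hx
      rw [hopen.frontier_eq] at hx
      obtain ⟨w, hw, rfl⟩ := hcl hx.1
      have hwf : w ∈ frontier W := by
        rw [hWo.frontier_eq]
        exact ⟨hw, fun hwW => hx.2 ⟨w, hwW, rfl⟩⟩
      obtain ⟨a, ha, rfl⟩ := hfr hwf
      exact ⟨a, ha, (hs2 a (hAC ha)).symm⟩
    have hbd2 : IsBounded W2 :=
      (hck.image (f := fun z : ℂ => z ^ 2) (by fun_prop)).isBounded.subset
        (image_mono subset_closure)
    have hsub := hfull W2 hopen hbd2 hfr2
    have hneg : ∀ w ∈ W, -w ∈ s '' A := by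
      intro w hw
      obtain ⟨a, ha, hae⟩ := hsub ⟨w, hw, rfl⟩
      grind
    have hcln : ∀ w ∈ closure W, -w ∈ s '' A := by
      intro w hw
      have : closure W ⊆ (fun z => -z) ⁻¹' (s '' A) :=
        closure_minimal hneg (hsk.isClosed.preimage continuous_neg)
      exact this hw
    obtain ⟨w, hw⟩ : (frontier W).Nonempty := by
      rw [nonempty_frontier_iff]
      refine ⟨⟨p, hpW⟩, fun hu => ?_⟩
      rw [hu] at hb
      exact NormedSpace.unbounded_univ ℂ ℂ hb
    obtain ⟨a, ha, hae⟩ := hfr hw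
    obtain ⟨b, hb', hbe⟩ := hcln w (frontier_subset_closure hw)
    have hab : a = b := hh.inj (hAC ha) (hAC hb') (by
      grind)
    grind

theorem Nice.limit {ι : Type*} {φ : Filter ι} [φ.NeBot] {F : ι → ℂ → ℂ} {f : ℂ → ℂ} {C : Set ℂ}
    (hC : IsOpen C) (hCc : IsPreconnected C) (hF : ∀ n, Nice C (F n))
    (hlim : TendstoLocallyUniformlyOn F f φ C) {z0 : ℂ} (hz0 : z0 ∈ C) (hd0 : deriv f z0 ≠ 0) :
    Nice C f := by
  have hev : ∀ᶠ n in φ, DifferentiableOn ℂ (F n) C := Filter.Eventually.of_forall fun n => (hF n).diff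
  have hfd : DifferentiableOn ℂ f C := hlim.differentiableOn hev hC
  have hder : TendstoLocallyUniformlyOn (deriv ∘ F) (deriv f) φ C := hlim.deriv hev hC
  have hne : ∀ z ∈ C, deriv f z ≠ 0 := by
    intro z hz h0
    have h1 := hurwitz hC (F := deriv ∘ F) (fun n => (hF n).diff.deriv hC) hder
      (fun n z hz => (hF n).der z hz) hz h0
    have han : AnalyticOnNhd ℂ (deriv f) C := (hfd.deriv hC).analyticOnNhd hC
    exact hd0 (han.eqOn_zero_of_preconnected_of_eventuallyEq_zero hCc hz h1 hz0)
  have hpt : ∀ z ∈ C, Filter.Tendsto (fun n => F n z) φ (𝓝 (f z)) := fun z hz =>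
    hlim.tendsto_at hz
  refine ⟨hfd, ?_, ?_, hne, ?_⟩
  · have hle : ∀ z ∈ C, f z ∈ closedBall (0 : ℂ) 1 := fun z hz =>
      isClosed_closedBall.mem_of_tendsto (hpt z hz)
        (Filter.Eventually.of_forall fun n => ball_subset_closedBall ((hF n).maps hz))
    intro z hz
    have hst : HasStrictDerivAt f (deriv f z) z :=
      ((hfd.analyticAt (hC.mem_nhds hz))).hasStrictDerivAt
    have hm := hst.map_nhds_eq (hne z hz)
    have : closedBall (0 : ℂ) 1 ∈ 𝓝 (f z) := by
      rw [← hm, Filter.mem_map]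
      exact Filter.mem_of_superset (hC.mem_nhds hz) hle
    rw [← interior_closedBall (0 : ℂ) one_ne_zero]
    exact mem_interior_iff_mem_nhds.2 this
  · intro z hz w hw hzw
    by_contra hne'
    have hU : IsOpen (C ∩ {w}ᶜ) := hC.inter isOpen_compl_singleton
    have hlim2 : TendstoLocallyUniformlyOn (fun n x => F n x - F n w) (fun x => f x - f w) φ
        (C ∩ {w}ᶜ) := by
      rw [tendstoLocallyUniformlyOn_iff] at hlim ⊢
      intro ε hε x hx
      obtain ⟨t, ht, hev⟩ := hlim (ε / 2) (by positivity) x hx.1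
      refine ⟨t, nhdsWithin_mono _ inter_subset_left ht, ?_⟩
      have h2 := tendsto_nhds.1 (hpt w hw) (ε / 2) (by positivity)
      filter_upwards [hev, h2] with n h3 h4 y hy
      have h5 := h3 y hy
      rw [dist_eq_norm] at h5 h4 ⊢
      have : f y - f w - (F n y - F n w) = (f y - F n y) + (F n w - f w) := by ring
      rw [this]
      exact (norm_add_le _ _).trans_lt (by linarith)
    have h1 := hurwitz hU (fun n => ((hF n).diff.mono inter_subset_left).sub_const _) hlim2
      (fun n x hx h0 => hx.2 ((hF n).inj hx.1 hw (sub_eq_zero.1 h0))) (c := z) ⟨hz, hne'⟩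
      (by rw [hzw, sub_self])
    apply hne z hz
    have h2 : f =ᶠ[𝓝 z] fun _ => f w := h1.mono fun x hx => sub_eq_zero.1 hx
    rw [h2.deriv_eq]; simp
  · intro A hAC hA hAF p hp
    rcases A.eq_empty_or_nonempty with rfl | hAne
    · exact ⟨fun _ => 0, by simp, by simp⟩
    have hfc : ContinuousOn f A := hfd.continuousOn.mono hAC
    obtain ⟨a, ha, hmin⟩ := hA.exists_isMinOn hAne ((hfc.sub continuousOn_const).norm :
      ContinuousOn (fun z => ‖f z - p‖) A)
    have hd : 0 < ‖f a - p‖ := by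
      rw [norm_pos_iff]; exact sub_ne_zero.2 fun h => hp ⟨a, ha, h⟩
    have hunif : TendstoUniformlyOn F f φ A :=
      (tendstoLocallyUniformlyOn_iff_tendstoUniformlyOn_of_compact hA).1 (hlim.mono hAC)
    obtain ⟨n, hn⟩ := (tendstoUniformlyOn_iff.1 hunif (‖f a - p‖ / 2) (by positivity)).exists
    have hbig : ∀ z ∈ A, ‖f a - p‖ / 2 < ‖F n z - p‖ ∧ ‖f z - F n z‖ < ‖f a - p‖ / 2 := by
      intro z hz
      have h1 := hn z hz
      have h2 : ‖f a - p‖ ≤ ‖f z - p‖ := hmin hz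
      rw [dist_eq_norm] at h1
      have h3 := norm_sub_le_norm_sub_add_norm_sub (f z) (F n z) p
      exact ⟨by linarith, h1⟩
    have hFp : p ∉ F n '' A := by
      rintro ⟨z, hz, rfl⟩
      have := (hbig z hz).1
      simp at this; linarith
    have hne2 : ∀ z ∈ A, F n z - p ≠ 0 := fun z hz => sub_ne_zero.2 fun h => hFp ⟨z, hz, h⟩
    have h1 := (hF n).log A hAC hA hAF p hFp
    have h2 : HasLog A (fun z => (f z - p) / (F n z - p)) := by
      apply hasLog_of_slit
      · exact (hfc.sub continuousOn_const).div
          (((hF n).diff.continuousOn.mono hAC).sub continuousOn_const) hne2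
      · intro z hz
        have : (f z - p) / (F n z - p) - 1 = (f z - F n z) / (F n z - p) := by
          have := hne2 z hz; field_simp; ring
        obtain ⟨h3, h4⟩ := hbig z hz
        rw [this, norm_div, div_lt_one (by linarith)]
        linarith
    refine (h1.mul h2).congr fun z hz => ?_
    have := hne2 z hz
    field_simp

theorem nice_affine {C : Set ℂ} {z0 : ℂ} {R : ℝ} (hR : 0 < R) (hb : C ⊆ ball z0 R) :
    Nice C (fun z => (z - z0) / R) := by
  have hR' : (R : ℂ) ≠ 0 := by exact_mod_cast hR.ne'
  have hd : ∀ z, HasDerivAt (fun z : ℂ => (z - z0) / R) (1 / R) z := fun z =>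
    ((hasDerivAt_id z).sub_const z0).div_const _
  refine ⟨fun z _ => (hd z).differentiableAt.differentiableWithinAt, ?_, ?_, ?_, ?_⟩
  · intro z hz
    have := hb hz
    rw [mem_ball, dist_eq_norm] at this
    rw [mem_ball_zero_iff, norm_div, norm_real, Real.norm_eq_abs, abs_of_pos hR]
    rwa [div_lt_one hR]
  · simp_all
  · simp_all
  · intro A _ hA hF p hp
    have h1 : z0 + R * p ∉ A := fun h => hp ⟨_, h, by field_simp; ring⟩
    refine ((hF.hasLog hA h1).mul (hasLog_const (inv_ne_zero hR'))).congr fun z _ => ?_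
    field_simp
    ring

theorem lip_of_disc {g : ℂ → ℂ} {c : ℂ} {r : ℝ} (hg : DifferentiableOn ℂ g (ball c r))
    (hm : MapsTo g (ball c r) (ball 0 1)) {z : ℂ} (hz : z ∈ ball c r) :
    dist (g z) (g c) ≤ 2 / r * dist z c := by
  have hr : 0 < r := nonempty_ball.mp ⟨_, hz⟩
  refine dist_le_div_mul_dist_of_mapsTo_ball hg ?_ hz
  intro w hw
  have h1 := hm hw
  have h2 := hm (mem_ball_self hr)
  rw [mem_ball_zero_iff] at h1 h2
  rw [mem_closedBall, dist_eq_norm]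
  exact (norm_sub_le _ _).trans (by linarith)

/-- Montel's theorem via an ultrafilter. -/
theorem montel {C : Set ℂ} (hC : IsOpen C) {F : ℕ → ℂ → ℂ}
    (hF : ∀ n, DifferentiableOn ℂ (F n) C) (hm : ∀ n, MapsTo (F n) C (ball 0 1))
    (φ : Ultrafilter ℕ) :
    ∃ f, TendstoLocallyUniformlyOn F f φ C := by
  have hpt : ∀ z ∈ C, ∃ y, Filter.Tendsto (fun n => F n z) φ (𝓝 y) := by
    intro z hz
    obtain ⟨y, -, hy⟩ := (isCompact_closedBall (0 : ℂ) 1).ultrafilter_le_nhds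
      (φ.map (fun n => F n z)) (by
        rw [Filter.le_principal_iff]
        have : ∀ n, F n z ∈ closedBall (0 : ℂ) 1 := fun n => ball_subset_closedBall (hm n hz)
        exact Filter.Eventually.of_forall (f := (φ : Filter ℕ)) this)
    exact ⟨y, hy⟩
  choose! f hf using hpt
  refine ⟨f, ?_⟩
  rw [tendstoLocallyUniformlyOn_iff]
  intro ε hε c hc
  obtain ⟨r, hr, hrC⟩ := isOpen_iff.1 hC c hc
  set δ := min r (ε * r / 8) with hδ
  have hδ0 : 0 < δ := by positivity
  have hlip : ∀ n, ∀ z ∈ ball c δ, dist (F n z) (F n c) ≤ ε / 4 := by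
    intro n z hz
    have h1 := lip_of_disc ((hF n).mono hrC) ((hm n).mono_left hrC)
      (ball_subset_ball (min_le_left _ _) hz)
    have h2 : dist z c ≤ ε * r / 8 := (mem_ball.1 hz).le.trans (min_le_right _ _)
    calc _ ≤ 2 / r * dist z c := h1
      _ ≤ 2 / r * (ε * r / 8) := by gcongr
      _ = ε / 4 := by field_simp; norm_num
  refine ⟨ball c δ, mem_nhdsWithin_of_mem_nhds (ball_mem_nhds c hδ0), ?_⟩
  have h2 := tendsto_nhds.1 (hf c hc) (ε / 4) (by positivity)
  filter_upwards [h2] with n hn z hz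
  have hzC : z ∈ C := hrC (ball_subset_ball (min_le_left _ _) hz)
  have h3 : dist (f z) (f c) ≤ ε / 4 :=
    le_of_tendsto ((hf z hzC).dist (hf c hc)) (Filter.Eventually.of_forall fun n => hlip n z hz)
  have h4 := hlip n z hz
  calc dist (f z) (F n z) ≤ dist (f z) (f c) + dist (f c) (F n c) + dist (F n c) (F n z) :=
        dist_triangle4 _ _ _ _
    _ < ε := by rw [dist_comm (f c), dist_comm (F n c) (F n z)]; linarith

/-- The Riemann mapping theorem. -/
theorem rmt {C : Set ℂ} (hC : IsOpen C) (hCc : IsPreconnected C) (hb : IsBounded C)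
    (hF : Full C) {z0 : ℂ} (hz0 : z0 ∈ C) : ∃ g, Nice C g ∧ g '' C = ball 0 1 := by
  set D : Set ℝ := {x | ∃ g, Nice C g ∧ g z0 = 0 ∧ x = ‖deriv g z0‖} with hD
  have hDne : D.Nonempty := by
    obtain ⟨R, hR⟩ := hb.subset_ball z0
    have hR0 : 0 < R := dist_nonneg.trans_lt (hR hz0)
    exact ⟨_, _, nice_affine hR0 hR, by simp, rfl⟩
  obtain ⟨r, hr, hrC⟩ := isOpen_iff.1 hC z0 hz0
  have hDb : BddAbove D := by
    refine ⟨2 / r, ?_⟩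
    rintro _ ⟨g, hg, -, rfl⟩
    refine (hg.diff.differentiableAt (hC.mem_nhds hz0)).hasDerivAt.le_of_lip' (by positivity) ?_
    filter_upwards [ball_mem_nhds z0 hr] with z hz
    simpa [dist_eq_norm] using
      lip_of_disc (hg.diff.mono hrC) (hg.maps.mono_left hrC) hz
  set M := sSup D with hM
  have hseq : ∀ n : ℕ, ∃ g, Nice C g ∧ g z0 = 0 ∧ M - 1 / (n + 1) < ‖deriv g z0‖ := by
    intro n
    obtain ⟨x, ⟨g, h1, h2, rfl⟩, hx⟩ := exists_lt_of_lt_csSup hDne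
      (show M - 1 / ((n : ℝ) + 1) < sSup D by
        rw [← hM]; have : (0:ℝ) < 1 / ((n:ℝ) + 1) := by positivity
        linarith)
    exact ⟨g, h1, h2, hx⟩
  choose F hF1 hF2 hF3 using hseq
  obtain ⟨f, hf⟩ := montel hC (fun n => (hF1 n).diff) (fun n => (hF1 n).maps) (Filter.hyperfilter ℕ)
  have hle : ((Filter.hyperfilter ℕ : Ultrafilter ℕ) : Filter ℕ) ≤ Filter.atTop := by
    rw [← Nat.cofinite_eq_atTop]; exact Filter.hyperfilter_le_cofinite
  have hev : ∀ᶠ n in ((Filter.hyperfilter ℕ : Ultrafilter ℕ) : Filter ℕ),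
    DifferentiableOn ℂ (F n) C := Filter.Eventually.of_forall fun n => (hF1 n).diff
  have hdlim : Filter.Tendsto (fun n => ‖deriv (F n) z0‖)
      ((Filter.hyperfilter ℕ : Ultrafilter ℕ) : Filter ℕ) (𝓝 ‖deriv f z0‖) :=
    ((hf.deriv hev hC).tendsto_at hz0).norm
  have hMlim : Filter.Tendsto (fun n : ℕ => M - 1 / ((n : ℝ) + 1))
      ((Filter.hyperfilter ℕ : Ultrafilter ℕ) : Filter ℕ) (𝓝 M) := by
    have := (tendsto_one_div_add_atTop_nhds_zero_nat (𝕜 := ℝ)).const_sub M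
    rw [sub_zero] at this
    exact this.mono_left hle
  have hMf : M ≤ ‖deriv f z0‖ :=
    le_of_tendsto_of_tendsto hMlim hdlim (Filter.Eventually.of_forall fun n => (hF3 n).le)
  have hMpos : 0 < M := by
    obtain ⟨x, hx⟩ := hDne
    have := le_csSup hDb hx
    obtain ⟨g, h1, -, rfl⟩ := hx
    exact lt_of_lt_of_le (norm_pos_iff.2 (h1.der z0 hz0)) this
  have hd0 : deriv f z0 ≠ 0 := norm_pos_iff.1 (hMpos.trans_le hMf)
  have hN : Nice C f := Nice.limit hC hCc hF1 hf hz0 hd0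
  have hf0 : f z0 = 0 := by
    have h1 := hf.tendsto_at hz0
    simp_all
  refine ⟨f, hN, Subset.antisymm (image_subset_iff.2 hN.maps) ?_⟩
  intro w hw
  by_contra hwf
  have hw1 : ‖w‖ < 1 := by simpa using hw
  have hh := hN.mob hC hw1
  have hh0 : ∀ z ∈ C, mob w (f z) ≠ 0 := by
    intro z hz h0
    have hn : ‖f z‖ < 1 := by simpa using hN.maps hz
    have h1 : mob w (f z) = mob w w := by rw [h0]; simp [mob]
    exact hwf ⟨z, hz, mob_inj hw1 hn hw1 h1⟩
  obtain ⟨s, hs, hs2⟩ := hh.sqrt hC hCc hF hh0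
  set b := s z0 with hb'
  have hb1 : ‖b‖ < 1 := by simpa using hs.maps hz0
  have hk := hs.mob hC hb1
  have hkD : ‖deriv (fun z => mob b (s z)) z0‖ ∈ D := ⟨_, hk, by simp [mob, hb'], rfl⟩
  have hkM := le_csSup hDb hkD
  -- compute the derivative
  have hb2 : b ^ 2 = - w := by
    rw [hb', hs2 z0 hz0, hf0]; simp [mob]
  have hsd := (hs.diff.differentiableAt (hC.mem_nhds hz0)).hasDerivAt
  have hfd := (hN.diff.differentiableAt (hC.mem_nhds hz0)).hasDerivAt
  have e1 : HasDerivAt (fun z => s z ^ 2) (2 * b * deriv s z0) z0 := by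
    have := hsd.pow 2
    simp only [Nat.cast_ofNat, Nat.add_one_sub_one, pow_one] at this
    exact this
  have hf1 : ‖f z0‖ < 1 := by rw [hf0]; simp
  have e2 : HasDerivAt (fun z => mob w (f z))
      ((1 - conj w * w) / (1 - conj w * f z0) ^ 2 * deriv f z0) z0 :=
    (mob_hasDerivAt hw1 hf1).comp z0 hfd
  have e3 : HasDerivAt (fun z => s z ^ 2)
      ((1 - conj w * w) / (1 - conj w * f z0) ^ 2 * deriv f z0) z0 :=
    e2.congr_of_eventuallyEq (by
      filter_upwards [hC.mem_nhds hz0] with z hz; exact hs2 z hz)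
  have e4 := e1.unique e3
  rw [hf0] at e4
  simp only [mul_zero, sub_zero, one_pow, div_one] at e4
  have e5 : deriv (fun z => mob b (s z)) z0 =
      (1 - conj b * b) / (1 - conj b * b) ^ 2 * deriv s z0 :=
    ((mob_hasDerivAt hb1 hb1).comp z0 hsd).deriv
  have nc : ∀ u : ℂ, ‖u‖ < 1 → ‖1 - conj u * u‖ = 1 - ‖u‖ ^ 2 := by
    intro u hu
    rw [mul_comm, mul_conj, ← ofReal_one, ← ofReal_sub, norm_real,
      normSq_eq_norm_sq, Real.norm_eq_abs, abs_of_pos]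
    nlinarith [norm_nonneg u]
  have n4 := congrArg norm e4
  rw [norm_mul, norm_mul, norm_mul, nc w hw1, norm_ofNat] at n4
  rw [e5, norm_mul, norm_div, norm_pow, nc b hb1] at hkM
  have nb : ‖b‖ ^ 2 = ‖w‖ := by rw [← norm_pow, hb2, norm_neg]
  have hw0 : w ≠ 0 := by rintro rfl; exact hwf ⟨z0, hz0, hf0⟩
  have hbpos : 0 < ‖b‖ := by
    rw [norm_pos_iff]; intro h0; rw [h0] at hb2; simp at hb2; exact hw0 hb2
  rw [← nb] at n4
  set β := ‖b‖
  set σ := ‖deriv s z0‖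
  set τ := ‖deriv f z0‖
  have h1 : 0 < 1 - β ^ 2 := by nlinarith
  have h2 : (1 - β ^ 2) / (1 - β ^ 2) ^ 2 * σ = σ / (1 - β ^ 2) := by field_simp
  rw [h2, div_le_iff₀ h1] at hkM
  have hτ : 0 < τ := hMpos.trans_le hMf
  -- 2 β σ = (1-β^4) τ, σ ≤ M (1-β²) ≤ τ (1-β²)
  have h3 : σ ≤ τ * (1 - β ^ 2) := hkM.trans (by gcongr)
  have h4 : (1 - (β ^ 2) ^ 2) * τ ≤ 2 * β * (τ * (1 - β ^ 2)) := by rw [← n4]; gcongr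
  have h5 : 0 < τ * (1 - β ^ 2) * (1 - β) ^ 2 := by
    have : 0 < 1 - β := by linarith
    positivity
  nlinarith

/-- Riemann mapping with its inverse. -/
theorem rmt' {C : Set ℂ} (hC : IsOpen C) (hCc : IsPreconnected C) (hb : IsBounded C)
    (hF : Full C) {z0 : ℂ} (hz0 : z0 ∈ C) : ∃ f g : ℂ → ℂ, DifferentiableOn ℂ f (ball 0 1) ∧
      ContinuousOn g C ∧ MapsTo f (ball 0 1) C ∧ MapsTo g C (ball 0 1) ∧
      (∀ z ∈ ball (0:ℂ) 1, g (f z) = z) ∧ (∀ w ∈ C, f (g w) = w) := by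
  obtain ⟨g, hg, hgC⟩ := rmt hC hCc hb hF hz0
  have hfg : ∀ w ∈ C, invFunOn g C (g w) = w := fun w hw => hg.inj.leftInvOn_invFunOn hw
  have hgf : ∀ z ∈ ball (0:ℂ) 1, g (invFunOn g C z) = z := by
    intro z hz; rw [← hgC] at hz; exact invFunOn_eq hz
  have hm : MapsTo (invFunOn g C) (ball 0 1) C := by
    intro z hz; rw [← hgC] at hz; exact invFunOn_mem hz
  refine ⟨invFunOn g C, g, ?_, hg.diff.continuousOn, hm, hg.maps, hgf, hfg⟩
  intro z hz
  obtain ⟨w, hw, rfl⟩ : ∃ w ∈ C, g w = z := ⟨_, hm hz, hgf z hz⟩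
  have hsd : HasStrictDerivAt g (deriv g w) w :=
    ((hg.diff.analyticAt (hC.mem_nhds hw)).contDiffAt (n := 1)).hasStrictDerivAt (by simp)
  have hc : ContinuousAt (invFunOn g C) (g w) := by
    unfold ContinuousAt
    rw [hfg w hw, ← hsd.map_nhds_eq (hg.der w hw), Filter.tendsto_map'_iff]
    refine Filter.Tendsto.congr' ?_ Filter.tendsto_id
    filter_upwards [hC.mem_nhds hw] with y hy
    simp [hfg y hy]
  refine DifferentiableAt.differentiableWithinAt (HasDerivAt.differentiableAt
    (HasDerivAt.of_local_left_inverse hc (f := g) (f' := deriv g w) ?_ (hg.der w hw) ?_))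
  · rw [hfg w hw]; exact hsd.hasDerivAt
  · filter_upwards [isOpen_ball.mem_nhds hz] with y hy using hgf y hy

theorem length_area {f : ℂ → ℂ} (hf : DifferentiableOn ℂ f (ball 0 1)) (hinj : InjOn f (ball 0 1))
    (hb : IsBounded (f '' ball 0 1)) {ε R : ℝ} (hε : 0 < ε) (hR : 0 < R) :
    ∃ r, 0 < r ∧ r < R ∧ ∀ z ∈ ball (0:ℂ) 1 ∩ sphere 1 r, ∀ z' ∈ ball (0:ℂ) 1 ∩ sphere 1 r,
      dist (f z) (f z') ≤ 4 * ε := by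
  set F : ℂ → ℂ := fun ζ => f (1 - exp ζ) with hF
  set Ω : Set ℂ := {ζ | (-π < ζ.im ∧ ζ.im < π) ∧ ‖1 - exp ζ‖ < 1} with hΩ
  have hΩo : IsOpen Ω := by
    refine IsOpen.and (IsOpen.and ?_ ?_) ?_
    · exact isOpen_lt continuous_const continuous_im
    · exact isOpen_lt continuous_im continuous_const
    · exact isOpen_lt (by fun_prop) continuous_const
  have hFd : DifferentiableOn ℂ F Ω := by
    intro ζ hζ
    have : DifferentiableAt ℂ f (1 - exp ζ) :=
      hf.differentiableAt (isOpen_ball.mem_nhds (by simpa using hζ.2))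
    exact (DifferentiableAt.comp ζ this (by fun_prop)).differentiableWithinAt
  have hFi : InjOn F Ω := by
    intro a ha b hb hab
    have := hinj (by simpa using ha.2) (by simpa using hb.2) hab
    exact exp_inj_of_neg_pi_lt_of_le_pi ha.1.1 ha.1.2.le hb.1.1 hb.1.2.le
      (by simpa using this)
  have hFb : MeasureTheory.volume (F '' Ω) < ⊤ := by
    refine (hb.subset ?_).measure_lt_top
    rintro _ ⟨ζ, hζ, rfl⟩
    exact ⟨_, by simpa using hζ.2, rfl⟩
  have hdF : ∀ ζ ∈ Ω, HasDerivAt F (deriv F ζ) ζ := fun ζ hζ =>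
    (hFd.differentiableAt (hΩo.mem_nhds hζ)).hasDerivAt
  have harea := MeasureTheory.lintegral_abs_det_fderiv_eq_addHaar_image MeasureTheory.volume
    hΩo.measurableSet (f := F)
    (f' := fun ζ => (ContinuousLinearMap.toSpanSingleton ℂ (deriv F ζ)).restrictScalars ℝ)
    (fun ζ hζ => ((hdF ζ hζ).hasFDerivAt.restrictScalars ℝ).hasFDerivWithinAt) hFi
  have hdet : ∀ c : ℂ, ((ContinuousLinearMap.toSpanSingleton ℂ c).restrictScalars ℝ).det
      = ‖c‖ ^ 2 := by
    intro c
    have : (((ContinuousLinearMap.toSpanSingleton ℂ c).restrictScalars ℝ : ℂ →L[ℝ] ℂ) : ℂ →ₗ[ℝ] ℂ)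
       = LinearMap.mulLeft ℝ c := by
      ext <;> simp [mul_comm]
    rw [ContinuousLinearMap.det, this]
    have h2 := Algebra.norm_complex_apply c
    rw [Algebra.norm_apply] at h2
    rw [← normSq_eq_norm_sq, ← h2]
    rfl
  simp only [hdet, abs_pow, abs_norm] at harea
  set h : ℂ → ENNReal := Ω.indicator (fun ζ => ENNReal.ofReal (‖deriv F ζ‖ ^ 2)) with hh
  have hhm : Measurable h := by
    refine Measurable.indicator ?_ hΩo.measurableSet
    fun_prop
  have hnt : ∫⁻ ζ, h ζ < ⊤ := by
    rw [hh, MeasureTheory.lintegral_indicator hΩo.measurableSet, harea]; exact hFb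
  have hprod : ∫⁻ ζ, h ζ = ∫⁻ x : ℝ, ∫⁻ y : ℝ, h ⟨x, y⟩ := by
    rw [← volume_preserving_equiv_real_prod.symm.lintegral_comp hhm]
    rw [MeasureTheory.Measure.volume_eq_prod, MeasureTheory.lintegral_prod]
    · rfl
    · fun_prop
  have hex : ∃ x < Real.log R, ∫⁻ y : ℝ, h ⟨x, y⟩ ≤ ENNReal.ofReal (ε ^ 2) := by
    by_contra! hcon
    have : ∫⁻ x in Iio (Real.log R), ENNReal.ofReal (ε ^ 2) ≤ ∫⁻ ζ, h ζ := by
      rw [hprod]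
      refine le_trans ?_ (MeasureTheory.setLIntegral_le_lintegral (Iio (Real.log R)) _)
      exact MeasureTheory.setLIntegral_mono' measurableSet_Iio fun x hx => (hcon x hx).le
    rw [MeasureTheory.setLIntegral_const, Real.volume_Iio, ENNReal.mul_top] at this
    · exact absurd (this.trans_lt hnt) (by simp)
    · simp; positivity
  obtain ⟨x, hxR, hx⟩ := hex
  have hslice : ∀ y, -π < y → y < π → ((⟨x, y⟩ : ℂ) ∈ Ω ↔ Real.exp x < 2 * Real.cos y) := by
    intro y h1 h2
    have e1 : ‖1 - exp ⟨x, y⟩‖ ^ 2 = 1 - Real.exp x * (2 * Real.cos y - Real.exp x) := by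
      rw [← normSq_eq_norm_sq, normSq_apply]
      simp only [sub_re, sub_im, exp_re, exp_im, one_re,
        one_im]
      have := Real.sin_sq_add_cos_sq y
      linear_combination (Real.exp x) ^ 2 * this
    have e2 : ‖1 - exp ⟨x, y⟩‖ < 1 ↔ ‖1 - exp ⟨x, y⟩‖ ^ 2 < 1 := by
      rw [sq_lt_one_iff_abs_lt_one, abs_norm]
    have hpos := Real.exp_pos x
    simp only [hΩ, mem_ofPred_eq, h1, h2, true_and, e2, e1]
    constructor
    · intro h; by_contra! h3; nlinarith
    · intro h; nlinarith
  have key : ∀ y1 y2, y1 ≤ y2 → (⟨x, y1⟩ : ℂ) ∈ Ω → (⟨x, y2⟩ : ℂ) ∈ Ω →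
      ‖F ⟨x, y2⟩ - F ⟨x, y1⟩‖ ≤ 4 * ε := by
    intro y1 y2 h12 m1 m2
    have hmem : ∀ y ∈ Icc y1 y2, (⟨x, y⟩ : ℂ) ∈ Ω := by
      intro y hy
      have p1 := m1.1; have p2 := m2.1
      simp only at p1 p2
      have q1 := (hslice y1 p1.1 p1.2).1 m1
      have q2 := (hslice y2 p2.1 p2.2).1 m2
      refine (hslice y (by linarith [hy.1]) (by linarith [hy.2])).2 ?_
      rcases le_total 0 y with h0 | h0
      · have := Real.cos_le_cos_of_nonneg_of_le_pi h0 p2.2.le hy.2; linarith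
      · have := Real.cos_le_cos_of_nonneg_of_le_pi (x := -y) (y := -y1) (by linarith) (by linarith)
          (by linarith [hy.1])
        rw [Real.cos_neg, Real.cos_neg] at this; linarith
    have hcurve : ∀ y : ℝ, HasDerivAt (fun y : ℝ => (⟨x, y⟩ : ℂ)) I y := by
      intro y
      have : (fun y : ℝ => (⟨x, y⟩ : ℂ)) = fun y : ℝ => (x : ℂ) + (y : ℂ) * I := by
        funext y; rw [← mk_eq_add_mul_I]
      rw [this]
      simpa using ((hasDerivAt_id y).ofReal_comp.mul_const I).const_add (x : ℂ)
    have hder : ∀ y ∈ Icc y1 y2, HasDerivAt (fun y : ℝ => F ⟨x, y⟩)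
        (deriv F ⟨x, y⟩ * I) y := by
      intro y hy
      exact (hdF _ (hmem y hy)).comp_of_eq y (hcurve y) rfl
    have hdc : ContinuousOn (fun y : ℝ => deriv F ⟨x, y⟩) (Icc y1 y2) := by
      have c1 : ContinuousOn (deriv F) Ω := (hFd.deriv hΩo).continuousOn
      refine c1.comp (f := fun y : ℝ => (⟨x, y⟩ : ℂ)) ?_ hmem
      exact fun y _ => (hcurve y).continuousAt.continuousWithinAt
    have hu : uIcc y1 y2 = Icc y1 y2 := uIcc_of_le h12
    have hftc := intervalIntegral.integral_eq_sub_of_hasDerivAt (a := y1) (b := y2)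
      (f := fun y : ℝ => F ⟨x, y⟩) (f' := fun y => deriv F ⟨x, y⟩ * I)
      (by rw [hu]; exact hder)
      (ContinuousOn.intervalIntegrable (by rw [hu]; exact hdc.mul continuousOn_const))
    rw [← hftc]
    refine (intervalIntegral.norm_integral_le_integral_norm h12).trans ?_
    have hpi : y2 - y1 ≤ 7 := by
      have p1 := m1.1; have p2 := m2.1
      simp only at p1 p2
      linarith [Real.pi_lt_d2]
    have hsq : ∫ y in y1..y2, ‖deriv F ⟨x, y⟩‖ ^ 2 ≤ ε ^ 2 := by
      rw [intervalIntegral.integral_of_le h12, ← MeasureTheory.integral_Icc_eq_integral_Ioc]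
      have hi : MeasureTheory.IntegrableOn (fun y : ℝ => ‖deriv F ⟨x, y⟩‖ ^ 2) (Icc y1 y2) :=
        (hdc.norm.pow 2).integrableOn_Icc
      rw [← ENNReal.ofReal_le_ofReal_iff (by positivity),
        MeasureTheory.ofReal_integral_eq_lintegral_ofReal hi (by
          exact Filter.Eventually.of_forall fun y => by positivity)]
      refine le_trans ?_ hx
      refine le_trans (MeasureTheory.setLIntegral_mono' measurableSet_Icc (g := fun y => h ⟨x, y⟩) ?_)
        (MeasureTheory.setLIntegral_le_lintegral _ _)
      intro y hy
      simp [hh, indicator_of_mem (hmem y hy)]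
    have hmono : ∫ y in y1..y2, ‖deriv F ⟨x, y⟩ * I‖ ≤
        ∫ y in y1..y2, (‖deriv F ⟨x, y⟩‖ ^ 2 * (1 / (2 * ε)) + ε / 2) := by
      refine intervalIntegral.integral_mono_on h12 ?_ ?_ ?_
      · exact ContinuousOn.intervalIntegrable (by rw [hu]; exact (hdc.mul continuousOn_const).norm)
      · exact ContinuousOn.intervalIntegrable (by
          rw [hu]; exact ((hdc.norm.pow 2).mul continuousOn_const).add continuousOn_const)
      · intro y _
        rw [norm_mul, norm_I, mul_one]
        have := sq_nonneg (‖deriv F ⟨x, y⟩‖ - ε)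
        have e : ‖deriv F ⟨x, y⟩‖ ^ 2 * (1 / (2 * ε)) + ε / 2 - ‖deriv F ⟨x, y⟩‖ =
          (‖deriv F ⟨x, y⟩‖ - ε) ^ 2 / (2 * ε) := by field_simp; ring
        have : 0 ≤ (‖deriv F ⟨x, y⟩‖ - ε) ^ 2 / (2 * ε) := by positivity
        linarith
    refine hmono.trans ?_
    rw [intervalIntegral.integral_add, intervalIntegral.integral_mul_const,
      intervalIntegral.integral_const]
    · have : (∫ y in y1..y2, ‖deriv F ⟨x, y⟩‖ ^ 2) * (1 / (2 * ε)) ≤ ε ^ 2 * (1 / (2 * ε)) := by gcongr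
      have e : ε ^ 2 * (1 / (2 * ε)) = ε / 2 := by field_simp
      rw [smul_eq_mul]
      nlinarith
    · exact ContinuousOn.intervalIntegrable (by rw [hu]; exact (hdc.norm.pow 2).mul continuousOn_const)
    · simp
  refine ⟨Real.exp x, Real.exp_pos x, (Real.lt_log_iff_exp_lt hR).1 hxR, ?_⟩
  have hlift : ∀ z ∈ ball (0:ℂ) 1 ∩ sphere 1 (Real.exp x), ∃ y, (⟨x, y⟩ : ℂ) ∈ Ω ∧ F ⟨x, y⟩ = f z := by
    rintro z ⟨hz1, hz2⟩
    have hz1' : ‖z‖ < 1 := by simpa using hz1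
    have hz2' : ‖1 - z‖ = Real.exp x := by rw [norm_sub_rev]; simpa [dist_eq_norm] using hz2
    have hne : 1 - z ≠ 0 := one_sub_ne hz1'
    have hlog : log (1 - z) = ⟨x, (1 - z).arg⟩ := by
      apply Complex.ext
      · simp [log_re, hz2']
      · simp [log_im]
    have he : exp ⟨x, (1 - z).arg⟩ = 1 - z := by rw [← hlog, exp_log hne]
    have hre : 0 < (1 - z).re := by
      have := re_le_norm z
      simp; linarith
    refine ⟨(1 - z).arg, ⟨⟨neg_pi_lt_arg _, ?_⟩, ?_⟩, ?_⟩
    · exact lt_of_le_of_ne (arg_le_pi _) (fun h => by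
        rw [arg_eq_pi_iff] at h; linarith [h.1])
    · rw [he]; simpa using hz1'
    · simp [hF, he]
  intro z hz z' hz'
  obtain ⟨y, hy, e⟩ := hlift z hz
  obtain ⟨y', hy', e'⟩ := hlift z' hz'
  rw [← e, ← e', dist_eq_norm]
  rcases le_total y y' with h | h
  · rw [norm_sub_rev]; exact key y y' h hy hy'
  · exact key y' y h hy' hy

structure RMap (C : Set ℂ) (f g : ℂ → ℂ) : Prop where
  df : DifferentiableOn ℂ f (ball 0 1)
  cg : ContinuousOn g C
  mf : MapsTo f (ball 0 1) C
  mg : MapsTo g C (ball 0 1)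
  gf : ∀ z ∈ ball (0:ℂ) 1, g (f z) = z
  fg : ∀ w ∈ C, f (g w) = w

def LC (C : Set ℂ) : Prop := ∀ ε > 0, ∃ δ > 0, ∀ a ∈ frontier C, ∀ b ∈ frontier C, dist a b < δ →
  ∃ T : Set ℂ, IsPreconnected T ∧ T ⊆ Cᶜ ∧ T ⊆ closedBall a ε ∧ a ∈ T ∧ b ∈ T

theorem isPreconnected_compl_closedBall (k : ℂ) {ρ : ℝ} (h : 0 < ρ) :
    IsPreconnected {z : ℂ | ρ < dist z k} := by
  have := (isPreconnected_exterior h).image (fun z => z + k) (by fun_prop)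
  convert this using 1
  ext z
  simp only [mem_ofPred_eq, mem_image]
  constructor
  · intro hz; exact ⟨z - k, by rwa [← dist_eq_norm], by simp⟩
  · rintro ⟨y, hy, rfl⟩; simpa [dist_eq_norm] using hy

theorem RMap.bdry_one {C : Set ℂ} {f g : ℂ → ℂ} (h : RMap C f g) (hC : IsOpen C)
    (hCc : IsPreconnected C)
    (hb : IsBounded C) (hL : LC C) {ε : ℝ} (hε : 0 < ε) :
    ∃ r > 0, ∀ z ∈ ball (0:ℂ) 1 ∩ ball 1 r, ∀ z' ∈ ball (0:ℂ) 1 ∩ ball 1 r,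
      dist (f z) (f z') ≤ ε := by
  have h0 : (0:ℂ) ∈ ball (0:ℂ) 1 := by simp
  obtain ⟨η, hη, hP⟩ := nhds_basis_closedBall.mem_iff.1 (hC.mem_nhds (h.mf h0))
  obtain ⟨R, hR0, hR1, hR⟩ : ∃ R > 0, R ≤ 1 ∧ ∀ z ∈ ball (0:ℂ) 1, dist z 1 < R →
      f z ∉ closedBall (f 0) η := by
    have hcp : IsCompact (g '' closedBall (f 0) η) :=
      (isCompact_closedBall _ _).image_of_continuousOn (h.cg.mono hP)
    have hne : (g '' closedBall (f 0) η).Nonempty := ⟨_, f 0, by simp [hη.le], rfl⟩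
    obtain ⟨m, ⟨w, hw, rfl⟩, hm⟩ := hcp.exists_isMaxOn hne continuous_norm.continuousOn
    have hw1 : ‖g w‖ < 1 := by simpa using h.mg (hP hw)
    refine ⟨1 - ‖g w‖, by linarith, by linarith [norm_nonneg (g w)], ?_⟩
    intro z hz hd hmem
    have h2 : ‖z‖ ≤ ‖g w‖ := hm ⟨f z, hmem, h.gf z hz⟩
    have h3 : (1:ℝ) ≤ ‖z‖ + dist z 1 := by
      have : ‖(1:ℂ)‖ ≤ ‖z‖ + ‖1 - z‖ := by simpa using norm_add_le z (1 - z)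
      rw [dist_comm, dist_eq_norm]; simpa using this
    linarith
  set ρ := min (ε / 2) η with hρ
  have hρ0 : 0 < ρ := lt_min (by linarith) hη
  obtain ⟨δ, hδ, hLC⟩ := hL (ρ / 4) (by linarith)
  set ε' := min (δ / 16) (ρ / 16) with hε'
  have hε'0 : 0 < ε' := lt_min (by linarith) (by linarith)
  have hinj : InjOn f (ball 0 1) := fun x hx y hy hxy => by
    rw [← h.gf x hx, ← h.gf y hy, hxy]
  obtain ⟨r, hr0, hrR, hlen⟩ := length_area h.df hinj
    (hb.subset (by rintro _ ⟨z, hz, rfl⟩; exact h.mf hz)) hε'0 hR0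
  have hε1 : 16 * ε' ≤ δ := by have := min_le_left (δ / 16) (ρ / 16); rw [← hε'] at this; linarith
  have hε2 : 16 * ε' ≤ ρ := by have := min_le_right (δ / 16) (ρ / 16); rw [← hε'] at this; linarith
  set A := ball (0:ℂ) 1 ∩ sphere 1 r with hA
  have hkA : ((1 - r : ℝ) : ℂ) ∈ A := by
    constructor
    · rw [mem_ball_zero_iff, norm_real, Real.norm_eq_abs, abs_of_pos] <;> linarith
    · rw [mem_sphere, dist_eq_norm]
      push_cast
      simp [hr0.le]
  set k := f ((1 - r : ℝ) : ℂ) with hk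
  set K0 := closure (f '' A) with hK0
  have hK0k : K0 ⊆ closedBall k (4 * ε') := by
    refine closure_minimal ?_ isClosed_closedBall
    rintro _ ⟨z, hz, rfl⟩
    exact hlen z hz _ hkA
  have hfAC : f '' A ⊆ C := by rintro _ ⟨z, hz, rfl⟩; exact h.mf hz.1
  obtain ⟨T, hTc, hTp, hTC, hTk, hET⟩ : ∃ T : Set ℂ, IsClosed T ∧ IsPreconnected T ∧ T ⊆ Cᶜ ∧
      T ⊆ closedBall k ρ ∧ K0 ∩ frontier C ⊆ T := by
    rcases (K0 ∩ frontier C).eq_empty_or_nonempty with hE | ⟨e0, he0⟩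
    · exact ⟨∅, isClosed_empty, isPreconnected_empty, by simp, by simp, by rw [hE]⟩
    have : ∀ e : (K0 ∩ frontier C : Set ℂ), ∃ T : Set ℂ, IsPreconnected T ∧ T ⊆ Cᶜ ∧
        T ⊆ closedBall e0 (ρ / 4) ∧ e0 ∈ T ∧ (e : ℂ) ∈ T := by
      rintro ⟨e, he⟩
      refine hLC e0 he0.2 e he.2 ?_
      have := dist_triangle_right e0 e k
      have h1 := hK0k he0.1; have h2 := hK0k he.1
      rw [mem_closedBall] at h1 h2
      linarith
    choose Te hT1 hT2 hT3 hT4 hT5 using this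
    refine ⟨closure (⋃ e, Te e), isClosed_closure, ?_, ?_, ?_, ?_⟩
    · exact (isPreconnected_iUnion ⟨e0, mem_iInter.2 hT4⟩ hT1).closure
    · exact closure_minimal (iUnion_subset hT2) hC.isClosed_compl
    · refine closure_minimal (iUnion_subset fun e => (hT3 e).trans ?_) isClosed_closedBall
      refine closedBall_subset_closedBall' ?_
      have h1 := hK0k he0.1
      rw [mem_closedBall] at h1
      linarith
    · intro e he
      exact subset_closure (mem_iUnion.2 ⟨⟨e, he⟩, hT5 _⟩)
  set K := K0 ∪ T with hK
  set L := frontier C ∪ T with hLdef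
  have hKk : K ⊆ closedBall k ρ :=
    union_subset (hK0k.trans (closedBall_subset_closedBall (by linarith))) hTk
  have hTcp : IsCompact T := (isCompact_closedBall k ρ).of_isClosed_subset hTc hTk
  have hKcp : IsCompact K :=
    ((isCompact_closedBall k _).of_isClosed_subset isClosed_closure hK0k).union hTcp
  have hLcp : IsCompact L := (hb.isCompact_closure.of_isClosed_subset isClosed_frontier
    frontier_subset_closure).union hTcp
  have hKL : K ∩ L = T := by
    grind
  have hCL : ∀ w ∈ C, w ∉ L := by
    rintro w hw (h1 | h1)
    · rw [hC.frontier_eq] at h1; exact h1.2 hw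
    · exact hTC h1 hw
  have main : ∀ z ∈ ball (0:ℂ) 1 ∩ ball 1 r, f z ∈ closedBall k ρ := by
    rintro z ⟨hz1, hzr⟩
    by_contra hcon
    have hcon' : ρ < dist (f z) k := by simpa using hcon
    have hw0 : ρ < dist (f 0) k := by
      have h1 := hR _ hkA.1 (by have := hkA.2; rw [mem_sphere] at this; rw [this]; exact hrR)
      rw [mem_closedBall, not_le] at h1
      have h2 : η < dist (f 0) k := by rw [dist_comm]; exact h1
      exact lt_of_le_of_lt (min_le_right _ _) h2
    have hout : ∀ w, ρ < dist w k → w ∉ K := fun w hw hwK => by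
      have := hKk hwK; rw [mem_closedBall] at this; linarith
    have j := janiszewski hKcp hLcp (by rw [hKL]; exact hTp) (p := f z) (q := f 0)
      (hCL _ (h.mf hz1)) (hout _ hw0) (hCL _ (h.mf h0))
      (comp_eq_of_preconn (isPreconnected_compl_closedBall k hρ0) (fun w hw => hout w hw) hcon' hw0)
      (comp_eq_of_preconn hCc hCL (h.mf hz1) (h.mf h0))
    set S := connectedComponentIn (K ∪ L)ᶜ (f z) with hS
    have hSp : IsPreconnected S := isPreconnected_connectedComponentIn
    have hSsub : S ⊆ (K ∪ L)ᶜ := connectedComponentIn_subset _ _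
    have hSC : S ⊆ C := preconn_subset_of_frontier hSp hC ⟨f 0, j, h.mf h0⟩
      (fun x hx hxf => hSsub hx (Or.inr (Or.inl hxf)))
    have hzS : f z ∈ S := mem_connectedComponentIn (by
      rintro (h1 | h1)
      · exact hout _ hcon' h1
      · exact hCL _ (h.mf hz1) h1)
    have hgS : IsPreconnected (g '' S) := hSp.image _ (h.cg.mono hSC)
    have := preconn_subset_of_frontier hgS (isOpen_ball (x := (1:ℂ)) (ε := r))
      ⟨z, ⟨f z, hzS, h.gf z hz1⟩, hzr⟩ (by
        rintro _ ⟨s, hs, rfl⟩ hfr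
        rw [frontier_ball _ hr0.ne'] at hfr
        refine hSsub hs (Or.inl (Or.inl (subset_closure ⟨g s, ⟨h.mg (hSC hs), hfr⟩, h.fg s (hSC hs)⟩))))
    have h1 : (0:ℂ) ∈ ball (1:ℂ) r := this ⟨f 0, j, h.gf 0 h0⟩
    rw [mem_ball, dist_eq_norm] at h1
    simp at h1
    linarith
  refine ⟨r, hr0, fun z hz z' hz' => ?_⟩
  have h1 := main z hz; have h2 := main z' hz'
  rw [mem_closedBall] at h1 h2
  have := dist_triangle_right (f z) (f z') k
  have := min_le_left (ε / 2) η
  linarith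

theorem RMap.bdry {C : Set ℂ} {f g : ℂ → ℂ} (h : RMap C f g) (hC : IsOpen C)
    (hCc : IsPreconnected C)
    (hb : IsBounded C) (hL : LC C) {a : ℂ} (ha : ‖a‖ = 1) {ε : ℝ} (hε : 0 < ε) :
    ∃ r > 0, ∀ z ∈ ball (0:ℂ) 1 ∩ ball a r, ∀ z' ∈ ball (0:ℂ) 1 ∩ ball a r,
      dist (f z) (f z') ≤ ε := by
  have ha0 : a ≠ 0 := by rintro rfl; simp at ha
  have hr : RMap C (fun z => f (a * z)) (fun w => a⁻¹ * g w) := by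
    have hm : ∀ z ∈ ball (0:ℂ) 1, a * z ∈ ball (0:ℂ) 1 := by intro z hz; simpa [ha] using hz
    refine ⟨h.df.comp (by fun_prop) hm, continuousOn_const.mul h.cg, fun z hz => h.mf (hm z hz),
      fun w hw => by simpa [ha] using h.mg hw, fun z hz => ?_, fun w hw => ?_⟩
    · rw [h.gf _ (hm z hz)]; field_simp
    · have := h.fg w hw
      grind
  obtain ⟨r, hr0, hr⟩ := hr.bdry_one hC hCc hb hL hε
  refine ⟨r, hr0, ?_⟩
  have key : ∀ z ∈ ball (0:ℂ) 1 ∩ ball a r, a⁻¹ * z ∈ ball (0:ℂ) 1 ∩ ball 1 r := by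
    rintro z ⟨h1, h2⟩
    refine ⟨by simpa [ha] using h1, ?_⟩
    rw [mem_ball, dist_eq_norm] at h2 ⊢
    have : a⁻¹ * z - 1 = a⁻¹ * (z - a) := by field_simp
    rw [this, norm_mul, norm_inv, ha]; simpa using h2
  intro z hz z' hz'
  have := hr _ (key z hz) _ (key z' hz')
  simpa [← mul_assoc, mul_inv_cancel₀ ha0] using this

/-- Extension to the boundary. -/
theorem RMap.extend {C : Set ℂ} {f g : ℂ → ℂ} (h : RMap C f g) (hC : IsOpen C)
    (hCc : IsPreconnected C) (hb : IsBounded C) (hL : LC C) :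
    ∃ F : ℂ → ℂ, ContinuousOn F (closedBall 0 1) ∧ EqOn F f (ball 0 1) ∧
      MapsTo F (sphere 0 1) (frontier C) ∧ frontier C ⊆ F '' (sphere 0 1) := by
  have hcl : closure (ball (0:ℂ) 1) = closedBall 0 1 := closure_ball _ one_ne_zero
  have hlim : ∀ x ∈ closedBall (0:ℂ) 1, ∃ y, Filter.Tendsto f (𝓝[ball 0 1] x) (𝓝 y) := by
    intro x hx
    rcases lt_or_eq_of_le (mem_closedBall_zero_iff.1 hx) with h1 | h1
    · exact ⟨f x, (h.df.continuousOn x (by simpa using h1)).tendsto⟩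
    · have : (𝓝[ball 0 1] x).NeBot := mem_closure_iff_nhdsWithin_neBot.1 (by rw [hcl]; exact hx)
      apply cauchy_map_iff_exists_tendsto.1
      rw [Metric.cauchy_iff]
      refine ⟨inferInstance, fun ε hε => ?_⟩
      obtain ⟨r, hr0, hr⟩ := h.bdry hC hCc hb hL h1 (half_pos hε)
      refine ⟨f '' (ball 0 1 ∩ ball x r), Filter.image_mem_map (Filter.inter_mem self_mem_nhdsWithin
        (mem_nhdsWithin_of_mem_nhds (ball_mem_nhds x hr0))), ?_⟩
      grind
  set F := extendFrom (ball (0:ℂ) 1) f with hF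
  have hFc : ContinuousOn F (closedBall 0 1) := continuousOn_extendFrom hcl.ge hlim
  have hFe : EqOn F f (ball 0 1) := by
    intro z hz
    exact extendFrom_eq (subset_closure hz) (h.df.continuousOn z hz).tendsto
  have hFcl : MapsTo F (closedBall 0 1) (closure C) := by
    intro z hz
    have : F z ∈ closure (F '' ball 0 1) := by
      rw [← hcl] at hz hFc
      exact hFc.image_closure ⟨z, hz, rfl⟩
    refine closure_mono ?_ this
    rintro _ ⟨y, hy, rfl⟩; rw [hFe hy]; exact h.mf hy
  have hns : ∀ a ∈ sphere (0:ℂ) 1, F a ∉ C := by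
    intro a ha hmem
    have hac : a ∈ closedBall (0:ℂ) 1 := sphere_subset_closedBall ha
    have : (𝓝[ball 0 1] a).NeBot := mem_closure_iff_nhdsWithin_neBot.1 (by rw [hcl]; exact hac)
    have t1 : Filter.Tendsto F (𝓝[ball 0 1] a) (𝓝 (F a)) :=
      (hFc a hac).mono_left (nhdsWithin_mono _ ball_subset_closedBall)
    have t2 : Filter.Tendsto (fun z => g (F z)) (𝓝[ball 0 1] a) (𝓝 (g (F a))) :=
      (h.cg.continuousAt (hC.mem_nhds hmem)).tendsto.comp t1
    have t3 : Filter.Tendsto (fun z => g (F z)) (𝓝[ball 0 1] a) (𝓝 a) := by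
      refine Filter.Tendsto.congr' ?_ (Filter.tendsto_id.mono_left nhdsWithin_le_nhds)
      filter_upwards [self_mem_nhdsWithin] with z hz
      rw [hFe hz, h.gf z hz]; rfl
    have e := tendsto_nhds_unique t2 t3
    have := h.mg hmem
    simp_all
  refine ⟨F, hFc, hFe, ?_, ?_⟩
  · intro a ha
    rw [hC.frontier_eq]
    exact ⟨hFcl (sphere_subset_closedBall ha), hns a ha⟩
  · intro w hw
    rw [hC.frontier_eq] at hw
    have hcp : IsClosed (F '' closedBall 0 1) :=
      ((isCompact_closedBall _ _).image_of_continuousOn hFc).isClosed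
    have : closure C ⊆ F '' closedBall 0 1 := by
      refine closure_minimal ?_ hcp
      intro c hc
      exact ⟨g c, ball_subset_closedBall (h.mg hc), by rw [hFe (h.mg hc), h.fg c hc]⟩
    obtain ⟨z, hz, rfl⟩ := this hw.1
    refine ⟨z, ?_, rfl⟩
    rcases lt_or_eq_of_le (mem_closedBall_zero_iff.1 hz) with h1 | h1
    · exfalso
      have hz' : z ∈ ball (0:ℂ) 1 := by simpa using h1
      exact hw.2 (by rw [hFe hz']; exact h.mf hz')
    · simpa using h1

theorem riesz {F : ℂ → ℂ} (hc : ContinuousOn F (closedBall 0 1))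
    (hd : DifferentiableOn ℂ F (ball 0 1)) {c v : ℂ} {s : ℝ} (hc1 : ‖c‖ = 1) (hs : 0 < s)
    (h : ∀ z ∈ sphere (0:ℂ) 1, dist z c < s → F z = v) : F 0 = v := by
  obtain ⟨n, hn⟩ := exists_nat_gt (2 * π / s)
  have hn0 : (0:ℝ) < n := lt_trans (by positivity) hn
  set ω : ℂ := exp ((2 * π / n : ℝ) * I) with hω
  have hω1 : ‖ω‖ = 1 := norm_exp_ofReal_mul_I _
  set P : ℂ → ℂ := fun z => ∏ k ∈ Finset.range n, (F (ω ^ k * z) - v) with hP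
  have hPc : ContinuousOn P (closedBall 0 1) := by
    refine continuousOn_finsetProd _ fun k _ => ContinuousOn.sub (hc.comp (by fun_prop) ?_) continuousOn_const
    intro z hz; simpa [hω1] using hz
  have hPd : DifferentiableOn ℂ P (ball 0 1) := by
    refine DifferentiableOn.fun_finsetProd fun k _ => DifferentiableOn.sub (hd.comp (by fun_prop) ?_) (by fun_prop)
    intro z hz; simpa [hω1] using hz
  have hDC : DiffContOnCl ℂ P (ball 0 1) :=
    ⟨hPd, by rw [closure_ball _ one_ne_zero]; exact hPc⟩
  have h0 : ‖P 0‖ ≤ 0 := by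
    refine norm_le_of_forall_mem_frontier_norm_le isBounded_ball hDC ?_
      (subset_closure (by simp))
    intro z hz
    rw [frontier_ball _ one_ne_zero] at hz
    have hz1 : ‖z‖ = 1 := by simpa using hz
    have hz0 : z ≠ 0 := by rintro rfl; simp at hz1
    suffices ∃ k ∈ Finset.range n, F (ω ^ k * z) - v = 0 by
      rw [hP]; simp only; rw [Finset.prod_eq_zero_iff.2 this, norm_zero]
    -- choose the angle
    set θ := toIcoMod Real.two_pi_pos 0 (c / z).arg with hθ
    have hθm : θ ∈ Ico 0 (2 * π) := by simpa using toIcoMod_mem_Ico Real.two_pi_pos 0 (c / z).arg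
    have hθe : c / z = exp (θ * I) := by
      have h1 : c / z = exp ((c / z).arg * I) := by
        have := norm_mul_exp_arg_mul_I (c / z)
        simp_all
      have h2 : (c / z).arg = θ + toIcoDiv Real.two_pi_pos 0 (c / z).arg • (2 * π) := by
        rw [hθ, toIcoMod_add_toIcoDiv_zsmul]
      rw [h1, h2, exp_eq_exp_iff_exists_int]
      exact ⟨toIcoDiv Real.two_pi_pos 0 (c / z).arg, by push_cast; simp; ring⟩
    set k := ⌊θ * n / (2 * π)⌋₊ with hk
    have hnn : 0 ≤ θ * n / (2 * π) := div_nonneg (mul_nonneg hθm.1 hn0.le) Real.two_pi_pos.le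
    have hk1 : (k : ℝ) ≤ θ * n / (2 * π) := Nat.floor_le hnn
    have hk2 : θ * n / (2 * π) < k + 1 := Nat.lt_floor_add_one _
    have hpi := Real.two_pi_pos
    refine ⟨k, ?_, ?_⟩
    · rw [Finset.mem_range, ← Nat.cast_lt (α := ℝ)]
      refine hk1.trans_lt ?_
      rw [div_lt_iff₀ hpi]
      nlinarith [hθm.2]
    · rw [sub_eq_zero]
      apply h
      · simp [hω1, hz1]
      · have e1 : ω ^ k = exp ((k * (2 * π / n) : ℝ) * I) := by
          rw [hω, ← exp_nat_mul]; congr 1; push_cast; ring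
        have e2 : c = z * exp (θ * I) := by rw [← hθe]; field_simp
        set φ := k * (2 * π / n) with hφ
        have e3 : ω ^ k * z - c = - (ω ^ k * z) * (exp (I * (θ - φ : ℝ)) - 1) := by
          rw [e2, e1]
          have : exp (θ * I) = exp (φ * I) *
            exp (I * (θ - φ : ℝ)) := by
            rw [← exp_add]; congr 1; push_cast; ring
          rw [this]; ring
        rw [dist_eq_norm, e3, norm_mul, norm_neg, norm_mul, norm_pow, hω1, hz1, one_pow, one_mul, one_mul]
        refine (Real.norm_exp_I_mul_ofReal_sub_one_le).trans_lt ?_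
        have q1 : φ ≤ θ := by
          rw [le_div_iff₀ hpi] at hk1
          rw [hφ, ← mul_div_assoc, div_le_iff₀ hn0]; exact hk1
        have q2 : θ < φ + 2 * π / n := by
          rw [div_lt_iff₀ hpi] at hk2
          rw [hφ]
          have : (k:ℝ) * (2 * π / n) + 2 * π / n = ((k + 1) * (2 * π)) / n := by ring
          rw [this, lt_div_iff₀ hn0]; exact hk2
        have q3 : 2 * π / n < s := by
          rw [div_lt_iff₀ hn0]; rw [div_lt_iff₀ hs] at hn; linarith
        rw [Real.norm_eq_abs, abs_of_nonneg (by linarith)]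
        linarith
  have h1 : P 0 = 0 := norm_le_zero_iff.1 h0
  simp only [hP, mul_zero, Finset.prod_const, Finset.card_range] at h1
  exact sub_eq_zero.1 (pow_eq_zero_iff (n := n) (by rintro rfl; simp at hn0) |>.1 h1)

/-- The affine function vanishing on the line through `a`, `b`. -/
def lin (a b z : ℂ) : ℝ := ((z - a) * conj (b - a)).im

theorem lin_cont (a b : ℂ) : Continuous (lin a b) := by unfold lin; fun_prop

theorem lin_add (a b z w : ℂ) (s t : ℝ) (h : s + t = 1) :
    lin a b (s • z + t • w) = s * lin a b z + t * lin a b w := by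
  have : t = 1 - s := by linarith
  subst this
  simp [lin]; ring

theorem lin_seg {a b z : ℂ} (hab : a ≠ b) (ha : ‖a‖ = 1) (hb : ‖b‖ = 1) (hz : ‖z‖ ≤ 1)
    (h : lin a b z = 0) : z ∈ segment ℝ a b := by
  set d := b - a with hd
  have hd0 : d ≠ 0 := sub_ne_zero.2 (Ne.symm hab)
  have hn : 0 < ‖d‖ ^ 2 := by positivity
  set t : ℝ := ((z - a) * conj d).re / ‖d‖ ^ 2 with ht
  have hzt : z = a + t * d := by
    have h1 : (z - a) * conj d = ((t * ‖d‖ ^ 2 : ℝ) : ℂ) := by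
      apply Complex.ext
      · rw [ofReal_re, ht]; field_simp
      · rw [ofReal_im]; exact h
    have h2 : (z - a) * (conj d * d) = t * d * (conj d * d) := by
      rw [← mul_assoc, h1, mul_comm (conj d) d, mul_conj,
        normSq_eq_norm_sq]; push_cast; ring
    have h3 : conj d * d ≠ 0 := mul_ne_zero (by simpa using hd0) hd0
    grind
  have hsq : ∀ w : ℂ, ‖w‖ ^ 2 = w.re ^ 2 + w.im ^ 2 := fun w => by
    rw [← normSq_eq_norm_sq, normSq_apply]; ring
  have e1 : ‖z‖ ^ 2 = 1 - t * (1 - t) * ‖d‖ ^ 2 := by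
    have ha2 := hsq a; have hb2 := hsq b
    rw [ha] at ha2; rw [hb] at hb2
    rw [hsq z, hsq d, hzt, hd]
    simp
    linear_combination (1 - t) * (-ha2) - t * hb2
  have hz2 : ‖z‖ ^ 2 ≤ 1 := by nlinarith [norm_nonneg z]
  have ht2 : 0 ≤ t * (1 - t) := by
    by_contra! hneg
    nlinarith
  have ht0 : 0 ≤ t := by by_contra! hneg; nlinarith
  have ht1 : t ≤ 1 := by by_contra! hneg; nlinarith
  refine ⟨1 - t, t, by linarith, ht0, by ring, ?_⟩
  rw [hzt, hd]; simp; ring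

theorem seg_ball {a b z : ℂ} (ha : ‖a‖ = 1) (hb : ‖b‖ = 1)
    (h : z ∈ segment ℝ a b) : z = a ∨ z = b ∨ z ∈ ball (0:ℂ) 1 := by
  rw [← insert_endpoints_openSegment] at h
  rcases h with h | h | h
  · exact Or.inl h
  · exact Or.inr (Or.inl h)
  by_cases hab : a = b
  · subst hab; simp at h; exact Or.inl h
  · right; right
    have := (strictConvex_closedBall ℝ (0:ℂ) 1).openSegment_subset (x := a) (y := b)
      (by simp [ha]) (by simp [hb]) hab h
    rwa [interior_closedBall _ one_ne_zero] at this

def NC (G : Set ℂ) : Prop := ∀ v, ∀ W : Set ℂ, IsOpen W → IsBounded W →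
  frontier W ∩ G ⊆ {v} → W ∩ G ⊆ {v}

theorem RMap.cap {C G : Set ℂ} {f g F : ℂ → ℂ} (h : RMap C f g)
    (hG1 : frontier C ⊆ G) (hG2 : ∀ x ∈ C, x ∉ G)
    (hFc : ContinuousOn F (closedBall 0 1)) (hFe : EqOn F f (ball 0 1))
    (hFs : MapsTo F (sphere 0 1) (frontier C)) {a b : ℂ} (hab : a ≠ b) (ha : ‖a‖ = 1) (hb : ‖b‖ = 1)
    (hv : F a = F b) : ∃ c, ‖c‖ = 1 ∧ 0 < lin a b c ∧ F c ≠ F a ∧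
      ∀ z ∈ ball (0:ℂ) 1, 0 < lin a b z →
        F c ∈ connectedComponentIn (F '' segment ℝ a b)ᶜ (f z) := by
  have hsegG : ∀ x ∈ segment ℝ a b, F x ∈ G → F x = F a := by
    intro x hx hxG
    rcases seg_ball ha hb hx with rfl | rfl | hx1
    · rfl
    · exact hv.symm
    · exfalso; rw [hFe hx1] at hxG; exact hG2 _ (h.mf hx1) hxG
  have hseg0 : ∀ x ∈ segment ℝ a b, lin a b x = 0 := by
    rintro x ⟨s, t, hs, ht, hst, rfl⟩
    rw [lin_add _ _ _ _ _ _ hst]; simp [lin]; right; ring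
  have hFa : F a ∈ frontier C := hFs (by simpa using ha)
  have hfr0 : f 0 ≠ F a := by
    intro e; rw [← e] at hFa; exact hG2 _ (h.mf (by simp)) (hG1 hFa)
  -- a point of the circle in the cap
  obtain ⟨c0, hc0, hl0⟩ : ∃ c0 : ℂ, ‖c0‖ = 1 ∧ 0 < lin a b c0 := by
    have hd0 : b - a ≠ 0 := sub_ne_zero.2 (Ne.symm hab)
    have hdn : 0 < ‖b - a‖ := norm_pos_iff.2 hd0
    refine ⟨I * (b - a) / ‖b - a‖, by simp [hdn.ne'], ?_⟩
    have e1 : lin a b (I * (b - a) / ‖b - a‖) = ‖b - a‖ - (a * conj b).im := by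
      unfold lin
      rw [sub_mul]
      have : I * (b - a) / ‖b - a‖ * conj (b - a) = I * (‖b - a‖ : ℝ) := by
        have h2 : (b - a) * conj (b - a) = (‖b - a‖ : ℂ) * ‖b - a‖ := by
          rw [mul_conj, normSq_eq_norm_sq]; push_cast; ring
        grind
      rw [this]
      simp; ring
    rw [e1]
    have e2 : (a * conj b).im = -(a * conj (a - b)).im := by
      simp; ring
    have e3 : |(a * conj b).im| ≤ ‖b - a‖ := by
      rw [e2, abs_neg]
      refine (abs_im_le_norm _).trans ?_
      rw [norm_mul, ha, one_mul, norm_conj, norm_sub_rev]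
    have e4 : (a * conj b).im ≠ ‖b - a‖ := by
      intro e4
      have hsq : ∀ w : ℂ, ‖w‖ ^ 2 = w.re ^ 2 + w.im ^ 2 := fun w => by
        rw [← normSq_eq_norm_sq, normSq_apply]; ring
      have ha2 := hsq a; have hb2 := hsq b; have hd2 := hsq (b - a)
      rw [ha] at ha2; rw [hb] at hb2
      rw [← e4] at hd2
      have e5 : ‖b - a‖ ≠ 0 := hdn.ne'
      rw [← e4] at e5
      simp at hd2 e5
      -- sin² = 2 - 2 cos, so cos = 1
      grind
    grind
  obtain ⟨c, hc1, hcl, hcv⟩ : ∃ c, ‖c‖ = 1 ∧ 0 < lin a b c ∧ F c ≠ F a := by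
    by_contra! hcon
    obtain ⟨s, hs, hsub⟩ := Metric.mem_nhds_iff.1
      ((isOpen_lt continuous_const (lin_cont a b)).mem_nhds hl0)
    have := riesz (v := F a) hFc (h.df.congr hFe) hc0 hs (fun z hz hd =>
      hcon z (by simpa using hz) (hsub hd))
    rw [hFe (by simp)] at this
    exact hfr0 this
  refine ⟨c, hc1, hcl, hcv, ?_⟩
  intro z hz hlz
  set S : Set ℂ := insert c (ball (0:ℂ) 1 ∩ {z | 0 < lin a b z}) with hS
  have hconv : Convex ℝ (ball (0:ℂ) 1 ∩ {z | 0 < lin a b z}) := by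
    refine (convex_ball _ _).inter ?_
    intro x hx y hy s t hs ht hst
    simp only [mem_ofPred_eq] at hx hy ⊢
    rw [lin_add _ _ _ _ _ _ hst]
    rcases eq_or_lt_of_le hs with h1 | h1
    · nlinarith
    · positivity
  have hSp : IsPreconnected S := by
    refine hconv.isPreconnected.subset_closure (subset_insert _ _) ?_
    refine insert_subset ?_ subset_closure
    rw [inter_comm]
    have ho : IsOpen {z | 0 < lin a b z} := isOpen_lt continuous_const (lin_cont a b)
    refine ho.inter_closure ⟨hcl, ?_⟩
    rw [closure_ball _ one_ne_zero]; simp [hc1]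
  have hSc : S ⊆ closedBall 0 1 := by
    refine insert_subset (by simp [hc1]) (inter_subset_left.trans ball_subset_closedBall)
  have hFS : IsPreconnected (F '' S) := hSp.image _ (hFc.mono hSc)
  have hinj : InjOn f (ball 0 1) := fun x hx y hy hxy => by
    rw [← h.gf x hx, ← h.gf y hy, hxy]
  refine comp_eq_of_preconn hFS ?_ ⟨z, Or.inr ⟨hz, hlz⟩, hFe hz⟩ ⟨c, Or.inl rfl, rfl⟩
  rintro _ ⟨x, hx, rfl⟩ ⟨y, hy, hxy⟩
  have hy0 := hseg0 y hy
  rcases hx with rfl | ⟨hx1, hx2⟩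
  · have hxG : F x ∈ G := hG1 (hFs (by simpa using hc1))
    rw [← hxy] at hxG hcv
    exact hcv (hsegG y hy hxG)
  · have hxC : F x ∈ C := by rw [hFe hx1]; exact h.mf hx1
    rcases seg_ball ha hb hy with rfl | rfl | hy1
    · rw [← hxy] at hxC; exact hG2 _ hxC (hG1 hFa)
    · rw [← hxy, ← hv] at hxC; exact hG2 _ hxC (hG1 hFa)
    · rw [hFe hx1, hFe hy1] at hxy
      have := hinj hy1 hx1 hxy
      grind

theorem RMap.inj {C G : Set ℂ} {f g F : ℂ → ℂ} (h : RMap C f g) (hC : IsOpen C)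
    (hCc : IsPreconnected C) (hCb : IsBounded C)
    (hG1 : frontier C ⊆ G) (hG2 : ∀ x ∈ C, x ∉ G) (hN : NC G)
    (hFc : ContinuousOn F (closedBall 0 1)) (hFe : EqOn F f (ball 0 1))
    (hFs : MapsTo F (sphere 0 1) (frontier C)) : InjOn F (sphere 0 1) := by
  intro a ha b hb hv
  by_contra hab
  have ha : ‖a‖ = 1 := by simpa using ha
  have hb : ‖b‖ = 1 := by simpa using hb
  obtain ⟨c1, hc1, hl1, hv1, hz1⟩ := h.cap hG1 hG2 hFc hFe hFs hab ha hb hv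
  obtain ⟨c2, hc2, hl2, hv2, hz2⟩ := h.cap hG1 hG2 hFc hFe hFs (Ne.symm hab) hb ha hv.symm
  rw [segment_symm] at hz2
  have hswap : ∀ z, lin b a z = - lin a b z := by
    intro z; simp [lin]; ring
  rw [hswap] at hl2
  simp only [hswap] at hz2
  set Γ := F '' segment ℝ a b with hΓ
  have hsegc : segment ℝ a b ⊆ closedBall 0 1 :=
    (convex_closedBall (0:ℂ) 1).segment_subset (by simp [ha]) (by simp [hb])
  have hΓcp : IsCompact Γ := by
    refine IsCompact.image_of_continuousOn ?_ (hFc.mono hsegc)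
    rw [← convexHull_pair]; exact (Set.toFinite _).isCompact_convexHull ℝ
  have hΓG : Γ ∩ G ⊆ {F a} := by
    rintro _ ⟨⟨x, hx, rfl⟩, hxG⟩
    rcases seg_ball ha hb hx with rfl | rfl | hx1
    · rfl
    · exact hv.symm
    · exfalso; rw [hFe hx1] at hxG; exact hG2 _ (h.mf hx1) hxG
  have hbd : ∀ c, ‖c‖ = 1 → F c ≠ F a →
      ¬ IsBounded (connectedComponentIn Γᶜ (F c)) := by
    intro c hc hcv hbd
    have hcG : F c ∈ G := hG1 (hFs (by simpa using hc))
    have hfr := frontier_comp_subset hΓcp.isClosed.isOpen_compl (F c)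
    rw [compl_compl] at hfr
    have := hN (F a) _ hΓcp.isClosed.isOpen_compl.connectedComponentIn hbd
      ((inter_subset_inter_left _ hfr).trans hΓG)
      ⟨mem_connectedComponentIn (fun hm => hcv (hΓG ⟨hm, hcG⟩)), hcG⟩
    exact hcv this
  have hn1 := hbd c1 hc1 hv1
  have hn2 := hbd c2 hc2 (by rw [hv]; exact hv2)
  -- choose interior points
  have hnt : ∀ c : ℂ, ‖c‖ = 1 → ∀ U : Set ℂ, IsOpen U → c ∈ U → ∃ z ∈ ball (0:ℂ) 1, z ∈ U := by
    intro c hc U hU hcU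
    have : c ∈ closure (ball (0:ℂ) 1) := by rw [closure_ball _ one_ne_zero]; simp [hc]
    obtain ⟨z, hz1, hz2⟩ := mem_closure_iff.1 this U hU hcU
    exact ⟨z, hz2, hz1⟩
  obtain ⟨z1, hzb1, hzl1⟩ := hnt c1 hc1 _ (isOpen_lt continuous_const (lin_cont a b)) hl1
  obtain ⟨z2, hzb2, hzl2⟩ := hnt c2 hc2 _ (isOpen_lt continuous_const (lin_cont a b).neg) hl2
  have k1 := hz1 z1 hzb1 hzl1
  have k2 := hz2 z2 hzb2 hzl2
  have k3 := unbounded_comp_unique hΓcp hn1 hn2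
  have k4 : f z2 ∈ connectedComponentIn Γᶜ (f z1) := by
    rw [connectedComponentIn_eq k1, connectedComponentIn_eq k3, ← connectedComponentIn_eq k2]
    refine mem_connectedComponentIn ?_
    by_contra hmem
    rw [connectedComponentIn_eq_empty hmem] at k2; exact k2
  have hz2Γ : f z2 ∉ Γ := connectedComponentIn_subset _ _ k4
  have hCf : ∀ x ∈ C, x ∉ frontier C := fun x hx hxf => hG2 x hx (hG1 hxf)
  have hfrcp : IsCompact (frontier C) := hCb.isCompact_closure.of_isClosed_subset isClosed_frontier
    frontier_subset_closure
  have j := janiszewski hΓcp hfrcp (by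
      refine (Set.Subsingleton.anti subsingleton_singleton
        ((inter_subset_inter_right _ hG1).trans hΓG)).isPreconnected) (hCf _ (h.mf hzb1)) hz2Γ
      (hCf _ (h.mf hzb2)) k4 (comp_eq_of_preconn hCc hCf (h.mf hzb1) (h.mf hzb2))
  set S := connectedComponentIn (Γ ∪ frontier C)ᶜ (f z1) with hS
  have hSp : IsPreconnected S := isPreconnected_connectedComponentIn
  have hSsub : S ⊆ (Γ ∪ frontier C)ᶜ := connectedComponentIn_subset _ _
  have hSC : S ⊆ C := preconn_subset_of_frontier hSp hC ⟨_, j, h.mf hzb2⟩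
    (fun x hx hxf => hSsub hx (Or.inr hxf))
  have hz1S : f z1 ∈ S := by
    refine mem_connectedComponentIn ?_
    by_contra hmem
    rw [hS, connectedComponentIn_eq_empty hmem] at j; exact j
  have hgS : IsPreconnected (g '' S) := hSp.image _ (h.cg.mono hSC)
  obtain ⟨_, ⟨s, hs, rfl⟩, hs0⟩ : (0:ℝ) ∈ lin a b '' (g '' S) := by
    refine (hgS.image _ (lin_cont a b).continuousOn).Icc_subset (a := lin a b z2) (b := lin a b z1)
      ⟨z2, ⟨_, j, h.gf _ hzb2⟩, rfl⟩ ⟨z1, ⟨_, hz1S, h.gf _ hzb1⟩, rfl⟩ ⟨?_, ?_⟩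
    · have : 0 < - lin a b z2 := hzl2
      linarith
    · exact le_of_lt hzl1
  have hgs := h.mg (hSC hs)
  have := lin_seg hab ha hb (by simpa using (ball_subset_closedBall hgs)) hs0
  exact hSsub hs (Or.inl ⟨_, this, by rw [hFe hgs, h.fg _ (hSC hs)]⟩)

section
theorem caratheodory {C G : Set ℂ} (hC : IsOpen C) (hCc : IsPreconnected C) (hne : C.Nonempty)
    (hb : IsBounded C) (hF : Full C) (hL : LC C)
    (hG1 : frontier C ⊆ G) (hG2 : ∀ x ∈ C, x ∉ G) (hN : NC G) :
    ∃ F : ℂ → ℂ, ContinuousOn F (closedBall 0 1) ∧ InjOn F (closedBall 0 1) ∧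
      F '' ball 0 1 = C ∧ F '' sphere 0 1 = frontier C := by
  obtain ⟨z0, hz0⟩ := hne
  obtain ⟨f, g, h1, h2, h3, h4, h5, h6⟩ := rmt' hC hCc hb hF hz0
  have h : RMap C f g := ⟨h1, h2, h3, h4, h5, h6⟩
  obtain ⟨F, hFc, hFe, hFs, hFs'⟩ := h.extend hC hCc hb hL
  have hinj := h.inj hC hCc hb hG1 hG2 hN hFc hFe hFs
  have hFb : F '' ball 0 1 = C := by
    rw [hFe.image_eq]
    refine Subset.antisymm h3.image_subset fun w hw => ⟨g w, h4 hw, h6 w hw⟩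
  have hCfr : ∀ x ∈ C, x ∉ frontier C := fun x hx hxf => hG2 x hx (hG1 hxf)
  refine ⟨F, hFc, ?_, hFb, Subset.antisymm hFs.image_subset hFs'⟩
  have hcase : ∀ z ∈ closedBall (0:ℂ) 1, z ∈ ball (0:ℂ) 1 ∨ z ∈ sphere (0:ℂ) 1 := by
    intro z hz; rw [← ball_union_sphere] at hz; exact hz
  have hm : ∀ z ∈ ball (0:ℂ) 1, F z ∈ C := fun z hz => by rw [hFe hz]; exact h3 hz
  intro x hx y hy hxy
  rcases hcase x hx with hx | hx <;> rcases hcase y hy with hy | hy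
  · grind
  · exact absurd (hFs hy) (by rw [← hxy]; exact hCfr _ (hm x hx))
  · exact absurd (hFs hx) (by rw [hxy]; exact hCfr _ (hm y hy))
  · exact hinj hx hy hxy

section graph
variable {X : Type*} [TopologicalSpace X]

def LCn (G : Set X) : Prop := ∀ x ∈ G, ∀ U ∈ 𝓝 x, ∃ W ∈ 𝓝 x, ∀ y ∈ W ∩ G,
  ∃ T : Set X, IsPreconnected T ∧ T ⊆ G ∩ U ∧ x ∈ T ∧ y ∈ T

def FlatAt (G : Set X) (x : X) : Prop := ∃ e : OpenPartialHomeomorph X ℂ, x ∈ e.source ∧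
  ∀ y ∈ e.source, (y ∈ G ↔ (e y).im = 0)

structure Good (G V : Set X) : Prop where
  closed : IsClosed G
  pre : IsPreconnected G
  conn : ∀ v, IsPreconnected (G \ {v})
  lc : LCn G
  fin : V.Finite
  sub : V ⊆ G
  two : V.Nontrivial
  flat : ∀ x ∈ G, x ∉ V → FlatAt G x

theorem LCn.union {G H : Set X} (hG : IsClosed G) (hH : IsClosed H) (h1 : LCn G) (h2 : LCn H) :
    LCn (G ∪ H) := by
  intro x hx U hU
  have key : ∀ G : Set X, IsClosed G → LCn G → ∃ W ∈ 𝓝 x, ∀ y ∈ W ∩ G,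
      ∃ T : Set X, IsPreconnected T ∧ T ⊆ G ∩ U ∧ x ∈ T ∧ y ∈ T := by
    intro G hG h1
    by_cases hx : x ∈ G
    · exact h1 x hx U hU
    · exact ⟨Gᶜ, hG.isOpen_compl.mem_nhds hx, fun y hy => absurd hy.2 hy.1⟩
  obtain ⟨W1, hW1, k1⟩ := key G hG h1
  obtain ⟨W2, hW2, k2⟩ := key H hH h2
  refine ⟨W1 ∩ W2, Filter.inter_mem hW1 hW2, ?_⟩
  rintro y ⟨⟨hy1, hy2⟩, hy | hy⟩
  · obtain ⟨T, t1, t2, t3⟩ := k1 y ⟨hy1, hy⟩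
    grind
  · obtain ⟨T, t1, t2, t3⟩ := k2 y ⟨hy2, hy⟩
    grind

theorem LCn.arc [T2Space X] {γ : ℝ → X} (hc : ContinuousOn γ (Icc 0 1)) (hi : InjOn γ (Icc 0 1)) :
    LCn (γ '' Icc 0 1) := by
  rintro _ ⟨s, hs, rfl⟩ U hU
  obtain ⟨ε, hε, hsub⟩ := Metric.mem_nhdsWithin_iff.1 (hc s hs hU)
  refine ⟨(γ '' (Icc 0 1 \ ball s ε))ᶜ, ?_, ?_⟩
  · refine IsOpen.mem_nhds (IsClosed.isOpen_compl (self := ?_)) ?_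
    · exact ((isCompact_Icc.diff isOpen_ball).image_of_continuousOn (hc.mono sdiff_subset)).isClosed
    · rintro ⟨t, ht, e⟩
      have := hi ht.1 hs e
      subst this
      exact ht.2 (mem_ball_self hε)
  · rintro _ ⟨hy, ⟨t, ht, rfl⟩⟩
    have htb : t ∈ ball s ε := by
      by_contra hcon; exact hy ⟨t, ⟨ht, hcon⟩, rfl⟩
    refine ⟨γ '' (ball s ε ∩ Icc 0 1), ?_, ?_, ⟨s, ⟨mem_ball_self hε, hs⟩, rfl⟩, ⟨t, ⟨htb, ht⟩, rfl⟩⟩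
    · exact (((convex_ball s ε).inter (convex_Icc 0 1)).isPreconnected).image _ (hc.mono inter_subset_right)
    · grind

theorem FlatAt.congr {G H : Set X} {x : X} (h : FlatAt G x) {U : Set X} (hU : U ∈ 𝓝 x)
    (hGH : ∀ y ∈ U, (y ∈ G ↔ y ∈ H)) : FlatAt H x := by
  obtain ⟨e, hx, he⟩ := h
  obtain ⟨U', hU'U, hU'o, hxU'⟩ := mem_nhds_iff.1 hU
  refine ⟨e.restrOpen U' hU'o, ⟨hx, hxU'⟩, ?_⟩
  intro y hy
  have hy' : y ∈ e.source ∩ U' := by simpa using hy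
  rw [← hGH y (hU'U hy'.2), he y hy'.1]; simp

theorem Good.addArc [T2Space X] {G V : Set X} (h : Good G V) {γ : ℝ → X}
    (hc : ContinuousOn γ (Icc 0 1)) (hi : InjOn γ (Icc 0 1)) (h0 : γ 0 ∈ G) (h1 : γ 1 ∈ G)
    (hd : ∀ s ∈ Ioo (0:ℝ) 1, γ s ∉ G) (hf : ∀ s ∈ Ioo (0:ℝ) 1, FlatAt (γ '' Icc 0 1) (γ s)) :
    Good (G ∪ γ '' Icc 0 1) (V ∪ {γ 0, γ 1}) := by
  have m0 : (0:ℝ) ∈ Icc (0:ℝ) 1 := by simp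
  have m1 : (1:ℝ) ∈ Icc (0:ℝ) 1 := by simp
  have hcl : IsClosed (γ '' Icc 0 1) := (isCompact_Icc.image_of_continuousOn hc).isClosed
  refine ⟨h.closed.union hcl, ?_, ?_, h.lc.union h.closed hcl (LCn.arc hc hi), h.fin.union (by simp),
    ?_, h.two.mono subset_union_left, ?_⟩
  · exact h.pre.union (γ 0) h0 ⟨0, m0, rfl⟩ (isPreconnected_Icc.image _ hc)
  · intro v
    by_cases hv : v ∈ γ '' Icc 0 1
    · obtain ⟨s, hs, rfl⟩ := hv
      have e : (G ∪ γ '' Icc 0 1) \ {γ s} = (G \ {γ s} ∪ γ '' Ico 0 s) ∪ γ '' Ioc s 1 := by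
        ext x
        constructor
        · grind
        · rintro ((hx | ⟨t, ht, rfl⟩) | ⟨t, ht, rfl⟩)
          · exact ⟨Or.inl hx.1, hx.2⟩
          · have htm : t ∈ Icc (0:ℝ) 1 := ⟨ht.1, ht.2.le.trans hs.2⟩
            exact ⟨Or.inr ⟨t, htm, rfl⟩, fun e => ht.2.ne (hi htm hs e)⟩
          · have htm : t ∈ Icc (0:ℝ) 1 := ⟨hs.1.trans ht.1.le, ht.2⟩
            exact ⟨Or.inr ⟨t, htm, rfl⟩, fun e => ht.1.ne' (hi htm hs e)⟩
      rw [e]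
      have p1 : IsPreconnected (G \ {γ s} ∪ γ '' Ico 0 s) := by
        rcases eq_or_lt_of_le hs.1 with h2 | h2
        · rw [← h2]; simpa using h.conn (γ 0)
        · refine (h.conn (γ s)).union (γ 0) ⟨h0, fun e => h2.ne (hi m0 hs e)⟩ ⟨0, ⟨le_rfl, h2⟩, rfl⟩ ?_
          exact isPreconnected_Ico.image _ (hc.mono fun t ht => ⟨ht.1, ht.2.le.trans hs.2⟩)
      rcases eq_or_lt_of_le hs.2 with h2 | h2
      · simp_all
      · refine p1.union (γ 1) (Or.inl ⟨h1, fun e => h2.ne' (hi m1 hs e)⟩) ⟨1, ⟨h2, le_rfl⟩, rfl⟩ ?_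
        exact isPreconnected_Ioc.image _ (hc.mono fun t ht => ⟨hs.1.trans ht.1.le, ht.2⟩)
    · rw [union_sdiff_distrib, sdiff_singleton_eq_self hv]
      refine (h.conn v).union (γ 0) ⟨h0, fun e => hv ⟨0, m0, e⟩⟩ ⟨0, m0, rfl⟩
        (isPreconnected_Icc.image _ hc)
  · rintro x (hx | rfl | rfl)
    · exact Or.inl (h.sub hx)
    · exact Or.inl h0
    · exact Or.inl h1
  · intro x hx hxV
    have hxV' : x ∉ V ∧ x ≠ γ 0 ∧ x ≠ γ 1 := by
      grind
    have hio : ∀ t ∈ Icc (0:ℝ) 1, γ t ≠ γ 0 → γ t ≠ γ 1 → t ∈ Ioo (0:ℝ) 1 := by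
      grind
    by_cases hxG : x ∈ G
    · have hxa : x ∉ γ '' Icc 0 1 := by
        grind
      refine (h.flat x hxG hxV'.1).congr (hcl.isOpen_compl.mem_nhds hxa) ?_
      grind
    · obtain ⟨t, ht, rfl⟩ := hx.resolve_left hxG
      refine (hf t (hio t ht hxV'.2.1 hxV'.2.2)).congr (h.closed.isOpen_compl.mem_nhds hxG) ?_
      grind

end graph
end

section
section circ
variable {X : Type*} [TopologicalSpace X]

/-- parametrization of the circle of radius 2 in a chart -/
def cp (c : ℂ → X) (θ : ℝ) : X := c (2 * exp (θ * I))

variable {c : ℂ → X}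

theorem cp_cont (hc : IsOpenEmbedding c) : Continuous (cp c) := by
  have := hc.continuous
  unfold cp; fun_prop

theorem cp_eq (hc : IsOpenEmbedding c) {θ t : ℝ} :
    cp c θ = cp c t ↔ ∃ k : ℤ, θ = t + k * (2 * π) := by
  unfold cp
  rw [hc.injective.eq_iff, mul_right_inj' two_ne_zero, exp_eq_exp_iff_exists_int]
  refine exists_congr fun k => ?_
  have : (t : ℂ) * I + k * (2 * π * I) = (t + k * (2 * π) : ℝ) * I := by
    push_cast; ring
  rw [this, mul_left_inj' I_ne_zero]
  norm_cast

theorem cp_period (hc : IsOpenEmbedding c) (θ : ℝ) (k : ℤ) : cp c (θ + k * (2 * π)) = cp c θ :=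
  (cp_eq hc).2 ⟨k, rfl⟩

theorem cp_rep (hc : IsOpenEmbedding c) (a θ : ℝ) : ∃ t ∈ Ico a (a + 2 * π), cp c t = cp c θ := by
  refine ⟨toIcoMod Real.two_pi_pos a θ, toIcoMod_mem_Ico _ _ _, ?_⟩
  rw [cp_eq hc]
  refine ⟨-toIcoDiv Real.two_pi_pos a θ, ?_⟩
  have := toIcoMod_add_toIcoDiv_zsmul Real.two_pi_pos a θ
  simp only [zsmul_eq_mul] at this
  push_cast
  linarith

theorem int_small {k : ℤ} (h1 : -(2 * π) < k * (2 * π)) (h2 : k * (2 * π) < 2 * π) :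
    k = 0 := by
  have hp := Real.two_pi_pos
  have a : (-1:ℝ) < k := by nlinarith
  have b : (k:ℝ) < 1 := by nlinarith
  have a' : -1 < k := by exact_mod_cast a
  have b' : k < 1 := by exact_mod_cast b
  omega

theorem cp_inj (hc : IsOpenEmbedding c) {a b : ℝ} (hab : b < a + 2 * π) : InjOn (cp c) (Icc a b) := by
  intro s hs t ht h
  obtain ⟨k, hk⟩ := (cp_eq hc).1 h
  have : k = 0 := int_small (by linarith [hs.1, hs.2, ht.1, ht.2]) (by linarith [hs.1, hs.2, ht.1, ht.2])
  subst this; simpa using hk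

theorem cp_range (hc : IsOpenEmbedding c) : range (cp c) = c '' sphere 0 2 := by
  ext x
  constructor
  · rintro ⟨θ, rfl⟩
    refine ⟨_, ?_, rfl⟩
    simp [norm_exp_ofReal_mul_I]
  · rintro ⟨z, hz, rfl⟩
    have hz : ‖z‖ = 2 := by simpa using hz
    refine ⟨z.arg, ?_⟩
    have := norm_mul_exp_arg_mul_I z
    rw [hz] at this
    unfold cp
    exact congrArg c (by simpa using this)

theorem flat_circle (hc : IsOpenEmbedding c) (θ : ℝ) : FlatAt (range (cp c)) (cp c θ) := by
  set m : ℂ := 2 * exp (θ * I) with hm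
  have hmn : ‖m‖ = 2 := by simp [hm, norm_exp_ofReal_mul_I]
  have hm0 : m ≠ 0 := by intro h; rw [h] at hmn; simp at hmn
  set e : OpenPartialHomeomorph X ℂ :=
    (((hc.toOpenPartialHomeomorph c).symm.trans
      (Homeomorph.mulLeft₀ m⁻¹ (inv_ne_zero hm0)).toOpenPartialHomeomorph).trans
      expOpenPartialHomeomorph.symm).trans
      (Homeomorph.mulLeft₀ I I_ne_zero).toOpenPartialHomeomorph with he
  have hinv : ∀ z, (hc.toOpenPartialHomeomorph c).symm (c z) = z := by
    intro z
    have := (hc.toOpenPartialHomeomorph c).left_inv (x := z) (by simp)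
    simpa using this
  have hsrc : ∀ z, c z ∈ e.source ↔ m⁻¹ * z ∈ slitPlane := by
    intro z
    simp [he, OpenPartialHomeomorph.trans_source, hinv, expOpenPartialHomeomorph]
  have hsr : ∀ y ∈ e.source, ∃ z, c z = y := by
    simp_all
  have hev : ∀ z, e (c z) = I * log (m⁻¹ * z) := by
    intro z
    simp [he, hinv]
    rfl
  refine ⟨e, ?_, ?_⟩
  · unfold cp; rw [hsrc, inv_mul_cancel₀ hm0]; simp
  · intro y hy
    obtain ⟨z, rfl⟩ := hsr y hy
    rw [hsrc] at hy
    have h0 : m⁻¹ * z ≠ 0 := slitPlane_ne_zero hy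
    rw [hev, cp_range hc, hc.injective.mem_set_image]
    have : (I * log (m⁻¹ * z)).im = Real.log ‖m⁻¹ * z‖ := by
      simp [log_re]
    rw [this, Real.log_eq_zero, norm_mul, norm_inv, hmn]
    have hz0 : 0 < ‖z‖ := norm_pos_iff.2 (right_ne_zero_of_mul h0)
    simp only [mem_sphere_iff_norm, sub_zero]
    grind

theorem flat_arc [T2Space X] (hc : IsOpenEmbedding c) {a b θ : ℝ} (hab : b ≤ a + 2 * π)
    (hθ : θ ∈ Ioo a b) :
    FlatAt (cp c '' Icc a b) (cp c θ) := by
  have hcl : IsClosed (cp c '' Icc b (a + 2 * π)) :=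
    (isCompact_Icc.image (cp_cont hc)).isClosed
  refine (flat_circle hc θ).congr (hcl.isOpen_compl.mem_nhds ?_) ?_
  · rintro ⟨t, ht, h⟩
    obtain ⟨k, hk⟩ := (cp_eq hc).1 h
    have := Real.pi_pos
    have : k = 0 := int_small (by linarith [hθ.1, hθ.2, ht.1, ht.2]) (by linarith [hθ.1, hθ.2, ht.1, ht.2])
    subst this
    simp at hk
    linarith [hθ.2, ht.1]
  · intro y hy
    refine ⟨?_, fun h => image_subset_range _ _ h⟩
    rintro ⟨s, rfl⟩
    obtain ⟨t, ht, h⟩ := cp_rep hc a s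
    grind

theorem affine_image {Y : Type*} (f : ℝ → Y) {a b : ℝ} (hab : a < b) :
    (fun s : ℝ => f (a + s * (b - a))) '' Icc 0 1 = f '' Icc a b := by
  ext y
  constructor
  · rintro ⟨s, hs, rfl⟩
    exact ⟨_, ⟨by nlinarith [hs.1], by nlinarith [hs.2]⟩, rfl⟩
  · rintro ⟨t, ht, rfl⟩
    have : 0 < b - a := by linarith
    refine ⟨(t - a) / (b - a), ⟨by apply div_nonneg <;> linarith [ht.1], by
      rw [div_le_one this]; linarith [ht.2]⟩, ?_⟩
    simp only; congr 1; field_simp; ring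

theorem lcn_cp [T2Space X] (hc : IsOpenEmbedding c) {a b : ℝ} (hab : a < b) (h2 : b < a + 2 * π) :
    LCn (cp c '' Icc a b) := by
  rw [← affine_image _ hab]
  refine LCn.arc (γ := fun s : ℝ => cp c (a + s * (b - a))) ?_ ?_
  · have := cp_cont hc
    fun_prop
  · intro s hs t ht h
    have hba : 0 < b - a := by linarith
    have := cp_inj hc h2 (x₁ := a + s * (b - a)) (x₂ := a + t * (b - a))
      ⟨by nlinarith [hs.1], by nlinarith [hs.2]⟩
      ⟨by nlinarith [ht.1], by nlinarith [ht.2]⟩ h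
    grind

/-- The initial graph: a circle. -/
theorem good_circle [T2Space X] (hc : IsOpenEmbedding c) : ∃ V, Good (range (cp c)) V := by
  have hpi := Real.pi_pos
  have hcc := cp_cont hc
  have hu : range (cp c) = cp c '' Icc 0 π ∪ cp c '' Icc π (2 * π) := by
    ext y
    constructor
    · rintro ⟨s, rfl⟩
      obtain ⟨t, ht, h⟩ := cp_rep hc 0 s
      grind
    · rintro (h | h) <;> exact image_subset_range _ _ h
  have hcl : ∀ a b, IsClosed (cp c '' Icc a b) := fun a b => (isCompact_Icc.image hcc).isClosed
  refine ⟨{cp c 0, cp c π}, ⟨?_, isPreconnected_range hcc, ?_, ?_, by simp, ?_, ?_, ?_⟩⟩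
  · rw [hu]; exact (hcl _ _).union (hcl _ _)
  · intro v
    by_cases hv : v ∈ range (cp c)
    · obtain ⟨θ, rfl⟩ := hv
      have : range (cp c) \ {cp c θ} = cp c '' Ioo θ (θ + 2 * π) := by
        ext y
        constructor
        · rintro ⟨⟨s, rfl⟩, hs⟩
          obtain ⟨t, ht, h⟩ := cp_rep hc θ s
          grind
        · rintro ⟨t, ht, rfl⟩
          refine ⟨⟨t, rfl⟩, fun h => ?_⟩
          obtain ⟨k, hk⟩ := (cp_eq hc).1 h
          have : k = 0 := int_small (by linarith [ht.1, ht.2]) (by linarith [ht.1, ht.2])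
          subst this
          simp at hk
          linarith [ht.1]
      rw [this]
      exact isPreconnected_Ioo.image _ hcc.continuousOn
    · rw [sdiff_singleton_eq_self hv]; exact isPreconnected_range hcc
  · rw [hu]
    exact (lcn_cp hc hpi (by linarith)).union (hcl _ _) (hcl _ _) (lcn_cp hc (by linarith) (by linarith))
  · rintro x (rfl | rfl) <;> exact ⟨_, rfl⟩
  · refine ⟨_, Or.inl rfl, _, Or.inr rfl, fun h => ?_⟩
    have := cp_inj hc (a := 0) (b := π) (by linarith) ⟨le_rfl, hpi.le⟩ ⟨hpi.le, le_rfl⟩ h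
    linarith
  · rintro x ⟨θ, rfl⟩ _
    exact flat_circle hc θ

theorem gap {G : Set X} (hc : IsOpenEmbedding c) (hG : IsClosed G) {θ1 θ2 : ℝ} (h1 : cp c θ1 ∈ G)
    (h2 : cp c θ2 ∈ G) (hne : cp c θ1 ≠ cp c θ2) (τ : ℝ) :
    ∃ a b, a ≤ τ ∧ τ ≤ b ∧ cp c a ∈ G ∧ cp c b ∈ G ∧ (∀ θ ∈ Ioo a b, cp c θ ∉ G) ∧
      b < a + 2 * π := by
  have hp := Real.two_pi_pos
  set Θ : Set ℝ := cp c ⁻¹' G with hΘ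
  have hΘc : IsClosed Θ := hG.preimage (cp_cont hc)
  have hper : ∀ θ ∈ Θ, ∀ k : ℤ, θ + k * (2 * π) ∈ Θ := by
    intro θ hθ k
    rw [hΘ, mem_preimage, cp_period hc]; exact hθ
  have hne1 : (Θ ∩ Iic τ).Nonempty := by
    obtain ⟨t, ht, h⟩ := cp_rep hc (τ - 2 * π) θ1
    exact ⟨t, by rw [hΘ, mem_preimage, h]; exact h1, by simp at ht; exact ht.2.le⟩
  have hne2 : (Θ ∩ Ici τ).Nonempty := by
    obtain ⟨t, ht, h⟩ := cp_rep hc τ θ1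
    exact ⟨t, by rw [hΘ, mem_preimage, h]; exact h1, ht.1⟩
  have hb1 : BddAbove (Θ ∩ Iic τ) := ⟨τ, fun x hx => hx.2⟩
  have hb2 : BddBelow (Θ ∩ Ici τ) := ⟨τ, fun x hx => hx.2⟩
  have ha := (hΘc.inter isClosed_Iic).csSup_mem hne1 hb1
  have hb := (hΘc.inter isClosed_Ici).csInf_mem hne2 hb2
  set a := sSup (Θ ∩ Iic τ)
  set b := sInf (Θ ∩ Ici τ)
  have hgap : ∀ θ ∈ Ioo a b, cp c θ ∉ G := by
    intro θ hθ hmem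
    rcases le_total θ τ with h | h
    · have := le_csSup hb1 (show θ ∈ Θ ∩ Iic τ from ⟨hmem, h⟩); exact absurd hθ.1 (not_lt.2 this)
    · have := csInf_le hb2 (show θ ∈ Θ ∩ Ici τ from ⟨hmem, h⟩); exact absurd hθ.2 (not_lt.2 this)
  have hba : b ≤ a + 2 * π := by
    have ha' := hper a ha.1 1
    grind
  refine ⟨a, b, ha.2, hb.2, ha.1, hb.1, hgap, lt_of_le_of_ne hba fun heq => hne ?_⟩
  have : ∀ θ, cp c θ ∈ G → cp c θ = cp c a := by
    intro θ hθ
    obtain ⟨t, ht, h⟩ := cp_rep hc a θ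
    grind
  rw [this _ h1, this _ h2]

theorem good_gaps [T2Space X] {G V : Set X} (hc : IsOpenEmbedding c) (h : Good G V)
    {a b : ℕ → ℝ} (hab : ∀ j, a j ≤ b j) (ha : ∀ j, cp c (a j) ∈ G) (hb : ∀ j, cp c (b j) ∈ G)
    (hgap : ∀ j, ∀ θ ∈ Ioo (a j) (b j), cp c θ ∉ G) (hlt : ∀ j, b j < a j + 2 * π) (n : ℕ) :
    ∃ V', Good (G ∪ ⋃ j < n, cp c '' Icc (a j) (b j)) V' := by
  induction n with
  | zero => exact ⟨V, by simpa using h⟩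
  | succ n ih =>
    obtain ⟨V', hV'⟩ := ih
    have hu : (⋃ j < n + 1, cp c '' Icc (a j) (b j)) = (⋃ j < n, cp c '' Icc (a j) (b j)) ∪
      cp c '' Icc (a n) (b n) := biUnion_lt_succ _ _
    rw [hu, ← union_assoc]
    by_cases hsub : cp c '' Icc (a n) (b n) ⊆ G ∪ ⋃ j < n, cp c '' Icc (a j) (b j)
    · rw [union_eq_left.2 hsub]; exact ⟨V', hV'⟩
    have hlt' : a n < b n := by
      grind
    have hdis : ∀ θ ∈ Ioo (a n) (b n), cp c θ ∉ G ∪ ⋃ j < n, cp c '' Icc (a j) (b j) := by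
      rintro θ hθ (h1 | h1)
      · exact hgap n θ hθ h1
      · simp only [mem_iUnion] at h1
        obtain ⟨i, hi, t, ht, e⟩ := h1
        have ht' : t ∈ Ioo (a i) (b i) := by
          grind
        obtain ⟨k, hk⟩ := (cp_eq hc).1 e
        have per : ∀ s, cp c (s - k * (2 * π)) = cp c s := by
          intro s
          have := cp_period hc s (-k)
          rw [← this]; congr 1; push_cast; ring
        have per' := fun s => cp_period hc s k
        have e1 : a i - k * (2 * π) ≤ a n := by
          grind
        have e2 : b n ≤ b i - k * (2 * π) := by
          grind
        refine hsub ?_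
        rintro _ ⟨s, hs, rfl⟩
        refine Or.inr ?_
        simp only [mem_iUnion]
        refine ⟨i, hi, s + k * (2 * π), ⟨by linarith [hs.1], by linarith [hs.2]⟩, per' s⟩
    have hba : 0 < b n - a n := by linarith
    have := hV'.addArc (γ := fun s : ℝ => cp c (a n + s * (b n - a n))) ?_ ?_ ?_ ?_ ?_ ?_
    · rw [affine_image _ hlt'] at this
      exact ⟨_, this⟩
    · have := cp_cont hc
      fun_prop
    · intro s hs t ht h
      have := cp_inj hc (hlt n) (x₁ := a n + s * (b n - a n)) (x₂ := a n + t * (b n - a n))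
        ⟨by nlinarith [hs.1], by nlinarith [hs.2]⟩
        ⟨by nlinarith [ht.1], by nlinarith [ht.2]⟩ h
      grind
    · simp only [zero_mul, add_zero]; exact Or.inl (ha n)
    · simp only [one_mul, add_sub_cancel]; exact Or.inl (hb n)
    · intro s hs
      exact hdis _ ⟨by nlinarith [hs.1], by nlinarith [hs.2]⟩
    · intro s hs
      rw [affine_image _ hlt']
      exact flat_arc hc (hlt n).le ⟨by nlinarith [hs.1], by nlinarith [hs.2]⟩

end circ
end

section
section proc
variable {X : Type*} [TopologicalSpace X] {c : ℂ → X}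

theorem ulc {G : Set X} (hG : IsClosed G) (hl : LCn G) (hc : IsOpenEmbedding c) (R : ℝ) {ε : ℝ}
    (hε : 0 < ε) : ∃ δ > 0, ∀ a b : ℂ, ‖a‖ ≤ R → c a ∈ G → c b ∈ G → dist a b < δ →
      ∃ T : Set ℂ, IsPreconnected T ∧ T ⊆ c ⁻¹' G ∧ T ⊆ ball a ε ∧ a ∈ T ∧ b ∈ T := by
  set K : Set ℂ := closedBall 0 R ∩ c ⁻¹' G with hK
  have hKc : IsCompact K := (isCompact_closedBall 0 R).inter_right (hG.preimage hc.continuous)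
  have h1 : ∀ x : K, ∃ W ∈ 𝓝 (c x), ∀ y ∈ W ∩ G,
      ∃ T : Set X, IsPreconnected T ∧ T ⊆ G ∩ c '' ball (x:ℂ) (ε/2) ∧ c x ∈ T ∧ y ∈ T := by
    intro x
    refine hl (c x) x.2.2 _ ?_
    exact hc.isOpenMap.image_mem_nhds (ball_mem_nhds _ (by positivity))
  choose W hW hT using h1
  obtain ⟨δ, hδ, hL⟩ := lebesgue_number_lemma_of_metric (s := K)
    (c := fun x : K => interior (c ⁻¹' W x) ∩ ball (x:ℂ) (ε/2)) hKc
    (fun x => isOpen_interior.inter isOpen_ball) (by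
      intro x hx
      refine mem_iUnion.2 ⟨⟨x, hx⟩, ?_, mem_ball_self (by positivity)⟩
      exact mem_interior_iff_mem_nhds.2 (hc.continuous.continuousAt (hW ⟨x, hx⟩)))
  refine ⟨δ, hδ, fun a b ha hca hcb hab => ?_⟩
  obtain ⟨x, hx⟩ := hL a ⟨by simpa using ha, hca⟩
  have hax := hx (mem_ball_self hδ)
  have hbx := hx (show b ∈ ball a δ by rwa [mem_ball, dist_comm])
  obtain ⟨T1, p1, s1, x1, y1⟩ := hT x (c a) ⟨(interior_subset hax.1 : a ∈ c ⁻¹' W x), hca⟩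
  obtain ⟨T2, p2, s2, x2, y2⟩ := hT x (c b) ⟨(interior_subset hbx.1 : b ∈ c ⁻¹' W x), hcb⟩
  have s3 : T1 ∪ T2 ⊆ G ∩ c '' ball (x:ℂ) (ε/2) := union_subset s1 s2
  refine ⟨c ⁻¹' (T1 ∪ T2), ?_, ?_, ?_, Or.inl y1, Or.inr y2⟩
  · refine (IsPreconnected.union _ x1 x2 p1 p2).preimage_of_isOpenMap hc.injective hc.isOpenMap ?_
    intro y hy
    obtain ⟨z, _, rfl⟩ := (s3 hy).2
    exact ⟨z, rfl⟩
  · intro z hz; exact (s3 hz).1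
  · intro z hz
    obtain ⟨w, hw, e⟩ := (s3 hz).2
    rw [hc.injective e] at hw
    have := hax.2
    rw [mem_ball] at *
    calc dist z a ≤ dist z x + dist a x := dist_triangle_right _ _ _
      _ < ε := by linarith

/-- circle point -/
def pt (θ : ℝ) : ℂ := 2 * exp (θ * I)

theorem norm_pt (θ : ℝ) : ‖pt θ‖ = 2 := by simp [pt, norm_exp_ofReal_mul_I]

theorem pt_cont : Continuous pt := by unfold pt; fun_prop

theorem dist_pt (s t : ℝ) : dist (pt s) (pt t) ≤ 2 * |s - t| := by
  have h := Real.norm_exp_I_mul_ofReal_sub_one_le (x := s - t)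
  have e : pt s - pt t = pt t * (exp (I * ((s - t : ℝ) : ℂ)) - 1) := by
    unfold pt
    rw [mul_sub, mul_assoc, ← exp_add]
    push_cast
    ring_nf
  rw [dist_eq_norm, e, norm_mul, norm_pt]
  rw [Real.norm_eq_abs] at h
  linarith

theorem chain_no_log {A : Set ℂ} {N : ℕ} (hN : 3 ≤ N)
    (h : ∀ j < N, ∃ T, IsPreconnected T ∧ T ⊆ A ∧ T ⊆ ball (pt (2 * π * j / N)) 1 ∧
      pt (2 * π * j / N) ∈ T ∧ pt (2 * π * (j + 1 : ℕ) / N) ∈ T) :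
    ¬ HasLog A (fun z => z) := by
  rintro ⟨l, hl, hexp⟩
  have hN0 : (0:ℝ) < N := by positivity
  have hN3 : (3:ℝ) ≤ N := by exact_mod_cast hN
  have step : ∀ j < N, l (pt (2 * π * (j + 1 : ℕ) / N)) - l (pt (2 * π * j / N)) =
      2 * π * I / N := by
    intro j hj
    obtain ⟨T, hT, hTA, hTb, h0, h1⟩ := h j hj
    set t := pt (2 * π * j / N) with ht
    have ht2 : ‖t‖ = 2 := norm_pt _
    have ht0 : t ≠ 0 := by rw [← norm_pos_iff, ht2]; norm_num
    have hre : ∀ z ∈ T, 0 < (z / t).re := by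
      intro z hz
      have hz' := hTb hz
      rw [mem_ball, dist_eq_norm] at hz'
      have h3 : ‖z / t - 1‖ ≤ 1 / 2 := by
        rw [div_sub_one ht0, norm_div, ht2]; linarith
      have h4 := (abs_re_le_norm (z / t - 1)).trans h3
      rw [abs_le, sub_re, one_re] at h4
      linarith
    have key := log_diff_const (m := fun z => log (z / t) + l t) hT (hl.mono hTA) (by
      refine ContinuousOn.add (ContinuousOn.clog (by fun_prop) ?_) continuousOn_const
      intro z hz; exact Or.inl (hre z hz)) (by
      intro z hz
      have hz0 : z / t ≠ 0 := by intro e; have := hre z hz; rw [e] at this; simp at this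
      rw [exp_add, exp_log hz0, hexp z (hTA hz), hexp t (hTA h0)]
      field_simp) h1 h0
    have e1 : pt (2 * π * (j + 1 : ℕ) / N) / t = exp (2 * π * I / N) := by
      rw [div_eq_iff ht0, ht]; unfold pt
      rw [mul_left_comm, ← exp_add]
      congr 2
      push_cast
      field_simp
      ring
    have e2 : log (exp (2 * π * I / N)) = 2 * π * I / N := by
      have im : (2 * π * I / N : ℂ).im = 2 * π / N := by
        simp_all
      apply log_exp
      · rw [im]
        have : 0 < 2 * π / N := by positivity
        linarith [Real.pi_pos]
      · rw [im, div_le_iff₀ hN0]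
        nlinarith [Real.pi_pos]
    simp only [e1, e2, div_self ht0, log_one] at key
    linear_combination key
  have tot : ∀ j ≤ N, l (pt (2 * π * j / N)) - l (pt 0) = j * (2 * π * I / N) := by
    intro j
    induction j with
    | zero => intro _; simp
    | succ j ih =>
      intro hj
      have a := ih (by omega)
      have b := step j (by omega)
      rw [Nat.cast_succ (R := ℂ)]
      linear_combination a + b
  have := tot N le_rfl
  have e : pt (2 * π * N / N) = pt 0 := by
    rw [mul_div_assoc, div_self hN0.ne']
    simp [pt, exp_two_pi_mul_I]
  rw [e, sub_self, mul_div_cancel₀] at this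
  · have := this.symm; simp [Real.pi_ne_zero] at this
  · exact_mod_cast hN0.ne'

theorem closure_chart [T2Space X] (hc : IsOpenEmbedding c) {W : Set ℂ} (hW : IsBounded W) :
    closure (c '' W) ⊆ c '' closure W :=
  closure_minimal (image_mono subset_closure) (hW.isCompact_closure.image hc.continuous).isClosed

theorem frontier_chart [T2Space X] (hc : IsOpenEmbedding c) {W : Set ℂ} (hW : IsBounded W) :
    frontier (c '' W) ⊆ c '' frontier W := by
  rintro x ⟨h1, h2⟩
  obtain ⟨z, hz, rfl⟩ := closure_chart hc hW h1
  refine ⟨z, ⟨hz, fun h3 => h2 ?_⟩, rfl⟩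
  exact interior_mono (image_mono interior_subset)
    ((hc.isOpenMap _ isOpen_interior).interior_eq.symm ▸ ⟨z, h3, rfl⟩)

theorem circle_meets [T2Space X] {S : Set X} (hc : IsOpenEmbedding c) (hS : IsPreconnected S)
    (hin : ∃ z ∈ ball 0 2, c z ∈ S) (hout : ∃ y ∈ S, y ∉ range c) : ∃ θ, cp c θ ∈ S := by
  by_contra hcon
  push Not at hcon
  obtain ⟨z, hz, hzS⟩ := hin
  obtain ⟨y, hy, hyr⟩ := hout
  have := preconn_subset_of_frontier hS (hc.isOpenMap _ (isOpen_ball (x := (0:ℂ)) (ε := 2)))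
    ⟨c z, hzS, z, hz, rfl⟩ (by
      intro x hx hxf
      obtain ⟨w, hw, rfl⟩ := frontier_chart hc isBounded_ball hxf
      rw [frontier_ball _ (by norm_num)] at hw
      have : c w ∈ range (cp c) := by rw [cp_range hc]; exact ⟨w, hw, rfl⟩
      grind)
  obtain ⟨w, _, hw⟩ := this hy
  exact hyr ⟨w, hw⟩

theorem process [T2Space X] {G V : Set X} (hc : IsOpenEmbedding c) (h : Good G V)
    (hin : ∃ z ∈ ball 0 2, c z ∈ G) (hout : ∃ y ∈ G, y ∉ range c) :
    ∃ G' V', G ⊆ G' ∧ Good G' V' ∧ ∀ z ∈ ball (0:ℂ) 1,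
      connectedComponentIn G'ᶜ (c z) ⊆ c '' ball 0 3 := by
  obtain ⟨θ1, h1⟩ := circle_meets hc h.pre hin hout
  have h2' : ∃ θ, cp c θ ∈ G \ {cp c θ1} := by
    refine circle_meets hc (h.conn _) ?_ ?_
    · obtain ⟨z, hz, hzG⟩ := hin
      refine ⟨z, hz, hzG, fun e => ?_⟩
      have := hc.injective e
      simp_all
    · obtain ⟨y, hy, hyr⟩ := hout
      exact ⟨y, ⟨hy, fun e => hyr ⟨_, e.symm⟩⟩, hyr⟩
  obtain ⟨θ2, h2, hne⟩ := h2'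
  have hne : cp c θ1 ≠ cp c θ2 := fun e => hne e.symm
  obtain ⟨δ, hδ, hu⟩ := ulc h.closed h.lc hc 2 (ε := 1/8) (by norm_num)
  obtain ⟨N, hN⟩ := exists_nat_gt (max 3 (4 * π / min δ (1/8)))
  have hN3 : (3:ℝ) < N := (le_max_left _ _).trans_lt hN
  have hN0 : (0:ℝ) < N := by linarith
  have hm : 0 < min δ (1/8) := lt_min hδ (by norm_num)
  have hNs : 2 * (2 * π / N) < min δ (1/8) := by
    have := (le_max_right _ _).trans_lt hN
    rw [div_lt_iff₀ hm] at this
    rw [← mul_div_assoc, div_lt_iff₀ hN0]; linarith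
  have hd1 : 2 * (2 * π / N) < δ := hNs.trans_le (min_le_left _ _)
  have hd2 : 2 * (2 * π / N) < 1/8 := hNs.trans_le (min_le_right _ _)
  choose a b ha hb haG hbG hgap hlt using fun j : ℕ => gap hc h.closed h1 h2 hne (2 * π * j / N)
  obtain ⟨V', hV'⟩ := good_gaps hc h (fun j => (ha j).trans (hb j)) haG hbG hgap hlt (N + 1)
  set G' := G ∪ ⋃ j < N + 1, cp c '' Icc (a j) (b j) with hG'
  have harc : ∀ j < N + 1, ∀ θ ∈ Icc (a j) (b j), c (pt θ) ∈ G' := by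
    intro j hj θ hθ
    right; simp only [mem_iUnion]; exact ⟨j, hj, θ, hθ, rfl⟩
  refine ⟨G', V', subset_union_left, hV', ?_⟩
  set A : Set ℂ := c ⁻¹' G' ∩ {z | 3/2 ≤ ‖z‖ ∧ ‖z‖ ≤ 5/2} with hA
  have hAcl : IsClosed A := by
    refine (hV'.closed.preimage hc.continuous).inter ?_
    exact (isClosed_le continuous_const continuous_norm).inter (isClosed_le continuous_norm continuous_const)
  have hAc : IsCompact A := by
    refine isCompact_of_isClosed_isBounded hAcl ((isBounded_closedBall (x := (0:ℂ)) (r := 5/2)).subset ?_)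
    intro z hz; simpa using hz.2.2
  have hcir : ∀ j : ℕ, 2 * π * (j + 1 : ℕ) / N = 2 * π * j / N + 2 * π / N := by
    intro j; push_cast; ring
  have hballA : ∀ θ, ∀ T ⊆ c ⁻¹' G', T ⊆ ball (pt θ) (1/2) → T ⊆ A ∧ T ⊆ ball (pt θ) 1 := by
    intro θ T hT1 hT2
    refine ⟨fun z hz => ⟨hT1 hz, ?_⟩, hT2.trans (ball_subset_ball (by norm_num))⟩
    have := hT2 hz
    rw [mem_ball, dist_eq_norm] at this
    have hp := norm_pt θ
    have e1 := norm_sub_norm_le z (pt θ)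
    have e2 := norm_sub_norm_le (pt θ) z
    rw [norm_sub_rev] at e2
    constructor <;> linarith
  have hpi : 0 < 2 * π / N := by have := Real.pi_pos; positivity
  have hnolog : ¬ HasLog A (fun z => z) := by
    refine chain_no_log (N := N) (by exact_mod_cast hN3.le) ?_
    intro j hj
    set τ := 2 * π * j / N with hτ
    rw [hcir j, ← hτ]
    set s := 2 * π / N with hs
    have hτ1 : 2 * π * (j + 1 : ℕ) / N = τ + s := hcir j
    have ha1 := ha (j+1); rw [hτ1] at ha1
    have hb1 := hb (j+1); rw [hτ1] at hb1
    have harcT : ∀ x y, x ≤ y → IsPreconnected (pt '' Icc x y) := fun x y _ =>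
      isPreconnected_Icc.image _ pt_cont.continuousOn
    have hnear : ∀ x ∈ Icc τ (τ + s), pt x ∈ ball (pt τ) (1/4) := by
      intro x hx
      rw [mem_ball]
      refine (dist_pt _ _).trans_lt ?_
      grind
    rcases le_or_gt (τ + s) (b j) with hcase | hcase
    · obtain ⟨u1, u2⟩ := hballA τ (pt '' Icc τ (τ + s)) (by
        rintro _ ⟨x, hx, rfl⟩
        exact harc j (by omega) x ⟨(ha j).trans hx.1, hx.2.trans hcase⟩) (by
        rintro _ ⟨x, hx, rfl⟩
        exact ball_subset_ball (by norm_num) (hnear x hx))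
      exact ⟨_, harcT _ _ (by linarith), u1, u2, ⟨τ, ⟨le_rfl, by linarith⟩, rfl⟩, ⟨τ + s, ⟨by linarith, le_rfl⟩, rfl⟩⟩
    · have hba : b j ≤ a (j+1) := by
        grind
      have hbj := hb j
      rw [← hτ] at hbj
      obtain ⟨T0, p0, s0, n0, m1, m2⟩ := hu (pt (b j)) (pt (a (j+1))) (norm_pt _).le (hbG j) (haG (j+1)) (by
        refine (dist_pt _ _).trans_lt ?_
        rw [abs_sub_comm, abs_of_nonneg (by linarith)]
        linarith)
      obtain ⟨u1, u2⟩ := hballA τ (pt '' Icc τ (b j) ∪ T0 ∪ pt '' Icc (a (j+1)) (τ + s)) (by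
        rintro z ((⟨x, hx, rfl⟩ | hz) | ⟨x, hx, rfl⟩)
        · exact harc j (by omega) x ⟨(ha j).trans hx.1, hx.2⟩
        · exact Or.inl (s0 hz)
        · exact harc (j+1) (by omega) x ⟨hx.1, hx.2.trans hb1⟩) (by
        rintro z ((⟨x, hx, rfl⟩ | hz) | ⟨x, hx, rfl⟩)
        · exact ball_subset_ball (by norm_num) (hnear x ⟨hx.1, by linarith [hx.2]⟩)
        · have q1 := n0 hz
          have q2 := hnear (b j) ⟨hbj, by linarith⟩
          rw [mem_ball] at *
          linarith [dist_triangle z (pt (b j)) (pt τ)]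
        · exact ball_subset_ball (by norm_num) (hnear x ⟨by linarith [hx.1], by linarith [hx.2]⟩))
      refine ⟨_, ?_, u1, u2, Or.inl (Or.inl ⟨τ, ⟨le_rfl, hbj⟩, rfl⟩), Or.inr ⟨τ + s, ⟨ha1, le_rfl⟩, rfl⟩⟩
      refine IsPreconnected.union (pt (a (j+1))) (Or.inr m2) ⟨_, ⟨le_rfl, ha1⟩, rfl⟩ ?_ (harcT _ _ ha1)
      exact IsPreconnected.union (pt (b j)) ⟨_, ⟨hbj, le_rfl⟩, rfl⟩ m1 (harcT _ _ hbj) p0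
  intro z hz
  rw [mem_ball_zero_iff] at hz
  have hin : ∀ w : ℂ, ‖w‖ < 3/2 → w ∈ Aᶜ := fun w hw hwA => by linarith [hwA.2.1]
  set W := connectedComponentIn Aᶜ z with hW
  have hzW : z ∈ W := mem_connectedComponentIn (hin z (by linarith))
  have hWo : IsOpen W := hAcl.isOpen_compl.connectedComponentIn
  have hWb : IsBounded W := by
    by_contra hcon
    have l1 := hasLog_sub_of_unbounded hAc isPreconnected_connectedComponentIn
      (connectedComponentIn_subset _ _) hzW hcon
    have l2 := hasLog_ratio_of_preconn (p := 0) (q := z) hAcl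
      (convex_ball (0:ℂ) (3/2)).isPreconnected (fun w hw => hin w (by simpa using hw))
      (by simp) (by simpa using (by linarith : ‖z‖ < 3/2))
    refine hnolog ((l1.mul l2).congr ?_)
    grind
  have hW3 : W ⊆ ball 0 3 := by
    intro w hw
    by_contra hcon
    rw [mem_ball_zero_iff, not_lt] at hcon
    apply isBounded_closedBall (x := (0:ℂ)) (r := 5/2) |> fun _ => ?_
    have hsub := (isPreconnected_compl_closedBall (0:ℂ) (show (0:ℝ) < 5/2 by norm_num)).subset_connectedComponentIn
      (show w ∈ {z : ℂ | 5/2 < dist z 0} by simp; linarith) (show _ ⊆ Aᶜ by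
        intro u hu hA; simp at hu; linarith [hA.2.2])
    rw [← connectedComponentIn_eq hw, ← hW] at hsub
    obtain ⟨R, hR⟩ := hWb.subset_closedBall 0
    have := hR (hsub (show (((max R 0) + 3 : ℝ) : ℂ) ∈ _ by
      simp only [mem_ofPred_eq, dist_zero_right, norm_real, Real.norm_eq_abs]
      rw [abs_of_nonneg (by positivity)]
      linarith [le_max_right R 0]))
    rw [mem_closedBall_zero_iff, norm_real, Real.norm_eq_abs, abs_of_nonneg (by positivity)] at this
    linarith [le_max_left R 0]
  by_cases hcz : c z ∈ G'ᶜ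
  · refine (preconn_subset_of_frontier isPreconnected_connectedComponentIn (hc.isOpenMap _ hWo)
      ⟨c z, mem_connectedComponentIn hcz, z, hzW, rfl⟩ ?_).trans (image_mono hW3)
    intro x hx hxf
    obtain ⟨w, hw, rfl⟩ := frontier_chart hc hWb hxf
    have := frontier_comp_subset hAcl.isOpen_compl z hw
    rw [compl_compl] at this
    exact connectedComponentIn_subset _ _ hx this.1
  · rw [connectedComponentIn_eq_empty hcz]; exact empty_subset _

end proc
end

section
section graph
variable {X : Type*} [TopologicalSpace X]

/-- arbitrarily small planar charts at every point -/
def LE (X : Type*) [TopologicalSpace X] : Prop :=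
  ∀ x : X, ∀ N ∈ 𝓝 x, ∃ c : ℂ → X, IsOpenEmbedding c ∧ c 0 = x ∧ range c ⊆ N

theorem le_of_surface (hX : IsSurface X) : LE X := by
  intro x N hN
  obtain ⟨U, hU, hxU, ⟨h⟩⟩ := hX.2.2.2 x
  let g : ℂ ≃ₜ E2 := orthonormalBasisOneI.repr.toHomeomorph
  let d : ℂ → X := fun z => ((h.symm (g z) : U) : X)
  have hd : IsOpenEmbedding d := hU.isOpenEmbedding_subtypeVal.comp
    (h.symm.isOpenEmbedding.comp g.isOpenEmbedding)
  let z0 : ℂ := g.symm (h ⟨x, hxU⟩)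
  have hz0 : d z0 = x := by simp [d, z0]
  obtain ⟨r, hr, hb⟩ := Metric.mem_nhds_iff.1 (hd.continuous.continuousAt (x := z0) (by rw [hz0]; exact hN))
  refine ⟨d ∘ OpenPartialHomeomorph.univBall z0 r, hd.comp (OpenPartialHomeomorph.isOpenEmbedding _
    (OpenPartialHomeomorph.univBall_source z0 r)), ?_, ?_⟩
  · simp [hz0]
  · rintro _ ⟨z, rfl⟩
    refine hb ?_
    rw [← OpenPartialHomeomorph.univBall_target z0 hr]
    exact OpenPartialHomeomorph.map_source _ (by simp)

theorem LE.locallyConnected (h : LE X) : LocallyConnectedSpace X := by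
  rw [locallyConnectedSpace_iff_connected_subsets]
  intro x U hU
  obtain ⟨c, hc, h0, hr⟩ := h x U hU
  exact ⟨range c, hc.isOpen_range.mem_nhds ⟨0, h0⟩, isPreconnected_range hc.continuous, hr⟩

theorem cover_step [T2Space X] [ConnectedSpace X] {ι : Type*} [Finite ι] (c : ι → ℂ → X)
    (hc : ∀ k, IsOpenEmbedding (c k)) (hcov : ∀ x, ∃ k, x ∈ c k '' ball 0 1) {G1 V1 : Set X}
    (h1 : Good G1 V1) (hmiss : ∀ k, ∃ y ∈ G1, y ∉ range (c k)) :
    ∃ G V, G1 ⊆ G ∧ Good G V ∧ ∀ x ∉ G, ∃ j, connectedComponentIn Gᶜ x ⊆ c j '' ball 0 3 := by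
  classical
  let ctl : Set X → ι → Prop := fun G k => ∀ z ∈ ball (0:ℂ) 1, c k z ∉ G →
    ∃ j, connectedComponentIn Gᶜ (c k z) ⊆ c j '' ball 0 3
  have mono : ∀ G G' k, G ⊆ G' → ctl G k → ctl G' k := by
    intro G G' k hGG h z hz hzG
    obtain ⟨j, hj⟩ := h z hz (fun e => hzG (hGG e))
    exact ⟨j, (connectedComponentIn_mono _ (compl_subset_compl.2 hGG)).trans hj⟩
  let P : Set (Set ι) := {K | ∃ G V, G1 ⊆ G ∧ Good G V ∧ ∀ k ∈ K, ctl G k}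
  obtain ⟨K, ⟨G, V, hG1, hG, hK⟩, hmax⟩ := (Set.toFinite P).exists_maximal ⟨∅, G1, V1, subset_rfl, h1, by simp⟩
  have hadd : ∀ k, k ∉ K → ∀ G' V', G ⊆ G' → Good G' V' → ctl G' k → False := by
    intro k hk G' V' hGG hG' hct
    refine hk (hmax (y := insert k K) ⟨G', V', hG1.trans hGG, hG', ?_⟩ (subset_insert _ _) (mem_insert _ _))
    grind
  have hdis : ∀ k, k ∉ K → ∀ z ∈ ball (0:ℂ) 2, c k z ∉ G := by
    intro k hk z hz hzG
    obtain ⟨y, hy, hyr⟩ := hmiss k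
    obtain ⟨G', V', hGG, hG', h⟩ := process (hc k) hG ⟨z, hz, hzG⟩ ⟨y, hG1 hy, hyr⟩
    grind
  suffices hall : ∀ k, k ∈ K by
    refine ⟨G, V, hG1, hG, fun x hx => ?_⟩
    obtain ⟨k, z, hz, rfl⟩ := hcov x
    exact hK k (hall k) z hz hx
  intro k0
  by_contra hk0
  have hopen : ∀ S : Set ι, IsOpen (⋃ k ∈ S, c k '' ball 0 1) := fun S =>
    isOpen_biUnion fun k _ => (hc k).isOpenMap _ isOpen_ball
  obtain ⟨x, _, hx1, hx2⟩ := (isPreconnected_univ (α := X)) _ _ (hopen K) (hopen Kᶜ) (by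
      intro x _
      obtain ⟨k, hk⟩ := hcov x
      by_cases h : k ∈ K
      · left; simp only [mem_iUnion]; exact ⟨k, h, hk⟩
      · right; simp only [mem_iUnion]; exact ⟨k, h, hk⟩) (by
      obtain ⟨v, hv⟩ := h1.two.nonempty
      obtain ⟨k, z, hz, e⟩ := hcov v
      refine ⟨v, trivial, ?_⟩
      simp only [mem_iUnion]
      refine ⟨k, ?_, z, hz, e⟩
      by_contra h
      exact hdis k h z (ball_subset_ball (by norm_num) hz) (e ▸ hG1 (h1.sub hv)))
      ⟨c k0 0, trivial, by simp only [mem_iUnion]; exact ⟨k0, hk0, 0, by simp, rfl⟩⟩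
  simp only [mem_iUnion] at hx1 hx2
  obtain ⟨j, hj, z, hz, rfl⟩ := hx1
  obtain ⟨k, hk, w, hw, e⟩ := hx2
  have hzG : c j z ∉ G := e ▸ hdis k hk w (ball_subset_ball (by norm_num) hw)
  obtain ⟨i, hi⟩ := hK j hj z hz hzG
  refine hadd k hk G V subset_rfl hG ?_
  intro u hu huG
  refine ⟨i, ?_⟩
  have hpre : IsPreconnected (c k '' ball 0 1) :=
    (convex_ball (0:ℂ) 1).isPreconnected.image _ (hc k).continuous.continuousOn
  have := comp_eq_of_preconn hpre (F := Gᶜ) (p := c j z) (q := c k u) (by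
    rintro _ ⟨s, hs, rfl⟩
    exact hdis k hk s (ball_subset_ball (by norm_num) hs)) ⟨w, hw, e⟩ ⟨u, hu, rfl⟩
  rw [← connectedComponentIn_eq this]
  exact hi

/-- parametrized closed face -/
structure Face (F : ℂ → X) (C : Set X) : Prop where
  cont : ContinuousOn F (closedBall 0 1)
  inj : InjOn F (closedBall 0 1)
  ball : F '' ball 0 1 = C
  sphere : F '' sphere 0 1 = frontier C

theorem face_of [T2Space X] [LocallyConnectedSpace X] {G V : Set X} (hG : Good G V) {c : ℂ → X}
    (hc : IsOpenEmbedding c) (hout : ∃ y ∈ G, y ∉ range c) {x : X} (hx : x ∉ G)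
    (hsub : connectedComponentIn Gᶜ x ⊆ c '' ball 0 3) :
    ∃ F, Face F (connectedComponentIn Gᶜ x) := by
  set C := connectedComponentIn Gᶜ x with hC
  have hxC : x ∈ C := mem_connectedComponentIn hx
  have hCo : IsOpen C := hG.closed.isOpen_compl.connectedComponentIn
  have hCr : C ⊆ range c := hsub.trans (image_subset_range _ _)
  have hCG : ∀ y ∈ C, y ∉ G := fun y hy => connectedComponentIn_subset _ _ hy
  have hfr : frontier C ⊆ G := by
    have := frontier_comp_subset hG.closed.isOpen_compl x
    rwa [compl_compl] at this
  have hC3 : c ⁻¹' C ⊆ ball 0 3 := by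
    intro z hz
    obtain ⟨w, hw, e⟩ := hsub hz
    rwa [hc.injective e] at hw
  have hCb : IsBounded (c ⁻¹' C) := isBounded_ball.subset hC3
  have hfr' : frontier (c ⁻¹' C) = c ⁻¹' frontier C :=
    (hc.isOpenMap.preimage_frontier_eq_frontier_preimage hc.continuous C).symm
  have hNC : NC (c ⁻¹' G) := by
    intro v W hW hWb hWv w hw
    by_contra hwv
    obtain ⟨y, hy, hyr⟩ := hout
    have := preconn_subset_of_frontier (hG.conn (c v)) (hc.isOpenMap _ hW)
      ⟨c w, ⟨hw.2, fun e => hwv (hc.injective e)⟩, w, hw.1, rfl⟩ (by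
        intro u hu huf
        obtain ⟨s, hs, rfl⟩ := frontier_chart hc hWb huf
        exact hu.2 (by rw [hWv ⟨hs, hu.1⟩]; rfl))
    obtain ⟨s, _, hs⟩ := this ⟨hy, fun e => hyr ⟨v, e.symm⟩⟩
    exact hyr ⟨s, hs⟩
  have hFull : Full (c ⁻¹' C) := by
    intro W hW hWb hWf w hw
    have hd : frontier W ∩ c ⁻¹' G = ∅ := by
      grind
    have hWG : ∀ u ∈ W, c u ∉ G := by
      intro u hu huG
      have a := hNC 0 W hW hWb (by rw [hd]; exact empty_subset _) ⟨hu, huG⟩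
      have b := hNC 1 W hW hWb (by rw [hd]; exact empty_subset _) ⟨hu, huG⟩
      exact zero_ne_one (α := ℂ) (a.symm.trans b)
    set W0 := connectedComponentIn W w
    have hW0W : W0 ⊆ W := connectedComponentIn_subset _ _
    have hW0 : w ∈ W0 := mem_connectedComponentIn hw
    have hfne : (frontier W0).Nonempty := by
      rw [nonempty_frontier_iff]
      refine ⟨⟨w, hW0⟩, fun e => ?_⟩
      have := hWb.subset hW0W
      rw [e] at this
      exact NoncompactSpace.noncompact_univ (X := ℂ) (by
        simpa using this.isCompact_closure)
    obtain ⟨u, hu⟩ := hfne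
    have hclo : closure W0 ⊆ W ∪ frontier W := by
      rw [← closure_eq_self_union_frontier]; exact closure_mono hW0W
    have huC : c u ∈ C := by
      rcases hclo (frontier_subset_closure hu) with h | h
      · exact absurd h (frontier_comp_subset hW w hu)
      · exact hWf h
    have := comp_eq_of_preconn (F := Gᶜ) (p := c u) (q := c w)
      (isPreconnected_connectedComponentIn.closure.image _ hc.continuous.continuousOn
        : IsPreconnected (c '' closure W0)) (by
        rintro _ ⟨s, hs, rfl⟩
        rcases hclo hs with h | h
        · exact hWG s h
        · exact hCG _ (hWf h)) ⟨u, frontier_subset_closure hu, rfl⟩ ⟨w, subset_closure hW0, rfl⟩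
    rw [← connectedComponentIn_eq huC] at this
    exact this
  have hLC : LC (c ⁻¹' C) := by
    intro ε hε
    obtain ⟨δ, hδ, h⟩ := ulc hG.closed hG.lc hc 3 hε
    refine ⟨δ, hδ, fun a ha b hb hab => ?_⟩
    have ha3 : ‖a‖ ≤ 3 := by
      have := closure_mono hC3 (frontier_subset_closure ha)
      simpa using closure_ball_subset_closedBall this
    rw [hfr'] at ha hb
    obtain ⟨T, t1, t2, t3, t4, t5⟩ := h a b ha3 (hfr ha) (hfr hb) hab
    exact ⟨T, t1, fun z hz hzC => hCG _ hzC (t2 hz), t3.trans ball_subset_closedBall, t4, t5⟩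
  obtain ⟨F, f1, f2, f3, f4⟩ := caratheodory (hCo.preimage hc.continuous)
    (isPreconnected_connectedComponentIn.preimage_of_isOpenMap hc.injective hc.isOpenMap hCr)
    (by obtain ⟨z, hz⟩ := hCr hxC; exact ⟨z, show c z ∈ C by rwa [hz]⟩) hCb hFull hLC
    (by rw [hfr']; exact preimage_mono hfr) (fun z hz => hCG _ hz) hNC
  refine ⟨c ∘ F, hc.continuous.comp_continuousOn f1, hc.injective.comp_injOn f2, ?_, ?_⟩
  · rw [image_comp, f3, image_preimage_eq_of_subset hCr]
  · rw [image_comp, f4]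
    apply Subset.antisymm
    · rw [hfr']; exact image_preimage_subset _ _
    · have := frontier_chart hc hCb
      rwa [image_preimage_eq_of_subset hCr] at this

theorem graph_exists (hX : IsSurface X) : ∃ G V : Set X, Good G V ∧
    ∀ x ∉ G, ∃ F, Face F (connectedComponentIn Gᶜ x) := by
  have hLE := le_of_surface hX
  obtain ⟨_, _, _, -⟩ := hX
  have := hLE.locallyConnected
  obtain ⟨x0⟩ : Nonempty X := inferInstance
  obtain ⟨c0, hc0, -⟩ := hLE x0 univ Filter.univ_mem
  obtain ⟨V1, hV1⟩ := good_circle hc0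
  have h1 : ∀ x : X, ∃ c : ℂ → X, IsOpenEmbedding c ∧ c 0 = x ∧ ∃ y ∈ range (cp c0), y ∉ range c := by
    intro x
    obtain ⟨v, hv, hvx⟩ := hV1.two.exists_ne x
    obtain ⟨c, hc, h0, hr⟩ := hLE x {v}ᶜ (isOpen_compl_singleton.mem_nhds hvx.symm)
    exact ⟨c, hc, h0, v, hV1.sub hv, fun h => hr h rfl⟩
  choose c hc h0 hm using h1
  obtain ⟨t, ht⟩ := isCompact_univ.elim_finite_subcover (fun x : X => c x '' ball 0 1)
    (fun x => (hc x).isOpenMap _ isOpen_ball) (fun x _ => mem_iUnion.2 ⟨x, 0, by simp, h0 x⟩)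
  obtain ⟨G, V, hsub, hG, h⟩ := cover_step (fun k : t => c k) (fun k => hc k) (by
    intro x
    have := ht (mem_univ x)
    simp only [mem_iUnion] at this
    obtain ⟨i, hi, h⟩ := this
    exact ⟨⟨i, hi⟩, h⟩) hV1 (fun k => hm k)
  refine ⟨G, V, hG, fun x hx => ?_⟩
  obtain ⟨j, hj⟩ := h x hx
  obtain ⟨y, hy, hyr⟩ := hm j
  exact face_of hG (hc j) ⟨y, hsub hy, hyr⟩ hx hj

end graph
end

/-- descend a function along a continuous map on a compact set -/
theorem descend {α β γ : Type*} [TopologicalSpace α] [TopologicalSpace β] [TopologicalSpace γ]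
    [T2Space β] {A : Set α} (hA : IsCompact A) (hAc : IsClosed A) {p : α → β} {g : α → γ}
    (hp : ContinuousOn p A) (hg : ContinuousOn g A)
    (h : ∀ x ∈ A, ∀ y ∈ A, p x = p y → g x = g y) [Nonempty γ] :
    ∃ Φ : β → γ, ContinuousOn Φ (p '' A) ∧ ∀ x ∈ A, Φ (p x) = g x := by
  classical
  let Φ : β → γ := fun y => if H : ∃ x ∈ A, p x = y then g H.choose else Classical.arbitrary γ
  have hΦ : ∀ x ∈ A, Φ (p x) = g x := by
    intro x hx
    have H : ∃ x' ∈ A, p x' = p x := ⟨x, hx, rfl⟩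
    grind
  refine ⟨Φ, ?_, hΦ⟩
  rw [continuousOn_iff_isClosed]
  intro t ht
  have hc : IsCompact (A ∩ g ⁻¹' t) := hA.of_isClosed_subset (hg.preimage_isClosed_of_isClosed hAc ht) inter_subset_left
  refine ⟨p '' (A ∩ g ⁻¹' t), (hc.image_of_continuousOn (hp.mono inter_subset_left)).isClosed, ?_⟩
  ext y
  constructor
  · grind
  · grind

/-- the exponential parametrization of the circle with period 1 -/
def ee (t : ℝ) : ℂ := exp (2 * π * t * I)

theorem ee_cont : Continuous ee := by unfold ee; fun_prop

theorem norm_ee (t : ℝ) : ‖ee t‖ = 1 := by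
  have : (2 * π * t * I : ℂ) = ((2 * π * t : ℝ) : ℂ) * I := by push_cast; ring
  rw [ee, this, norm_exp_ofReal_mul_I]

theorem hmemee (t : ℝ) : ee t ∈ closedBall (0:ℂ) 1 := by rw [mem_closedBall_zero_iff, norm_ee]

theorem ee_ne (t : ℝ) : ee t ≠ 0 := exp_ne_zero _

theorem ee_add (s t : ℝ) : ee (s + t) = ee s * ee t := by
  unfold ee; rw [← exp_add]; push_cast; ring_nf

theorem ee_zero : ee 0 = 1 := by simp [ee]

theorem ee_one : ee 1 = 1 := by simp [ee, exp_two_pi_mul_I]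

theorem ee_eq {s t : ℝ} : ee s = ee t ↔ ∃ k : ℤ, s = t + k := by
  unfold ee
  rw [exp_eq_exp_iff_exists_int]
  refine exists_congr fun k => ?_
  have h2 : (2 * π * I : ℂ) ≠ 0 := two_pi_I_ne_zero
  constructor
  · intro h
    have : (2 * π * I : ℂ) * s = (2 * π * I : ℂ) * (t + k) := by
      linear_combination h
    have := mul_left_cancel₀ h2 this
    exact_mod_cast this
  · intro h; rw [h]; push_cast; ring

theorem ee_neg (t : ℝ) : ee (-t) = conj (ee t) := by
  unfold ee
  rw [← exp_conj]
  simp [conj_ofNat]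

theorem ee_add_int (s : ℝ) (k : ℤ) : ee (s + k) = ee s := ee_eq.2 ⟨k, rfl⟩

theorem ee_inj {s t : ℝ} (hs : s ∈ Ico (0:ℝ) 1) (ht : t ∈ Ico (0:ℝ) 1) (h : ee s = ee t) : s = t := by
  obtain ⟨k, hk⟩ := ee_eq.1 h
  have h1 : (k:ℝ) < 1 := by linarith [hs.2, ht.1]
  have h2 : (-1:ℝ) < k := by linarith [hs.1, ht.2]
  have h1' : k < 1 := by exact_mod_cast h1
  have h2' : -1 < k := by exact_mod_cast h2
  have : k = 0 := by omega
  simpa [this] using hk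

theorem ee_eq_Icc {s t : ℝ} (hs : s ∈ Icc (0:ℝ) 1) (ht : t ∈ Icc (0:ℝ) 1) (h : ee s = ee t) :
    s = t ∨ (s = 0 ∧ t = 1) ∨ (s = 1 ∧ t = 0) := by
  rcases eq_or_lt_of_le hs.2 with h1 | h1 <;> rcases eq_or_lt_of_le ht.2 with h2 | h2
  · left; rw [h1, h2]
  · right; right
    refine ⟨h1, ee_inj ⟨ht.1, h2⟩ (by simp) ?_⟩
    rw [← h, h1, ee_one, ee_zero]
  · right; left
    refine ⟨ee_inj ⟨hs.1, h1⟩ (by simp) ?_, h2⟩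
    rw [h, h2, ee_one, ee_zero]
  · left; exact ee_inj ⟨hs.1, h1⟩ ⟨ht.1, h2⟩ h

theorem ee_surj {z : ℂ} (hz : ‖z‖ = 1) : ∃ t ∈ Ico (0:ℝ) 1, ee t = z := by
  refine ⟨Int.fract (arg z / (2 * π)), ⟨Int.fract_nonneg _, Int.fract_lt_one _⟩, ?_⟩
  have : ee (Int.fract (arg z / (2 * π))) = ee (arg z / (2 * π)) := by
    rw [ee_eq]; exact ⟨-⌊arg z / (2 * π)⌋, by rw [Int.fract]; push_cast; ring⟩
  rw [this, ee]
  have h2 := norm_mul_exp_arg_mul_I z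
  rw [hz, ofReal_one, one_mul] at h2
  rw [← h2]
  congr 1
  have hpi : (π : ℂ) ≠ 0 := by exact_mod_cast Real.pi_ne_zero
  push_cast
  rw [h2]
  field_simp

theorem polar_exists {z : ℂ} (hz : ‖z‖ ≤ 1) : ∃ r ∈ Icc (0:ℝ) 1, ∃ t ∈ Ico (0:ℝ) 1, (r:ℂ) * ee t = z ∧ r = ‖z‖ := by
  by_cases h0 : z = 0
  · exact ⟨0, by simp, 0, by simp, by simp [h0], by simp [h0]⟩
  obtain ⟨t, ht, h⟩ := ee_surj (z := z / ‖z‖) (by simp [h0])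
  refine ⟨‖z‖, ⟨norm_nonneg _, hz⟩, t, ht, ?_, rfl⟩
  rw [h, mul_div_cancel₀]
  simpa using h0

theorem norm_polar {r t : ℝ} (hr : 0 ≤ r) : ‖(r:ℂ) * ee t‖ = r := by
  rw [norm_mul, norm_ee, mul_one, norm_real, Real.norm_of_nonneg hr]

theorem cone {h : ℝ → ℂ} (hc : ContinuousOn h (Icc 0 1)) (h01 : h 0 = h 1) (hinj : InjOn h (Ico 0 1))
    {K : Set ℂ} (hK : Convex ℝ K) (hKc : IsCompact K) (himg : h '' Ico 0 1 = frontier K) {x0 : ℂ}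
    (hx0 : x0 ∈ interior K) :
    ∃ Φ : ℂ → ℂ, ContinuousOn Φ (closedBall 0 1) ∧ InjOn Φ (closedBall 0 1) ∧
      Φ '' closedBall 0 1 = K ∧ ∀ τ ∈ Icc (0:ℝ) 1, Φ (ee τ) = h τ := by
  set A : Set (ℝ × ℝ) := Icc 0 1 ×ˢ Icc 0 1 with hA
  have hAc : IsCompact A := isCompact_Icc.prod isCompact_Icc
  let p : ℝ × ℝ → ℂ := fun x => (x.1:ℂ) * ee x.2
  let g : ℝ × ℝ → ℂ := fun x => x0 + (x.1:ℂ) * (h x.2 - x0)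
  have hp : Continuous p := by have := ee_cont; fun_prop
  have hg : ContinuousOn g A := by
    have : ContinuousOn (fun x : ℝ × ℝ => h x.2) A := hc.comp continuousOn_snd (fun x hx => hx.2)
    exact continuousOn_const.add ((continuous_ofReal.comp continuous_fst).continuousOn.mul (this.sub continuousOn_const))
  have hfr : ∀ τ ∈ Icc (0:ℝ) 1, h τ ∈ frontier K := by
    grind
  have hfK : ∀ a ∈ frontier K, a ∈ K := fun a ha => hKc.isClosed.frontier_subset ha
  have hee : ∀ s ∈ Icc (0:ℝ) 1, ∀ t ∈ Icc (0:ℝ) 1, ee s = ee t → h s = h t := by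
    intro s hs t ht e
    rcases ee_eq_Icc hs ht e with h1 | ⟨h1, h2⟩ | ⟨h1, h2⟩
    · rw [h1]
    · rw [h1, h2, h01]
    · rw [h1, h2, h01]
  have hhe : ∀ s ∈ Icc (0:ℝ) 1, ∀ t ∈ Icc (0:ℝ) 1, h s = h t → ee s = ee t := by
    have key : ∀ s ∈ Icc (0:ℝ) 1, ∃ s' ∈ Ico (0:ℝ) 1, h s' = h s ∧ ee s' = ee s := by
      intro s hs
      rcases eq_or_lt_of_le hs.2 with e | e
      · exact ⟨0, by simp, by rw [h01, e], by rw [e, ee_zero, ee_one]⟩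
      · exact ⟨s, ⟨hs.1, e⟩, rfl, rfl⟩
    intro s hs t ht e
    obtain ⟨s', hs', e1, e2⟩ := key s hs
    obtain ⟨t', ht', e3, e4⟩ := key t ht
    rw [← e2, ← e4, hinj hs' ht' (by rw [e1, e3, e])]
  obtain ⟨Φ, hΦ, hΦp⟩ := descend hAc (isClosed_Icc.prod isClosed_Icc) hp.continuousOn hg (by
    rintro ⟨r, s⟩ ⟨hr, hs⟩ ⟨r', s'⟩ ⟨hr', hs'⟩ e
    simp only [p] at e
    have e1 := congrArg norm e
    rw [norm_polar hr.1, norm_polar hr'.1] at e1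
    grind)
  have himp : p '' A = closedBall 0 1 := by
    ext z
    rw [mem_closedBall_zero_iff]
    constructor
    · rintro ⟨⟨r, s⟩, ⟨hr, hs⟩, rfl⟩
      simp only [p]; rw [norm_polar hr.1]; exact hr.2
    · intro hz
      obtain ⟨r, hr, t, ht, e, _⟩ := polar_exists hz
      exact ⟨(r, t), ⟨hr, Ico_subset_Icc_self ht⟩, e⟩
  rw [himp] at hΦ
  have hlt : ∀ a ∈ frontier K, ∀ b ∈ frontier K, ∀ r s : ℝ, 0 ≤ r → r < s →
      (r:ℂ) * (a - x0) = (s:ℂ) * (b - x0) → False := by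
    intro a ha b hb r s hr hrs e
    have hs : 0 < s := hr.trans_lt hrs
    have hs' : (s:ℂ) ≠ 0 := by exact_mod_cast hs.ne'
    have e2 : b = (1 - r / s) • x0 + (r / s) • a := by
      simp only [real_smul]
      push_cast
      field_simp
      linear_combination -e
    refine hb.2 ?_
    rw [e2]
    refine hK.combo_interior_self_mem_interior hx0 (hfK a ha) ?_ (by positivity) (by ring)
    rw [sub_pos, div_lt_one hs]; exact hrs
  refine ⟨Φ, hΦ, ?_, ?_, ?_⟩
  · rw [← himp]
    rintro _ ⟨⟨r, s⟩, ⟨hr, hs⟩, rfl⟩ _ ⟨⟨r', s'⟩, ⟨hr', hs'⟩, rfl⟩ e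
    rw [hΦp _ ⟨hr, hs⟩, hΦp _ ⟨hr', hs'⟩] at e
    simp only [g] at e
    have e := add_left_cancel e
    grind
  · apply Subset.antisymm
    · rw [← himp]
      rintro _ ⟨_, ⟨⟨r, s⟩, ⟨hr, hs⟩, rfl⟩, rfl⟩
      rw [hΦp _ ⟨hr, hs⟩]
      have := hK (interior_subset hx0) (hfK _ (hfr s hs)) (sub_nonneg.2 hr.2) hr.1 (by ring)
      convert this using 1
      simp only [g, real_smul]; push_cast; ring
    · intro x hx
      by_cases hxx : x = x0
      · refine ⟨p (0, 0), ?_, ?_⟩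
        · simp [p]
        · rw [hΦp _ ⟨by simp, by simp⟩]; simp [g, hxx]
      set T : Set ℝ := (fun t : ℝ => x0 + (t:ℂ) * (x - x0)) ⁻¹' K ∩ Ici 1 with hT
      have hpos : 0 < ‖x - x0‖ := by rw [norm_pos_iff, sub_ne_zero]; exact hxx
      have hTc : IsCompact T := by
        obtain ⟨M, hM⟩ := hKc.isBounded.subset_closedBall x0
        refine isCompact_of_isClosed_isBounded ((hKc.isClosed.preimage (by fun_prop)).inter isClosed_Ici)
          ((isBounded_Icc (1:ℝ) (M / ‖x - x0‖)).subset ?_)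
        intro t ht
        refine ⟨ht.2, ?_⟩
        have h1 := hM ht.1
        have ht1 : (1:ℝ) ≤ t := ht.2
        rw [mem_closedBall, dist_eq_norm, add_sub_cancel_left, norm_mul, norm_real,
          Real.norm_of_nonneg (by linarith)] at h1
        rw [le_div_iff₀ hpos]; exact h1
      obtain ⟨t, ht, hmax⟩ := hTc.exists_isMaxOn (f := id) ⟨1, by simpa [hT] using hx⟩ continuousOn_id
      have ht1 : (1:ℝ) ≤ t := ht.2
      have htf : x0 + (t:ℂ) * (x - x0) ∈ frontier K := by
        refine ⟨subset_closure ht.1, fun hin => ?_⟩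
        have hnb : (fun s : ℝ => x0 + (s:ℂ) * (x - x0)) ⁻¹' K ∈ 𝓝 t :=
          (show Continuous (fun s : ℝ => x0 + (s:ℂ) * (x - x0)) by fun_prop).continuousAt
            (mem_interior_iff_mem_nhds.1 hin)
        obtain ⟨ε, hε, hb⟩ := Metric.mem_nhds_iff.1 hnb
        have := hmax (a := t + ε / 2) ⟨hb (by
          rw [mem_ball, Real.dist_eq, add_sub_cancel_left, abs_of_pos (by positivity)]; linarith), by
            show (1:ℝ) ≤ _; linarith⟩
        grind
      rw [← himg] at htf
      obtain ⟨τ, hτ, e⟩ := htf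
      have hm : ((1 / t, τ) : ℝ × ℝ) ∈ A := ⟨⟨by positivity, by rw [div_le_one (by linarith)]; exact ht1⟩, Ico_subset_Icc_self hτ⟩
      refine ⟨p (1 / t, τ), by rw [← himp]; exact ⟨_, hm, rfl⟩, ?_⟩
      rw [hΦp _ hm]
      simp only [g]
      rw [e]
      have : (t:ℂ) ≠ 0 := by exact_mod_cast (by linarith : t ≠ 0)
      push_cast
      field_simp
      ring
  · intro τ hτ
    have := hΦp (1, τ) ⟨by simp, hτ⟩
    simpa [p, g] using this

theorem ee_re (t : ℝ) : (ee t).re = Real.cos (2 * π * t) := by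
  have : (2 * π * t * I : ℂ) = ((2 * π * t : ℝ) : ℂ) * I := by push_cast; ring
  rw [ee, this, exp_ofReal_mul_I_re]

theorem ee_im (t : ℝ) : (ee t).im = Real.sin (2 * π * t) := by
  have : (2 * π * t * I : ℂ) = ((2 * π * t : ℝ) : ℂ) * I := by push_cast; ring
  rw [ee, this, exp_ofReal_mul_I_im]

theorem ee_half : ee (1/2) = -1 := by
  apply Complex.ext
  · rw [ee_re, show 2 * π * (1/2) = π by ring]; simp
  · rw [ee_im, show 2 * π * (1/2) = π by ring]; simp

theorem re_sq_add_im_sq (z : ℂ) : z.re ^ 2 + z.im ^ 2 = ‖z‖ ^ 2 := by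
  rw [Complex.sq_norm, normSq_apply]; ring

/-- the cap `{|z| ≤ 1, re z ≥ c}` -/
def cap (c : ℝ) : Set ℂ := closedBall 0 1 ∩ {z | c ≤ z.re}

theorem cap_frontier (c : ℝ) : frontier (cap c) = {z | z ∈ cap c ∧ (‖z‖ = 1 ∨ z.re = c)} := by
  have hcl : IsClosed (cap c) := isClosed_closedBall.inter (isClosed_le continuous_const continuous_re)
  rw [hcl.frontier_eq, cap, interior_inter, interior_closedBall _ one_ne_zero, interior_setOfPred_le_re]
  ext z
  simp only [mem_sdiff, mem_inter_iff, mem_closedBall_zero_iff, mem_ball_zero_iff, mem_ofPred_eq, not_and, not_lt]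
  grind

theorem cap_convex (c : ℝ) : Convex ℝ (cap c) :=
  (convex_closedBall _ _).inter (convex_halfSpace_re_ge c)

theorem cap_compact (c : ℝ) : IsCompact (cap c) :=
  (isCompact_closedBall _ _).inter_right (isClosed_le continuous_const continuous_re)

theorem seg0 {m p β : ℝ} (hm : 0 < m) (hp : 0 < p) (hb : 0 < β) (hb1 : β < 1) :
    ∃ Φ : ℂ → ℂ, ContinuousOn Φ (closedBall 0 1) ∧ InjOn Φ (closedBall 0 1) ∧
      Φ '' closedBall 0 1 = cap (Real.cos (π * β)) ∧
      (∀ s ∈ Icc 0 m, Φ (ee (s / (m + p))) = ee (β * s / m - β / 2)) ∧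
      (∀ t ∈ Icc 0 p, Φ (ee ((m + t) / (m + p))) =
        ⟨Real.cos (π * β), (1 - 2 * t / p) * Real.sin (π * β)⟩) := by
  set c := Real.cos (π * β) with hcd
  set d := Real.sin (π * β) with hdd
  have hpi := Real.pi_pos
  have hd : 0 < d := Real.sin_pos_of_pos_of_lt_pi (by positivity) (by nlinarith)
  have hcd1 : c ^ 2 + d ^ 2 = 1 := by rw [hcd, hdd]; exact Real.cos_sq_add_sin_sq _
  have hn : 0 < m + p := by positivity
  let arc : ℝ → ℂ := fun τ => ee (β * (τ * (m + p)) / m - β / 2)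
  let chord : ℝ → ℂ := fun τ => (c : ℂ) + ((1 - 2 * (τ * (m + p) - m) / p) * d : ℝ) * I
  let h : ℝ → ℂ := fun τ => if τ * (m + p) ≤ m then arc τ else chord τ
  have cre : ∀ τ, (chord τ).re = c := by intro τ; simp [chord]
  have cim : ∀ τ, (chord τ).im = (1 - 2 * (τ * (m + p) - m) / p) * d := by
    intro τ; simp only [chord, add_im, ofReal_im, im_ofReal_mul, I_im]; ring
  have hend : ee (β / 2) = ⟨c, d⟩ := by
    apply Complex.ext
    · rw [ee_re, hcd]; congr 1; ring
    · rw [ee_im, hdd]; congr 1; ring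
  have hend' : ee (-(β / 2)) = ⟨c, -d⟩ := by
    rw [ee_neg, hend]; rfl
  have hcont : Continuous h := by
    have := ee_cont
    apply Continuous.if_le
    · fun_prop
    · fun_prop
    · fun_prop
    · fun_prop
    · intro τ hτ
      simp only [arc]
      have : β * (τ * (m + p)) / m - β / 2 = β / 2 := by rw [hτ]; field_simp; ring
      rw [this, hend]
      apply Complex.ext
      · rw [cre]
      · rw [cim, hτ]; simp
  have h01 : h 0 = h 1 := by
    have e1 : h 0 = arc 0 := if_pos (by simpa using hm.le)
    have e2 : h 1 = chord 1 := if_neg (by simpa using hp)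
    have e3 : arc 0 = ee (-(β/2)) := by simp [arc]
    rw [e1, e2, e3, hend']
    apply Complex.ext
    · rw [cre]
    · rw [cim]
      grind
  have arc_mem : ∀ τ, 0 ≤ τ → τ * (m + p) ≤ m → ‖arc τ‖ = 1 ∧ c ≤ (arc τ).re := by
    intro τ h0 h1
    refine ⟨norm_ee _, ?_⟩
    simp only [arc]
    rw [ee_re, ← Real.cos_abs, hcd]
    apply Real.cos_le_cos_of_nonneg_of_le_pi (abs_nonneg _) (by nlinarith)
    rw [abs_le]
    have a1 : 0 ≤ β * (τ * (m + p)) / m := by positivity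
    have a2 : β * (τ * (m + p)) / m ≤ β := by
      rw [div_le_iff₀ hm]; gcongr
    constructor <;> nlinarith
  have chord_mem : ∀ τ, m < τ * (m + p) → τ < 1 → ‖chord τ‖ < 1 := by
    intro τ h0 h1
    have e := re_sq_add_im_sq (chord τ)
    rw [cre, cim] at e
    have a1 : 0 < 2 * (τ * (m + p) - m) / p := by
      apply div_pos _ hp; linarith
    have a2 : 2 * (τ * (m + p) - m) / p < 2 := by
      rw [div_lt_iff₀ hp]; nlinarith
    set y := 1 - 2 * (τ * (m + p) - m) / p with hy
    have : y ^ 2 < 1 := by rw [sq_lt_one_iff_abs_lt_one, abs_lt]; constructor <;> linarith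
    have : (y * d) ^ 2 < d ^ 2 := by rw [mul_pow]; nlinarith [pow_pos hd 2]
    by_contra hcon
    push Not at hcon
    nlinarith [norm_nonneg (chord τ)]
  have hinj : InjOn h (Ico 0 1) := by
    intro τ hτ τ' hτ' e
    simp only [h] at e
    by_cases h1 : τ * (m + p) ≤ m <;> by_cases h2 : τ' * (m + p) ≤ m
    · rw [if_pos h1, if_pos h2] at e
      simp only [arc] at e
      have e2 : ee (β * (τ * (m + p)) / m) = ee (β * (τ' * (m + p)) / m) := by
        have x1 : β * (τ * (m + p)) / m = (β * (τ * (m + p)) / m - β/2) + β/2 := by ring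
        have x2 : β * (τ' * (m + p)) / m = (β * (τ' * (m + p)) / m - β/2) + β/2 := by ring
        rw [x1, x2, ee_add, e, ← ee_add]
      have key : ∀ τ ∈ Ico (0:ℝ) 1, τ * (m + p) ≤ m → β * (τ * (m + p)) / m ∈ Ico (0:ℝ) 1 := by
        intro τ hτ h1
        have := hτ.1
        refine ⟨by positivity, ?_⟩
        rw [div_lt_iff₀ hm]; nlinarith
      have e3 := ee_inj (key τ hτ h1) (key τ' hτ' h2) e2
      field_simp at e3
      exact e3
    · grind
    · grind
    · rw [if_neg h1, if_neg h2] at e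
      have e := congrArg im e
      rw [cim, cim] at e
      have e := mul_right_cancel₀ hd.ne' e
      grind
  have himg : h '' Ico 0 1 = frontier (cap c) := by
    rw [cap_frontier]
    ext z
    constructor
    · rintro ⟨τ, hτ, rfl⟩
      by_cases h1 : τ * (m + p) ≤ m
      · simp only [h]; rw [if_pos h1]
        have := arc_mem τ hτ.1 h1
        exact ⟨⟨by simpa using this.1.le, this.2⟩, Or.inl this.1⟩
      · simp only [h]; rw [if_neg h1]
        have := chord_mem τ (by linarith) hτ.2
        exact ⟨⟨by simpa using this.le, (cre τ).ge⟩, Or.inr (cre τ)⟩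
    · rintro ⟨⟨hz, hzc⟩, hz1⟩
      have hz : ‖z‖ ≤ 1 := by simpa using hz
      have hzc : c ≤ z.re := hzc
      by_cases hn1 : ‖z‖ = 1
      · have hzarg : ee (arg z / (2 * π)) = z := by
          have h2 := norm_mul_exp_arg_mul_I z
          rw [hn1, ofReal_one, one_mul] at h2
          rw [ee]
          conv_rhs => rw [← h2]
          congr 1
          have hpi : (π : ℂ) ≠ 0 := by exact_mod_cast Real.pi_ne_zero
          push_cast
          field_simp
        have hre : z.re = Real.cos (arg z) := by
          conv_lhs => rw [← hzarg, ee_re]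
          congr 1; field_simp
        have habs : |arg z| ≤ π * β := by
          by_contra hcon
          push Not at hcon
          have := Real.cos_lt_cos_of_nonneg_of_le_pi (by positivity) (abs_arg_le_pi z) hcon
          rw [Real.cos_abs, ← hre] at this
          linarith
        rw [abs_le] at habs
        set θ := arg z / (2 * π) with hθ
        have t1 : -(β / 2) ≤ θ := by rw [hθ, le_div_iff₀ (by positivity)]; nlinarith
        have t2 : θ ≤ β / 2 := by rw [hθ, div_le_iff₀ (by positivity)]; nlinarith
        have q : (θ + β / 2) * m / β / (m + p) * (m + p) = (θ + β / 2) * m / β := by field_simp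
        have q2 : (θ + β / 2) * m / β ≤ m := by rw [div_le_iff₀ hb]; nlinarith
        refine ⟨(θ + β / 2) * m / β / (m + p), ⟨?_, ?_⟩, ?_⟩
        · have : 0 ≤ θ + β / 2 := by linarith
          positivity
        · rw [div_lt_one hn]; linarith
        · grind
      · have hre : z.re = c := hz1.resolve_left hn1
        have e := re_sq_add_im_sq z
        have : ‖z‖ ^ 2 < 1 := by
          have := lt_of_le_of_ne hz hn1
          nlinarith [norm_nonneg z]
        have : z.im ^ 2 < d ^ 2 := by rw [hre] at e; linarith
        have hab := abs_lt_of_sq_lt_sq this hd.le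
        rw [abs_lt] at hab
        set t := p * (d - z.im) / (2 * d) with ht
        have t0 : 0 < t := by
          rw [ht]; apply div_pos (mul_pos hp _) <;> linarith
        have t1 : t < p := by
          rw [ht, div_lt_iff₀ (by positivity)]; nlinarith
        have q : (m + t) / (m + p) * (m + p) = m + t := by field_simp
        refine ⟨(m + t) / (m + p), ⟨by positivity, ?_⟩, ?_⟩
        · rw [div_lt_one hn]; linarith
        · simp only [h]; rw [if_neg (by rw [q]; linarith)]
          apply Complex.ext
          · rw [cre, hre]
          · rw [cim, q, ht]; field_simp; ring
  have hx0 : (((1 + c) / 2 : ℝ) : ℂ) ∈ interior (cap c) := by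
    have hc1 : c < 1 := by nlinarith [pow_pos hd 2]
    have hc2 : -1 < c := by nlinarith [pow_pos hd 2]
    rw [cap, interior_inter, interior_closedBall _ one_ne_zero, interior_setOfPred_le_re]
    refine ⟨?_, ?_⟩
    · rw [mem_ball_zero_iff, norm_real, Real.norm_eq_abs, abs_lt]; constructor <;> linarith
    · show c < _
      rw [ofReal_re]; linarith
  obtain ⟨Φ, h1, h2, h3, h4⟩ := cone hcont.continuousOn h01 hinj (cap_convex c) (cap_compact c) himg hx0
  refine ⟨Φ, h1, h2, h3, ?_, ?_⟩
  · intro s hs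
    have q : s / (m + p) * (m + p) = s := by field_simp
    rw [h4 _ ⟨div_nonneg hs.1 hn.le, by rw [div_le_one hn]; linarith [hs.2]⟩]
    grind
  · intro t ht
    have q : (m + t) / (m + p) * (m + p) = m + t := by field_simp
    rw [h4 _ ⟨div_nonneg (by linarith [ht.1]) hn.le, by rw [div_le_one hn]; linarith [ht.2]⟩]
    simp only [h]
    rcases eq_or_lt_of_le ht.1 with e | e
    · rw [if_pos (by rw [q]; linarith)]
      simp only [arc]; rw [q, ← e]
      have : β * (m + 0) / m - β / 2 = β / 2 := by field_simp; ring
      rw [this, hend]; simp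
    · rw [if_neg (by rw [q]; linarith)]
      apply Complex.ext
      · rw [cre]
      · rw [cim, q]; simp

theorem seg {m p β : ℝ} (hm : 0 < m) (hp : 0 < p) (hb : 0 < β) (hb1 : β < 1) :
    ∃ Φ : ℂ → ℂ, ContinuousOn Φ (closedBall 0 1) ∧ InjOn Φ (closedBall 0 1) ∧
      Φ '' closedBall 0 1 = {z | ‖z‖ ≤ 1 ∧ Real.cos (π * β) ≤ (z * ee (-(β / 2))).re} ∧
      (∀ s ∈ Icc 0 m, Φ (ee (s / (m + p))) = ee (β * s / m)) ∧
      (∀ t ∈ Icc 0 p, Φ (ee ((m + t) / (m + p))) = (1 - t / p : ℝ) * ee β + (t / p : ℝ)) := by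
  obtain ⟨Φ, h1, h2, h3, h4, h5⟩ := seg0 hm hp hb hb1
  have hmul : ee (β / 2) * ee (-(β / 2)) = 1 := by rw [← ee_add, add_neg_cancel, ee_zero]
  refine ⟨fun z => ee (β / 2) * Φ z, continuousOn_const.mul h1, ?_, ?_, ?_, ?_⟩
  · intro x hx y hy e
    exact h2 hx hy (mul_left_cancel₀ (ee_ne _) e)
  · ext z
    constructor
    · rintro ⟨x, hx, rfl⟩
      have : Φ x ∈ cap (Real.cos (π * β)) := h3 ▸ mem_image_of_mem _ hx
      refine ⟨?_, ?_⟩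
      · simp only [norm_mul, norm_ee, one_mul]; simpa using this.1
      · have e : ee (β / 2) * Φ x * ee (-(β / 2)) = Φ x := by linear_combination Φ x * hmul
        simp only [e]; exact this.2
    · rintro ⟨ha, hb⟩
      have : z * ee (-(β / 2)) ∈ Φ '' closedBall 0 1 := by
        rw [h3]; exact ⟨by simpa [norm_ee] using ha, hb⟩
      grind
  · intro s hs
    simp only
    rw [h4 s hs, ← ee_add]; congr 1; ring
  · intro t ht
    simp only
    rw [h5 t ht]
    have hend : ee (β / 2) = ⟨Real.cos (π * β), Real.sin (π * β)⟩ := by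
      apply Complex.ext
      · rw [ee_re]; congr 1; ring
      · rw [ee_im]; congr 1; ring
    have hb2 : ee β = ee (β / 2) * ee (β / 2) := by rw [← ee_add]; congr 1; ring
    rw [hb2, hend]
    have := Real.cos_sq_add_sin_sq (π * β)
    rw [mul_div_assoc]
    generalize t / p = q
    apply Complex.ext
    · simp
      linear_combination q * this
    · simp
      ring

abbrev D := closedBall (0:ℂ) 1
abbrev Word := List (ℕ × Bool)

def tb (b : Bool) (t : ℝ) : ℝ := if b then t else 1 - t

theorem tb_mem {b : Bool} {t : ℝ} (ht : t ∈ Icc (0:ℝ) 1) : tb b t ∈ Icc (0:ℝ) 1 := by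
  unfold tb; split_ifs <;> grind

theorem tb_not (b : Bool) (t : ℝ) : tb (!b) t = 1 - tb b t := by
  cases b <;> simp [tb]

def OnAt : Word → ℕ → ℝ → ℝ → Prop
  | [], _, _, _ => False
  | (x :: u), a, t, s => (x.1 = a ∧ s = tb x.2 t) ∨ OnAt u a t (s - 1)

theorem OnAt_append (u v : Word) (a : ℕ) (t s : ℝ) :
    OnAt (u ++ v) a t s ↔ OnAt u a t s ∨ OnAt v a t (s - u.length) := by
  induction u generalizing s with
  | nil => simp [OnAt]
  | cons x u ih =>
    simp only [List.cons_append, OnAt, ih, or_assoc, List.length_cons, Nat.cast_add, Nat.cast_one]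
    rw [show s - 1 - (u.length : ℝ) = s - (u.length + 1) by ring]

theorem OnAt_single (x : ℕ × Bool) (a : ℕ) (t s : ℝ) : OnAt [x] a t s ↔ x.1 = a ∧ s = tb x.2 t := by
  simp [OnAt]

theorem OnAt.mem {u : Word} {a : ℕ} {t s : ℝ} (h : OnAt u a t s) : a ∈ u.map Prod.fst := by
  induction u generalizing s with
  | nil => exact h.elim
  | cons x u ih =>
    rcases h with h | h
    · simp [h.1]
    · exact List.mem_cons_of_mem _ (ih h)

theorem OnAt.range {u : Word} {a : ℕ} {t s : ℝ} (ht : t ∈ Icc (0:ℝ) 1) (h : OnAt u a t s) :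
    s ∈ Icc (0:ℝ) u.length := by
  induction u generalizing s with
  | nil => exact h.elim
  | cons x u ih =>
    rcases h with h | h
    · rw [h.2]; have := tb_mem (b := x.2) ht
      refine ⟨this.1, this.2.trans ?_⟩
      simp
    · have := ih h
      simp only [List.length_cons, Nat.cast_add, Nat.cast_one]
      exact ⟨by linarith [this.1], by linarith [this.2]⟩

def flipL (x : ℕ × Bool) : ℕ × Bool := (x.1, !x.2)
def winv (u : Word) : Word := (u.map flipL).reverse

@[simp] theorem winv_nil : winv [] = [] := rfl
@[simp] theorem winv_cons (x : ℕ × Bool) (u : Word) : winv (x :: u) = winv u ++ [flipL x] := by simp [winv]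
@[simp] theorem winv_append (u v : Word) : winv (u ++ v) = winv v ++ winv u := by simp [winv]
@[simp] theorem flipL_flipL (x : ℕ × Bool) : flipL (flipL x) = x := by simp [flipL]
@[simp] theorem winv_winv (u : Word) : winv (winv u) = u := by
  induction u with
  | nil => rfl
  | cons x u ih => simp [ih]
@[simp] theorem winv_length (u : Word) : (winv u).length = u.length := by simp [winv]
@[simp] theorem flipL_fst (x : ℕ × Bool) : (flipL x).1 = x.1 := rfl
@[simp] theorem flipL_mk (a : ℕ) (b : Bool) : flipL (a, b) = (a, !b) := rfl

theorem OnAt_winv (u : Word) (a : ℕ) (t s : ℝ) : OnAt (winv u) a t s ↔ OnAt u a t (u.length - s) := by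
  induction u generalizing s with
  | nil => simp [OnAt]
  | cons x u ih =>
    rw [winv_cons, OnAt_append, ih, OnAt_single, OnAt]
    simp only [winv_length, List.length_cons, Nat.cast_add, Nat.cast_one, flipL, tb_not]
    rw [or_comm]
    refine or_congr (and_congr_right fun _ => ?_) ?_
    · constructor <;> intro h <;> linarith
    · grind

def On (u : Word) (a : ℕ) (t : ℝ) (z : ℂ) : Prop := ∃ s, OnAt u a t s ∧ z = ee (s / u.length)

def OnP {ι : Type} (w : ι → Word) (a : ℕ) (t : ℝ) (p : Σ _ : ι, D) : Prop := On (w p.1) a t p.2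

def RR {ι : Type} (w : ι → Word) (p q : Σ _ : ι, D) : Prop :=
  ∃ a, ∃ t ∈ Icc (0:ℝ) 1, OnP w a t p ∧ OnP w a t q

def Pres (X : Type) [TopologicalSpace X] {ι : Type} (w : ι → Word) : Prop :=
  ∃ q : (Σ _ : ι, D) → X, IsQuotientMap q ∧ ∀ x y, q x = q y ↔ EqvGen (RR w) x y

instance : CompactSpace D := isCompact_iff_compactSpace.1 (isCompact_closedBall _ _)

theorem pres_move {X : Type} [TopologicalSpace X] {ι ι' : Type} [Finite ι'] {w : ι → Word} {w' : ι' → Word}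
    (C : ℕ → Prop) (Φ : (Σ _ : ι', D) → Σ _ : ι, D) (hc : Continuous Φ) (hs : Surjective Φ)
    (h1 : ∀ a, ¬ C a → ∀ t ∈ Icc (0:ℝ) 1, ∀ x, OnP w' a t x → OnP w a t (Φ x))
    (h1c : ∀ a, C a → ∀ t ∈ Icc (0:ℝ) 1, ∀ x y, OnP w' a t x → OnP w' a t y → Φ x = Φ y)
    (h2 : ∀ x y, Φ x = Φ y → EqvGen (RR w') x y)
    (h3 : ∀ a, ∀ t ∈ Icc (0:ℝ) 1, ∀ p, OnP w a t p → ∃ x, Φ x = p ∧ OnP w' a t x) :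
    Pres X w' ↔ Pres X w := by
  have hq : IsQuotientMap Φ := hc.isClosedMap.isQuotientMap hc hs
  have key : ∀ x y, EqvGen (RR w') x y ↔ EqvGen (RR w) (Φ x) (Φ y) := by
    intro x y
    constructor
    · intro h
      induction h with
      | rel x y h =>
        obtain ⟨a, t, ht, hx, hy⟩ := h
        by_cases ha : C a
        · rw [h1c a ha t ht x y hx hy]; exact .refl _
        · exact .rel _ _ ⟨a, t, ht, h1 a ha t ht x hx, h1 a ha t ht y hy⟩
      | refl x => exact .refl _
      | symm x y _ ih => exact .symm _ _ ih
      | trans x y z _ _ ih1 ih2 => exact .trans _ _ _ ih1 ih2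
    · have : ∀ p q, EqvGen (RR w) p q → ∀ x y, Φ x = p → Φ y = q → EqvGen (RR w') x y := by
        intro p q h
        induction h with
        | rel p q h =>
          intro x y hx hy
          obtain ⟨a, t, ht, hp, hq⟩ := h
          obtain ⟨x', e1, o1⟩ := h3 a t ht p hp
          obtain ⟨y', e2, o2⟩ := h3 a t ht q hq
          exact .trans _ _ _ (h2 x x' (by rw [hx, e1])) (.trans _ _ _ (.rel _ _ ⟨a, t, ht, o1, o2⟩)
            (h2 y' y (by rw [hy, e2])))
        | refl p => intro x y hx hy; exact h2 _ _ (by rw [hx, hy])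
        | symm p q _ ih => intro x y hx hy; exact .symm _ _ (ih y x hy hx)
        | trans p q r _ _ ih1 ih2 =>
          intro x y hx hy
          obtain ⟨z, hz⟩ := hs q
          exact .trans _ _ _ (ih1 x z hx hz) (ih2 z y hz hy)
      intro h; exact this _ _ h x y rfl rfl
  constructor
  · rintro ⟨q', hq', hf⟩
    have hcomp : ∀ x y, Φ x = Φ y → q' x = q' y := fun x y h => (hf x y).2 (h2 x y h)
    let q : (Σ _ : ι, D) → X := fun p => q' (surjInv hs p)
    have hqq : q ∘ Φ = q' := by
      ext x; exact hcomp _ _ (surjInv_eq hs _)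
    refine ⟨q, ?_, ?_⟩
    · have hqc : Continuous q := hq.continuous_iff.2 (by rw [hqq]; exact hq'.continuous)
      exact IsQuotientMap.of_comp hc hqc (by rw [hqq]; exact hq')
    · intro p p'
      obtain ⟨x, rfl⟩ := hs p
      obtain ⟨y, rfl⟩ := hs p'
      rw [← key, ← hf, ← hqq]; rfl
  · rintro ⟨q, hq1, hf⟩
    refine ⟨q ∘ Φ, hq1.comp hq, fun x y => ?_⟩
    rw [key, ← hf]; rfl

/-- reindexing -/
theorem pres_reindex {X : Type} [TopologicalSpace X] {ι ι' : Type} [Finite ι'] (e : ι' ≃ ι) (w : ι → Word) :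
    Pres X (fun i => w (e i)) ↔ Pres X w := by
  refine pres_move (fun _ => False) (fun x => ⟨e x.1, x.2⟩) ?_ ?_ ?_ ?_ ?_ ?_
  · exact continuous_sigma fun i => (continuous_sigmaMk (σ := fun _ : ι => D) (i := e i))
  · rintro ⟨i, z⟩; exact ⟨⟨e.symm i, z⟩, by simp⟩
  · intro a _ t ht x hx; exact hx
  · intro a ha; exact ha.elim
  · rintro ⟨i, z⟩ ⟨j, z'⟩ h
    have h1 : i = j := e.injective (congrArg Sigma.fst h)
    subst h1
    have h2 : z = z' := by simpa using h
    subst h2; exact .refl _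
  · rintro a t ht ⟨i, z⟩ h
    obtain ⟨j, rfl⟩ := e.surjective i
    exact ⟨⟨j, z⟩, rfl, h⟩

def Deq (u v : Word) : Prop := ∃ φ : D ≃ₜ D, ∀ a t z, On u a t (z : D) ↔ On v a t (φ z)

theorem Deq.refl (u : Word) : Deq u u := ⟨Homeomorph.refl _, fun _ _ _ => Iff.rfl⟩
theorem Deq.symm {u v : Word} (h : Deq u v) : Deq v u := by
  obtain ⟨φ, h⟩ := h
  exact ⟨φ.symm, fun a t z => by rw [h]; simp⟩
theorem Deq.trans {u v w : Word} (h : Deq u v) (h' : Deq v w) : Deq u w := by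
  obtain ⟨φ, h⟩ := h
  obtain ⟨ψ, h'⟩ := h'
  exact ⟨φ.trans ψ, fun a t z => by rw [h, h']; rfl⟩

theorem pres_deq {X : Type} [TopologicalSpace X] {ι : Type} [Finite ι] {w w' : ι → Word}
    (h : ∀ i, Deq (w i) (w' i)) : Pres X w ↔ Pres X w' := by
  choose φ hφ using h
  refine pres_move (fun _ => False) (fun x => ⟨x.1, φ x.1 x.2⟩) ?_ ?_ ?_ ?_ ?_ ?_
  · exact continuous_sigma fun i => continuous_sigmaMk.comp (φ i).continuous
  · rintro ⟨i, z⟩; exact ⟨⟨i, (φ i).symm z⟩, by simp⟩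
  · rintro a _ t ht ⟨i, z⟩ hx; exact (hφ i a t z).1 hx
  · intro a ha; exact ha.elim
  · rintro ⟨i, z⟩ ⟨j, z'⟩ h
    have h1 : i = j := congrArg Sigma.fst h
    subst h1
    have h2 : z = z' := by simpa using h
    subst h2; exact .refl _
  · rintro a t ht ⟨i, z⟩ h
    refine ⟨⟨i, (φ i).symm z⟩, by simp, (hφ i a t _).2 (by rw [Homeomorph.apply_symm_apply]; exact h)⟩

def rotH (θ : ℝ) : D ≃ₜ D where
  toFun z := ⟨ee θ * z, by have := mem_closedBall_zero_iff.1 z.2; rw [mem_closedBall_zero_iff]; simpa only [norm_mul, norm_ee, one_mul] using this⟩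
  invFun z := ⟨ee (-θ) * z, by have := mem_closedBall_zero_iff.1 z.2; rw [mem_closedBall_zero_iff]; simpa only [norm_mul, norm_ee, one_mul] using this⟩
  left_inv z := by ext; simp only; rw [← mul_assoc, ← ee_add, neg_add_cancel, ee_zero, one_mul]
  right_inv z := by ext; simp only; rw [← mul_assoc, ← ee_add, add_neg_cancel, ee_zero, one_mul]
  continuous_toFun := by fun_prop
  continuous_invFun := by fun_prop

def conjH : D ≃ₜ D where
  toFun z := ⟨conj z, by have := mem_closedBall_zero_iff.1 z.2; rw [mem_closedBall_zero_iff, norm_conj]; exact this⟩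
  invFun z := ⟨conj z, by have := mem_closedBall_zero_iff.1 z.2; rw [mem_closedBall_zero_iff, norm_conj]; exact this⟩
  left_inv z := by ext; simp
  right_inv z := by ext; simp
  continuous_toFun := by
    fun_prop
  continuous_invFun := by
    fun_prop

theorem deq_of_imp {u v : Word} (φ : D ≃ₜ D) (h : ∀ a t z, On u a t (z : D) → On v a t (φ z))
    (h' : ∀ a t z, On v a t (z : D) → On u a t (φ.symm z)) : Deq u v :=
  ⟨φ, fun a t z => ⟨h a t z, fun k => by simpa using h' a t _ k⟩⟩

theorem deq_rot (u v : Word) : Deq (u ++ v) (v ++ u) := by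
  by_cases hu : u = []
  · subst hu; simpa using Deq.refl _
  have hn : ((u.length : ℝ) + v.length) ≠ 0 := by
    have : 0 < u.length := List.length_pos_iff.2 hu
    positivity
  refine deq_of_imp (rotH (-(u.length / (u.length + v.length)))) ?_ ?_
  · rintro a t z ⟨s, hs, hz⟩
    rw [OnAt_append] at hs
    simp only [List.length_append, Nat.cast_add] at hz
    show On _ a t (ee _ * (z:ℂ))
    rw [hz, ← ee_add]
    rcases hs with hs | hs
    · refine ⟨s + v.length, ?_, ?_⟩
      · rw [OnAt_append]; right; simpa using hs
      · rw [ee_eq]; refine ⟨-1, ?_⟩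
        simp only [List.length_append, Nat.cast_add]; push_cast
        rw [add_comm (v.length : ℝ) u.length]; field_simp; ring
    · refine ⟨s - u.length, ?_, ?_⟩
      · rw [OnAt_append]; left; exact hs
      · congr 1
        simp only [List.length_append, Nat.cast_add]
        rw [add_comm (v.length : ℝ) u.length]; field_simp; ring
  · rintro a t z ⟨s, hs, hz⟩
    rw [OnAt_append] at hs
    simp only [List.length_append, Nat.cast_add] at hz
    show On _ a t (ee (- -_) * (z:ℂ))
    rw [hz, ← ee_add, neg_neg]
    rcases hs with hs | hs
    · refine ⟨s + u.length, ?_, ?_⟩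
      · rw [OnAt_append]; right; simpa using hs
      · congr 1
        simp only [List.length_append, Nat.cast_add]
        rw [add_comm (v.length : ℝ) u.length]; field_simp; ring
    · refine ⟨s - v.length, ?_, ?_⟩
      · rw [OnAt_append]; left; exact hs
      · rw [ee_eq]; refine ⟨1, ?_⟩
        simp only [List.length_append, Nat.cast_add]; push_cast
        rw [add_comm (v.length : ℝ) u.length]; field_simp; ring

theorem deq_inv (u : Word) : Deq u (winv u) := by
  by_cases hu : u = []
  · subst hu; simpa using Deq.refl _
  have hn : (u.length : ℝ) ≠ 0 := by
    simp_all
  have key : ∀ u : Word, (u.length : ℝ) ≠ 0 → ∀ a t (z : D), On u a t z → On (winv u) a t (conj (z:ℂ)) := by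
    rintro u hn a t z ⟨s, hs, hz⟩
    refine ⟨u.length - s, ?_, ?_⟩
    · rw [OnAt_winv]; simpa using hs
    · rw [hz, ← ee_neg, ee_eq]
      refine ⟨-1, ?_⟩
      rw [winv_length]; push_cast; field_simp; ring
  refine deq_of_imp conjH (key u hn) ?_
  intro a t z h
  have := key (winv u) (by simpa using hn) a t z h
  rw [winv_winv] at this
  exact this

/-- relbelling -/
def relb (f : ℕ → ℕ) (g : ℕ → Bool) (u : Word) : Word := u.map fun x => (f x.1, xor x.2 (g x.1))

theorem OnAt_relb (f : ℕ → ℕ) (g : ℕ → Bool) (u : Word) (b : ℕ) (t s : ℝ) :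
    OnAt (relb f g u) b t s ↔ ∃ a, f a = b ∧ OnAt u a (tb (!(g a)) t) s := by
  induction u generalizing s with
  | nil => simp [relb, OnAt]
  | cons x u ih =>
    have : relb f g (x :: u) = (f x.1, xor x.2 (g x.1)) :: relb f g u := rfl
    rw [this, OnAt, ih]
    have h2 : ∀ x y : Bool, tb (xor x y) t = tb x (tb (!y) t) := by
      intro x y; cases x <;> cases y <;> simp [tb]
    constructor
    · rintro (⟨h, h'⟩ | ⟨a, h, h'⟩)
      · exact ⟨x.1, h, Or.inl ⟨rfl, by rw [h', h2]⟩⟩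
      · exact ⟨a, h, Or.inr h'⟩
    · rintro ⟨a, h, ⟨h', h''⟩ | h'⟩ <;> grind

theorem pres_relb {X : Type} [TopologicalSpace X] {ι : Type} (f : ℕ → ℕ) (hf : Injective f) (g : ℕ → Bool)
    (w : ι → Word) : Pres X (fun i => relb f g (w i)) ↔ Pres X w := by
  have hl : ∀ u : Word, (relb f g u).length = u.length := by intro u; simp [relb]
  have : RR (fun i => relb f g (w i)) = RR w := by
    ext p q
    constructor
    · rintro ⟨b, t, ht, ⟨s, hs, e⟩, ⟨s', hs', e'⟩⟩
      obtain ⟨a, ha, h⟩ := (OnAt_relb _ _ _ _ _ _).1 hs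
      obtain ⟨a', ha', h'⟩ := (OnAt_relb _ _ _ _ _ _).1 hs'
      have : a' = a := hf (by rw [ha, ha'])
      subst this
      rw [hl] at e e'
      exact ⟨a', tb (!(g a')) t, tb_mem ht, ⟨s, h, e⟩, ⟨s', h', e'⟩⟩
    · rintro ⟨a, t, ht, ⟨s, hs, e⟩, ⟨s', hs', e'⟩⟩
      have htb : tb (!(g a)) (tb (!(g a)) t) = t := by cases g a <;> simp [tb]
      refine ⟨f a, tb (!(g a)) t, tb_mem ht, ⟨s, ?_, ?_⟩, ⟨s', ?_, ?_⟩⟩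
      · rw [OnAt_relb]; exact ⟨a, rfl, by rw [htb]; exact hs⟩
      · rw [hl]; exact e
      · rw [OnAt_relb]; exact ⟨a, rfl, by rw [htb]; exact hs'⟩
      · rw [hl]; exact e'
  unfold Pres; rw [this]

theorem chord_of {β : ℝ} (hb : 0 < β) (hb1 : β < 1) {z : ℂ} (hz : ‖z‖ ≤ 1)
    (h : (z * ee (-(β / 2))).re = Real.cos (π * β)) :
    ∃ t ∈ Icc (0:ℝ) 1, z = (1 - t : ℝ) * ee β + (t : ℝ) := by
  set c := Real.cos (π * β) with hcd
  set d := Real.sin (π * β) with hdd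
  have hpi := Real.pi_pos
  have hd : 0 < d := Real.sin_pos_of_pos_of_lt_pi (by positivity) (by nlinarith)
  have hcd1 : c ^ 2 + d ^ 2 = 1 := by rw [hcd, hdd]; exact Real.cos_sq_add_sin_sq _
  have hend : ee (β / 2) = ⟨c, d⟩ := by
    apply Complex.ext
    · rw [ee_re, hcd]; congr 1; ring
    · rw [ee_im, hdd]; congr 1; ring
  have hb2 : ee β = ee (β / 2) * ee (β / 2) := by rw [← ee_add]; congr 1; ring
  have hmul : ee (β / 2) * ee (-(β / 2)) = 1 := by rw [← ee_add, add_neg_cancel, ee_zero]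
  set x := z * ee (-(β / 2)) with hx
  have hzx : z = ee (β / 2) * x := by rw [hx]; linear_combination (-z) * hmul
  have hxn : ‖x‖ ≤ 1 := by rw [hx, norm_mul, norm_ee, mul_one]; exact hz
  have e := re_sq_add_im_sq x
  have : x.im ^ 2 ≤ d ^ 2 := by rw [h] at e; nlinarith [norm_nonneg x]
  have hab := abs_le_of_sq_le_sq this hd.le
  rw [abs_le] at hab
  refine ⟨(d - x.im) / (2 * d), ⟨by apply div_nonneg <;> linarith, by rw [div_le_one (by positivity)]; linarith⟩, ?_⟩
  have hxe : x = ⟨c, (1 - 2 * ((d - x.im) / (2 * d))) * d⟩ := by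
    apply Complex.ext
    · exact h
    · simp only; field_simp; ring
  generalize (d - x.im) / (2 * d) = q at *
  rw [hzx, hb2, hxe, hend]
  apply Complex.ext
  · simp
    linear_combination q * hcd1
  · simp
    ring

theorem cutmaps {m p : ℝ} (hm : 0 < m) (hp : 0 < p) : ∃ Φ1 Φ2 : ℂ → ℂ,
    ContinuousOn Φ1 (closedBall 0 1) ∧ ContinuousOn Φ2 (closedBall 0 1) ∧
    InjOn Φ1 (closedBall 0 1) ∧ InjOn Φ2 (closedBall 0 1) ∧
    Φ1 '' closedBall 0 1 ∪ Φ2 '' closedBall 0 1 = closedBall 0 1 ∧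
    (∀ s ∈ Icc 0 m, Φ1 (ee (s / (m + 1))) = ee (s / (m + p))) ∧
    (∀ s ∈ Icc 0 p, Φ2 (ee (s / (p + 1))) = ee ((m + s) / (m + p))) ∧
    (∀ t ∈ Icc (0:ℝ) 1, Φ1 (ee ((m + t) / (m + 1))) = Φ2 (ee ((p + (1 - t)) / (p + 1)))) ∧
    (∀ x ∈ closedBall 0 1, ∀ y ∈ closedBall 0 1, Φ1 x = Φ2 y →
      ∃ t ∈ Icc (0:ℝ) 1, x = ee ((m + t) / (m + 1)) ∧ y = ee ((p + (1 - t)) / (p + 1))) := by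
  set β := m / (m + p) with hβ
  have hb : 0 < β := by positivity
  have hb1 : β < 1 := by rw [hβ, div_lt_one (by positivity)]; linarith
  obtain ⟨Φ, c1, i1, m1, a1, b1⟩ := seg hm one_pos hb hb1
  obtain ⟨Ψ, c2, i2, m2, a2, b2⟩ := seg (β := 1 - β) hp one_pos (by linarith) (by linarith)
  have hrot : ∀ z : ℂ, (ee (-β) * z * ee (-((1 - β) / 2))).re = -(z * ee (-(β / 2))).re := by
    intro z
    have : ee (-β) * ee (-((1 - β) / 2)) = - ee (-(β/2)) := by
      rw [← ee_add, show -β + -((1 - β) / 2) = -(1/2) + -(β/2) by ring, ee_add, ee_neg, ee_half]; simp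
    rw [mul_right_comm, this]; simp [mul_comm]
  have hcos : Real.cos (π * (1 - β)) = - Real.cos (π * β) := by
    rw [← Real.cos_pi_sub]; congr 1; ring
  have hmul : ee β * ee (-β) = 1 := by rw [← ee_add, add_neg_cancel, ee_zero]
  have hPsi : ∀ y ∈ closedBall (0:ℂ) 1, (ee β * Ψ y * ee (-(β / 2))).re ≤ Real.cos (π * β) := by
    intro y hy
    have : Ψ y ∈ Ψ '' closedBall 0 1 := mem_image_of_mem _ hy
    rw [m2] at this
    have h2 := this.2
    rw [hcos] at h2
    have h3 := hrot (ee β * Ψ y)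
    grind
  have hn1 : ∀ x ∈ closedBall (0:ℂ) 1, ‖Φ x‖ ≤ 1 := by
    intro x hx
    have : Φ x ∈ Φ '' closedBall 0 1 := mem_image_of_mem _ hx
    rw [m1] at this; exact this.1
  have hn2 : ∀ x ∈ closedBall (0:ℂ) 1, ‖Ψ x‖ ≤ 1 := by
    intro x hx
    have : Ψ x ∈ Ψ '' closedBall 0 1 := mem_image_of_mem _ hx
    rw [m2] at this; exact this.1
  have hb' : ∀ t ∈ Icc (0:ℝ) 1, ee β * Ψ (ee ((p + (1 - t)) / (p + 1))) = (1 - t : ℝ) * ee β + (t : ℝ) := by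
    intro t ht
    rw [b2 (1 - t) ⟨by linarith [ht.2], by linarith [ht.1]⟩]
    have : ee β * ee (1 - β) = 1 := by rw [← ee_add]; simp [ee_one]
    grind
  have hb1' : ∀ t ∈ Icc (0:ℝ) 1, Φ (ee ((m + t) / (m + 1))) = (1 - t : ℝ) * ee β + (t : ℝ) := by
    intro t ht
    rw [b1 t ht]; simp
  refine ⟨Φ, fun z => ee β * Ψ z, c1, continuousOn_const.mul c2, i1,
    fun x hx y hy e => i2 hx hy (mul_left_cancel₀ (ee_ne _) e), ?_, ?_, ?_, ?_, ?_⟩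
  · apply subset_antisymm
    · rintro z (⟨x, hx, rfl⟩ | ⟨x, hx, rfl⟩)
      · simpa using hn1 x hx
      · simpa [norm_ee] using hn2 x hx
    · intro z hz
      have hz : ‖z‖ ≤ 1 := by simpa using hz
      rcases le_total (Real.cos (π * β)) (z * ee (-(β / 2))).re with h | h
      · left; rw [m1]; exact ⟨hz, h⟩
      · right
        have : ee (-β) * z ∈ Ψ '' closedBall 0 1 := by
          rw [m2]; refine ⟨by simpa [norm_ee] using hz, ?_⟩
          rw [hrot, hcos]; linarith
        grind
  · intro s hs
    rw [a1 s hs, hβ]; congr 1; field_simp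
  · intro s hs
    simp only
    rw [a2 s hs, ← ee_add, hβ]; congr 1; field_simp; ring
  · intro t ht
    simp only
    rw [hb' t ht, hb1' t ht]
  · intro x hx y hy e
    simp only at e
    have h1 : Φ x ∈ Φ '' closedBall 0 1 := mem_image_of_mem _ hx
    rw [m1] at h1
    have h2 := hPsi y hy
    rw [← e] at h2
    obtain ⟨t, ht, h3⟩ := chord_of hb hb1 h1.1 (le_antisymm h2 h1.2)
    refine ⟨t, ht, i1 hx (hmemee _) (by rw [h3, hb1' t ht]), i2 hy (hmemee _) ?_⟩
    grind

theorem cancelmap {m : ℝ} (hm : 0 < m) : ∃ Φ : ℂ → ℂ, ContinuousOn Φ (closedBall 0 1) ∧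
    Φ '' closedBall 0 1 = closedBall 0 1 ∧
    (∀ s ∈ Icc 0 m, Φ (ee (s / (m + 2))) = ee (s / m)) ∧
    (∀ t ∈ Icc (0:ℝ) 2, Φ (ee ((m + t) / (m + 2))) = (t - 1) ^ 2) ∧
    (∀ x ∈ closedBall 0 1, ∀ y ∈ closedBall 0 1, Φ x = Φ y → x = y ∨
      ∃ t ∈ Icc (0:ℝ) 2, x = ee ((m + t) / (m + 2)) ∧ y = ee ((m + (2 - t)) / (m + 2))) := by
  obtain ⟨Φ, c1, i1, m1, a1, b1⟩ := seg (β := 1/2) hm two_pos (by norm_num) (by norm_num)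
  have hq : ee (-(1 / 2 / 2)) = -I := by
    apply Complex.ext
    · rw [ee_re, show 2 * π * -(1/2/2) = -(π / 2) by ring]; simp
    · rw [ee_im, show 2 * π * -(1/2/2) = -(π / 2) by ring]; simp
  have hset : {z : ℂ | ‖z‖ ≤ 1 ∧ Real.cos (π * (1/2)) ≤ (z * ee (-(1 / 2 / 2))).re} =
      {z : ℂ | ‖z‖ ≤ 1 ∧ 0 ≤ z.im} := by
    ext z
    rw [hq, show π * (1/2) = π / 2 by ring]; simp
  rw [hset] at m1
  have hm1 : ∀ x ∈ closedBall (0:ℂ) 1, ‖Φ x‖ ≤ 1 ∧ 0 ≤ (Φ x).im := by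
    intro x hx
    have : Φ x ∈ Φ '' closedBall 0 1 := mem_image_of_mem _ hx
    rw [m1] at this; exact this
  have hb1 : ∀ t ∈ Icc (0:ℝ) 2, Φ (ee ((m + t) / (m + 2))) = t - 1 := by
    intro t ht
    rw [b1 t ht, ee_half]; push_cast; ring
  refine ⟨fun z => Φ z ^ 2, c1.pow 2, ?_, ?_, ?_, ?_⟩
  · apply subset_antisymm
    · rintro z ⟨x, hx, rfl⟩
      simp only [mem_closedBall_zero_iff, norm_pow]
      exact pow_le_one₀ (norm_nonneg _) (hm1 x hx).1
    · intro z hz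
      have hz : ‖z‖ ≤ 1 := by simpa using hz
      obtain ⟨r, hr⟩ : ∃ r : ℂ, r ^ 2 = z := ⟨z ^ (1/2:ℂ), by simp⟩
      have hrn : ‖r‖ ≤ 1 := by
        have : ‖r‖ ^ 2 ≤ 1 := by rw [← norm_pow, hr]; exact hz
        exact (sq_le_one_iff₀ (norm_nonneg _)).1 this
      obtain ⟨r', hr', h1, h2⟩ : ∃ r' : ℂ, r' ^ 2 = z ∧ ‖r'‖ ≤ 1 ∧ 0 ≤ r'.im := by
        rcases le_total 0 r.im with h | h
        · exact ⟨r, hr, hrn, h⟩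
        · exact ⟨-r, by rw [neg_sq, hr], by rwa [norm_neg], by simpa using h⟩
      have : r' ∈ Φ '' closedBall 0 1 := by rw [m1]; exact ⟨h1, h2⟩
      grind
  · intro s hs
    simp only
    rw [a1 s hs, sq, ← ee_add]; congr 1; ring
  · intro t ht
    simp only
    rw [hb1 t ht]
  · intro x hx y hy e
    simp only at e
    rcases sq_eq_sq_iff_eq_or_eq_neg.1 e with h | h
    · exact Or.inl (i1 hx hy h)
    · right
      have h1 := hm1 x hx
      have h2 := hm1 y hy
      have h3 : (Φ x).im = 0 := by
        have := congrArg im h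
        simp only [neg_im] at this
        linarith [h1.2, h2.2]
      have h4 : Φ x = ((Φ x).re : ℂ) := Complex.ext rfl (by rw [h3]; simp)
      have h5 : |(Φ x).re| ≤ 1 := (abs_re_le_norm _).trans h1.1
      rw [abs_le] at h5
      refine ⟨1 + (Φ x).re, ⟨by linarith, by linarith⟩, i1 hx (hmemee _) ?_, i1 hy (hmemee _) ?_⟩
      · rw [hb1 _ ⟨by linarith, by linarith⟩]; push_cast; rw [← h4]; ring
      · rw [hb1 _ ⟨by linarith, by linarith⟩]; push_cast; rw [← h4, h]; ring

def lab (u : Word) : List ℕ := u.map Prod.fst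

@[simp] theorem lab_append (u v : Word) : lab (u ++ v) = lab u ++ lab v := by simp [lab]
@[simp] theorem lab_cons (x : ℕ × Bool) (v : Word) : lab (x :: v) = x.1 :: lab v := by simp [lab]
@[simp] theorem lab_nil : lab [] = [] := rfl
@[simp] theorem mem_lab_winv {c : ℕ} (u : Word) : c ∈ lab (winv u) ↔ c ∈ lab u := by
  induction u with
  | nil => simp
  | cons x u ih => simp [ih, or_comm]

def fam {κ : Type} (x : Word) (w : κ → Word) : Option κ → Word
  | none => x
  | some k => w k

theorem pres_cut {X : Type} [TopologicalSpace X] {κ : Type} [Finite κ] {u v : Word} {w : κ → Word} {c : ℕ}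
    (hu : u ≠ []) (hv : v ≠ []) (hcu : c ∉ lab u) (hcv : c ∉ lab v) (hcw : ∀ k, c ∉ lab (w k)) :
    Pres X (fam (u ++ [(c, true)]) (fam (v ++ [(c, false)]) w)) ↔ Pres X (fam (u ++ v) w) := by
  have hm : (0:ℝ) < u.length := by exact_mod_cast List.length_pos_iff.2 hu
  have hp : (0:ℝ) < v.length := by exact_mod_cast List.length_pos_iff.2 hv
  obtain ⟨Φ1, Φ2, c1, c2, i1, i2, him, a1, a2, hch, hch'⟩ := cutmaps hm hp
  let F1 : D → D := fun z => ⟨Φ1 z, him.subset <| by exact Or.inl (mem_image_of_mem _ z.2)⟩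
  let F2 : D → D := fun z => ⟨Φ2 z, him.subset <| by exact Or.inr (mem_image_of_mem _ z.2)⟩
  have hF1 : Continuous F1 := (continuousOn_iff_continuous_domRestrict.1 c1).subtype_mk _
  have hF2 : Continuous F2 := (continuousOn_iff_continuous_domRestrict.1 c2).subtype_mk _
  let Φ : (Σ _ : Option (Option κ), D) → Σ _ : Option κ, D := fun x => match x with
    | ⟨none, z⟩ => ⟨none, F1 z⟩
    | ⟨some none, z⟩ => ⟨none, F2 z⟩
    | ⟨some (some k), z⟩ => ⟨some k, z⟩
  have onu : ∀ a t z, On (u ++ [(c, true)]) a t z → (a ≠ c ∧ ∃ s, OnAt u a t s ∧ z = ee (s / (u.length + 1))) ∨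
      (a = c ∧ z = ee ((u.length + t) / (u.length + 1))) := by
    rintro a t z ⟨s, hs, rfl⟩
    simp only [OnAt_append, OnAt_single, List.length_append, List.length_singleton, Nat.cast_add, Nat.cast_one] at hs ⊢
    rcases hs with hs | ⟨h1, h2⟩
    · left; exact ⟨fun h => hcu (h ▸ hs.mem), s, hs, rfl⟩
    · right; refine ⟨h1.symm, ?_⟩
      simp only [tb] at h2
      congr 2; simp at h2; linarith
  have onv : ∀ a t z, On (v ++ [(c, false)]) a t z → (a ≠ c ∧ ∃ s, OnAt v a t s ∧ z = ee (s / (v.length + 1))) ∨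
      (a = c ∧ z = ee ((v.length + (1 - t)) / (v.length + 1))) := by
    rintro a t z ⟨s, hs, rfl⟩
    simp only [OnAt_append, OnAt_single, List.length_append, List.length_singleton, Nat.cast_add, Nat.cast_one] at hs ⊢
    rcases hs with hs | ⟨h1, h2⟩
    · left; exact ⟨fun h => hcv (h ▸ hs.mem), s, hs, rfl⟩
    · right; refine ⟨h1.symm, ?_⟩
      simp only [tb] at h2
      congr 2; simp at h2; linarith
  have hrel : ∀ x y : D, F1 x = F2 y → RR (fam (u ++ [(c, true)]) (fam (v ++ [(c, false)]) w))
      ⟨none, x⟩ ⟨some none, y⟩ := by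
    intro x y e
    obtain ⟨t, ht, e1, e2⟩ := hch' x x.2 y y.2 (congrArg Subtype.val e)
    refine ⟨c, t, ht, ⟨u.length + t, ?_, ?_⟩, ⟨v.length + (1 - t), ?_, ?_⟩⟩
    · show OnAt (u ++ [(c, true)]) c t _
      rw [OnAt_append, OnAt_single]; right; simp [tb]
    · simp only [fam]; rw [e1]; simp
    · show OnAt (v ++ [(c, false)]) c t _
      rw [OnAt_append, OnAt_single]; right; simp [tb]
    · simp only [fam]; rw [e2]; simp
  refine pres_move (fun a => a = c) Φ ?_ ?_ ?_ ?_ ?_ ?_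
  · refine continuous_sigma fun i => ?_
    match i with
    | none => exact (continuous_sigmaMk (σ := fun _ : Option κ => D)).comp hF1
    | some none => exact (continuous_sigmaMk (σ := fun _ : Option κ => D)).comp hF2
    | some (some k) => exact continuous_sigmaMk (σ := fun _ : Option κ => D) (i := some k)
  · rintro ⟨_ | k, z⟩
    · have hz := him.superset z.2
      rcases hz with ⟨x, hx, e⟩ | ⟨x, hx, e⟩
      · exact ⟨⟨none, ⟨x, hx⟩⟩, by simp only [Φ]; congr 1; exact Subtype.ext e⟩
      · exact ⟨⟨some none, ⟨x, hx⟩⟩, by simp only [Φ]; congr 1; exact Subtype.ext e⟩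
    · exact ⟨⟨some (some k), z⟩, rfl⟩
  · rintro a ha t ht ⟨_ | _ | k, z⟩ hx
    · rcases onu a t z hx with ⟨_, s, hs, e⟩ | h
      · refine ⟨s, ?_, ?_⟩
        · show OnAt (u ++ v) a t s
          rw [OnAt_append]; exact Or.inl hs
        · simp only [Φ, F1, fam]; rw [e, a1 s (hs.range ht)]; simp
      · exact absurd h.1 ha
    · rcases onv a t z hx with ⟨_, s, hs, e⟩ | h
      · refine ⟨u.length + s, ?_, ?_⟩
        · show OnAt (u ++ v) a t _
          rw [OnAt_append]; right; simpa using hs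
        · simp only [Φ, F2, fam]; rw [e, a2 s (hs.range ht)]; simp
      · exact absurd h.1 ha
    · exact hx
  · intro a ha t ht
    have claim : ∀ x, OnP (fam (u ++ [(c, true)]) (fam (v ++ [(c, false)]) w)) a t x →
        Φ x = ⟨none, F1 ⟨_, hmemee ((u.length + t) / (u.length + 1))⟩⟩ := by
      rintro ⟨_ | _ | k, z⟩ hx
      · rcases onu a t z hx with h | h <;> grind
      · rcases onv a t z hx with h | h <;> grind
      · obtain ⟨s, hs, _⟩ := hx
        exact absurd (ha ▸ hs.mem) (hcw k)
    intro x y hx hy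
    rw [claim x hx, claim y hy]
  · have inj1 : ∀ x y : D, F1 x = F1 y → x = y := fun x y e => Subtype.ext (i1 x.2 y.2 (congrArg Subtype.val e))
    have inj2 : ∀ x y : D, F2 x = F2 y → x = y := fun x y e => Subtype.ext (i2 x.2 y.2 (congrArg Subtype.val e))
    rintro ⟨_ | _ | k, z⟩ ⟨_ | _ | k', z'⟩ e <;> simp only [Φ, Sigma.mk.injEq, heq_eq_eq, true_and, Option.some.injEq, reduceCtorEq, false_and] at e
    · rw [inj1 _ _ e]; exact .refl _
    · exact .rel _ _ (hrel _ _ e)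
    · exact .symm _ _ (.rel _ _ (hrel _ _ e.symm))
    · rw [inj2 _ _ e]; exact .refl _
    · rw [e.1, e.2]; exact .refl _
  · rintro a t ht ⟨_ | k, z⟩ hp
    · obtain ⟨s, hs, e⟩ := hp
      have hs : OnAt (u ++ v) a t s := hs
      rw [OnAt_append] at hs
      simp only [fam, List.length_append, Nat.cast_add] at e
      rcases hs with hs | hs
      · refine ⟨⟨none, ⟨_, hmemee (s / (u.length + 1))⟩⟩, ?_, s, ?_, ?_⟩
        · simp only [Φ]; congr 1; apply Subtype.ext; simp only [F1]; rw [a1 s (hs.range ht), e]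
        · show OnAt (u ++ [(c, true)]) a t s
          rw [OnAt_append]; exact Or.inl hs
        · simp [fam]
      · refine ⟨⟨some none, ⟨_, hmemee ((s - u.length) / (v.length + 1))⟩⟩, ?_, s - u.length, ?_, ?_⟩
        · simp only [Φ]; congr 1; apply Subtype.ext; simp only [F2]; rw [a2 _ (hs.range ht), e]; congr 2; ring
        · show OnAt (v ++ [(c, false)]) a t _
          rw [OnAt_append]; exact Or.inl hs
        · simp [fam]
    · exact ⟨⟨some (some k), z⟩, rfl, hp⟩

theorem pres_cancel {X : Type} [TopologicalSpace X] {κ : Type} [Finite κ] {u : Word} {w : κ → Word} {c : ℕ}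
    (hu : u ≠ []) (hcu : c ∉ lab u) (hcw : ∀ k, c ∉ lab (w k)) :
    Pres X (fam (u ++ [(c, true), (c, false)]) w) ↔ Pres X (fam u w) := by
  have hm : (0:ℝ) < u.length := by exact_mod_cast List.length_pos_iff.2 hu
  obtain ⟨Φ1, c1, him, a1, b1, hch⟩ := cancelmap hm
  let F1 : D → D := fun z => ⟨Φ1 z, him.subset <| by exact mem_image_of_mem _ z.2⟩
  have hF1 : Continuous F1 := (continuousOn_iff_continuous_domRestrict.1 c1).subtype_mk _
  let Φ : (Σ _ : Option κ, D) → Σ _ : Option κ, D := fun x => match x with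
    | ⟨none, z⟩ => ⟨none, F1 z⟩
    | ⟨some k, z⟩ => ⟨some k, z⟩
  have hon : ∀ a t s, OnAt (u ++ [(c, true), (c, false)]) a t s ↔ OnAt u a t s ∨ (a = c ∧
      (s = u.length + t ∨ s = u.length + (2 - t))) := by
    intro a t s
    simp only [OnAt_append, OnAt, tb, or_false]
    refine or_congr Iff.rfl ?_
    constructor
    · rintro (⟨h1, h2⟩ | ⟨h1, h2⟩) <;> grind
    · grind
  have hlen : (((u ++ [(c, true), (c, false)]).length : ℕ) : ℝ) = u.length + 2 := by simp
  have onu : ∀ a t z, On (u ++ [(c, true), (c, false)]) a t z →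
      (a ≠ c ∧ ∃ s, OnAt u a t s ∧ z = ee (s / (u.length + 2))) ∨
      (a = c ∧ (z = ee ((u.length + t) / (u.length + 2)) ∨ z = ee ((u.length + (2 - t)) / (u.length + 2)))) := by
    rintro a t z ⟨s, hs, rfl⟩
    rw [hlen]
    rcases (hon a t s).1 hs with hs | ⟨h1, h2⟩
    · left; exact ⟨fun h => hcu (h ▸ hs.mem), s, hs, rfl⟩
    · grind
  refine pres_move (fun a => a = c) Φ ?_ ?_ ?_ ?_ ?_ ?_
  · refine continuous_sigma fun i => ?_
    match i with
    | none => exact (continuous_sigmaMk (σ := fun _ : Option κ => D)).comp hF1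
    | some k => exact continuous_sigmaMk (σ := fun _ : Option κ => D) (i := some k)
  · rintro ⟨_ | k, z⟩
    · have hz := him.superset z.2
      obtain ⟨x, hx, e⟩ := hz
      exact ⟨⟨none, ⟨x, hx⟩⟩, by simp only [Φ]; congr 1; exact Subtype.ext e⟩
    · exact ⟨⟨some k, z⟩, rfl⟩
  · rintro a ha t ht ⟨_ | k, z⟩ hx
    · rcases onu a t z hx with ⟨_, s, hs, e⟩ | h
      · refine ⟨s, hs, ?_⟩
        simp only [Φ, F1, fam]; rw [e, a1 s (hs.range ht)]
      · exact absurd h.1 ha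
    · exact hx
  · intro a ha t ht
    have claim : ∀ x, OnP (fam (u ++ [(c, true), (c, false)]) w) a t x →
        Φ x = ⟨none, F1 ⟨_, hmemee ((u.length + t) / (u.length + 2))⟩⟩ := by
      have ht2 : t ∈ Icc (0:ℝ) 2 := ⟨ht.1, by linarith [ht.2]⟩
      have ht2' : 2 - t ∈ Icc (0:ℝ) 2 := ⟨by linarith [ht.2], by linarith [ht.1]⟩
      rintro ⟨_ | k, z⟩ hx
      · rcases onu a t z hx with h | ⟨_, h | h⟩
        · exact absurd ha h.1
        · simp only [Φ]; congr 1; exact congrArg F1 (Subtype.ext h)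
        · simp only [Φ]; congr 1; apply Subtype.ext
          simp only [F1]; rw [h, b1 _ ht2, b1 _ ht2']; push_cast; ring
      · obtain ⟨s, hs, _⟩ := hx
        exact absurd (ha ▸ hs.mem) (hcw k)
    intro x y hx hy
    rw [claim x hx, claim y hy]
  · have honc : ∀ (t : ℝ) (z : D), (z:ℂ) = ee ((u.length + t) / (u.length + 2)) →
        OnP (fam (u ++ [(c, true), (c, false)]) w) c t ⟨none, z⟩ := by
      intro t z h
      refine ⟨u.length + t, (hon _ _ _).2 (Or.inr ⟨rfl, Or.inl rfl⟩), ?_⟩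
      simp only [fam]; rw [hlen, h]
    have honc' : ∀ (t : ℝ) (z : D), (z:ℂ) = ee ((u.length + (2 - t)) / (u.length + 2)) →
        OnP (fam (u ++ [(c, true), (c, false)]) w) c t ⟨none, z⟩ := by
      intro t z h
      refine ⟨u.length + (2 - t), (hon _ _ _).2 (Or.inr ⟨rfl, Or.inr rfl⟩), ?_⟩
      simp only [fam]; rw [hlen, h]
    rintro ⟨_ | k, z⟩ ⟨_ | k', z'⟩ e <;> simp only [Φ, Sigma.mk.injEq, heq_eq_eq, true_and, Option.some.injEq, reduceCtorEq, false_and] at e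
    · rcases hch z z.2 z' z'.2 (congrArg Subtype.val e) with h | ⟨t, ht, h1, h2⟩
      · rw [Subtype.ext h]; exact .refl _
      · rcases le_total t 1 with h | h
        · exact .rel _ _ ⟨c, t, ⟨ht.1, h⟩, honc t z h1, honc' t z' h2⟩
        · refine .rel _ _ ⟨c, 2 - t, ⟨by linarith [ht.2], by linarith⟩, honc' (2 - t) z ?_, honc (2 - t) z' h2⟩
          rw [h1]; congr 2; ring
    · rw [e.1, e.2]; exact .refl _
  · rintro a t ht ⟨_ | k, z⟩ hp
    · obtain ⟨s, hs, e⟩ := hp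
      have hs : OnAt u a t s := hs
      simp only [fam] at e
      refine ⟨⟨none, ⟨_, hmemee (s / (u.length + 2))⟩⟩, ?_, s, (hon _ _ _).2 (Or.inl hs), ?_⟩
      · simp only [Φ]; congr 1; apply Subtype.ext; simp only [F1]; rw [a1 s (hs.range ht), e]
      · simp only [fam]; rw [hlen]
    · exact ⟨⟨some k, z⟩, rfl, hp⟩

/-- one-polygon presentations -/
def W1 (X : Type) [TopologicalSpace X] (u : Word) : Prop := Pres X (fam u (Empty.elim : Empty → Word))

def Eqw (u v : Word) : Prop := ∀ (X : Type) [TopologicalSpace X], W1 X u ↔ W1 X v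

theorem Eqw.refl (u : Word) : Eqw u u := fun _ _ => Iff.rfl
theorem Eqw.symm {u v : Word} (h : Eqw u v) : Eqw v u := fun X _ => (h X).symm
theorem Eqw.trans {u v w : Word} (h : Eqw u v) (h' : Eqw v w) : Eqw u w := fun X _ => (h X).trans (h' X)
instance : Trans Eqw Eqw Eqw := ⟨Eqw.trans⟩

theorem Eqw.deq {u v : Word} (h : Deq u v) : Eqw u v := by
  intro X _
  refine pres_deq fun i => ?_
  match i with
  | none => exact h
  | some k => exact k.elim

theorem Eqw.rot (u v : Word) : Eqw (u ++ v) (v ++ u) := .deq (deq_rot u v)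
theorem Eqw.inv (u : Word) : Eqw u (winv u) := .deq (deq_inv u)

theorem Eqw.relb (f : ℕ → ℕ) (hf : Injective f) (g : ℕ → Bool) (u : Word) : Eqw u (relb f g u) := by
  intro X _
  have := pres_relb (X := X) f hf g (fam u (Empty.elim : Empty → Word))
  unfold W1
  rw [← this]
  have e : (fun i => CS.relb f g (fam u (Empty.elim : Empty → Word) i)) = fam (CS.relb f g u) Empty.elim := by
    funext i
    match i with
    | none => rfl
    | some k => exact k.elim
  rw [e]

theorem relb_append (f : ℕ → ℕ) (g : ℕ → Bool) (u v : Word) : relb f g (u ++ v) = relb f g u ++ relb f g v := by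
  simp [relb]
theorem relb_cons (f : ℕ → ℕ) (g : ℕ → Bool) (x : ℕ × Bool) (v : Word) :
    relb f g (x :: v) = (f x.1, xor x.2 (g x.1)) :: relb f g v := by
  simp [relb]
theorem relb_id {f : ℕ → ℕ} {g : ℕ → Bool} {u : Word} (h : ∀ a ∈ lab u, f a = a ∧ g a = false) : relb f g u = u := by
  induction u with
  | nil => rfl
  | cons x u ih =>
    rw [relb_cons, ih (fun a ha => h a (by simp [ha]))]
    have := h x.1 (by simp)
    rw [this.1, this.2]; simp

/-- rename `c` to `a` flipping so that `(c,true)` becomes `(a,b)`. -/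
theorem rename_exists (a c : ℕ) (b : Bool) : ∃ f : ℕ → ℕ, ∃ g : ℕ → Bool, Injective f ∧
    (f c = a ∧ xor true (g c) = b ∧ xor false (g c) = !b) ∧ ∀ u : Word, a ∉ lab u → c ∉ lab u → relb f g u = u := by
  refine ⟨Equiv.swap a c, fun x => if x = c then !b else false, (Equiv.swap a c).injective, ⟨by simp, by simp, by simp⟩, ?_⟩
  intro u ha hc
  apply relb_id
  intro d hd
  have h1 : d ≠ a := fun h => ha (h ▸ hd)
  have h2 : d ≠ c := fun h => hc (h ▸ hd)
  exact ⟨Equiv.swap_apply_of_ne_of_ne h1 h2, by simp [h2]⟩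

theorem flip_eqw (a : ℕ) : ∃ g : ℕ → Bool, g a = true ∧ (∀ u : Word, Eqw u (relb id g u)) ∧
    ∀ u : Word, a ∉ lab u → relb id g u = u := by
  refine ⟨fun x => decide (x = a), by simp, fun u => Eqw.relb id injective_id _ u, ?_⟩
  intro u ha
  apply relb_id
  intro d hd
  have h1 : d ≠ a := fun h => ha (h ▸ hd)
  simp [h1]

theorem exists_fresh (u : Word) : ∃ c, c ∉ lab u := by
  obtain ⟨c, hc⟩ := Infinite.exists_notMem_finset (lab u).toFinset
  exact ⟨c, by simpa using hc⟩

theorem Eqw.cancel {u : Word} {x : ℕ × Bool} (hu : u ≠ []) (hx : x.1 ∉ lab u) : Eqw (u ++ [x, flipL x]) u := by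
  obtain ⟨a, b⟩ := x
  have key : Eqw (u ++ [(a, true), (a, false)]) u := fun X _ => pres_cancel hu hx (fun k => k.elim)
  cases b with
  | true => exact key
  | false =>
    obtain ⟨g, hg, h1, h2⟩ := flip_eqw a
    refine Eqw.trans (h1 _) ?_
    rw [relb_append, h2 u hx]
    simpa [CS.relb, hg, flipL] using key

theorem pres_swap {X : Type} [TopologicalSpace X] (u v : Word) :
    Pres X (fam u (fam v (Empty.elim : Empty → Word))) ↔ Pres X (fam v (fam u (Empty.elim : Empty → Word))) := by
  rw [← pres_reindex (Equiv.swap none (some none))]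
  have : (fun i => fam u (fam v (Empty.elim : Empty → Word)) (Equiv.swap none (some none) i)) =
      fam v (fam u (Empty.elim : Empty → Word)) := by
    funext i
    match i with
    | none => simp [fam]
    | some none => simp [fam]
    | some (some k) => exact k.elim
  rw [this]

theorem Eqw.cutpaste {u v u' v' : Word} {c d : ℕ} {b : Bool} (hu : u ≠ []) (hv : v ≠ []) (hu' : u' ≠ []) (hv' : v' ≠ [])
    (hcu : c ∉ lab u) (hcv : c ∉ lab v) (hdu : d ∉ lab u') (hdv : d ∉ lab v')
    (h1 : Deq (u ++ [(c, true)]) (u' ++ [(d, b)])) (h2 : Deq (v ++ [(c, false)]) (v' ++ [(d, !b)])) :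
    Eqw (u ++ v) (u' ++ v') := by
  intro X _
  have s1 := pres_cut (X := X) (w := (Empty.elim : Empty → Word)) hu hv hcu hcv (fun k => k.elim)
  have s2 : Pres X (fam (u ++ [(c, true)]) (fam (v ++ [(c, false)]) (Empty.elim : Empty → Word))) ↔
      Pres X (fam (u' ++ [(d, b)]) (fam (v' ++ [(d, !b)]) (Empty.elim : Empty → Word))) := by
    refine pres_deq fun i => ?_
    match i with
    | none => exact h1
    | some none => exact h2
    | some (some k) => exact k.elim
  unfold W1
  rw [← s1, s2]
  cases b with
  | true => exact pres_cut (X := X) (w := (Empty.elim : Empty → Word)) hu' hv' hdu hdv (fun k => k.elim)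
  | false =>
    rw [pres_swap]
    rw [show (!false) = true from rfl, pres_cut (X := X) (w := (Empty.elim : Empty → Word)) hv' hu' hdv hdu (fun k => k.elim)]
    exact Eqw.rot v' u' X

theorem deq_rot' {w u v : Word} (h : w = u ++ v) : Deq w (v ++ u) := h ▸ deq_rot u v
theorem Eqw.rot' {w u v : Word} (h : w = u ++ v) : Eqw w (v ++ u) := h ▸ Eqw.rot u v
theorem Eqw.of_eq {w u : Word} (h : w = u) : Eqw w u := h ▸ Eqw.refl _

theorem ruleA (x : ℕ × Bool) {M N L : Word} (hM : x.1 ∉ lab M) (hN : x.1 ∉ lab N) (hL : x.1 ∉ lab L) :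
    Eqw (x :: (M ++ N ++ flipL x :: L)) (x :: (N ++ M ++ flipL x :: L)) := by
  obtain ⟨c, hc⟩ := exists_fresh (x :: (M ++ N ++ L))
  simp only [lab_cons, lab_append, List.mem_cons, List.mem_append, not_or] at hc
  obtain ⟨h0, ⟨h1, h2⟩, h3⟩ := hc
  obtain ⟨a, b⟩ := x
  simp only at *
  have s1 : Eqw ((a, b) :: (M ++ N ++ flipL (a, b) :: L)) ((N ++ [(a, !b)]) ++ (L ++ (a, b) :: M)) := by
    refine (Eqw.rot' (u := (a, b) :: M) (v := N ++ (a, !b) :: L) (by simp)).trans (Eqw.of_eq (by simp))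
  have s2 : Eqw ((N ++ [(a, !b)]) ++ (L ++ (a, b) :: M)) (((c, true) :: N) ++ (M ++ (c, false) :: L)) := by
    refine Eqw.cutpaste (c := c) (d := a) (b := !b) (by simp) (by simp) (by simp) (by simp) ?_ ?_ ?_ ?_ ?_ ?_
    · simp [h2, h0]
    · simp [h3, h0, h1]
    · simp [hN, Ne.symm h0]
    · simp [hM, hL, Ne.symm h0]
    · refine (deq_rot (N ++ [(a, !b)]) [(c, true)]).trans ?_
      simpa using Deq.refl _
    · refine (deq_rot' (u := L ++ [(a, b)]) (v := M ++ [(c, false)]) (by simp)).trans ?_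
      simpa using Deq.refl _
  obtain ⟨f, g, hf, ⟨e1, e2, e3⟩, hid⟩ := rename_exists a c b
  have s3 := Eqw.relb f hf g (((c, true) :: N) ++ (M ++ (c, false) :: L))
  rw [relb_append, relb_cons, relb_append, relb_cons, hid N hN h2, hid M hM h1, hid L hL h3] at s3
  simp only at s3
  rw [e1, e2, e3] at s3
  refine s1.trans (s2.trans (s3.trans (Eqw.of_eq (by simp))))

theorem ruleB (x : ℕ × Bool) {M N K L : Word} (hM : x.1 ∉ lab M) (hN : x.1 ∉ lab N) (hK : x.1 ∉ lab K) (hL : x.1 ∉ lab L) :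
    Eqw (x :: (M ++ N ++ x :: (K ++ L))) (x :: (N ++ winv L ++ x :: (winv M ++ K))) := by
  obtain ⟨c, hc⟩ := exists_fresh (x :: (M ++ N ++ K ++ L))
  simp only [lab_cons, lab_append, List.mem_cons, List.mem_append, not_or] at hc
  obtain ⟨h0, ⟨⟨h1, h2⟩, h3⟩, h4⟩ := hc
  obtain ⟨a, b⟩ := x
  simp only at *
  have s1 : Eqw ((a, b) :: (M ++ N ++ (a, b) :: (K ++ L))) ((N ++ (a, b) :: K) ++ (L ++ (a, b) :: M)) := by
    refine (Eqw.rot' (u := (a, b) :: M) (v := N ++ (a, b) :: (K ++ L)) (by simp)).trans (Eqw.of_eq (by simp))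
  have s2 : Eqw ((N ++ (a, b) :: K) ++ (L ++ (a, b) :: M)) ((K ++ (c, true) :: N) ++ (winv L ++ (c, true) :: winv M)) := by
    refine Eqw.cutpaste (c := c) (d := a) (b := b) (by simp) (by simp) (by simp) (by simp) ?_ ?_ ?_ ?_ ?_ ?_
    · simp [h2, h0, h3]
    · simp [h4, h0, h1]
    · simp [hN, hK, Ne.symm h0]
    · simp [hM, hL, Ne.symm h0]
    · refine (deq_rot' (u := N ++ [(a, b)]) (v := K ++ [(c, true)]) (by simp)).trans ?_
      simpa using Deq.refl _
    · refine (deq_inv _).trans ((deq_rot' (u := (c, true) :: (winv M ++ [(a, !b)])) (v := winv L) (by simp)).trans ?_)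
      simpa using Deq.refl _
  obtain ⟨f, g, hf, ⟨e1, e2, e3⟩, hid⟩ := rename_exists a c b
  have s3 := Eqw.relb f hf g ((K ++ (c, true) :: N) ++ (winv L ++ (c, true) :: winv M))
  rw [relb_append, relb_append, relb_cons, relb_append, relb_cons, hid N hN h2, hid K hK h3,
    hid (winv M) (by simpa using hM) (by simpa using h1), hid (winv L) (by simpa using hL) (by simpa using h4)] at s3
  simp only at s3
  rw [e1, e2] at s3
  refine s1.trans (s2.trans (s3.trans ?_))
  exact (Eqw.rot' (u := K) (v := (a, b) :: N ++ (winv L ++ (a, b) :: winv M)) (by simp)).trans (Eqw.of_eq (by simp))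

theorem R1 (x : ℕ × Bool) {N L : Word} (hN : x.1 ∉ lab N) (hL : x.1 ∉ lab L) :
    Eqw (x :: (N ++ x :: L)) (x :: x :: (N ++ winv L)) := by
  have := ruleB x (M := []) (N := N) (K := []) (L := L) (by simp) hN (by simp) hL
  simp only [List.nil_append, winv_nil] at this
  refine this.trans ((Eqw.rot' (u := x :: (N ++ winv L)) (v := [x]) (by simp)).trans (Eqw.of_eq (by simp)))

theorem R2 (x : ℕ × Bool) {M R : Word} (hM : x.1 ∉ lab M) (hR : x.1 ∉ lab R) :
    Eqw (x :: x :: (M ++ R)) (x :: x :: (R ++ M)) := by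
  have s1 := ruleB x (M := []) (N := []) (K := M) (L := R) (by simp) (by simp) hM hR
  simp only [List.nil_append, winv_nil] at s1
  refine s1.trans ((Eqw.inv _).trans ?_)
  simp only [winv_cons, winv_append, winv_winv]
  have s2 : Eqw (winv M ++ [flipL x] ++ R ++ [flipL x]) (flipL x :: (R ++ flipL x :: winv M)) :=
    (Eqw.rot' (u := winv M) (v := [flipL x] ++ R ++ [flipL x]) (by simp)).trans (Eqw.of_eq (by simp))
  refine (Eqw.of_eq (by simp)).trans (s2.trans ((R1 (flipL x) hR (by simpa using hM)).trans ?_))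
  obtain ⟨g, hg, h1, h2⟩ := flip_eqw x.1
  refine (h1 _).trans ?_
  rw [relb_cons, relb_cons, relb_append, h2 R hR, winv_winv, h2 M hM]
  apply Eqw.of_eq
  simp [hg, flipL]

theorem handle (x y : ℕ × Bool) {A B C E : Word} (hxy : x.1 ≠ y.1)
    (hxA : x.1 ∉ lab A) (hxB : x.1 ∉ lab B) (hxC : x.1 ∉ lab C) (hxE : x.1 ∉ lab E)
    (hyA : y.1 ∉ lab A) (hyB : y.1 ∉ lab B) (hyC : y.1 ∉ lab C) (hyE : y.1 ∉ lab E) :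
    Eqw (x :: (A ++ y :: (B ++ flipL x :: (C ++ flipL y :: E))))
      (x :: y :: flipL x :: flipL y :: (E ++ C ++ B ++ A)) := by
  have hyx : y.1 ≠ x.1 := hxy.symm
  have s1 := ruleA x (M := A) (N := y :: B) (L := C ++ flipL y :: E) hxA (by simp [hxB, hxy]) (by simp [hxC, hxE, hxy])
  have s2 := ruleA y (M := B ++ A) (N := flipL x :: C) (L := E ++ [x]) (by simp [hyB, hyA]) (by simp [hyC, hyx]) (by simp [hyE, hyx])
  have s3 := ruleA (flipL x) (M := C ++ B ++ A) (N := flipL y :: E) (L := [y]) (by simp [hxA, hxB, hxC]) (by simp [hxE, hxy]) (by simp [hxy])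
  refine (Eqw.of_eq (by simp)).trans (s1.trans ?_)
  refine (Eqw.rot' (u := [x]) (v := y :: B ++ A ++ flipL x :: (C ++ flipL y :: E)) (by simp)).trans ?_
  refine (Eqw.of_eq (by simp)).trans (s2.trans ?_)
  refine (Eqw.rot' (u := [y]) (v := flipL x :: C ++ (B ++ A) ++ flipL y :: (E ++ [x])) (by simp)).trans ?_
  refine (Eqw.of_eq (by simp)).trans (s3.trans ?_)
  refine (Eqw.rot' (u := flipL x :: (flipL y :: E ++ (C ++ B ++ A))) (v := [x, y]) (by simp)).trans (Eqw.of_eq (by simp))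

theorem R2' (x y : ℕ × Bool) {M R : Word} (hxy : x.1 ≠ y.1) (hxM : x.1 ∉ lab M) (hxR : x.1 ∉ lab R)
    (hyM : y.1 ∉ lab M) (hyR : y.1 ∉ lab R) :
    Eqw (x :: y :: flipL x :: flipL y :: (M ++ R)) (x :: y :: flipL x :: flipL y :: (R ++ M)) := by
  have s := handle x y (A := R) (B := []) (C := []) (E := M) hxy hxR (by simp) (by simp) hxM hyR (by simp) (by simp) hyM
  have s2 := handle y (flipL x) (A := []) (B := []) (C := M) (E := R) hxy.symm (by simp) (by simp) hyM hyR (by simp) (by simp) hxM hxR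
  have s3 := handle x y (A := R ++ M) (B := []) (C := []) (E := []) hxy (by simp [hxR, hxM]) (by simp) (by simp) (by simp) (by simp [hyM, hyR]) (by simp) (by simp) (by simp)
  refine (Eqw.of_eq (by simp)).trans (s.symm.trans ?_)
  refine (Eqw.rot' (u := x :: R) (v := [y, flipL x, flipL y] ++ M) (by simp)).trans ?_
  refine (Eqw.of_eq (by simp)).trans (s2.trans ?_)
  refine (Eqw.rot' (u := [y, flipL x, flipL y]) (v := x :: (R ++ M)) (by simp)).trans ?_
  exact (Eqw.of_eq (by simp)).trans (s3.trans (Eqw.of_eq (by simp)))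

theorem three (c x y : ℕ × Bool) {Y : Word} (hcx : c.1 ≠ x.1) (hcy : c.1 ≠ y.1) (hxy : x.1 ≠ y.1)
    (hc : c.1 ∉ lab Y) (hx : x.1 ∉ lab Y) (hy : y.1 ∉ lab Y) :
    Eqw (c :: c :: x :: y :: flipL x :: flipL y :: Y) (flipL c :: flipL c :: (Y ++ [x, x, y, y])) := by
  have s1 := R1 c (N := [x, y]) (L := winv Y ++ [y, x]) (by simp [hcx, hcy]) (by simp [hc, hcx, hcy])
  have s2 := R1 y (N := c :: winv Y) (L := [x, c, x]) (by simp [hcy.symm, hy]) (by simp [hxy.symm, hcy.symm])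
  have s3 := R1 (flipL x) (N := [flipL c]) (L := y :: y :: c :: winv Y) (by simp [hcx.symm]) (by simp [hxy, hcx.symm, hx])
  have s4 := R1 (flipL c) (N := Y) (L := [flipL y, flipL y, flipL x, flipL x]) (by simp [hc]) (by simp [hcy, hcx])
  refine (Eqw.of_eq (by simp)).trans (s1.symm.trans ?_)
  refine (Eqw.rot' (u := [c, x, y, c] ++ winv Y) (v := [y, x]) (by simp)).trans ?_
  refine (Eqw.rot' (w := [y, x] ++ ([c, x, y, c] ++ winv Y)) (u := [y, x, c, x]) (v := [y, c] ++ winv Y) (by simp)).trans ?_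
  refine (Eqw.of_eq (by simp)).trans (s2.trans ?_)
  refine (Eqw.rot' (u := [y, y, c] ++ winv Y) (v := [flipL x, flipL c, flipL x]) (by simp)).trans ?_
  refine (Eqw.of_eq (by simp)).trans (s3.trans ?_)
  refine (Eqw.rot' (u := [flipL x, flipL x]) (v := flipL c :: (Y ++ [flipL c, flipL y, flipL y])) (by simp)).trans ?_
  exact (Eqw.of_eq (by simp)).trans (s4.trans (Eqw.of_eq (by simp)))

inductive Block
  | sq (x : ℕ × Bool) : Block
  | co (x y : ℕ × Bool) : Block

def Block.w : Block → Word
  | .sq x => [x, x]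
  | .co x y => [x, y, flipL x, flipL y]

def Block.inv : Block → Block
  | .sq x => .sq (flipL x)
  | .co x y => .co y x

theorem Block.w_inv (b : Block) : b.inv.w = winv b.w := by
  cases b <;> simp [Block.w, Block.inv]

def bws (l : List Block) : Word := l.flatMap Block.w

@[simp] theorem bws_nil : bws [] = [] := rfl
@[simp] theorem bws_cons (b : Block) (l : List Block) : bws (b :: l) = b.w ++ bws l := by simp [bws]
@[simp] theorem bws_append (l l' : List Block) : bws (l ++ l') = bws l ++ bws l' := by simp [bws]

def binv (l : List Block) : List Block := (l.map Block.inv).reverse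

theorem bws_binv (l : List Block) : bws (binv l) = winv (bws l) := by
  induction l with
  | nil => rfl
  | cons b l ih =>
    have : binv (b :: l) = binv l ++ [b.inv] := by simp [binv]
    rw [this]; simp [ih, Block.w_inv]

def Val (w : Word) : Prop := ∀ a, (lab w).count a = 0 ∨ (lab w).count a = 2

@[simp] theorem count_lab_winv (u : Word) (a : ℕ) : (lab (winv u)).count a = (lab u).count a := by
  induction u with
  | nil => rfl
  | cons x u ih => simp [ih, List.count_cons]

theorem Val.congr {w w' : Word} (h : Val w) (e : ∀ a, (lab w').count a = (lab w).count a) : Val w' := by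
  intro a; rw [e]; exact h a

theorem bhop (b : Block) {M R : Word} (h : Val (b.w ++ (M ++ R))) : Eqw (b.w ++ (M ++ R)) (b.w ++ (R ++ M)) := by
  cases b with
  | sq x =>
    have hx := h x.1
    simp [Block.w, List.count_cons, List.count_append] at hx
    have := R2 x (M := M) (R := R) (by rw [← List.count_eq_zero]; omega) (by rw [← List.count_eq_zero]; omega)
    simpa [Block.w] using this
  | co x y =>
    have hx := h x.1
    have hy := h y.1
    simp [Block.w, List.count_cons, List.count_append] at hx hy
    have hxy : x.1 ≠ y.1 := by
      intro e
      simp [e] at hx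
    simp only [if_neg hxy, if_neg hxy.symm] at hx hy
    have := R2' x y (M := M) (R := R) hxy (by rw [← List.count_eq_zero]; omega) (by rw [← List.count_eq_zero]; omega)
      (by rw [← List.count_eq_zero]; omega) (by rw [← List.count_eq_zero]; omega)
    simpa [Block.w] using this

theorem adj_or_linked (n : ℕ) : ∀ (Z Z1 Y Z2 : Word) (x : ℕ × Bool), Y.length = n →
    Z = Z1 ++ x :: (Y ++ flipL x :: Z2) → (∀ y ∈ Z, flipL y ∈ Z) → Z.Nodup →
    (∃ A B y, Z = A ++ y :: flipL y :: B) ∨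
    (∃ A B C E G y z, Z = A ++ y :: (B ++ z :: (C ++ flipL y :: (E ++ flipL z :: G)))) := by
  induction n using Nat.strong_induction_on with
  | _ n ih =>
    intro Z Z1 Y Z2 x hn hZ hopp hnd
    rcases Y with _ | ⟨y, Y⟩
    · left; exact ⟨Z1, Z2, x, by simpa using hZ⟩
    · have h1 : flipL y ∈ Z := hopp y (by rw [hZ]; simp)
      rw [hZ] at h1
      simp only [List.mem_append, List.mem_cons, List.cons_append] at h1
      have hne : ∀ a : ℕ × Bool, flipL a ≠ a := by
        rintro ⟨a, b⟩ h; simp [flipL] at h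
      rcases h1 with h1 | h1 | h1 | h1 | h1 | h1
      · obtain ⟨A, B, e⟩ := List.append_of_mem h1
        right
        refine ⟨A, B, [], Y, Z2, flipL y, x, ?_⟩
        rw [hZ, e]; simp
      · exfalso
        have : y = flipL x := by rw [← h1]; simp
        grind
      · exact absurd h1 (hne y)
      · obtain ⟨A, B, e⟩ := List.append_of_mem h1
        refine ih A.length (by rw [← hn, e]; simp) Z (Z1 ++ [x]) A (B ++ flipL x :: Z2) y rfl ?_ hopp hnd
        rw [hZ, e]; simp
      · exfalso
        have : y = x := by rw [← flipL_flipL y, h1, flipL_flipL]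
        grind
      · obtain ⟨A, B, e⟩ := List.append_of_mem h1
        right
        refine ⟨Z1, [], Y, A, B, x, y, ?_⟩
        rw [hZ, e]; simp

theorem dup_of_not_nodup (Z : Word) (h : ¬ Z.Nodup) : ∃ Z1 x Y Z2, Z = Z1 ++ x :: (Y ++ x :: Z2) := by
  induction Z with
  | nil => simp at h
  | cons z Z ih =>
    by_cases hz : z ∈ Z
    · obtain ⟨A, B, e⟩ := List.append_of_mem hz
      exact ⟨[], z, A, B, by rw [e]; simp⟩
    · grind

theorem even_bws (bs : List Block) (a : ℕ) : 2 ∣ (lab (bws bs)).count a := by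
  induction bs with
  | nil => simp
  | cons b bs ih =>
    rw [bws_cons, lab_append, List.count_append]
    refine dvd_add ?_ ih
    cases b with
    | sq x =>
      simp [Block.w, List.count_cons]
      split_ifs <;> omega
    | co x y =>
      simp [Block.w, List.count_cons]
      split_ifs <;> omega

theorem Val.right {bs : List Block} {Z : Word} (h : Val (bws bs ++ Z)) : Val Z := by
  intro a
  have h1 := h a
  have h2 := even_bws bs a
  rw [lab_append, List.count_append] at h1
  omega

theorem Val.opp {Z : Word} (h : Val Z) (hn : Z.Nodup) : ∀ y ∈ Z, flipL y ∈ Z := by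
  intro y hy
  obtain ⟨A, B, e⟩ := List.append_of_mem hy
  have h1 := h y.1
  rw [e] at h1
  simp only [lab_append, lab_cons, List.count_append, List.count_cons_self] at h1
  have h2 : y.1 ∈ lab (A ++ B) := by
    rw [← List.one_le_count_iff]
    simp only [lab_append, List.count_append]; omega
  simp only [lab, List.mem_map] at h2
  obtain ⟨z, hz, hzy⟩ := h2
  have hne : z ≠ y := by
    grind
  have hf : z = flipL y := by
    rcases z with ⟨z, b⟩
    rcases y with ⟨y, b'⟩
    simp only at hzy
    subst hzy
    simp only [flipL, Prod.mk.injEq, true_and]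
    cases b <;> cases b' <;> simp_all
  grind

theorem nc {a : ℕ} {u : Word} (h : (lab u).count a = 0) : a ∉ lab u := List.count_eq_zero.1 h

theorem normal1 (n : ℕ) : ∀ (bs : List Block) (Z : Word), Z.length = n → Val (bws bs ++ Z) → bws bs ++ Z ≠ [] →
    (∃ x, Eqw (bws bs ++ Z) [x, flipL x]) ∨
    ∃ bs', bs' ≠ [] ∧ Val (bws bs') ∧ Eqw (bws bs ++ Z) (bws bs') := by
  induction n using Nat.strong_induction_on with
  | _ n ih =>
    intro bs Z hn hv hne
    have step : ∀ (bs' : List Block) (Z' : Word), Z'.length < n → bws bs' ++ Z' ≠ [] →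
        (∀ a, (lab (bws bs' ++ Z')).count a = (lab (bws bs ++ Z)).count a ∨ (lab (bws bs' ++ Z')).count a = 0) →
        Eqw (bws bs ++ Z) (bws bs' ++ Z') → (∃ x, Eqw (bws bs ++ Z) [x, flipL x]) ∨
          ∃ bs', bs' ≠ [] ∧ Val (bws bs') ∧ Eqw (bws bs ++ Z) (bws bs') := by
      intro bs' Z' hl hne' hc he
      rcases ih _ hl bs' Z' rfl (fun a => by rcases hc a with h | h <;> [(rw [h]; exact hv a); exact Or.inl h]) hne' with
        ⟨x, hx⟩ | ⟨b, h1, h2, h3⟩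
      · exact Or.inl ⟨x, he.trans hx⟩
      · exact Or.inr ⟨b, h1, h2, he.trans h3⟩
    rcases eq_or_ne Z [] with rfl | hZ
    · right
      refine ⟨bs, ?_, by simpa using hv, .of_eq (by simp)⟩
      rintro rfl; simp at hne
    by_cases hnd : Z.Nodup
    · have hopp := hv.right.opp hnd
      have hlast : (∃ A B y, Z = A ++ y :: flipL y :: B) ∨
          (∃ A B C E G y z, Z = A ++ y :: (B ++ z :: (C ++ flipL y :: (E ++ flipL z :: G)))) := by
        obtain ⟨x, Z', rfl⟩ := List.exists_cons_of_ne_nil hZ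
        have h1 := hopp x (by simp)
        have : flipL x ∈ Z' := by
          rcases List.mem_cons.1 h1 with h | h
          · exfalso; rcases x with ⟨a, b⟩; simp [flipL] at h
          · exact h
        obtain ⟨A, B, e⟩ := List.append_of_mem this
        exact adj_or_linked A.length _ [] A B x rfl (by rw [e]; simp) hopp hnd
      rcases hlast with ⟨A, B, y, rfl⟩ | ⟨A, B, C, E, G, x, y, rfl⟩
      · have hy := hv y.1
        simp [List.count_append] at hy
        by_cases hAB : bws bs ++ (A ++ B) = []
        · left
          simp only [List.append_eq_nil_iff] at hAB
          obtain ⟨h1, rfl, rfl⟩ := hAB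
          exact ⟨y, .of_eq (by rw [h1]; simp)⟩
        · refine step bs (A ++ B) (by rw [← hn]; simp) hAB ?_ ?_
          · intro a
            simp only [lab_append, lab_cons, List.count_append, List.count_cons, flipL_fst]
            grind
          · refine (Eqw.rot' (u := bws bs ++ A ++ [y, flipL y]) (v := B) (by simp)).trans ?_
            refine (Eqw.of_eq (by simp)).trans ((Eqw.cancel (u := B ++ (bws bs ++ A)) (x := y) ?_ ?_).trans ?_)
            · intro h; apply hAB; simp at h ⊢; tauto
            · simp only [lab_append, List.mem_append]
              grind
            · exact (Eqw.rot _ _).trans (.of_eq (by simp))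
      · have hx := hv x.1
        have hy := hv y.1
        have hxy : x.1 ≠ y.1 := by
          intro e
          simp [List.count_append, e] at hx
          omega
        simp [List.count_append, List.count_cons, hxy, hxy.symm] at hx hy
        refine step (.co x y :: bs) (A ++ E ++ C ++ B ++ G) (by rw [← hn]; simp; omega) (by simp [Block.w]) ?_ ?_
        · intro a; left
          simp [Block.w, List.count_append, List.count_cons]; omega
        · refine (Eqw.rot' (u := bws bs ++ A) (v := x :: (B ++ y :: (C ++ flipL x :: (E ++ flipL y :: G)))) (by simp)).trans ?_
          have h1 := handle x y (A := B) (B := C) (C := E) (E := G ++ (bws bs ++ A)) hxy (nc (by omega)) (nc (by omega))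
            (nc (by omega)) (nc (by simp; omega)) (nc (by omega)) (nc (by omega)) (nc (by omega)) (nc (by simp; omega))
          refine (Eqw.of_eq (by simp)).trans (h1.trans ?_)
          have h2 := R2' x y (M := G) (R := bws bs ++ A ++ E ++ C ++ B) hxy (nc (by omega)) (nc (by simp; omega)) (nc (by omega)) (nc (by simp; omega))
          exact (Eqw.of_eq (by simp)).trans (h2.trans (Eqw.of_eq (by simp [Block.w])))
    · obtain ⟨Z1, x, Y, Z2, rfl⟩ := dup_of_not_nodup Z hnd
      have hx := hv x.1
      simp [List.count_append] at hx
      refine step (.sq x :: binv bs) (winv Z2 ++ Y ++ winv Z1) (by rw [← hn]; simp; omega) (by simp [Block.w]) ?_ ?_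
      · intro a; left
        simp [Block.w, List.count_append, List.count_cons, bws_binv]; omega
      · refine (Eqw.rot' (u := bws bs ++ Z1) (v := x :: (Y ++ x :: Z2)) (by simp)).trans ?_
        have h1 := R1 x (N := Y) (L := Z2 ++ bws bs ++ Z1) (nc (by omega)) (nc (by simp; omega))
        refine (Eqw.of_eq (by simp)).trans (h1.trans ?_)
        have h2 := R2 x (M := Y ++ winv Z1) (R := winv (bws bs) ++ winv Z2) (nc (by simp; omega)) (nc (by simp; omega))
        exact (Eqw.of_eq (by simp)).trans (h2.trans (Eqw.of_eq (by simp [Block.w, bws_binv])))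

def isSq : Block → Bool
  | .sq _ => true
  | .co _ _ => false

theorem blk_front (P Q : List Block) (b : Block) (h : Val (bws (P ++ b :: Q))) :
    Eqw (bws (P ++ b :: Q)) (bws (b :: P ++ Q)) := by
  refine (Eqw.rot' (u := bws P) (v := b.w ++ bws Q) (by simp)).trans ?_
  refine (Eqw.of_eq (by simp)).trans ((bhop b (M := bws Q) (R := bws P) (h.congr ?_)).trans (Eqw.of_eq (by simp)))
  intro a; simp [List.count_append]; omega

theorem normal2 (n : ℕ) : ∀ (bs : List Block), (bs.filter (fun b => !isSq b)).length = n → Val (bws bs) →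
    (∃ b ∈ bs, isSq b = true) → ∃ bs', bs' ≠ [] ∧ Val (bws bs') ∧ (∀ b ∈ bs', isSq b = true) ∧ Eqw (bws bs) (bws bs') := by
  induction n with
  | zero =>
    intro bs hn hv hs
    refine ⟨bs, ?_, hv, ?_, .refl _⟩
    · obtain ⟨b, hb, _⟩ := hs; rintro rfl; simp at hb
    · simp_all
  | succ n ih =>
    intro bs hn hv hs
    have : ∃ b ∈ bs, isSq b = false := by
      by_contra hcon
      push Not at hcon
      have : bs.filter (fun b => !isSq b) = [] := by
        simp_all
      rw [this] at hn; simp at hn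
    obtain ⟨b, hb, hbf⟩ := this
    obtain ⟨P, Q, rfl⟩ := List.append_of_mem hb
    obtain ⟨s, hs, hst⟩ := hs
    have hs' : s ∈ P ++ Q := by
      grind
    obtain ⟨P', Q', e⟩ := List.append_of_mem hs'
    have e1 := blk_front P Q b hv
    rw [List.cons_append, e] at e1
    have hc : ∀ a, (lab (bws (P ++ b :: Q))).count a = (lab b.w).count a + (lab (bws (P ++ Q))).count a := by
      intro a; simp [List.count_append]; omega
    have hv1 : Val (bws (b :: P' ++ s :: Q')) := hv.congr (fun a => by
      rw [hc, e]; simp [List.count_append])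
    have e2 := blk_front (b :: P') Q' s hv1
    simp only [List.cons_append] at e2
    cases s with
    | co x y => simp [isSq] at hst
    | sq c =>
      cases b with
      | sq x => simp [isSq] at hbf
      | co x y =>
        have h1 := hv1 c.1
        have h2 := hv1 x.1
        have h3 := hv1 y.1
        have hcx : c.1 ≠ x.1 := by intro e; simp [Block.w, ← e, List.count_append, List.count_cons] at h2; omega
        have hcy : c.1 ≠ y.1 := by intro e; simp [Block.w, ← e, List.count_append, List.count_cons] at h3; omega
        have hxy : x.1 ≠ y.1 := by intro e; simp [Block.w, e, List.count_append] at h3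
        simp [Block.w, List.count_append, List.count_cons, hxy, hxy.symm, hcx, hcx.symm, hcy, hcy.symm] at h1 h2 h3
        have h4 := three c x y (Y := bws (P' ++ Q')) hcx hcy hxy (nc (by simp; omega)) (nc (by simp; omega)) (nc (by simp; omega))
        have e3 : Eqw (bws (P ++ Block.co x y :: Q)) (bws (.sq (flipL c) :: (P' ++ Q') ++ [.sq x, .sq y])) := by
          refine e1.trans (e2.trans ((Eqw.of_eq ?_).trans (h4.trans (Eqw.of_eq ?_)))) <;> simp [Block.w]
        obtain ⟨bs', k1, k2, k3, k4⟩ := ih (.sq (flipL c) :: (P' ++ Q') ++ [.sq x, .sq y]) (by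
          have hl : ((P ++ Q).filter (fun b => !isSq b)).length = n := by
            simp [isSq] at hn ⊢; omega
          rw [e] at hl
          simpa [isSq] using hl) (hv1.congr (fun a => by
            simp [Block.w, List.count_append, List.count_cons]; omega)) ⟨.sq (flipL c), by simp, rfl⟩
        exact ⟨bs', k1, k2, k3, e3.trans k4⟩

theorem normal_form (w : Word) (hv : Val w) (hw : w ≠ []) :
    (∃ x, Eqw w [x, flipL x]) ∨ ∃ bs, bs ≠ [] ∧ Val (bws bs) ∧ Eqw w (bws bs) ∧
      ((∀ b ∈ bs, isSq b = true) ∨ ∀ b ∈ bs, isSq b = false) := by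
  rcases normal1 _ [] w rfl (by simpa using hv) (by simpa using hw) with ⟨x, h⟩ | ⟨bs, h1, h2, h3⟩
  · exact Or.inl ⟨x, by simpa using h⟩
  · right
    simp only [bws_nil, List.nil_append] at h3
    by_cases hs : ∃ b ∈ bs, isSq b = true
    · obtain ⟨bs', k1, k2, k3, k4⟩ := normal2 _ bs rfl h2 hs
      exact ⟨bs', k1, k2, h3.trans k4, Or.inl k3⟩
    · grind

theorem lab_last (u : Word) (c : ℕ) (b : Bool) (h : c ∈ lab u) : ∃ u' : Word, Deq u (u' ++ [(c, b)]) ∧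
    u'.length + 1 = u.length ∧ ∀ a, (lab u).count a = (lab u').count a + if c = a then 1 else 0 := by
  simp only [lab, List.mem_map] at h
  obtain ⟨⟨c', b'⟩, hx, rfl⟩ := h
  obtain ⟨A, B, rfl⟩ := List.append_of_mem hx
  have h1 : Deq (A ++ (c', b') :: B) (B ++ A ++ [(c', b')]) := by
    have := deq_rot (A ++ [(c', b')]) B
    simpa using this
  by_cases hb : b' = b
  · subst hb
    refine ⟨B ++ A, h1, by simp; omega, fun a => ?_⟩
    simp [List.count_append, List.count_cons]; omega
  · have hb2 : b = !b' := by cases b <;> cases b' <;> simp_all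
    refine ⟨winv (B ++ A), (h1.trans (deq_inv _)).trans ?_, by simp; omega, fun a => ?_⟩
    · have := deq_rot [(c', !b')] (winv (B ++ A))
      simpa [hb2] using this
    · simp [List.count_append, List.count_cons]; omega

theorem shared {X : Type} [TopologicalSpace X] [PreconnectedSpace X] {ι : Type} (w : ι → Word)
    (h : Pres X w) (i : ι) (hi : ∃ j, j ≠ i) : ∃ j, j ≠ i ∧ ∃ c, c ∈ lab (w i) ∧ c ∈ lab (w j) := by
  classical
  by_contra hcon
  push Not at hcon
  obtain ⟨q, hq, hf⟩ := h
  have mem : ∀ a t (p : Σ _ : ι, D), OnP w a t p → a ∈ lab (w p.1) := by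
    rintro a t p ⟨s, hs, -⟩; exact hs.mem
  let g : (Σ _ : ι, D) → Bool := fun p => decide (p.1 = i)
  have hg : Continuous g := continuous_sigma fun j => by
    show Continuous fun _ : D => decide (j = i)
    exact continuous_const
  have hR : ∀ x y, EqvGen (RR w) x y → g x = g y := by
    intro x y h
    induction h with
    | rel x y h =>
      obtain ⟨a, t, ht, h1, h2⟩ := h
      have m1 := mem _ _ _ h1
      have m2 := mem _ _ _ h2
      by_cases hx : x.1 = i <;> by_cases hy : y.1 = i
      · simp [g, hx, hy]
      · exact absurd m2 (hcon y.1 hy a (hx ▸ m1))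
      · exact absurd m1 (hcon x.1 hx a (hy ▸ m2))
      · simp [g, hx, hy]
    | refl x => rfl
    | symm x y _ ih => exact ih.symm
    | trans x y z _ _ h1 h2 => exact h1.trans h2
  let G : X → Bool := fun x => g (hq.surjective x).choose
  have hG : ∀ p, G (q p) = g p := fun p => hR _ _ ((hf _ _).1 (hq.surjective (q p)).choose_spec)
  have hGc : Continuous G := by
    rw [hq.continuous_iff]
    have : G ∘ q = g := funext hG
    rw [this]; exact hg
  obtain ⟨j, hj⟩ := hi
  have z0 : D := ⟨0, by simp⟩
  have := PreconnectedSpace.constant (inferInstance : PreconnectedSpace X) hGc (x := q ⟨i, z0⟩) (y := q ⟨j, z0⟩)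
  rw [hG, hG] at this
  simp [g, hj] at this

theorem merge {X : Type} [TopologicalSpace X] [PreconnectedSpace X] (n : ℕ) : ∀ (ι : Type) [Fintype ι] (w : ι → Word),
    Fintype.card ι = n + 1 → (∀ i, 2 ≤ (w i).length) →
    (∀ a, ∑ i, (lab (w i)).count a = 0 ∨ ∑ i, (lab (w i)).count a = 2) → Pres X w →
    ∃ u, u ≠ [] ∧ Val u ∧ W1 X u := by
  classical
  induction n with
  | zero =>
    intro ι _ w hc hl ht hp
    rw [Fintype.card_eq_one_iff] at hc
    obtain ⟨i, hi⟩ := hc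
    refine ⟨w i, ?_, ?_, ?_⟩
    · intro h; have := hl i; rw [h] at this; simp at this
    · have hu : (Finset.univ : Finset ι) = {i} := by ext j; simp [hi j]
      intro a; have := ht a
      rw [hu] at this; simpa using this
    · let e : Option Empty ≃ ι :=
        { toFun := fun _ => i, invFun := fun _ => none,
          left_inv := fun x => by rcases x with _ | x <;> [rfl; exact x.elim],
          right_inv := fun j => (hi j).symm }
      have := (pres_reindex (X := X) e w).2 hp
      refine (pres_deq fun k => ?_).1 this
      match k with
      | none => exact Deq.refl _
      | some k => exact k.elim
  | succ n ih =>
    intro ι _ w hc hl ht hp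
    have hone : 1 < Fintype.card ι := by omega
    have : Nontrivial ι := Fintype.one_lt_card_iff_nontrivial.1 hone
    obtain ⟨i⟩ : Nonempty ι := inferInstance
    obtain ⟨j, hj, c, hci, hcj⟩ := shared w hp i (exists_ne i)
    let j' : {y // y ≠ i} := ⟨j, hj⟩
    let κ := {y : {y // y ≠ i} // y ≠ j'}
    let e : Option (Option κ) ≃ ι := (Equiv.optionCongr (Equiv.optionSubtypeNe j')).trans (Equiv.optionSubtypeNe i)
    have ei : e none = i := by simp [e]
    have ej : e (some none) = j := by simp [e, j']
    have hp1 := (pres_reindex (X := X) e w).2 hp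
    obtain ⟨u, du, lu, cu⟩ := lab_last (w i) c true hci
    obtain ⟨v, dv, lv, cv⟩ := lab_last (w j) c false hcj
    let w' : κ → Word := fun k => w (e (some (some k)))
    have hp2 : Pres X (fam (u ++ [(c, true)]) (fam (v ++ [(c, false)]) w')) := by
      refine (pres_deq fun k => ?_).1 hp1
      match k with
      | none => rw [ei]; exact du
      | some none => rw [ej]; exact dv
      | some (some k) => exact Deq.refl _
    have hsum : ∀ a, ∑ i, (lab (w i)).count a = (lab u).count a + (lab v).count a +
        (if c = a then 2 else 0) + ∑ k, (lab (w' k)).count a := by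
      intro a
      rw [← e.sum_comp, Fintype.sum_option, Fintype.sum_option, ei, ej, cu, cv]
      split_ifs <;> simp only [w'] <;> omega
    have hcc := ht c
    rw [hsum] at hcc
    simp only [if_true] at hcc
    have hw0 : ∑ k, (lab (w' k)).count c = 0 := by omega
    rw [Finset.sum_eq_zero_iff] at hw0
    have hli := hl i
    have hlj := hl j
    have hp3 := (pres_cut (X := X) (w := w') (by rintro rfl; simp at lu; omega) (by rintro rfl; simp at lv; omega)
      (nc (by omega)) (nc (by omega)) (fun k => nc (hw0 k (Finset.mem_univ _)))).1 hp2
    refine ih (Option κ) _ ?_ ?_ ?_ hp3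
    · have := Fintype.card_congr e
      rw [Fintype.card_option, hc] at this
      omega
    · intro k
      match k with
      | none => simp [fam]; omega
      | some k => exact hl _
    · intro a
      have h1 := ht a
      rw [hsum] at h1
      rw [Fintype.sum_option]
      simp only [fam, lab_append, List.count_append]
      split_ifs at h1 <;> omega

def sg (t : ℝ) : ℂ := (⟨2 * t - 1, √(1 - (2 * t - 1) ^ 2)⟩ : ℂ) ^ 2

theorem sg_eq (t : ℝ) (ht : t ∈ Icc (0:ℝ) 1) : sg t = ⟨2 * (2 * t - 1) ^ 2 - 1, 2 * (2 * t - 1) * √(1 - (2 * t - 1) ^ 2)⟩ := by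
  have h : √(1 - (2 * t - 1) ^ 2) ^ 2 = 1 - (2 * t - 1) ^ 2 := Real.sq_sqrt (by nlinarith [ht.1, ht.2])
  rw [sg, sq]
  apply Complex.ext <;> simp only [mul_re, mul_im] <;> nlinarith

theorem sg_symm (t : ℝ) : sg (1 - t) = conj (sg t) := by
  rw [sg, sg, map_pow]
  have : (2 * (1 - t) - 1) = - (2 * t - 1) := by ring
  rw [this, neg_sq]
  have h : (⟨-(2 * t - 1), √(1 - (2 * t - 1) ^ 2)⟩ : ℂ) = - conj ⟨2 * t - 1, √(1 - (2 * t - 1) ^ 2)⟩ := by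
    apply Complex.ext <;> simp
  rw [h, neg_sq]

theorem sg_norm (t : ℝ) (ht : t ∈ Icc (0:ℝ) 1) : ‖sg t‖ = 1 := by
  have h : √(1 - (2 * t - 1) ^ 2) ^ 2 = 1 - (2 * t - 1) ^ 2 := Real.sq_sqrt (by nlinarith [ht.1, ht.2])
  rw [sg, norm_pow]
  rw [Complex.sq_norm, normSq_mk]; nlinarith

theorem sg_surj (z : ℂ) (hz : ‖z‖ = 1) : ∃ t ∈ Icc (0:ℝ) 1, sg t = z := by
  have h1 : z.re ^ 2 + z.im ^ 2 = 1 := by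
    have := Complex.sq_norm z
    rw [hz, normSq_apply] at this; nlinarith
  have hre : -1 ≤ z.re ∧ z.re ≤ 1 := ⟨by nlinarith [sq_nonneg z.im], by nlinarith [sq_nonneg z.im]⟩
  set c := √((1 + z.re) / 2) with hc
  have hc2 : c ^ 2 = (1 + z.re) / 2 := Real.sq_sqrt (by linarith)
  have hc0 : 0 ≤ c := Real.sqrt_nonneg _
  have hc1 : c ≤ 1 := by nlinarith
  set d := √(1 - c ^ 2) with hd
  have hd2 : d ^ 2 = 1 - c ^ 2 := Real.sq_sqrt (by nlinarith)
  have hd0 : 0 ≤ d := Real.sqrt_nonneg _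
  have hcd : (2 * c * d) ^ 2 = z.im ^ 2 := by
    rw [mul_pow, mul_pow, hd2, hc2]; nlinarith
  rcases le_total 0 z.im with hi | hi
  · refine ⟨(1 + c) / 2, ⟨by linarith, by linarith⟩, ?_⟩
    have e : 2 * ((1 + c) / 2) - 1 = c := by ring
    rw [sg_eq _ ⟨by linarith, by linarith⟩, e, ← hd]
    apply Complex.ext
    · simp only; linarith
    · simp only
      exact (pow_left_inj₀ (by positivity) hi two_ne_zero).1 hcd
  · refine ⟨(1 - c) / 2, ⟨by linarith, by linarith⟩, ?_⟩
    have e : 2 * ((1 - c) / 2) - 1 = -c := by ring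
    rw [sg_eq _ ⟨by linarith, by linarith⟩, e, neg_sq, ← hd]
    apply Complex.ext
    · simp only; linarith
    · simp only
      have : 2 * c * d = -z.im := (pow_left_inj₀ (by positivity) (by linarith) two_ne_zero).1 (by rw [hcd]; ring)
      linarith

structure Cres (m : ℝ) (Ψ : ℂ → ℂ) : Prop where
  cont : ContinuousOn Ψ (closedBall 0 1)
  arc : ∀ s ∈ Icc 0 m, Ψ (ee (s / (m + 1))) = ee (s / m)
  inn : ∀ t ∈ Icc (0:ℝ) 1, Ψ (ee ((m + t) / (m + 1))) = (1 + sg t) / 2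
  img : Ψ '' closedBall 0 1 = {y | ‖y‖ ≤ 1 ∧ 1 / 2 ≤ ‖y - 1 / 2‖}
  inj : ∀ z ∈ closedBall (0:ℂ) 1, ∀ z' ∈ closedBall (0:ℂ) 1, Ψ z = Ψ z' → z = z' ∨
    ((z = 1 ∨ z = ee (m / (m + 1))) ∧ (z' = 1 ∨ z' = ee (m / (m + 1))))

def EE (z : ℂ) : ℂ := 1 + ((z.im + √(1 - z.re ^ 2) : ℝ) : ℂ) * ⟨-√(1 - z.re ^ 2), z.re⟩

theorem EE_cont : Continuous EE := by
  unfold EE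
  have : (fun z : ℂ => (⟨-√(1 - z.re ^ 2), z.re⟩ : ℂ)) = fun z : ℂ => ((-√(1 - z.re ^ 2) : ℝ) : ℂ) + (z.re : ℂ) * I := by
    ext z; apply Complex.ext <;> simp
  have h2 : Continuous (fun z : ℂ => (⟨-√(1 - z.re ^ 2), z.re⟩ : ℂ)) := by rw [this]; fun_prop
  fun_prop

theorem norm_le_iff_sq (z : ℂ) : ‖z‖ ≤ 1 ↔ z.re ^ 2 + z.im ^ 2 ≤ 1 := by
  have h := Complex.sq_norm z
  rw [normSq_apply] at h
  constructor
  · intro h'; nlinarith [norm_nonneg z]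
  · intro h'; nlinarith [norm_nonneg z]

theorem half_le_iff (z : ℂ) : 1 / 2 ≤ ‖z - 1 / 2‖ ↔ z.re ≤ z.re ^ 2 + z.im ^ 2 := by
  have h := Complex.sq_norm (z - 1 / 2)
  rw [normSq_apply] at h
  simp at h
  have hn := norm_nonneg (z - 1 / 2)
  simp only [one_div] at *
  constructor
  · intro h'; nlinarith
  · intro h'
    nlinarith

theorem cres_exists {m : ℝ} (hm : 0 < m) : ∃ Ψ, Cres m Ψ := by
  obtain ⟨Φ, c1, i1, m1, a1, b1⟩ := seg (β := 1/2) hm one_pos (by norm_num) (by norm_num)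
  have hq : ee (-(1 / 2 / 2)) = -I := by
    apply Complex.ext
    · rw [ee_re, show 2 * π * -(1/2/2) = -(π / 2) by ring]; simp
    · rw [ee_im, show 2 * π * -(1/2/2) = -(π / 2) by ring]; simp
  have hset : {z : ℂ | ‖z‖ ≤ 1 ∧ Real.cos (π * (1/2)) ≤ (z * ee (-(1 / 2 / 2))).re} =
      {z : ℂ | z.re ^ 2 + z.im ^ 2 ≤ 1 ∧ 0 ≤ z.im} := by
    ext z
    rw [hq, show π * (1/2) = π / 2 by ring, Real.cos_pi_div_two]
    simp only [mem_ofPred_eq, norm_le_iff_sq]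
    simp
  rw [hset] at m1
  have hin : ∀ z ∈ closedBall (0:ℂ) 1, (Φ z).re ^ 2 + (Φ z).im ^ 2 ≤ 1 ∧ 0 ≤ (Φ z).im := fun z hz => by
    have := mem_image_of_mem Φ hz
    rw [m1] at this; exact this
  have hm1 : 0 < m + 1 := by linarith
  have P1 : Φ 1 = 1 := by
    have := a1 0 ⟨le_rfl, hm.le⟩
    simpa [ee_zero] using this
  have P2 : Φ (ee (m / (m + 1))) = -1 := by
    have := a1 m ⟨hm.le, le_rfl⟩
    rw [this, mul_div_assoc, div_self hm.ne', mul_one]; exact ee_half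
  have sqr : ∀ x y : ℝ, x ^ 2 + y ^ 2 ≤ 1 → √(1 - x ^ 2) ^ 2 = 1 - x ^ 2 := fun x y h => Real.sq_sqrt (by nlinarith [sq_nonneg y])
  refine ⟨fun z => EE (Φ z), EE_cont.comp_continuousOn c1, ?_, ?_, ?_, ?_⟩
  · intro s hs
    have h1 := hin _ (hmemee (s / (m + 1)))
    rw [a1 s hs] at h1 ⊢
    have h2 : (ee (1 / 2 * s / m)).re ^ 2 + (ee (1 / 2 * s / m)).im ^ 2 = 1 := by
      have := Complex.sq_norm (ee (1 / 2 * s / m))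
      rw [norm_ee, normSq_apply] at this; nlinarith
    have h3 : ee (s / m) = ee (1 / 2 * s / m) * ee (1 / 2 * s / m) := by rw [← ee_add]; congr 1; ring
    rw [h3]
    set z := ee (1 / 2 * s / m)
    have h4 : √(1 - z.re ^ 2) = z.im := by
      rw [Real.sqrt_eq_iff_mul_self_eq (by nlinarith [sq_nonneg z.im]) h1.2]; nlinarith
    rw [EE, h4]
    apply Complex.ext <;> simp <;> nlinarith
  · intro t ht
    rw [b1 t ht, ee_half]
    have e : ((1 - t / 1 : ℝ) : ℂ) * -1 + ((t / 1 : ℝ) : ℂ) = ((2 * t - 1 : ℝ) : ℂ) := by push_cast; ring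
    rw [e, EE, sg_eq t ht]
    have h := sqr (2 * t - 1) 0 (by nlinarith [ht.1, ht.2])
    apply Complex.ext
    · simp
      nlinarith
    · simp; ring
  · rw [show (fun z => EE (Φ z)) = EE ∘ Φ from rfl, image_comp, m1]
    ext Y
    simp only [mem_image, mem_ofPred_eq, norm_le_iff_sq, half_le_iff]
    constructor
    · rintro ⟨z, ⟨h1, h2⟩, rfl⟩
      have h := sqr _ _ h1
      have hr := Real.sqrt_nonneg (1 - z.re ^ 2)
      rw [EE]
      set r := √(1 - z.re ^ 2)
      have hy : z.im ≤ r := by nlinarith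
      simp
      have hid : (1 + -((z.im + r) * r)) ^ 2 + ((z.im + r) * z.re) ^ 2 = 1 - (z.im + r) * (r - z.im) := by
        grind
      rw [hid]
      constructor
      · grind
      · nlinarith [mul_nonneg (add_nonneg h2 hr) h2]
    · rintro ⟨h1, h2⟩
      by_cases hY : Y = 1
      · refine ⟨1, by simp, ?_⟩
        rw [EE]; simp [hY]
      · set k := ‖Y - 1‖ with hk
        have hk0 : 0 < k := norm_pos_iff.2 (sub_ne_zero.2 hY)
        have hk2 : k ^ 2 = (Y.re - 1) ^ 2 + Y.im ^ 2 := by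
          have := Complex.sq_norm (Y - 1)
          rw [normSq_apply] at this
          rw [hk, this]; simp; ring
        set r := (1 - Y.re) / k with hr
        set x := Y.im / k with hx
        have hr' : r * k = 1 - Y.re := by rw [hr]; field_simp
        have hx' : x * k = Y.im := by rw [hx]; field_simp
        have hrx : r ^ 2 + x ^ 2 = 1 := by
          rw [hr, hx]; field_simp; nlinarith
        have hrk : k ≤ 2 * r := by
          by_contra hcon; push Not at hcon
          nlinarith
        have hkr : r ≤ k := by
          by_contra hcon; push Not at hcon
          nlinarith
        have hsq : √(1 - x ^ 2) = r := by
          rw [Real.sqrt_eq_iff_mul_self_eq (by nlinarith) (by linarith)]; nlinarith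
        refine ⟨⟨x, k - r⟩, ⟨by simp only; nlinarith, by simp only; linarith⟩, ?_⟩
        rw [EE]
        simp only [hsq, sub_add_cancel]
        apply Complex.ext <;> simp <;> linarith
  · intro z hz z' hz' he
    have h1 := hin z hz
    have h2 := hin z' hz'
    have hs1 := sqr _ _ h1.1
    have hs2 := sqr _ _ h2.1
    have hr1 := Real.sqrt_nonneg (1 - (Φ z).re ^ 2)
    have hr2 := Real.sqrt_nonneg (1 - (Φ z').re ^ 2)
    simp only [EE] at he
    set r := √(1 - (Φ z).re ^ 2)
    set r' := √(1 - (Φ z').re ^ 2)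
    have e1 := congrArg re he
    have e2 := congrArg im he
    simp at e1 e2
    have hk : ((Φ z).im + r) ^ 2 = ((Φ z').im + r') ^ 2 := by
      grind
    have hk' : (Φ z).im + r = (Φ z').im + r' :=
      (pow_left_inj₀ (by linarith [h1.2]) (by linarith [h2.2]) two_ne_zero).1 hk
    rcases eq_or_ne ((Φ z).im + r) 0 with h0 | h0
    · right
      have key : ∀ w ∈ closedBall (0:ℂ) 1, (Φ w).im = 0 → (Φ w).re ^ 2 = 1 → w = 1 ∨ w = ee (m / (m + 1)) := by
        intro w hw him hre
        rcases (by simpa using hre : (Φ w).re = 1 ∨ (Φ w).re = -1) with h | h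
        · left; exact i1 hw (by simp) (by rw [P1]; apply Complex.ext <;> simp [him, h])
        · right; exact i1 hw (hmemee _) (by rw [P2]; apply Complex.ext <;> simp [him, h])
      have a1 : r = 0 := by linarith [h1.2]
      have a2 : r' = 0 := by linarith [h2.2]
      grind
    · left
      apply i1 hz hz'
      rw [← hk'] at e1 e2
      have b1 := mul_left_cancel₀ h0 e1
      have b2 := mul_left_cancel₀ h0 e2
      apply Complex.ext
      · exact b2
      · linarith

theorem quot_homeo {A X Y : Type*} [TopologicalSpace A] [TopologicalSpace X] [TopologicalSpace Y]
    {q : A → X} {Q : A → Y} (hq : IsQuotientMap q) (hQ : IsQuotientMap Q) (h : ∀ a b, q a = q b ↔ Q a = Q b) :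
    Nonempty (X ≃ₜ Y) := by
  let F : X → Y := fun x => Q (surjInv hq.surjective x)
  let G : Y → X := fun y => q (surjInv hQ.surjective y)
  have hF : ∀ a, F (q a) = Q a := fun a => (h _ _).1 (surjInv_eq hq.surjective _)
  have hG : ∀ a, G (Q a) = q a := fun a => (h _ _).2 (surjInv_eq hQ.surjective _)
  refine ⟨⟨⟨F, G, ?_, ?_⟩, ?_, ?_⟩⟩
  · intro x; obtain ⟨a, rfl⟩ := hq.surjective x; rw [hF, hG]
  · intro x; obtain ⟨a, rfl⟩ := hQ.surjective x; rw [hG, hF]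
  · exact hq.continuous_iff.2 (by rw [show F ∘ q = Q from funext hF]; exact hQ.continuous)
  · exact hQ.continuous_iff.2 (by rw [show G ∘ Q = q from funext hG]; exact hq.continuous)

theorem eqvGen_equiv {α β : Type*} (e : α ≃ β) (r : β → β → Prop) (x y : α) :
    EqvGen r (e x) (e y) ↔ EqvGen (fun a b => r (e a) (e b)) x y := by
  constructor
  · intro h
    have : ∀ p q, EqvGen r p q → EqvGen (fun a b => r (e a) (e b)) (e.symm p) (e.symm q) := by
      intro p q h
      induction h with
      | rel p q h => exact .rel _ _ (by simpa using h)
      | refl p => exact .refl _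
      | symm p q _ ih => exact .symm _ _ ih
      | trans p q s _ _ h1 h2 => exact .trans _ _ _ h1 h2
    simpa using this _ _ h
  · intro h
    induction h with
    | rel p q h => exact .rel _ _ h
    | refl p => exact .refl _
    | symm p q _ ih => exact .symm _ _ ih
    | trans p q s _ _ h1 h2 => exact .trans _ _ _ h1 h2

def Rw (u : Word) (z z' : D) : Prop := ∃ a, ∃ t ∈ Icc (0:ℝ) 1, On u a t z ∧ On u a t z'

def sigD : D ≃ₜ Σ _ : Option Empty, D where
  toFun z := ⟨none, z⟩
  invFun p := p.2
  left_inv _ := rfl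
  right_inv p := by rcases p with ⟨_ | i, z⟩ <;> [rfl; exact i.elim]
  continuous_toFun := continuous_sigmaMk (σ := fun _ : Option Empty => D)
  continuous_invFun := continuous_sigma fun _ => continuous_id

theorem W1_iff {X : Type} [TopologicalSpace X] (u : Word) : W1 X u ↔
    ∃ pr : D → X, IsQuotientMap pr ∧ ∀ z z', pr z = pr z' ↔ EqvGen (Rw u) z z' := by
  constructor
  · rintro ⟨q, hq, hf⟩
    refine ⟨q ∘ sigD, hq.comp sigD.isQuotientMap, fun z z' => ?_⟩
    exact (hf _ _).trans (eqvGen_equiv sigD.toEquiv _ z z')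
  · rintro ⟨q, hq, hf⟩
    refine ⟨q ∘ sigD.symm, hq.comp sigD.symm.isQuotientMap, fun z z' => (hf _ _).trans ?_⟩
    have h1 := eqvGen_equiv sigD.toEquiv (RR (fam u (Empty.elim : Empty → Word))) (sigD.symm z) (sigD.symm z')
    have h2 : ∀ p, sigD.toEquiv (sigD.symm p) = p := sigD.apply_symm_apply
    rw [h2, h2] at h1
    exact h1.symm

theorem Rw_norm {u : Word} {z z' : D} (h : Rw u z z') : ‖(z:ℂ)‖ = 1 ∧ ‖(z':ℂ)‖ = 1 := by
  obtain ⟨a, t, ht, ⟨s, _, h1⟩, ⟨s', _, h2⟩⟩ := h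
  rw [h1, h2, norm_ee, norm_ee]; exact ⟨rfl, rfl⟩

theorem eqv_cases {u : Word} {z z' : D} (h : EqvGen (Rw u) z z') : z = z' ∨ (‖(z:ℂ)‖ = 1 ∧ ‖(z':ℂ)‖ = 1) := by
  induction h with
  | rel p q h => exact Or.inr (Rw_norm h)
  | refl p => exact Or.inl rfl
  | symm p q _ ih => rcases ih with h | h <;> [exact Or.inl h.symm; exact Or.inr h.symm]
  | trans p q s _ _ h1 h2 =>
    rcases h1 with rfl | h1
    · exact h2
    · grind

def eD (t : ℝ) : D := ⟨ee t, by rw [mem_closedBall_zero_iff, norm_ee]⟩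

def inD (θ : E2 ≃ₗᵢ[ℝ] ℂ) (d : Disc) : D := ⟨(1 + θ d) / 2, by
  have h : ‖(d:E2)‖ ≤ 1 := mem_closedBall_zero_iff.1 d.2
  rw [mem_closedBall_zero_iff, norm_div]
  have := norm_add_le (1:ℂ) (θ d)
  rw [θ.norm_map] at this
  norm_num at this ⊢; linarith⟩

def rho (w : ℂ) : ℂ := 1 + (w - 1) * ((min 2 (2 * (1 - ‖w‖ ^ 2) / ‖w - 1‖ ^ 2) : ℝ) : ℂ)

theorem rho_cont : ContinuousOn rho (closedBall 0 1) := by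
  intro w hw
  by_cases h : w = 1
  · subst h
    have h0 : rho 1 = 1 := by simp [rho]
    rw [ContinuousWithinAt, h0, tendsto_iff_norm_sub_tendsto_zero]
    have hb : Filter.Tendsto (fun w : ℂ => ‖w - 1‖ * 2) (𝓝[closedBall 0 1] 1) (𝓝 0) := by
      have : Continuous fun w : ℂ => ‖w - 1‖ * 2 := by fun_prop
      have := (this.tendsto 1).mono_left (nhdsWithin_le_nhds (s := closedBall (0:ℂ) 1))
      simpa using this
    refine squeeze_zero' (Filter.Eventually.of_forall fun _ => norm_nonneg _) ?_ hb
    filter_upwards [self_mem_nhdsWithin] with w hw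
    have hn : ‖w‖ ≤ 1 := mem_closedBall_zero_iff.1 hw
    rw [rho, add_sub_cancel_left, norm_mul]
    refine mul_le_mul_of_nonneg_left ?_ (norm_nonneg _)
    rw [norm_real, Real.norm_eq_abs, abs_of_nonneg]
    · exact min_le_left _ _
    · refine le_min (by norm_num) (div_nonneg ?_ (by positivity))
      nlinarith [norm_nonneg w]
  · apply ContinuousAt.continuousWithinAt
    have hne : ‖w - 1‖ ^ 2 ≠ 0 := by
      have : 0 < ‖w - 1‖ := norm_pos_iff.2 (sub_ne_zero.2 h)
      positivity
    unfold rho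
    fun_prop

theorem rho_circle {w : ℂ} (h : ‖w‖ = 1) : rho w = 1 := by simp [rho, h]

theorem rho_in {z : ℂ} (h : ‖z‖ ≤ 1) : rho ((1 + z) / 2) = z := by
  by_cases hz : z = 1
  · subst hz; simp [rho]
  have e : (1 + z) / 2 - 1 = (z - 1) / 2 := by ring
  have hp : 0 < ‖z - 1‖ := norm_pos_iff.2 (sub_ne_zero.2 hz)
  have hle : (2:ℝ) ≤ 2 * (1 - ‖(1 + z) / 2‖ ^ 2) / ‖(z - 1) / 2‖ ^ 2 := by
    rw [le_div_iff₀ (by rw [norm_div, Complex.norm_two]; positivity)]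
    rw [Complex.sq_norm, Complex.sq_norm, normSq_apply, normSq_apply]
    have := (norm_le_iff_sq z).1 h
    simp
    nlinarith
  rw [rho, e, min_eq_left hle]; push_cast; ring

theorem inD_cont (θ : E2 ≃ₗᵢ[ℝ] ℂ) : Continuous (inD θ) := by
  unfold inD
  fun_prop

theorem disc_emb {W : Type} [TopologicalSpace W] {u : Word} {pr : D → W} (hq : IsQuotientMap pr)
    (hf : ∀ z z', pr z = pr z' ↔ EqvGen (Rw u) z z') (θ : E2 ≃ₗᵢ[ℝ] ℂ) :
    IsEmbedding (fun d : Disc => pr (inD θ d)) := by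
  let ρ : W → ℂ := fun x => rho (surjInv hq.surjective x : D)
  have hρ : ∀ z : D, ρ (pr z) = rho z := by
    intro z
    rcases eqv_cases ((hf _ _).1 (surjInv_eq hq.surjective (pr z))) with h | h
    · show rho _ = rho _
      rw [h]
    · show rho _ = rho _
      rw [rho_circle h.1, rho_circle h.2]
  have hρc : Continuous ρ := by
    rw [hq.continuous_iff, show ρ ∘ pr = fun z : D => rho z from funext hρ]
    exact rho_cont.comp_continuous continuous_subtype_val (fun z => z.2)
  have hid : ∀ d : Disc, θ.symm (ρ (pr (inD θ d))) = d := by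
    intro d
    rw [hρ, inD, rho_in, θ.symm_apply_apply]
    rw [θ.norm_map]; exact mem_closedBall_zero_iff.1 d.2
  have hcont : Continuous fun d : Disc => pr (inD θ d) := hq.continuous.comp (inD_cont θ)
  refine ⟨⟨?_⟩, fun d d' h => Subtype.ext (by rw [← hid d, ← hid d', h])⟩
  refine le_antisymm hcont.le_induced ?_
  have h1 : (instTopologicalSpaceSubtype : TopologicalSpace Disc) = TopologicalSpace.induced Subtype.val inferInstance := rfl
  rw [h1]
  have h2 : (Subtype.val : Disc → E2) = (fun x => θ.symm (ρ x)) ∘ fun d : Disc => pr (inD θ d) := funext fun d => (hid d).symm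
  rw [h2, ← induced_compose]
  exact induced_mono (continuous_iff_le_induced.1 (θ.symm.continuous.comp hρc))

theorem mem_discCompl {W : Type} [TopologicalSpace W] {u : Word} {pr : D → W}
    (hf : ∀ z z', pr z = pr z' ↔ EqvGen (Rw u) z z') (θ : E2 ≃ₗᵢ[ℝ] ℂ) (y : D) :
    pr y ∈ discCompl (fun d : Disc => pr (inD θ d)) ↔ 1 / 2 ≤ ‖(y:ℂ) - 1 / 2‖ := by
  have hs : ∀ z : ℂ, ‖(1 + z) / 2 - 1 / 2‖ = ‖z‖ / 2 := by
    intro z; rw [show (1 + z) / 2 - 1 / 2 = z / 2 by ring, norm_div]; simp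
  rw [← not_lt, discCompl, mem_ofPred_eq, not_iff_not]
  constructor
  · rintro ⟨d, hd, h⟩
    simp only [mem_ofPred_eq, dist_zero_right] at hd
    have hlt : ‖((inD θ d : D) : ℂ)‖ < 1 := by
      have := norm_add_le (1:ℂ) (θ d)
      rw [θ.norm_map] at this
      show ‖(1 + θ d) / 2‖ < 1
      rw [norm_div]; norm_num at this ⊢; linarith
    rcases eqv_cases ((hf _ _).1 h) with h | h
    · rw [← h]
      show ‖(1 + θ d) / 2 - 1 / 2‖ < _
      rw [hs, θ.norm_map]; linarith
    · exact absurd h.1 hlt.ne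
  · intro h
    have hn : ‖θ.symm (2 * (y:ℂ) - 1)‖ < 1 := by
      rw [θ.symm.norm_map, show (2 * (y:ℂ) - 1) = 2 * (y - 1 / 2) by ring, norm_mul]
      norm_num at h ⊢; linarith
    refine ⟨⟨θ.symm (2 * (y:ℂ) - 1), mem_closedBall_zero_iff.2 hn.le⟩, ?_, ?_⟩
    · simp only [mem_ofPred_eq, dist_zero_right]; exact hn
    · show pr _ = pr y
      congr 1
      apply Subtype.ext
      show (1 + θ (θ.symm (2 * (y:ℂ) - 1))) / 2 = y
      rw [θ.apply_symm_apply]; ring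

theorem Cres.memD {m : ℝ} {Ψ : ℂ → ℂ} (h : Cres m Ψ) (z : D) : Ψ z ∈ closedBall (0:ℂ) 1 := by
  have : Ψ z ∈ Ψ '' closedBall 0 1 := mem_image_of_mem _ z.2
  rw [h.img] at this
  exact mem_closedBall_zero_iff.2 this.1

def Cres.f {m : ℝ} {Ψ : ℂ → ℂ} (h : Cres m Ψ) (z : D) : D := ⟨Ψ z, h.memD z⟩

theorem Cres.f_cont {m : ℝ} {Ψ : ℂ → ℂ} (h : Cres m Ψ) : Continuous h.f :=
  Continuous.subtype_mk (h.cont.comp_continuous continuous_subtype_val (fun z => z.2)) _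

theorem Cres.lift_iff {m : ℝ} {Ψ : ℂ → ℂ} (h : Cres m Ψ) (y : D) : (∃ z, h.f z = y) ↔ 1 / 2 ≤ ‖(y:ℂ) - 1 / 2‖ := by
  constructor
  · rintro ⟨z, rfl⟩
    have : Ψ z ∈ Ψ '' closedBall 0 1 := mem_image_of_mem _ z.2
    rw [h.img] at this
    exact this.2
  · intro hy
    have : (y:ℂ) ∈ Ψ '' closedBall 0 1 := by
      rw [h.img]; exact ⟨mem_closedBall_zero_iff.1 y.2, hy⟩
    obtain ⟨z, hz, e⟩ := this
    exact ⟨⟨z, hz⟩, Subtype.ext e⟩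

theorem Cres.inj' {m : ℝ} {Ψ : ℂ → ℂ} (h : Cres m Ψ) (z z' : D) (e : h.f z = h.f z') : z = z' ∨
    ((z = eD 0 ∨ z = eD (m / (m + 1))) ∧ (z' = eD 0 ∨ z' = eD (m / (m + 1)))) := by
  have h0 : ∀ z : D, (z:ℂ) = 1 → z = eD 0 := fun z hz => Subtype.ext (hz.trans ee_zero.symm)
  rcases h.inj z z.2 z' z'.2 (congrArg Subtype.val e) with h | ⟨h1, h2⟩
  · exact Or.inl (Subtype.ext h)
  · exact Or.inr ⟨h1.imp (h0 z) (fun h => Subtype.ext h), h2.imp (h0 z') (fun h => Subtype.ext h)⟩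

theorem side {W : Type} [TopologicalSpace W] {X : Type} {u : Word} {pr : D → W}
    (hf : ∀ z z', pr z = pr z' ↔ EqvGen (Rw u) z z') (hu : u ≠ []) {Ψ : ℂ → ℂ} (hΨ : Cres u.length Ψ)
    {q : D → X} (h1 : ∀ a, ∀ t ∈ Icc (0:ℝ) 1, ∀ s s', OnAt u a t s → OnAt u a t s' →
      q (eD (s / (u.length + 1))) = q (eD (s' / (u.length + 1))))
    (h2 : q (eD 0) = q (eD (u.length / (u.length + 1)))) (z z' : D) (h : pr (hΨ.f z) = pr (hΨ.f z')) : q z = q z' := by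
  have base : ∀ z z', hΨ.f z = hΨ.f z' → q z = q z' := by
    intro z z' e
    rcases hΨ.inj' z z' e with h | ⟨h | h, h' | h'⟩ <;> rw [h] <;> try rw [h']
    · exact h2
    · exact h2.symm
  have key : ∀ y y', EqvGen (Rw u) y y' → ((∃ z, hΨ.f z = y) ↔ (∃ z, hΨ.f z = y')) ∧
      ∀ z z', hΨ.f z = y → hΨ.f z' = y' → q z = q z' := by
    intro y y' h
    induction h with
    | rel y y' h =>
      obtain ⟨a, t, ht, ⟨s, hs, e1⟩, ⟨s', hs', e2⟩⟩ := h
      have l1 : hΨ.f (eD (s / (u.length + 1))) = y := Subtype.ext ((hΨ.arc s (hs.range ht)).trans e1.symm)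
      have l2 : hΨ.f (eD (s' / (u.length + 1))) = y' := Subtype.ext ((hΨ.arc s' (hs'.range ht)).trans e2.symm)
      refine ⟨⟨fun _ => ⟨_, l2⟩, fun _ => ⟨_, l1⟩⟩, fun z z' hz hz' => ?_⟩
      rw [base z _ (hz.trans l1.symm), base z' _ (hz'.trans l2.symm)]
      exact h1 a t ht s s' hs hs'
    | refl y => exact ⟨Iff.rfl, fun z z' hz hz' => base z z' (hz.trans hz'.symm)⟩
    | symm y y' _ ih => exact ⟨ih.1.symm, fun z z' hz hz' => (ih.2 z' z hz' hz).symm⟩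
    | trans y y' y'' _ _ i1 i2 =>
      refine ⟨i1.1.trans i2.1, fun z z' hz hz' => ?_⟩
      obtain ⟨z1, hz1⟩ := i1.1.1 ⟨z, hz⟩
      exact (i1.2 z z1 hz hz1).trans (i2.2 z1 z' hz1 hz')
  exact (key _ _ ((hf _ _).1 h)).2 z z' rfl rfl

def PosR (v : Word) (s s' : ℝ) : Prop := ∃ a, ∃ t ∈ Icc (0:ℝ) 1, OnAt v a t s ∧ OnAt v a t s'

def θ1 : E2 ≃ₗᵢ[ℝ] ℂ := orthonormalBasisOneI.repr.symm
def θ2 : E2 ≃ₗᵢ[ℝ] ℂ := θ1.trans conjLIE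

theorem closed_side {W : Type} [TopologicalSpace W] {u : Word} {pr : D → W} (hq : IsQuotientMap pr)
    (hf : ∀ z z', pr z = pr z' ↔ EqvGen (Rw u) z z') {m : ℝ} {Ψ : ℂ → ℂ} (hΨ : Cres m Ψ) (θ : E2 ≃ₗᵢ[ℝ] ℂ)
    (S : Set (discCompl (fun d : Disc => pr (inD θ d))))
    (hS : IsClosed {z : D | ∃ x ∈ S, (x:W) = pr (hΨ.f z)}) : IsClosed S := by
  have hcl : IsClosed (Subtype.val '' S) := by
    rw [← hq.isClosed_preimage]
    have : pr ⁻¹' (Subtype.val '' S) = hΨ.f '' {z : D | ∃ x ∈ S, (x:W) = pr (hΨ.f z)} := by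
      ext y
      constructor
      · rintro ⟨x, hx, e⟩
        have : pr y ∈ discCompl (fun d : Disc => pr (inD θ d)) := e ▸ x.2
        rw [mem_discCompl hf] at this
        obtain ⟨z, rfl⟩ := (hΨ.lift_iff y).2 this
        exact ⟨z, ⟨x, hx, e⟩, rfl⟩
      · rintro ⟨z, ⟨x, hx, e⟩, rfl⟩
        exact ⟨x, hx, e⟩
    rw [this]
    exact (hS.isCompact.image hΨ.f_cont).isClosed
  have : S = Subtype.val ⁻¹' (Subtype.val '' S) := by rw [preimage_image_eq _ Subtype.val_injective]
  rw [this]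
  exact hcl.preimage continuous_subtype_val

theorem connsum {X W B : Type} [TopologicalSpace X] [TopologicalSpace W] [TopologicalSpace B] {u v : Word}
    (hu : u ≠ []) (hv : v ≠ []) (hdis : ∀ a ∈ lab u, a ∉ lab v) (hX : W1 X (u ++ v)) (hW : W1 W u) (hB : W1 B v)
    (hend : EqvGen (PosR v) 0 v.length) : IsConnSum X W B := by
  obtain ⟨c, hc⟩ := exists_fresh (u ++ v)
  simp only [lab_append, List.mem_append, not_or] at hc
  have hP := (pres_cut (X := X) (w := (Empty.elim : Empty → Word)) hu hv hc.1 hc.2 (fun k => k.elim)).2 hX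
  obtain ⟨q, hq, hqf⟩ := hP
  obtain ⟨pr, hpr, hprf⟩ := (W1_iff u).1 hW
  obtain ⟨τ, hτ, hτf⟩ := (W1_iff v).1 hB
  have hm : (0:ℝ) < u.length := by exact_mod_cast List.length_pos_iff.2 hu
  have hp : (0:ℝ) < v.length := by exact_mod_cast List.length_pos_iff.2 hv
  obtain ⟨Ψ, hΨ⟩ := cres_exists hm
  obtain ⟨Ξ, hΞ⟩ := cres_exists hp
  set w := fam (u ++ [(c, true)]) (fam (v ++ [(c, false)]) (Empty.elim : Empty → Word)) with hw
  let f : Disc → W := fun d => pr (inD θ1 d)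
  let g : Disc → B := fun d => τ (inD θ2 d)
  have memf : ∀ z, pr (hΨ.f z) ∈ discCompl f := fun z => (mem_discCompl hprf θ1 _).2 ((hΨ.lift_iff _).1 ⟨z, rfl⟩)
  have memg : ∀ z, τ (hΞ.f z) ∈ discCompl g := fun z => (mem_discCompl hτf θ2 _).2 ((hΞ.lift_iff _).1 ⟨z, rfl⟩)
  let Q : (Σ _ : Option (Option Empty), D) → ConnSumSpace f g := fun p =>
    match p with
    | ⟨none, z⟩ => Quot.mk _ (Sum.inl ⟨pr (hΨ.f z), memf z⟩)
    | ⟨some none, z⟩ => Quot.mk _ (Sum.inr ⟨τ (hΞ.f z), memg z⟩)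
    | ⟨some (some k), _⟩ => k.elim
  have lu : ((u ++ [(c, true)]).length : ℝ) = u.length + 1 := by simp
  have lv : ((v ++ [(c, false)]).length : ℝ) = v.length + 1 := by simp
  -- on-characterizations
  have onu : ∀ a t s, OnAt u a t s → OnP w a t ⟨none, eD (s / (u.length + 1))⟩ := by
    intro a t s h
    refine ⟨s, (OnAt_append _ _ _ _ _).2 (Or.inl h), ?_⟩
    show ee _ = ee (s / ((u ++ [(c, true)]).length : ℝ))
    rw [lu]
  have onv : ∀ a t s, OnAt v a t s → OnP w a t ⟨some none, eD (s / (v.length + 1))⟩ := by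
    intro a t s h
    refine ⟨s, (OnAt_append _ _ _ _ _).2 (Or.inl h), ?_⟩
    show ee _ = ee (s / ((v ++ [(c, false)]).length : ℝ))
    rw [lv]
  have onc1 : ∀ t, OnP w c t ⟨none, eD ((u.length + t) / (u.length + 1))⟩ := by
    intro t
    refine ⟨u.length + t, (OnAt_append _ _ _ _ _).2 (Or.inr ?_), ?_⟩
    · rw [OnAt_single]; simp [tb]
    · show ee _ = ee (_ / ((u ++ [(c, true)]).length : ℝ))
      rw [lu]
  have onc2 : ∀ t, OnP w c t ⟨some none, eD ((v.length + (1 - t)) / (v.length + 1))⟩ := by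
    intro t
    refine ⟨v.length + (1 - t), (OnAt_append _ _ _ _ _).2 (Or.inr ?_), ?_⟩
    · rw [OnAt_single]; simp [tb]
    · show ee _ = ee (_ / ((v ++ [(c, false)]).length : ℝ))
      rw [lv]
  have qrel : ∀ a t, t ∈ Icc (0:ℝ) 1 → ∀ p p', OnP w a t p → OnP w a t p' → q p = q p' :=
    fun a t ht p p' h h' => (hqf _ _).2 (.rel _ _ ⟨a, t, ht, h, h'⟩)
  have eD1 : ∀ n : ℝ, 0 < n → eD ((n + 1) / (n + 1)) = eD 0 := by
    intro n hn
    apply Subtype.ext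
    show ee _ = ee _
    rw [div_self (by linarith), ee_one, ee_zero]
  -- endpoints
  have endv : q ⟨some none, eD 0⟩ = q ⟨some none, eD (v.length / (v.length + 1))⟩ := by
    have : ∀ s s', EqvGen (PosR v) s s' → q ⟨some none, eD (s / (v.length + 1))⟩ = q ⟨some none, eD (s' / (v.length + 1))⟩ := by
      intro s s' h
      induction h with
      | rel s s' h =>
        obtain ⟨a, t, ht, h1, h2⟩ := h
        exact qrel a t ht _ _ (onv _ _ _ h1) (onv _ _ _ h2)
      | refl s => rfl
      | symm s s' _ ih => exact ih.symm
      | trans s s' s'' _ _ h1 h2 => exact h1.trans h2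
    have := this _ _ hend
    rwa [zero_div] at this
  have endu : q ⟨none, eD 0⟩ = q ⟨none, eD (u.length / (u.length + 1))⟩ := by
    have h1 := qrel c 1 (by simp) _ _ (onc1 1) (onc2 1)
    have h0 := qrel c 0 (by simp) _ _ (onc1 0) (onc2 0)
    grind
  have sideu := side (q := fun z => q ⟨none, z⟩) hprf hu hΨ
    (fun a t ht s s' h h' => qrel a t ht _ _ (onu _ _ _ h) (onu _ _ _ h')) endu
  have sidev := side (q := fun z => q ⟨some none, z⟩) hτf hv hΞ
    (fun a t ht s s' h h' => qrel a t ht _ _ (onv _ _ _ h) (onv _ _ _ h')) endv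
  have in1 : ∀ t ∈ Icc (0:ℝ) 1, ∀ d : Disc, θ1 d = sg t → hΨ.f (eD ((u.length + t) / (u.length + 1))) = inD θ1 d := by
    intro t ht d hd
    apply Subtype.ext
    show Ψ (ee _) = (1 + θ1 d) / 2
    rw [hΨ.inn t ht, hd]
  have in2 : ∀ t ∈ Icc (0:ℝ) 1, ∀ d : Disc, θ1 d = sg t → hΞ.f (eD ((v.length + (1 - t)) / (v.length + 1))) = inD θ2 d := by
    intro t ht d hd
    apply Subtype.ext
    show Ξ (ee _) = (1 + θ2 d) / 2
    rw [hΞ.inn (1 - t) ⟨by linarith [ht.2], by linarith [ht.1]⟩, sg_symm, ← hd]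
    rfl
  -- back map
  have lift1 : ∀ x : discCompl f, ∃ z, pr (hΨ.f z) = x := by
    rintro ⟨x, hx⟩
    obtain ⟨y, rfl⟩ := hpr.surjective x
    obtain ⟨z, rfl⟩ := (hΨ.lift_iff y).2 ((mem_discCompl hprf θ1 y).1 hx)
    exact ⟨z, rfl⟩
  have lift2 : ∀ x : discCompl g, ∃ z, τ (hΞ.f z) = x := by
    rintro ⟨x, hx⟩
    obtain ⟨y, rfl⟩ := hτ.surjective x
    obtain ⟨z, rfl⟩ := (hΞ.lift_iff y).2 ((mem_discCompl hτf θ2 y).1 hx)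
    exact ⟨z, rfl⟩
  choose l1 hl1 using lift1
  choose l2 hl2 using lift2
  let R : discCompl f ⊕ discCompl g → X := Sum.elim (fun x => q ⟨none, l1 x⟩) (fun y => q ⟨some none, l2 y⟩)
  have hR : ∀ a b, glueRel f g a b → R a = R b := by
    rintro (a | a) (b | b) ⟨s, hs, h1, h2⟩ <;> simp only [Sum.elim_inl, Sum.elim_inr] at h1 h2
    have hs' : ‖θ1 s‖ = 1 := by rw [θ1.norm_map]; simpa using hs
    obtain ⟨t, ht, e⟩ := sg_surj _ hs'
    have e1 : q ⟨none, l1 a⟩ = q ⟨none, eD ((u.length + t) / (u.length + 1))⟩ := by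
      apply sideu
      rw [hl1, h1, in1 t ht s e.symm]
    have e2 : q ⟨some none, l2 b⟩ = q ⟨some none, eD ((v.length + (1 - t)) / (v.length + 1))⟩ := by
      apply sidev
      rw [hl2, h2, in2 t ht s e.symm]
    show q _ = q _
    rw [e1, e2]
    exact qrel c t ht _ _ (onc1 t) (onc2 t)
  let R' : ConnSumSpace f g → X := Quot.lift R hR
  have hRQ : ∀ p, R' (Q p) = q p := by
    rintro ⟨_ | _ | k, z⟩
    · exact sideu _ _ (hl1 _)
    · exact sidev _ _ (hl2 _)
    · exact k.elim
  -- forward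
  have posu : ∀ a t (z : D), OnP w a t ⟨none, z⟩ → (∃ s, OnAt u a t s ∧ z = eD (s / (u.length + 1))) ∨
      (a = c ∧ z = eD ((u.length + t) / (u.length + 1))) := by
    rintro a t z ⟨s, hs, e⟩
    change (z:ℂ) = ee (s / ((u ++ [(c, true)]).length : ℝ)) at e
    rw [lu] at e
    rcases (OnAt_append _ _ _ _ _).1 hs with h | h
    · exact Or.inl ⟨s, h, Subtype.ext e⟩
    · rw [OnAt_single] at h
      simp only [tb, if_true] at h
      refine Or.inr ⟨h.1.symm, Subtype.ext (e.trans ?_)⟩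
      rw [← h.2]; show _ = ee _; congr 2; ring
  have posv : ∀ a t (z : D), OnP w a t ⟨some none, z⟩ → (∃ s, OnAt v a t s ∧ z = eD (s / (v.length + 1))) ∨
      (a = c ∧ z = eD ((v.length + (1 - t)) / (v.length + 1))) := by
    rintro a t z ⟨s, hs, e⟩
    change (z:ℂ) = ee (s / ((v ++ [(c, false)]).length : ℝ)) at e
    rw [lv] at e
    rcases (OnAt_append _ _ _ _ _).1 hs with h | h
    · exact Or.inl ⟨s, h, Subtype.ext e⟩
    · rw [OnAt_single] at h
      have h2 : s - v.length = 1 - t := by simpa [tb] using h.2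
      refine Or.inr ⟨h.1.symm, Subtype.ext (e.trans ?_)⟩
      rw [← h2]; show _ = ee _; congr 2; ring
  have Qu : ∀ a, ∀ t ∈ Icc (0:ℝ) 1, ∀ s s', OnAt u a t s → OnAt u a t s' →
      Q ⟨none, eD (s / (u.length + 1))⟩ = Q ⟨none, eD (s' / (u.length + 1))⟩ := by
    intro a t ht s s' h h'
    show Quot.mk _ _ = Quot.mk _ _
    congr 2
    apply Subtype.ext
    refine (hprf _ _).2 (.rel _ _ ⟨a, t, ht, ⟨s, h, hΨ.arc s (h.range ht)⟩, ⟨s', h', hΨ.arc s' (h'.range ht)⟩⟩)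
  have Qv : ∀ a, ∀ t ∈ Icc (0:ℝ) 1, ∀ s s', OnAt v a t s → OnAt v a t s' →
      Q ⟨some none, eD (s / (v.length + 1))⟩ = Q ⟨some none, eD (s' / (v.length + 1))⟩ := by
    intro a t ht s s' h h'
    show Quot.mk _ _ = Quot.mk _ _
    congr 2
    apply Subtype.ext
    refine (hτf _ _).2 (.rel _ _ ⟨a, t, ht, ⟨s, h, hΞ.arc s (h.range ht)⟩, ⟨s', h', hΞ.arc s' (h'.range ht)⟩⟩)
  have Qc : ∀ t ∈ Icc (0:ℝ) 1, Q ⟨none, eD ((u.length + t) / (u.length + 1))⟩ =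
      Q ⟨some none, eD ((v.length + (1 - t)) / (v.length + 1))⟩ := by
    intro t ht
    apply Quot.sound
    have hn : ‖θ1.symm (sg t)‖ = 1 := by rw [θ1.symm.norm_map, sg_norm t ht]
    refine ⟨⟨θ1.symm (sg t), mem_closedBall_zero_iff.2 hn.le⟩, by simpa using hn, ?_, ?_⟩
    · simp only [Sum.elim_inl]
      rw [in1 t ht ⟨θ1.symm (sg t), mem_closedBall_zero_iff.2 hn.le⟩ (θ1.apply_symm_apply _)]
    · simp only [Sum.elim_inr]
      rw [in2 t ht ⟨θ1.symm (sg t), mem_closedBall_zero_iff.2 hn.le⟩ (θ1.apply_symm_apply _)]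
  have Quv : ∀ a t s s', OnAt u a t s → OnAt v a t s' → False := fun a t s s' h h' => hdis a h.mem h'.mem
  have Quc : ∀ a t s, OnAt u a t s → a = c → False := by rintro a t s h rfl; exact hc.1 h.mem
  have Qvc : ∀ a t s, OnAt v a t s → a = c → False := by rintro a t s h rfl; exact hc.2 h.mem
  have hfw : ∀ p p', EqvGen (RR w) p p' → Q p = Q p' := by
    intro p p' h
    induction h with
    | rel p p' h =>
      obtain ⟨a, t, ht, h1, h2⟩ := h
      rcases p with ⟨_ | _ | k, z⟩ <;> rcases p' with ⟨_ | _ | k', z'⟩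
      · rcases posu _ _ _ h1 with ⟨s, hs, rfl⟩ | ⟨hac, rfl⟩ <;> rcases posu _ _ _ h2 with ⟨s', hs', rfl⟩ | ⟨hac', rfl⟩
        · exact Qu a t ht s s' hs hs'
        · exact (Quc _ _ _ hs hac').elim
        · exact (Quc _ _ _ hs' hac).elim
        · rfl
      · rcases posu _ _ _ h1 with ⟨s, hs, rfl⟩ | ⟨hac, rfl⟩ <;> rcases posv _ _ _ h2 with ⟨s', hs', rfl⟩ | ⟨hac', rfl⟩
        · exact (Quv _ _ _ _ hs hs').elim
        · exact (Quc _ _ _ hs hac').elim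
        · exact (Qvc _ _ _ hs' hac).elim
        · exact Qc t ht
      · exact k'.elim
      · rcases posv _ _ _ h1 with ⟨s, hs, rfl⟩ | ⟨hac, rfl⟩ <;> rcases posu _ _ _ h2 with ⟨s', hs', rfl⟩ | ⟨hac', rfl⟩
        · exact (Quv _ _ _ _ hs' hs).elim
        · exact (Qvc _ _ _ hs hac').elim
        · exact (Quc _ _ _ hs' hac).elim
        · exact (Qc t ht).symm
      · rcases posv _ _ _ h1 with ⟨s, hs, rfl⟩ | ⟨hac, rfl⟩ <;> rcases posv _ _ _ h2 with ⟨s', hs', rfl⟩ | ⟨hac', rfl⟩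
        · exact Qv a t ht s s' hs hs'
        · exact (Qvc _ _ _ hs hac').elim
        · exact (Qvc _ _ _ hs' hac).elim
        · rfl
      · exact k'.elim
      all_goals exact k.elim
    | refl p => rfl
    | symm p p' _ ih => exact ih.symm
    | trans p p' p'' _ _ h1 h2 => exact h1.trans h2
  -- quotient map
  have Q1c : Continuous fun z : D => Q ⟨none, z⟩ :=
    (continuous_quot_mk (r := glueRel f g)).comp (continuous_inl.comp (Continuous.subtype_mk (hpr.continuous.comp hΨ.f_cont) memf))
  have Q2c : Continuous fun z : D => Q ⟨some none, z⟩ :=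
    (continuous_quot_mk (r := glueRel f g)).comp (continuous_inr.comp (Continuous.subtype_mk (hτ.continuous.comp hΞ.f_cont) memg))
  have hQ : IsQuotientMap Q := by
    rw [isQuotientMap_iff_isClosed]
    constructor
    · rintro x
      obtain ⟨a, rfl⟩ := Quot.exists_rep x
      rcases a with a | a
      · refine ⟨⟨none, l1 a⟩, ?_⟩
        show Quot.mk _ _ = _
        congr 2; exact Subtype.ext (hl1 a)
      · refine ⟨⟨some none, l2 a⟩, ?_⟩
        show Quot.mk _ _ = _
        congr 2; exact Subtype.ext (hl2 a)
    · intro S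
      constructor
      · intro h
        refine h.preimage (continuous_sigma fun i => ?_)
        match i with
        | none => exact Q1c
        | some none => exact Q2c
        | some (some k) => exact k.elim
      · intro h
        refine (isQuotientMap_quot_mk (r := glueRel f g)).isClosed_preimage.1 (isClosed_sum_iff.2 ?_)
        have hc1 : IsClosed {z : D | Q ⟨none, z⟩ ∈ S} :=
          h.preimage (continuous_sigmaMk (σ := fun _ : Option (Option Empty) => D) (i := none))
        have hc2 : IsClosed {z : D | Q ⟨some none, z⟩ ∈ S} :=
          h.preimage (continuous_sigmaMk (σ := fun _ : Option (Option Empty) => D) (i := some none))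
        constructor
        · apply closed_side hpr hprf hΨ θ1
          convert hc1 using 1
          ext z
          constructor
          · rintro ⟨x, hx, e⟩
            have : x = ⟨pr (hΨ.f z), memf z⟩ := Subtype.ext e
            rw [this] at hx; exact hx
          · intro hz
            exact ⟨⟨pr (hΨ.f z), memf z⟩, hz, rfl⟩
        · apply closed_side hτ hτf hΞ θ2
          convert hc2 using 1
          ext z
          constructor
          · rintro ⟨x, hx, e⟩
            have : x = ⟨τ (hΞ.f z), memg z⟩ := Subtype.ext e
            rw [this] at hx; exact hx
          · intro hz
            exact ⟨⟨τ (hΞ.f z), memg z⟩, hz, rfl⟩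
  refine ⟨f, g, disc_emb hpr hprf θ1, disc_emb hτ hτf θ2, quot_homeo hq hQ fun p p' => ?_⟩
  rw [hqf]
  constructor
  · exact hfw p p'
  · intro h
    rw [← hqf, ← hRQ p, ← hRQ p', h]

theorem tb_tb (b : Bool) (t : ℝ) : tb b (tb b t) = t := by cases b <;> simp [tb]

theorem W1_of {B : Type} [TopologicalSpace B] [T2Space B] {u : Word} (pr : D → B) (hc : Continuous pr)
    (hs : Surjective pr) (h1 : ∀ z z', Rw u z z' → pr z = pr z')
    (h2 : ∀ z z', pr z = pr z' → EqvGen (Rw u) z z') : W1 B u := by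
  refine (W1_iff u).2 ⟨pr, IsQuotientMap.of_surjective_continuous hs hc, fun z z' => ⟨h2 z z', fun h => ?_⟩⟩
  induction h with
  | rel p q h => exact h1 p q h
  | refl p => rfl
  | symm p q _ ih => exact ih.symm
  | trans p q s _ _ h1 h2 => exact h1.trans h2

theorem W1_unique {X Y : Type} [TopologicalSpace X] [TopologicalSpace Y] {u : Word} (h : W1 X u) (h' : W1 Y u) :
    Nonempty (X ≃ₜ Y) := by
  obtain ⟨pr, hpr, hf⟩ := (W1_iff u).1 h
  obtain ⟨τ, hτ, hg⟩ := (W1_iff u).1 h'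
  exact quot_homeo hpr hτ fun a b => (hf a b).trans (hg a b).symm

def sq1 (w : ℂ) : ℂ := w ^ 2 / ‖w‖

theorem norm_sq1 (w : ℂ) : ‖sq1 w‖ = ‖w‖ := by
  by_cases h : w = 0
  · simp [sq1, h]
  · have : ‖w‖ ≠ 0 := norm_ne_zero_iff.2 h
    simp [sq1]; field_simp

theorem sq1_cont : Continuous sq1 := by
  rw [continuous_iff_continuousAt]
  intro w
  by_cases h : w = 0
  · subst h
    have h0 : sq1 0 = 0 := by simp [sq1]
    rw [ContinuousAt, h0, tendsto_zero_iff_norm_tendsto_zero]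
    simp only [norm_sq1]
    simpa using (continuous_norm (E := ℂ)).tendsto 0
  · unfold sq1
    refine ContinuousAt.div (by fun_prop) (by fun_prop) ?_
    exact_mod_cast norm_ne_zero_iff.2 h

theorem sq1_inj {w w' : ℂ} (h : sq1 w = sq1 w') : w = w' ∨ w = -w' := by
  have hn : ‖w‖ = ‖w'‖ := by rw [← norm_sq1, h, norm_sq1]
  by_cases h0 : w = 0
  · left; rw [h0, norm_zero] at hn; rw [h0, norm_eq_zero.1 hn.symm]
  · have : (‖w‖:ℂ) ≠ 0 := by exact_mod_cast norm_ne_zero_iff.2 h0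
    unfold sq1 at h
    grind

theorem sq1_surj (ζ : ℂ) : ∃ w : ℂ, 0 ≤ w.im ∧ sq1 w = ζ := by
  by_cases h : ζ = 0
  · exact ⟨0, by simp, by simp [sq1, h]⟩
  obtain ⟨w, hw⟩ := IsAlgClosed.exists_pow_nat_eq (ζ * ‖ζ‖) (n := 2) (by norm_num)
  have hn : ‖w‖ = ‖ζ‖ := by
    have := congrArg norm hw
    simp only [norm_pow, norm_mul, norm_real, norm_norm] at this
    nlinarith [norm_nonneg w, norm_nonneg ζ]
  have h0 : (‖ζ‖:ℂ) ≠ 0 := by exact_mod_cast norm_ne_zero_iff.2 h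
  rcases le_total 0 w.im with h1 | h1
  · exact ⟨w, h1, by rw [sq1, hw, hn]; field_simp⟩
  · exact ⟨-w, by simpa using h1, by rw [sq1, norm_neg, hn, neg_sq, hw]; field_simp⟩

theorem D_sq (z : D) : (z:ℂ).re ^ 2 + (z:ℂ).im ^ 2 ≤ 1 := by
  have h := mem_closedBall_zero_iff.1 z.2
  have h2 := Complex.sq_norm (z:ℂ)
  rw [normSq_apply] at h2
  nlinarith [norm_nonneg (z:ℂ)]

theorem D_norm (z : ℂ) (h : z.re ^ 2 + z.im ^ 2 = 1) : ‖z‖ = 1 := by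
  have h2 := Complex.sq_norm z
  rw [normSq_apply] at h2
  nlinarith [norm_nonneg z]

theorem D_mem {z : ℂ} (h : z.re ^ 2 + z.im ^ 2 ≤ 1) : z ∈ closedBall (0:ℂ) 1 := by
  rw [mem_closedBall_zero_iff]
  have h2 := Complex.sq_norm z
  rw [normSq_apply] at h2
  nlinarith [norm_nonneg z]

/-- height over the disc -/
def ht (z : D) : ℝ := √(1 - ((z:ℂ).re ^ 2 + (z:ℂ).im ^ 2))

theorem ht_cont : Continuous ht := by unfold ht; fun_prop
theorem ht_nonneg (z : D) : 0 ≤ ht z := Real.sqrt_nonneg _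
theorem ht_sq (z : D) : (z:ℂ).re ^ 2 + (z:ℂ).im ^ 2 + ht z ^ 2 = 1 := by
  rw [ht, Real.sq_sqrt (by linarith [D_sq z])]; ring
theorem ht_zero {z : D} (h : ‖(z:ℂ)‖ = 1) : ht z = 0 := by
  have h2 := Complex.sq_norm (z:ℂ)
  rw [normSq_apply, h] at h2
  have := ht_sq z
  nlinarith [ht_nonneg z]
theorem ht_eq {z : D} {s : ℝ} (hs : 0 ≤ s) (h : (z:ℂ).re ^ 2 + (z:ℂ).im ^ 2 + s ^ 2 = 1) : ht z = s := by
  have := ht_sq z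
  nlinarith [ht_nonneg z]

def sphM (z : D) : Sphere2 :=
  ⟨!₂[(z:ℂ).re, (sq1 ⟨(z:ℂ).im, ht z⟩).re, (sq1 ⟨(z:ℂ).im, ht z⟩).im], by
    rw [mem_sphere_zero_iff_norm, EuclideanSpace.norm_eq, Real.sqrt_eq_one, Fin.sum_univ_three]
    have h1 := Complex.sq_norm (sq1 ⟨(z:ℂ).im, ht z⟩)
    rw [norm_sq1, Complex.sq_norm, normSq_apply, normSq_apply] at h1
    have := ht_sq z
    simp only [Real.norm_eq_abs, sq_abs]
    simp at h1 ⊢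
    nlinarith⟩

theorem W1_sphere (x : ℕ × Bool) : W1 Sphere2 [x, flipL x] := by
  have : T2Space Sphere2 := by unfold Sphere2; infer_instance
  have key : ∀ z z' : D, ‖(z:ℂ)‖ = 1 → (z':ℂ) = (starRingEnd ℂ) z → Rw [x, flipL x] z z' := by
    intro z z' hz hzz
    obtain ⟨θ, hθ, e⟩ := ee_surj hz
    rw [mem_Ico] at hθ
    by_cases h : θ ≤ 1/2
    · refine ⟨x.1, tb x.2 (2*θ), tb_mem ⟨by linarith, by linarith⟩, ⟨2*θ, ?_, ?_⟩, ⟨2 - 2*θ, ?_, ?_⟩⟩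
      · simp [OnAt, tb_tb]
      · rw [← e]; simp
      · simp only [OnAt, flipL, tb_not, tb_tb]; right; left; exact ⟨trivial, by ring⟩
      · rw [hzz, ← e, ← ee_neg]; refine ee_eq.2 ⟨-1, ?_⟩; push_cast [List.length]; ring
    · refine ⟨x.1, tb x.2 (2-2*θ), tb_mem ⟨by linarith, by linarith⟩, ⟨2*θ, ?_, ?_⟩, ⟨2 - 2*θ, ?_, ?_⟩⟩
      · simp only [OnAt, flipL, tb_not, tb_tb]; right; left; exact ⟨trivial, by ring⟩
      · rw [← e]; simp
      · simp [OnAt, tb_tb]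
      · rw [hzz, ← e, ← ee_neg]; refine ee_eq.2 ⟨-1, ?_⟩; push_cast [List.length]; ring
  have key2 : ∀ z z' : D, Rw [x, flipL x] z z' → ‖(z:ℂ)‖ = 1 ∧ ((z':ℂ) = z ∨ (z':ℂ) = (starRingEnd ℂ) z) := by
    intro z z' h
    refine ⟨(Rw_norm h).1, ?_⟩
    obtain ⟨a, t, ht, ⟨s, h1, e1⟩, ⟨s', h2, e2⟩⟩ := h
    simp only [OnAt, or_false, flipL, tb_not] at h1 h2
    rw [e1, e2, ← ee_neg]
    rcases h1 with ⟨-, h1⟩ | ⟨-, h1⟩ <;> rcases h2 with ⟨-, h2⟩ | ⟨-, h2⟩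
    · left; rw [h1, h2]
    · right; refine ee_eq.2 ⟨1, ?_⟩; push_cast [List.length]; linarith
    · right; refine ee_eq.2 ⟨1, ?_⟩; push_cast [List.length]; linarith
    · left; rw [show s = s' by linarith]
  have hc : Continuous fun z : D => sq1 ⟨(z:ℂ).im, ht z⟩ := by
    refine sq1_cont.comp ?_
    have : (fun z : D => (⟨(z:ℂ).im, ht z⟩ : ℂ)) = fun z : D => ((z:ℂ).im : ℂ) + ht z * I := by
      funext z; apply Complex.ext <;> simp
    rw [this]; have := ht_cont; fun_prop
  refine W1_of sphM (Continuous.subtype_mk ?_ _) ?_ ?_ ?_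
  · fun_prop
  · rintro ⟨v, hv⟩
    rw [mem_sphere_zero_iff_norm, EuclideanSpace.norm_eq, Real.sqrt_eq_one, Fin.sum_univ_three] at hv
    simp only [Real.norm_eq_abs, sq_abs] at hv
    obtain ⟨w, hw, e⟩ := sq1_surj ⟨v 1, v 2⟩
    have hn := norm_sq1 w
    rw [e] at hn
    have hn2 : v 1 ^ 2 + v 2 ^ 2 = w.re ^ 2 + w.im ^ 2 := by
      have := congrArg (· ^ 2) hn
      simp only [Complex.sq_norm, normSq_apply] at this; linarith
    let z : D := ⟨⟨v 0, w.re⟩, D_mem (by simp; nlinarith [sq_nonneg w.im])⟩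
    have hz : ht z = w.im := ht_eq hw (by simp [z]; linarith)
    refine ⟨z, Subtype.ext ?_⟩
    have : sq1 ⟨(z:ℂ).im, ht z⟩ = ⟨v 1, v 2⟩ := by rw [hz, ← e]
    simp only [sphM, this]
    ext i; fin_cases i <;> simp [z]
  · intro z z' h
    obtain ⟨h1, h2 | h2⟩ := key2 z z' h
    · rw [Subtype.ext h2]
    · have hz : ht z = 0 := ht_zero h1
      have hz' : ht z' = 0 := ht_zero (Rw_norm h).2
      refine Subtype.ext ?_
      have : sq1 ⟨(z:ℂ).im, ht z⟩ = sq1 ⟨(z':ℂ).im, ht z'⟩ := by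
        rw [hz, hz', h2, conj_im]
        have : (⟨-(z:ℂ).im, 0⟩ : ℂ) = -⟨(z:ℂ).im, 0⟩ := by apply Complex.ext <;> simp
        rw [this, sq1, sq1, neg_sq, norm_neg]
      have h3 : (z':ℂ).re = (z:ℂ).re := by rw [h2, conj_re]
      simp only [sphM, this, h3]
  · intro z z' h
    have h := congrArg (fun p : Sphere2 => (p.1 : EuclideanSpace ℝ (Fin 3))) h
    simp only [sphM] at h
    have h0 := congrFun (congrArg (fun p : EuclideanSpace ℝ (Fin 3) => p.ofLp) h) 0
    have h1 := congrFun (congrArg (fun p : EuclideanSpace ℝ (Fin 3) => p.ofLp) h) 1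
    have h2 := congrFun (congrArg (fun p : EuclideanSpace ℝ (Fin 3) => p.ofLp) h) 2
    simp at h0 h1 h2
    rcases sq1_inj (Complex.ext h1 h2) with e | e
    · have := congrArg re e
      have e : z = z' := Subtype.ext (Complex.ext h0 this)
      rw [e]; exact .refl _
    · have e1 := congrArg re e
      have e2 := congrArg im e
      simp at e1 e2
      have hz : ht z = 0 := by linarith [ht_nonneg z, ht_nonneg z']
      refine .rel _ _ (key z z' (D_norm _ ?_) ?_)
      · have := ht_sq z; rw [hz] at this; linarith
      · apply Complex.ext
        · simp [h0]
        · simp [e1]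

abbrev E3 := EuclideanSpace ℝ (Fin 3)

theorem rp_ker (v w : {v : E3 // v ≠ 0}) : (Quotient.mk (projectivizationSetoid ℝ E3) v = Quotient.mk (projectivizationSetoid ℝ E3) w) ↔
    ∃ c : ℝ, c • (w:E3) = v := by
  exact Projectivization.mk_eq_mk_iff' ℝ v.1 w.1 v.2 w.2

theorem rp_t2 : T2Space RP2 := by
  let F : {v : E3 // v ≠ 0} → (Fin 3 → Fin 3 → ℝ) := fun v i j => v.1 i * v.1 j / ‖v.1‖ ^ 2
  have hF : Continuous F := by
    refine continuous_pi fun i => continuous_pi fun j => ?_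
    refine Continuous.div (by fun_prop) (by fun_prop) fun v => ?_
    exact pow_ne_zero _ (norm_ne_zero_iff.2 v.2)
  have hF2 : ∀ v w, F v = F w ↔ Quotient.mk (projectivizationSetoid ℝ E3) v = Quotient.mk (projectivizationSetoid ℝ E3) w := by
    intro v w
    rw [rp_ker]
    have hv : ‖v.1‖ ≠ 0 := norm_ne_zero_iff.2 v.2
    have hw : ‖w.1‖ ≠ 0 := norm_ne_zero_iff.2 w.2
    constructor
    · intro h
      obtain ⟨j, hj⟩ : ∃ j, w.1 j ≠ 0 := by
        by_contra! hc
        exact w.2 (by ext i; simp [hc i])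
      have h' : ∀ i, v.1 i * v.1 j / ‖v.1‖ ^ 2 = w.1 i * w.1 j / ‖w.1‖ ^ 2 := fun i => congrFun (congrFun h i) j
      have hvj : v.1 j ≠ 0 := by
        intro h0
        have := h' j
        rw [h0, mul_zero, zero_div] at this
        exact (div_ne_zero (mul_ne_zero hj hj) (pow_ne_zero 2 hw)) this.symm
      refine ⟨‖v.1‖ ^ 2 * w.1 j / (‖w.1‖ ^ 2 * v.1 j), ?_⟩
      ext i
      have := h' i
      simp only [PiLp.smul_apply, smul_eq_mul]
      field_simp at this ⊢
      linarith
    · rintro ⟨c, hc⟩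
      have hc0 : c ≠ 0 := by rintro rfl; exact v.2 (by rw [← hc, zero_smul])
      funext i j
      simp only [F, ← hc, PiLp.smul_apply, smul_eq_mul, norm_smul, Real.norm_eq_abs, mul_pow, sq_abs]
      field_simp
  let G : RP2 → (Fin 3 → Fin 3 → ℝ) := Quotient.lift F fun v w h => (hF2 v w).2 (Quotient.sound h)
  have hG : Continuous G := hF.quotient_lift _
  refine T2Space.of_injective_continuous (f := G) ?_ hG
  intro p q
  induction p using Quotient.ind with | _ v
  induction q using Quotient.ind with | _ w
  exact (hF2 v w).1

def rpv (z : D) : {v : E3 // v ≠ 0} := ⟨!₂[(z:ℂ).re, (z:ℂ).im, ht z], by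
  intro h
  have h0 := congrFun (congrArg (fun p : E3 => p.ofLp) h) 0
  have h1 := congrFun (congrArg (fun p : E3 => p.ofLp) h) 1
  have h2 := congrFun (congrArg (fun p : E3 => p.ofLp) h) 2
  simp at h0 h1 h2
  have := ht_sq z
  rw [h0, h1, h2] at this; norm_num at this⟩

def rpM (z : D) : RP2 := Quotient.mk (projectivizationSetoid ℝ E3) (rpv z)

theorem rpM_eq (z z' : D) : rpM z = rpM z' ↔ ∃ c : ℝ, c * (z':ℂ).re = (z:ℂ).re ∧ c * (z':ℂ).im = (z:ℂ).im ∧ c * ht z' = ht z := by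
  refine (rp_ker _ _).trans (exists_congr fun c => ?_)
  constructor
  · intro h
    have h0 := congrFun (congrArg (fun p : E3 => p.ofLp) h) 0
    have h1 := congrFun (congrArg (fun p : E3 => p.ofLp) h) 1
    have h2 := congrFun (congrArg (fun p : E3 => p.ofLp) h) 2
    simp [rpv] at h0 h1 h2
    exact ⟨h0, h1, h2⟩
  · rintro ⟨h0, h1, h2⟩
    ext i; fin_cases i <;> simp [rpv, h0, h1, h2]

theorem W1_rp (x : ℕ × Bool) : W1 RP2 [x, x] := by
  have := rp_t2
  have key : ∀ z z' : D, ‖(z:ℂ)‖ = 1 → (z':ℂ) = - z → Rw [x, x] z z' := by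
    intro z z' hz hzz
    obtain ⟨θ, hθ, e⟩ := ee_surj hz
    rw [mem_Ico] at hθ
    have hm : -(z:ℂ) = ee (θ + 1/2) := by rw [ee_add, ee_half, e]; ring
    by_cases h : θ ≤ 1/2
    · refine ⟨x.1, tb x.2 (2*θ), tb_mem ⟨by linarith, by linarith⟩, ⟨2*θ, ?_, ?_⟩, ⟨1 + 2*θ, ?_, ?_⟩⟩
      · simp [OnAt, tb_tb]
      · rw [← e]; simp
      · simp [OnAt, tb_tb]
      · rw [hzz, hm]; congr 1; push_cast [List.length]; ring
    · refine ⟨x.1, tb x.2 (2*θ-1), tb_mem ⟨by linarith, by linarith⟩, ⟨2*θ, ?_, ?_⟩, ⟨2*θ-1, ?_, ?_⟩⟩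
      · simp [OnAt, tb_tb]
      · rw [← e]; simp
      · simp [OnAt, tb_tb]
      · rw [hzz, hm]; refine ee_eq.2 ⟨1, ?_⟩; push_cast [List.length]; ring
  have key2 : ∀ z z' : D, Rw [x, x] z z' → ‖(z:ℂ)‖ = 1 ∧ ((z':ℂ) = z ∨ (z':ℂ) = - z) := by
    intro z z' h
    refine ⟨(Rw_norm h).1, ?_⟩
    obtain ⟨a, t, ht, ⟨s, h1, e1⟩, ⟨s', h2, e2⟩⟩ := h
    simp only [OnAt, or_false] at h1 h2
    have hm : -ee (s / ([x,x] : Word).length) = ee (s / 2 + 1/2) := by rw [ee_add, ee_half]; push_cast [List.length]; norm_num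
    rw [e1, e2, hm]
    rcases h1 with ⟨-, h1⟩ | ⟨-, h1⟩ <;> rcases h2 with ⟨-, h2⟩ | ⟨-, h2⟩
    · left; rw [h1, h2]
    · right; refine ee_eq.2 ⟨0, ?_⟩; push_cast [List.length]; linarith
    · right; refine ee_eq.2 ⟨-1, ?_⟩; push_cast [List.length]; linarith
    · left; rw [show s = s' by linarith]
  refine W1_of rpM ?_ ?_ ?_ ?_
  · refine continuous_quotient_mk'.comp (Continuous.subtype_mk ?_ _)
    refine (PiLp.continuous_toLp 2 _).comp (continuous_pi fun i => ?_)
    have := ht_cont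
    fin_cases i <;> simp <;> fun_prop
  · intro p
    induction p using Quotient.ind with | _ v
    have hn : 0 < v.1 0 ^ 2 + v.1 1 ^ 2 + v.1 2 ^ 2 := by
      by_contra hc
      refine v.2 ?_
      ext i; fin_cases i <;> simp <;> nlinarith [sq_nonneg (v.1 0), sq_nonneg (v.1 1), sq_nonneg (v.1 2)]
    obtain ⟨r, hr, hr2⟩ : ∃ r : ℝ, 0 ≤ r * v.1 2 ∧ r ^ 2 * (v.1 0 ^ 2 + v.1 1 ^ 2 + v.1 2 ^ 2) = 1 := by
      have h1 : ((√(v.1 0 ^ 2 + v.1 1 ^ 2 + v.1 2 ^ 2))⁻¹) ^ 2 * (v.1 0 ^ 2 + v.1 1 ^ 2 + v.1 2 ^ 2) = 1 := by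
        rw [inv_pow, Real.sq_sqrt hn.le, inv_mul_cancel₀ hn.ne']
      have h2 : 0 ≤ (√(v.1 0 ^ 2 + v.1 1 ^ 2 + v.1 2 ^ 2))⁻¹ := by positivity
      rcases le_total 0 (v.1 2) with h | h
      · exact ⟨_, mul_nonneg h2 h, h1⟩
      · exact ⟨_, mul_nonneg_of_nonpos_of_nonpos (neg_nonpos.2 h2) h, by rw [neg_sq]; exact h1⟩
    let z : D := ⟨⟨r * v.1 0, r * v.1 1⟩, D_mem (by simp; nlinarith [sq_nonneg (r * v.1 2)])⟩
    have hz : ht z = r * v.1 2 := ht_eq hr (by simp [z]; linarith)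
    refine ⟨z, (rp_ker _ _).2 ⟨r, ?_⟩⟩
    ext i; fin_cases i <;> simp [rpv, hz, z]
  · intro z z' h
    obtain ⟨h1, h2 | h2⟩ := key2 z z' h
    · rw [Subtype.ext h2]
    · refine (rpM_eq _ _).2 ⟨-1, ?_, ?_, ?_⟩
      · rw [h2]; simp
      · rw [h2]; simp
      · rw [ht_zero h1, ht_zero (Rw_norm h).2]; simp
  · intro z z' h
    obtain ⟨c, h0, h1, h2⟩ := (rpM_eq _ _).1 h
    have hc : c ^ 2 = 1 := by
      have := ht_sq z
      rw [← h0, ← h1, ← h2] at this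
      have h3 := ht_sq z'
      linear_combination this - c ^ 2 * h3
    rcases (sq_eq_sq_iff_eq_or_eq_neg (b := (1:ℝ))).1 (by rw [hc, one_pow]) with rfl | rfl
    · rw [show z = z' from Subtype.ext (Complex.ext (by linarith) (by linarith))]; exact .refl _
    · have hz : ht z = 0 := by linarith [ht_nonneg z, ht_nonneg z']
      refine .rel _ _ (key z z' (D_norm _ ?_) ?_)
      · have := ht_sq z; rw [hz] at this; linarith
      · apply Complex.ext <;> simp <;> linarith

def sqh (τ : ℝ) : ℂ := ⟨max 0 (min 1 (min (4*τ) (3 - 4*τ))), max 0 (min 1 (min (4*τ-1) (4 - 4*τ)))⟩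

theorem sqh1 {τ : ℝ} (h0 : 0 ≤ τ) (h1 : 4*τ ≤ 1) : sqh τ = ⟨4*τ, 0⟩ := by
  unfold sqh; congr 1
  · grind
  · grind
theorem sqh2 {τ : ℝ} (h0 : 1 ≤ 4*τ) (h1 : 4*τ ≤ 2) : sqh τ = ⟨1, 4*τ-1⟩ := by
  unfold sqh; congr 1
  · grind
  · grind
theorem sqh3 {τ : ℝ} (h0 : 2 ≤ 4*τ) (h1 : 4*τ ≤ 3) : sqh τ = ⟨3 - 4*τ, 1⟩ := by
  unfold sqh; congr 1
  · grind
  · grind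
theorem sqh4 {τ : ℝ} (h0 : 3 ≤ 4*τ) (h1 : 4*τ ≤ 4) : sqh τ = ⟨0, 4 - 4*τ⟩ := by
  unfold sqh; congr 1
  · grind
  · grind

theorem sqh_cases {τ : ℝ} (h : τ ∈ Icc (0:ℝ) 1) : (4*τ ≤ 1 ∧ sqh τ = ⟨4*τ, 0⟩) ∨ (1 ≤ 4*τ ∧ 4*τ ≤ 2 ∧ sqh τ = ⟨1, 4*τ-1⟩) ∨
    (2 ≤ 4*τ ∧ 4*τ ≤ 3 ∧ sqh τ = ⟨3 - 4*τ, 1⟩) ∨ (3 ≤ 4*τ ∧ sqh τ = ⟨0, 4-4*τ⟩) := by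
  rcases le_total (4*τ) 1 with a | a
  · exact Or.inl ⟨a, sqh1 h.1 a⟩
  rcases le_total (4*τ) 2 with b | b
  · exact Or.inr (Or.inl ⟨a, b, sqh2 a b⟩)
  rcases le_total (4*τ) 3 with c | c
  · exact Or.inr (Or.inr (Or.inl ⟨b, c, sqh3 b c⟩))
  · exact Or.inr (Or.inr (Or.inr ⟨c, sqh4 c (by linarith [h.2])⟩))

theorem square_map : ∃ Φ : ℂ → ℂ, ContinuousOn Φ (closedBall 0 1) ∧ InjOn Φ (closedBall 0 1) ∧
      Φ '' closedBall 0 1 = Icc 0 1 ×ℂ Icc 0 1 ∧ ∀ τ ∈ Icc (0:ℝ) 1, Φ (ee τ) = sqh τ := by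
  refine cone (x0 := ⟨1/2, 1/2⟩) ?_ ?_ ?_ ?_ ?_ ?_ ?_
  · have : sqh = fun τ => ((max 0 (min 1 (min (4*τ) (3 - 4*τ))) : ℝ) : ℂ) +
        ((max 0 (min 1 (min (4*τ-1) (4 - 4*τ))) : ℝ) : ℂ) * I := by
      funext τ; apply Complex.ext <;> simp [sqh]
    rw [this]; fun_prop
  · rw [sqh1 le_rfl (by norm_num), sqh4 (by norm_num) (by norm_num)]; norm_num
  · intro s hs t ht e
    have h1 := sqh_cases ⟨hs.1, hs.2.le⟩
    have h2 := sqh_cases ⟨ht.1, ht.2.le⟩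
    grind
  · exact ((convex_Icc (0:ℝ) 1).linear_preimage reLm).inter ((convex_Icc (0:ℝ) 1).linear_preimage imLm)
  · exact isCompact_Icc.reProdIm isCompact_Icc
  · rw [frontier_reProdIm, closure_Icc, frontier_Icc zero_le_one]
    ext z
    simp only [mem_image, mem_union, mem_reProdIm, mem_Icc, mem_insert_iff, mem_singleton_iff]
    constructor
    · rintro ⟨τ, hτ, rfl⟩
      rw [mem_Ico] at hτ
      rcases sqh_cases ⟨hτ.1, hτ.2.le⟩ with ⟨a, h⟩ | ⟨a, a', h⟩ | ⟨a, a', h⟩ | ⟨a, h⟩ <;> rw [h] <;> simp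
      all_goals grind
    · rintro (⟨h, h' | h'⟩ | ⟨h' | h', h⟩)
      · by_cases h1 : z.re = 1
        · exact ⟨1/4, ⟨by norm_num, by norm_num⟩, by rw [sqh1 (by norm_num) (by norm_num)]; apply Complex.ext <;> simp [h1, h']⟩
        · refine ⟨z.re/4, ⟨by linarith, by linarith⟩, ?_⟩
          rw [sqh1 (by linarith) (by linarith)]; apply Complex.ext <;> simp [h']; ring
      · refine ⟨(3 - z.re)/4, ⟨by linarith, by linarith⟩, ?_⟩
        rw [sqh3 (by linarith) (by linarith)]; apply Complex.ext <;> simp [h']; ring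
      · by_cases h1 : z.im = 0
        · exact ⟨0, ⟨by norm_num, by norm_num⟩, by rw [sqh1 (by norm_num) (by norm_num)]; apply Complex.ext <;> simp [h1, h']⟩
        · have : 0 < z.im := lt_of_le_of_ne h.1 (Ne.symm h1)
          refine ⟨(4 - z.im)/4, ⟨by linarith, by linarith⟩, ?_⟩
          rw [sqh4 (by linarith) (by linarith)]; apply Complex.ext <;> simp [h']; ring
      · refine ⟨(1 + z.im)/4, ⟨by linarith, by linarith⟩, ?_⟩
        rw [sqh2 (by linarith) (by linarith)]; apply Complex.ext <;> simp [h']; ring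
  · rw [interior_reProdIm, interior_Icc, mem_reProdIm]; norm_num

def ec (t : ℝ) : Circle := ⟨ee t, mem_sphere_zero_iff_norm.2 (norm_ee t)⟩
theorem ec_cont : Continuous ec := Continuous.subtype_mk ee_cont _
theorem ec_eq {s t : ℝ} : ec s = ec t ↔ ee s = ee t := Subtype.ext_iff

theorem W1_torus (x y : ℕ × Bool) (hxy : x.1 ≠ y.1) : W1 Torus [x, y, flipL x, flipL y] := by
  have : T2Space Torus := by unfold Torus; infer_instance
  obtain ⟨Φ, hΦc, hΦi, hΦ, hΦe⟩ := square_map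
  set u : Word := [x, y, flipL x, flipL y] with hu
  have hmem : ∀ z : D, (Φ z).re ∈ Icc (0:ℝ) 1 ∧ (Φ z).im ∈ Icc (0:ℝ) 1 := fun z =>
    mem_reProdIm.1 (hΦ ▸ mem_image_of_mem Φ z.2)
  have hsur : ∀ p ∈ Icc (0:ℝ) 1, ∀ q ∈ Icc (0:ℝ) 1, ∃ z : D, Φ z = ⟨p, q⟩ := by
    intro p hp q hq
    obtain ⟨z, hz, e⟩ : (⟨p, q⟩ : ℂ) ∈ Φ '' closedBall 0 1 := by rw [hΦ]; exact ⟨hp, hq⟩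
    exact ⟨⟨z, hz⟩, e⟩
  have hfc : Continuous fun z : D => Φ z := hΦc.comp_continuous continuous_subtype_val fun z => z.2
  have hat : ∀ (z : D) (s : ℝ), s ∈ Icc (0:ℝ) 1 → Φ z = sqh s → (z:ℂ) = ee s := by
    intro z s hs e
    exact hΦi z.2 (by rw [mem_closedBall_zero_iff, norm_ee]) (by rw [e, hΦe s hs])
  have hl : ((u.length : ℕ) : ℝ) = 4 := by simp [hu]
  have hv : ∀ z z' : D, (Φ z).re = (Φ z').re → (Φ z).im = 0 → (Φ z').im = 1 → Rw u z z' := by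
    intro z z' h1 h2 h3
    have hp := (hmem z).1
    rw [mem_Icc] at hp
    refine ⟨x.1, tb x.2 (Φ z).re, tb_mem hp, ⟨(Φ z).re, by simp [hu, OnAt, tb_tb], ?_⟩, ⟨3 - (Φ z).re, ?_, ?_⟩⟩
    · rw [hl]; refine hat z _ ⟨by linarith, by linarith⟩ ?_
      rw [sqh1 (by linarith) (by linarith)]; apply Complex.ext <;> simp [h2]; ring
    · simp only [hu, OnAt, flipL, tb_not, tb_tb]; right; right; left; exact ⟨trivial, by ring⟩
    · rw [hl]; refine hat z' _ ⟨by linarith, by linarith⟩ ?_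
      rw [sqh3 (by linarith) (by linarith)]; apply Complex.ext <;> simp [h3]; linarith
  have hh : ∀ z z' : D, (Φ z).im = (Φ z').im → (Φ z).re = 1 → (Φ z').re = 0 → Rw u z z' := by
    intro z z' h1 h2 h3
    have hp := (hmem z).2
    rw [mem_Icc] at hp
    refine ⟨y.1, tb y.2 (Φ z).im, tb_mem hp, ⟨1 + (Φ z).im, by simp [hu, OnAt, tb_tb], ?_⟩, ⟨4 - (Φ z).im, ?_, ?_⟩⟩
    · rw [hl]; refine hat z _ ⟨by linarith, by linarith⟩ ?_
      rw [sqh2 (by linarith) (by linarith)]; apply Complex.ext <;> simp [h2]; ring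
    · simp only [hu, OnAt, flipL, tb_not, tb_tb]; right; right; right; left; exact ⟨trivial, by ring⟩
    · rw [hl]; refine hat z' _ ⟨by linarith, by linarith⟩ ?_
      rw [sqh4 (by linarith) (by linarith)]; apply Complex.ext <;> simp [h3]; linarith
  let Θ : D → Torus := fun z => ((ec (Φ z).re, ec (Φ z).im) : Circle × Circle)
  have hOn : ∀ (z : D) a t, t ∈ Icc (0:ℝ) 1 → On u a t z →
      (a = x.1 ∧ Θ z = ((ec (tb x.2 t), ec 0) : Circle × Circle)) ∨ (a = y.1 ∧ Θ z = ((ec 0, ec (tb y.2 t)) : Circle × Circle)) := by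
    have e01 : ec 1 = ec 0 := ec_eq.2 (by rw [ee_one, ee_zero])
    rintro z a t ht ⟨s, hs, e⟩
    have hx := tb_mem (b := x.2) ht
    have hy := tb_mem (b := y.2) ht
    rw [mem_Icc] at hx hy
    rw [hl] at e
    have hs4 := hs.range ht
    rw [hl, mem_Icc] at hs4
    have ez : Φ z = sqh (s/4) := by rw [e]; exact hΦe _ ⟨by linarith, by linarith⟩
    have e4 : 4 * (s / 4) = s := by ring
    simp only [hu, OnAt, flipL, tb_not, or_false] at hs
    simp only [Θ]
    rcases hs with ⟨h, hs⟩ | ⟨h, hs⟩ | ⟨h, hs⟩ | ⟨h, hs⟩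
    · left; refine ⟨h.symm, ?_⟩
      rw [ez, sqh1 (by linarith) (by linarith)]; dsimp only; rw [e4, hs]
    · right; refine ⟨h.symm, ?_⟩
      rw [ez, sqh2 (by linarith) (by linarith)]; dsimp only; rw [e4, hs, e01]
    · left; refine ⟨h.symm, ?_⟩
      rw [ez, sqh3 (by linarith) (by linarith)]; dsimp only; rw [e4, e01, show 3 - s = tb x.2 t by linarith]
    · right; refine ⟨h.symm, ?_⟩
      rw [ez, sqh4 (by linarith) (by linarith)]; dsimp only; rw [e4, show 4 - s = tb y.2 t by linarith]
  refine W1_of Θ ?_ ?_ ?_ ?_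
  · have h1 : Continuous fun z : D => ec (Φ z).re := ec_cont.comp (continuous_re.comp hfc)
    have h2 : Continuous fun z : D => ec (Φ z).im := ec_cont.comp (continuous_im.comp hfc)
    exact h1.prodMk h2
  · rintro ⟨c, d⟩
    obtain ⟨p, hp, ep⟩ := ee_surj (z := c) c.norm_coe
    obtain ⟨q, hq, eq⟩ := ee_surj (z := d) d.norm_coe
    obtain ⟨z, hz⟩ := hsur p ⟨hp.1, hp.2.le⟩ q ⟨hq.1, hq.2.le⟩
    refine ⟨z, ?_⟩
    simp only [Θ, hz]
    exact Prod.ext (Subtype.ext ep) (Subtype.ext eq)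
  · rintro z z' ⟨a, t, ht, h1, h2⟩
    grind
  · intro z z' h
    obtain ⟨hp, hq⟩ := hmem z
    obtain ⟨hp', hq'⟩ := hmem z'
    have e1 := ee_eq_Icc hp hp' (ec_eq.1 (congrArg (fun a : Circle × Circle => a.1) h))
    have e2 := ee_eq_Icc hq hq' (ec_eq.1 (congrArg (fun a : Circle × Circle => a.2) h))
    obtain ⟨m, hm⟩ := hsur _ hp' _ hq
    have s1 : EqvGen (Rw u) z m := by
      rcases e1 with e1 | ⟨a, b⟩ | ⟨a, b⟩
      · rw [show z = m from Subtype.ext (hΦi z.2 m.2 (by rw [hm]; exact Complex.ext e1 rfl))]; exact .refl _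
      · exact .symm _ _ (.rel _ _ (hh m z (by rw [hm]) (by rw [hm]; exact b) a))
      · exact .rel _ _ (hh z m (by rw [hm]) a (by rw [hm]; exact b))
    refine s1.trans _ _ _ ?_
    rcases e2 with e2 | ⟨a, b⟩ | ⟨a, b⟩
    · rw [show m = z' from Subtype.ext (hΦi m.2 z'.2 (by rw [hm]; exact Complex.ext rfl e2))]; exact .refl _
    · exact .rel _ _ (hv m z' (by rw [hm]) (by rw [hm]; exact a) b)
    · exact .symm _ _ (.rel _ _ (hv z' m (by rw [hm]) b (by rw [hm]; exact a)))

theorem pos_sq (x : ℕ × Bool) {τ : ℝ} (h : τ ∈ Icc (0:ℝ) 1) : PosR [x, x] τ (1 + τ) :=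
  ⟨x.1, tb x.2 τ, tb_mem h, by simp [OnAt, tb_tb], by simp [OnAt, tb_tb]⟩

theorem pos_co1 (x y : ℕ × Bool) {τ : ℝ} (h : τ ∈ Icc (0:ℝ) 1) : PosR [x, y, flipL x, flipL y] τ (3 - τ) := by
  refine ⟨x.1, tb x.2 τ, tb_mem h, by simp [OnAt, tb_tb], ?_⟩
  simp only [OnAt, flipL, tb_not, tb_tb]; right; right; left; exact ⟨trivial, by ring⟩

theorem pos_co2 (x y : ℕ × Bool) {τ : ℝ} (h : τ ∈ Icc (0:ℝ) 1) : PosR [x, y, flipL x, flipL y] (1 + τ) (4 - τ) := by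
  refine ⟨y.1, tb y.2 τ, tb_mem h, by simp [OnAt, tb_tb], ?_⟩
  simp only [OnAt, flipL, tb_not, tb_tb]; right; right; right; left; exact ⟨trivial, by ring⟩

theorem pos_end (b : Block) : EqvGen (PosR b.w) 0 b.w.length := by
  have m0 : (0:ℝ) ∈ Icc (0:ℝ) 1 := by simp
  have m1 : (1:ℝ) ∈ Icc (0:ℝ) 1 := by simp
  cases b with
  | sq x =>
    have h1 := EqvGen.rel _ _ (pos_sq x m0)
    have h2 := EqvGen.rel _ _ (pos_sq x m1)
    norm_num at h1 h2
    simpa [Block.w] using h1.trans _ _ _ h2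
  | co x y =>
    have h1 := EqvGen.rel _ _ (pos_co1 x y m0)
    have h2 := EqvGen.rel _ _ (pos_co2 x y m1)
    have h3 := EqvGen.rel _ _ (pos_co1 x y m1)
    have h4 := EqvGen.rel _ _ (pos_co2 x y m0)
    norm_num at h1 h2 h3 h4
    have := ((h1.trans _ _ _ (h2.symm _ _)).trans _ _ _ (h3.symm _ _)).trans _ _ _ h4
    simpa [Block.w] using this

theorem W1_quot (u : Word) : W1 (Quot (Rw u)) u :=
  (W1_iff u).2 ⟨Quot.mk _, isQuotientMap_quot_mk, fun _ _ => Quot.eq⟩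

theorem copies {B : Type} [TopologicalSpace B] (p : Bool) (hB : ∀ b : Block, isSq b = p → Val b.w → W1 B b.w) (n : ℕ) :
    ∀ bs : List Block, bs.length = n + 1 → (∀ b ∈ bs, isSq b = p) → Val (bws bs) →
    ∀ (X : Type) (tX : TopologicalSpace X), W1 X (bws bs) → IsConnSumOfCopies B (n + 1) X tX := by
  induction n with
  | zero =>
    intro bs hl hp hv X tX hX
    obtain ⟨b, rfl⟩ := List.length_eq_one_iff.1 hl
    have e : bws [b] = b.w := by simp
    rw [e] at hv hX
    exact W1_unique hX (hB b (hp b (by simp)) hv)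
  | succ n ih =>
    intro bs hl hp hv X tX hX
    rcases List.eq_nil_or_concat bs with rfl | ⟨bs', b, rfl⟩
    · simp at hl
    have e : bws (bs'.concat b) = bws bs' ++ b.w := by simp
    rw [e] at hv hX
    have e1 : ∀ a, (lab (bws bs')).count a + (lab b.w).count a = 0 ∨ (lab (bws bs')).count a + (lab b.w).count a = 2 := by
      intro a
      have := hv a
      rwa [lab_append, List.count_append] at this
    have e2 : ∀ a, 2 ∣ (lab b.w).count a := fun a => by simpa using even_bws [b] a
    have e3 := even_bws bs'
    have hl' : bs'.length = n + 1 := by simpa using hl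
    refine ⟨Quot (Rw (bws bs')), inferInstance, ih bs' hl' (fun b hb => hp b (by simp [hb])) ?_ _ _ (W1_quot _), ?_⟩
    · intro a; have := e1 a; have := e2 a; have := e3 a; omega
    · refine connsum (u := bws bs') (v := b.w) ?_ ?_ ?_ hX (W1_quot _) (hB b (hp b (by simp)) ?_) (pos_end b)
      · intro h
        cases bs' with
        | nil => simp at hl'
        | cons c cs => cases c <;> simp [Block.w] at h
      · cases b <;> simp [Block.w]
      · intro a ha
        apply nc
        grind
      · intro a; have := e1 a; have := e2 a; have := e3 a; omega

theorem classify {X : Type} [tX : TopologicalSpace X] {w : Word} (hv : Val w) (hw : w ≠ []) (hX : W1 X w) :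
    Nonempty (X ≃ₜ Sphere2) ∨ (∃ n : ℕ, 1 ≤ n ∧ IsConnSumOfCopies Torus n X tX) ∨
      (∃ n : ℕ, 1 ≤ n ∧ IsConnSumOfCopies RP2 n X tX) := by
  rcases normal_form w hv hw with ⟨x, h⟩ | ⟨bs, hne, hvb, h, hs | hs⟩
  · exact Or.inl (W1_unique ((h X).1 hX) (W1_sphere x))
  all_goals obtain ⟨n, hn⟩ := Nat.exists_eq_succ_of_ne_zero (mt List.length_eq_zero_iff.1 hne)
  · refine Or.inr (Or.inr ⟨n + 1, by omega, copies true ?_ n bs hn hs hvb X tX ((h X).1 hX)⟩)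
    intro b hb _
    cases b with
    | sq x => exact W1_rp x
    | co x y => simp [isSq] at hb
  · refine Or.inr (Or.inl ⟨n + 1, by omega, copies false ?_ n bs hn hs hvb X tX ((h X).1 hX)⟩)
    intro b hb hvb
    cases b with
    | sq x => simp [isSq] at hb
    | co x y =>
      refine W1_torus x y fun e => ?_
      have := hvb x.1
      simp [Block.w, lab, e] at this

section
variable {X : Type} [TopologicalSpace X]

theorem flat_local {G O : Set X} {x : X} (hx : x ∈ G) (h : FlatAt G x) (hO : O ∈ 𝓝 x) : ∃ N P M : Set X, IsOpen N ∧ x ∈ N ∧ N ⊆ O ∧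
    IsOpen P ∧ IsOpen M ∧ IsPreconnected P ∧ IsPreconnected M ∧ Disjoint P M ∧ N \ G = P ∪ M ∧
    N ∩ G ⊆ closure P ∧ N ∩ G ⊆ closure M := by
  obtain ⟨e, hxe, he⟩ := h
  have hU : e.target ∩ e.symm ⁻¹' O ∈ 𝓝 (e x) := by
    refine Filter.inter_mem (e.open_target.mem_nhds (e.map_source hxe)) ?_
    refine (e.symm.continuousAt (e.map_source hxe)).preimage_mem_nhds ?_
    rw [e.left_inv hxe]; exact hO
  obtain ⟨r, hr, hrU⟩ := Metric.mem_nhds_iff.1 hU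
  set g := e.symm
  set b := ball (e x) r
  have hbt : b ⊆ e.target := fun z hz => (hrU hz).1
  have hgc : ContinuousOn g b := e.continuousOn_symm.mono hbt
  have hop : ∀ T : Set ℂ, IsOpen T → IsOpen (g '' (b ∩ T)) := fun T hT =>
    e.symm.isOpen_image_of_subset_source (isOpen_ball.inter hT) (inter_subset_left.trans hbt)
  have hG : ∀ z ∈ b, (g z ∈ G ↔ z.im = 0) := fun z hz => by
    rw [he _ (e.map_target (hbt hz)), e.right_inv (hbt hz)]
  have hinj : InjOn g b := e.symm.injOn.mono hbt
  have hP : IsOpen {z : ℂ | 0 < z.im} := isOpen_lt continuous_const continuous_im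
  have hM : IsOpen {z : ℂ | z.im < 0} := isOpen_lt continuous_im continuous_const
  have hcl : ∀ T : Set ℂ, {z : ℂ | z.im = 0} ⊆ closure T → (g '' b) ∩ G ⊆ closure (g '' (b ∩ T)) := by
    rintro T hT _ ⟨⟨z, hz, rfl⟩, hzG⟩
    refine mem_closure_image (hgc.continuousAt (isOpen_ball.mem_nhds hz)) ?_
    exact isOpen_ball.inter_closure ⟨hz, hT ((hG z hz).1 hzG)⟩
  refine ⟨g '' b, g '' (b ∩ {z | 0 < z.im}), g '' (b ∩ {z | z.im < 0}), ?_, ⟨e x, mem_ball_self hr, e.left_inv hxe⟩, ?_,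
    hop _ hP, hop _ hM, ?_, ?_, ?_, ?_, hcl _ ?_, hcl _ ?_⟩
  · simpa using hop univ isOpen_univ
  · rintro _ ⟨z, hz, rfl⟩; exact (hrU hz).2
  · exact ((convex_ball _ _).inter (convex_halfSpace_im_gt 0)).isPreconnected.image _ (hgc.mono inter_subset_left)
  · exact ((convex_ball _ _).inter (convex_halfSpace_im_lt 0)).isPreconnected.image _ (hgc.mono inter_subset_left)
  · rw [Set.disjoint_left]
    rintro _ ⟨z, hz, rfl⟩ ⟨w, hw, e⟩
    have h1 : 0 < z.im := hz.2
    have h2 : w.im < 0 := hw.2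
    rw [hinj hw.1 hz.1 e] at h2; linarith
  · rw [← image_union]
    ext y
    constructor
    · rintro ⟨⟨z, hz, rfl⟩, hy⟩
      grind
    · rintro ⟨z, hz | hz, rfl⟩
      · grind
      · exact ⟨⟨z, hz.1, rfl⟩, fun h => (ne_of_lt hz.2) ((hG z hz.1).1 h)⟩
  · simp_all
  · simp_all

/-- the set of faces -/
def Fcs (G : Set X) : Set (Set X) := {C | ∃ x ∉ G, C = connectedComponentIn Gᶜ x}

structure Ctx (G V : Set X) : Prop where
  good : Good G V
  le : LE X
  face : ∀ x ∉ G, ∃ F, Face F (connectedComponentIn Gᶜ x)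

variable {G V : Set X}

theorem fcs_eq {C : Set X} (hC : C ∈ Fcs G) {y : X} (hy : y ∈ C) : C = connectedComponentIn Gᶜ y := by
  obtain ⟨x, -, rfl⟩ := hC
  exact connectedComponentIn_eq hy

theorem fcs_notG {C : Set X} (hC : C ∈ Fcs G) {y : X} (hy : y ∈ C) : y ∉ G := by
  obtain ⟨x, -, rfl⟩ := hC
  exact connectedComponentIn_subset _ _ hy

variable [T2Space X] [CompactSpace X]

namespace Ctx

theorem open' (h : Ctx G V) {C : Set X} (hC : C ∈ Fcs G) : IsOpen C := by
  have := h.le.locallyConnected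
  obtain ⟨x, -, rfl⟩ := hC
  exact h.good.closed.isOpen_compl.connectedComponentIn

theorem frontG (h : Ctx G V) {C : Set X} (hC : C ∈ Fcs G) : frontier C ⊆ G := by
  have := h.le.locallyConnected
  obtain ⟨x, -, rfl⟩ := hC
  simpa using frontier_comp_subset h.good.closed.isOpen_compl x

theorem front (h : Ctx G V) {C : Set X} (hC : C ∈ Fcs G) {x : X} : x ∈ frontier C ↔ x ∈ closure C ∧ x ∈ G := by
  constructor
  · exact fun hx => ⟨frontier_subset_closure hx, h.frontG hC hx⟩
  · rintro ⟨h1, h2⟩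
    rw [(h.open' hC).frontier_eq]
    exact ⟨h1, fun h3 => fcs_notG hC h3 h2⟩

theorem clos (h : Ctx G V) {C : Set X} (hC : C ∈ Fcs G) {x : X} (hx : x ∈ closure C) (hG : x ∉ G) : x ∈ C := by
  by_contra h1
  exact hG (h.frontG hC (by rw [(h.open' hC).frontier_eq]; exact ⟨hx, h1⟩))

theorem face' (h : Ctx G V) {C : Set X} (hC : C ∈ Fcs G) : ∃ F, Face F C := by
  obtain ⟨x, hx, rfl⟩ := hC
  exact h.face x hx

theorem two_faces (h : Ctx G V) {x : X} (hx : x ∈ G) (hV : x ∉ V) {O : Set X} (hO : O ∈ 𝓝 x) : ∃ C1 ∈ Fcs G, ∃ C2 ∈ Fcs G, C1 ≠ C2 ∧ ∃ N, IsOpen N ∧ x ∈ N ∧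
    N ⊆ O ∧ (∀ C ∈ Fcs G, (C ∩ N).Nonempty → C = C1 ∨ C = C2) ∧ N ∩ G ⊆ closure C1 ∧ N ∩ G ⊆ closure C2 := by
  obtain ⟨N, P, M, hN, hxN, hNO, hPo, hMo, hP, hM, hPM, hNG, hcP, hcM⟩ := flat_local hx (h.good.flat x hx hV) hO
  have hPG : P ⊆ Gᶜ := fun y hy => (hNG.symm ▸ (Or.inl hy) : y ∈ N \ G).2
  have hMG : M ⊆ Gᶜ := fun y hy => (hNG.symm ▸ (Or.inr hy) : y ∈ N \ G).2
  obtain ⟨p, hp⟩ := closure_nonempty_iff.1 ⟨x, hcP ⟨hxN, hx⟩⟩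
  obtain ⟨m, hm⟩ := closure_nonempty_iff.1 ⟨x, hcM ⟨hxN, hx⟩⟩
  have hP1 := hP.subset_connectedComponentIn hp hPG
  have hM1 := hM.subset_connectedComponentIn hm hMG
  have hC1 : connectedComponentIn Gᶜ p ∈ Fcs G := ⟨p, hPG hp, rfl⟩
  have hC2 : connectedComponentIn Gᶜ m ∈ Fcs G := ⟨m, hMG hm, rfl⟩
  refine ⟨_, hC1, _, hC2, ?_, N, hN, hxN, hNO, ?_, hcP.trans (closure_mono hP1), hcM.trans (closure_mono hM1)⟩
  · intro heq
    obtain ⟨F, hF⟩ := h.face' hC1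
    rw [← heq] at hM1
    generalize connectedComponentIn Gᶜ p = C at *
    have hxf : x ∈ F '' sphere 0 1 := by
      rw [hF.sphere]; exact (h.front hC1).2 ⟨closure_mono hP1 (hcP ⟨hxN, hx⟩), hx⟩
    obtain ⟨p0, hp0, rfl⟩ := hxf
    have hp0' : p0 ∈ closedBall (0:ℂ) 1 := sphere_subset_closedBall hp0
    obtain ⟨δ, hδ, hδN⟩ := Metric.mem_nhdsWithin_iff.1 ((hF.cont p0 hp0').preimage_mem_nhdsWithin (hN.mem_nhds hxN))
    have hH : IsPreconnected (F '' (ball 0 1 ∩ ball p0 δ)) :=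
      ((convex_ball _ _).inter (convex_ball _ _)).isPreconnected.image _
        (hF.cont.mono (inter_subset_left.trans ball_subset_closedBall))
    have hsub : F '' (ball 0 1 ∩ ball p0 δ) ⊆ P ∪ M := by
      rw [← hNG]
      rintro _ ⟨z, hz, rfl⟩
      exact ⟨hδN ⟨hz.2, ball_subset_closedBall hz.1⟩, fcs_notG hC1 (hF.ball ▸ mem_image_of_mem F hz.1)⟩
    have hK : IsClosed (F '' (closedBall 0 1 \ ball p0 δ)) :=
      (((isCompact_closedBall _ _).diff isOpen_ball).image_of_continuousOn (hF.cont.mono sdiff_subset)).isClosed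
    have hxK : F p0 ∉ F '' (closedBall 0 1 \ ball p0 δ) := by
      rintro ⟨z, hz, e⟩
      rw [hF.inj hz.1 hp0' e] at hz
      exact hz.2 (mem_ball_self hδ)
    have key : ∀ A ⊆ C, F p0 ∈ closure A → ∃ y ∈ A, y ∈ F '' (ball 0 1 ∩ ball p0 δ) := by
      intro A hA hxA
      obtain ⟨y, hy1, hy2⟩ := mem_closure_iff.1 hxA _ hK.isOpen_compl hxK
      obtain ⟨z, hz, rfl⟩ := hF.ball.symm ▸ hA hy2
      refine ⟨_, hy2, z, ⟨hz, ?_⟩, rfl⟩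
      by_contra h3
      exact hy1 ⟨z, ⟨ball_subset_closedBall hz, h3⟩, rfl⟩
    obtain ⟨y1, hy1, hy1'⟩ := key P hP1 (hcP ⟨hxN, hx⟩)
    obtain ⟨y2, hy2, hy2'⟩ := key M hM1 (hcM ⟨hxN, hx⟩)
    have hsP := hH.subset_left_of_subset_union hPo hMo hPM hsub ⟨y1, hy1', hy1⟩
    exact Set.disjoint_left.1 hPM (hsP hy2') hy2
  · rintro C hC ⟨y, hyC, hyN⟩
    have : y ∈ P ∪ M := hNG ▸ (⟨hyN, fcs_notG hC hyC⟩ : y ∈ N \ G)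
    rcases this with hy | hy
    · left; rw [fcs_eq hC hyC, ← fcs_eq hC1 (hP1 hy)]
    · right; rw [fcs_eq hC hyC, ← fcs_eq hC2 (hM1 hy)]

/-- faces around an ordinary point of the graph -/
theorem pair (h : Ctx G V) {x : X} (hx : x ∈ G) (hV : x ∉ V) : ∃ C1 ∈ Fcs G, ∃ C2 ∈ Fcs G, C1 ≠ C2 ∧
    ∀ C ∈ Fcs G, x ∈ closure C ↔ C = C1 ∨ C = C2 := by
  obtain ⟨C1, hC1, C2, hC2, hne, N, hN, hxN, -, h1, h2, h3⟩ := h.two_faces hx hV Filter.univ_mem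
  refine ⟨C1, hC1, C2, hC2, hne, fun C hC => ⟨fun hc => h1 C hC ?_, ?_⟩⟩
  · obtain ⟨y, hy⟩ := mem_closure_iff.1 hc N hN hxN
    exact ⟨y, hy.2, hy.1⟩
  · grind

theorem sub_front (h : Ctx G V) {C S : Set X} (hC : C ∈ Fcs G) (hS : IsPreconnected S) (hSG : S ⊆ G)
    (hne : (S ∩ frontier C).Nonempty) (hV : ∀ x ∈ S, x ∈ frontier C → x ∉ V) : S ⊆ frontier C := by
  have hO : ∀ x ∈ S ∩ frontier C, ∃ N, IsOpen N ∧ x ∈ N ∧ N ∩ G ⊆ frontier C := by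
    rintro x ⟨hxS, hxC⟩
    obtain ⟨C1, hC1, C2, hC2, hne, N, hN, hxN, -, h1, h2, h3⟩ := h.two_faces (hSG hxS) (hV x hxS hxC) Filter.univ_mem
    obtain ⟨y, hy⟩ := mem_closure_iff.1 ((h.front hC).1 hxC).1 N hN hxN
    refine ⟨N, hN, hxN, fun z hz => (h.front hC).2 ⟨?_, hz.2⟩⟩
    rcases h1 C hC ⟨y, hy.2, hy.1⟩ with rfl | rfl
    · exact h2 hz
    · exact h3 hz
  choose! N hN hxN hNG using hO
  by_contra hc
  obtain ⟨y, hyS, hyC⟩ := not_subset.1 hc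
  obtain ⟨x, hx⟩ := hne
  have := hS (⋃ x ∈ S ∩ frontier C, N x) (frontier C)ᶜ (isOpen_biUnion hN) isClosed_frontier.isOpen_compl ?_
    ⟨x, hx.1, mem_biUnion hx (hxN x hx)⟩ ⟨y, hyS, hyC⟩
  · obtain ⟨z, hzS, hz1, hz2⟩ := this
    obtain ⟨x, hx, hz⟩ := mem_iUnion₂.1 hz1
    exact hz2 (hNG x hx ⟨hz, hSG hzS⟩)
  · intro z hz
    by_cases hzC : z ∈ frontier C
    · exact Or.inl (mem_biUnion (⟨hz, hzC⟩ : z ∈ S ∩ frontier C) (hxN z ⟨hz, hzC⟩))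
    · exact Or.inr hzC

theorem two_vert (h : Ctx G V) {C : Set X} (hC : C ∈ Fcs G) (v : X) : ∃ v' ∈ frontier C, v' ∈ V ∧ v' ≠ v := by
  by_contra! hc
  obtain ⟨F, hF⟩ := h.face' hC
  have hsub : G \ {v} ⊆ frontier C := by
    refine h.sub_front hC (h.good.conn v) sdiff_subset ?_ fun x hx hxC hxV => hx.2 (hc x hxC hxV)
    have h1 : F 1 ∈ frontier C := hF.sphere ▸ mem_image_of_mem F (by simp)
    have h2 : F (-1) ∈ frontier C := hF.sphere ▸ mem_image_of_mem F (by simp)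
    have h3 : F 1 ≠ F (-1) := fun e => by
      have := congrArg re (hF.inj (by simp) (by simp) e)
      norm_num at this
    by_cases h4 : F 1 = v
    · exact ⟨_, ⟨h.frontG hC h2, fun e => h3 (h4.trans e.symm)⟩, h2⟩
    · exact ⟨_, ⟨h.frontG hC h1, h4⟩, h1⟩
  obtain ⟨v', hv', hne⟩ := h.good.two.exists_ne v
  exact hne (hc v' (hsub ⟨h.good.sub hv', hne⟩) hv')

theorem finF (h : Ctx G V) : (Fcs G).Finite := by
  have hch : ∀ v ∈ V, ∃ c : ℂ → X, IsOpenEmbedding c ∧ c 0 = v ∧ ∀ v' ∈ V, v' ∈ range c → v' = v := by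
    intro v hv
    obtain ⟨c, hc, h0, hr⟩ := h.le v (V \ {v})ᶜ ((h.good.fin.sdiff).isClosed.isOpen_compl.mem_nhds (by simp))
    grind
  choose! c hc h0 hV using hch
  set K : Set X := ⋃ v ∈ V, (c v '' sphere 0 1) ∩ G with hK
  have hKc : IsCompact K := h.good.fin.isCompact_biUnion fun v hv =>
    ((isCompact_sphere 0 1).image (hc v hv).continuous).inter_right h.good.closed
  have hKV : ∀ x ∈ K, x ∈ G ∧ x ∉ V := by
    intro x hx
    obtain ⟨v, hv, ⟨z, hz, rfl⟩, hG⟩ := mem_iUnion₂.1 hx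
    refine ⟨hG, fun hxV => ?_⟩
    have := hV v hv _ hxV (mem_range_self _)
    rw [(hc v hv).injective (this.trans (h0 v hv).symm)] at hz
    simp at hz
  have hN : ∀ x ∈ K, ∃ N, IsOpen N ∧ x ∈ N ∧ {C ∈ Fcs G | (C ∩ N).Nonempty}.Finite := by
    intro x hx
    obtain ⟨C1, -, C2, -, -, N, hN, hxN, -, h1, -⟩ := h.two_faces (hKV x hx).1 (hKV x hx).2 Filter.univ_mem
    exact ⟨N, hN, hxN, (toFinite {C1, C2}).subset fun C hC => h1 C hC.1 hC.2⟩
  choose! N hN1 hN2 hN3 using hN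
  obtain ⟨t, htK, ht⟩ := hKc.elim_nhds_subcover N fun x hx => (hN1 x hx).mem_nhds (hN2 x hx)
  refine (t.finite_toSet.biUnion fun x hx => hN3 x (htK x hx)).subset fun C hC => ?_
  obtain ⟨v, hv, hvV, -⟩ := h.two_vert hC (h.good.two.nonempty.some)
  obtain ⟨v', hv', hv'V, hne⟩ := h.two_vert hC v
  obtain ⟨F, hF⟩ := h.face' hC
  have hpre : IsPreconnected (frontier C) := by
    rw [← hF.sphere]
    refine IsPreconnected.image ?_ _ (hF.cont.mono sphere_subset_closedBall)
    exact isPreconnected_sphere (by rw [rank_real_complex]; norm_num) _ _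
  have hmeet : ∃ x ∈ frontier C, x ∈ c v '' sphere 0 1 := by
    by_contra! hcon
    have hW : IsOpen (c v '' ball 0 1) := (hc v hvV).isOpenMap _ isOpen_ball
    have := preconn_subset_of_frontier hpre hW ⟨v, hv, 0, by simp, h0 v hvV⟩ fun x hx hxf => by
      have := frontier_chart (hc v hvV) isBounded_ball hxf
      rw [frontier_ball _ one_ne_zero] at this
      exact hcon x hx this
    grind
  obtain ⟨x, hxC, hx⟩ := hmeet
  have hxK : x ∈ K := mem_biUnion hvV ⟨hx, h.frontG hC hxC⟩
  obtain ⟨y, hy, hxy⟩ := mem_iUnion₂.1 (ht hxK)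
  obtain ⟨w, hw1, hw2⟩ := mem_closure_iff.1 ((h.front hC).1 hxC).1 _ (hN1 y (htK y hy)) hxy
  exact mem_biUnion hy ⟨hC, w, hw2, hw1⟩

theorem dense (h : Ctx G V) {x : X} {N : Set X} (hN : N ∈ 𝓝 x) : ∃ y ∈ N, y ∉ G := by
  obtain ⟨c, hc, h0, hr⟩ := h.le x _ hN
  obtain ⟨_, ⟨z, rfl⟩, hz⟩ := (infinite_range_of_injective hc.injective).exists_notMem_finite h.good.fin
  by_cases hG : c z ∈ G
  · obtain ⟨C1, hC1, -, -, -, M, hM, hxM, hMr, -, h2, -⟩ := h.two_faces hG hz (hc.isOpen_range.mem_nhds (mem_range_self z))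
    obtain ⟨y, hy1, hy2⟩ := mem_closure_iff.1 (h2 ⟨hxM, hG⟩) M hM hxM
    exact ⟨y, hr (hMr hy1), fcs_notG hC1 hy2⟩
  · exact ⟨c z, hr (mem_range_self z), hG⟩

/-- every point lies in the closure of a face -/
theorem cover (h : Ctx G V) (x : X) : ∃ C ∈ Fcs G, x ∈ closure C := by
  have hcl : IsClosed (⋃ C ∈ Fcs G, closure C) := h.finF.isClosed_biUnion fun C _ => isClosed_closure
  have : x ∈ closure (⋃ C ∈ Fcs G, closure C) := by
    rw [mem_closure_iff_nhds]
    intro N hN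
    obtain ⟨y, hy, hyG⟩ := h.dense hN
    exact ⟨y, hy, mem_biUnion (⟨y, hyG, rfl⟩ : connectedComponentIn Gᶜ y ∈ Fcs G) (subset_closure (mem_connectedComponentIn hyG))⟩
  rw [hcl.closure_eq] at this
  simpa using this

end Ctx
end

section
theorem subdiv {S : Set ℂ} (hf : S.Finite) (h2 : S.Nontrivial) (hS : ∀ z ∈ S, ‖z‖ = 1) : ∃ n : ℕ, 2 ≤ n ∧ ∃ θ : ℕ → ℝ,
    (∀ k < n, θ k < θ (k + 1)) ∧ θ n = θ 0 + 1 ∧ ∀ z, z ∈ S ↔ ∃ k < n, ee (θ k) = z := by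
  have hA : (Ico (0:ℝ) 1 ∩ ee ⁻¹' S).Finite := by
    refine Finite.of_finite_image (f := ee) (hf.subset ?_) fun s hs t ht e => ee_inj hs.1 ht.1 e
    rintro _ ⟨t, ht, rfl⟩; exact ht.2
  set A := hA.toFinset
  have hmem : ∀ t, t ∈ A ↔ t ∈ Ico (0:ℝ) 1 ∧ ee t ∈ S := fun t => by simp [A]
  have hn : 2 ≤ A.card := by
    obtain ⟨x, hx, y, hy, hne⟩ := h2
    obtain ⟨s, hs, rfl⟩ := ee_surj (hS x hx)
    obtain ⟨t, ht, rfl⟩ := ee_surj (hS y hy)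
    exact Finset.one_lt_card.2 ⟨s, (hmem s).2 ⟨hs, hx⟩, t, (hmem t).2 ⟨ht, hy⟩, fun e => hne (by rw [e])⟩
  let f := A.orderEmbOfFin rfl
  have hfm : ∀ k, f k ∈ Ico (0:ℝ) 1 ∧ ee (f k) ∈ S := fun k => (hmem _).1 (A.orderEmbOfFin_mem rfl k)
  refine ⟨A.card, hn, fun k => if h : k < A.card then f ⟨k, h⟩ else f ⟨0, by omega⟩ + 1, ?_, ?_, ?_⟩
  · intro k hk
    by_cases h : k + 1 < A.card
    · simp_all
    · grind
  · simp [show 0 < A.card by omega]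
  · intro z
    constructor
    · intro hz
      obtain ⟨t, ht, rfl⟩ := ee_surj (hS z hz)
      have : t ∈ range f := by rw [A.range_orderEmbOfFin rfl]; exact (hmem t).2 ⟨ht, hz⟩
      obtain ⟨k, rfl⟩ := this
      exact ⟨k, k.2, by simp⟩
    · grind

theorem locate (θ : ℕ → ℝ) (n : ℕ) {t : ℝ} (h0 : θ 0 ≤ t) (h1 : t < θ n) : ∃ k < n, θ k ≤ t ∧ t < θ (k + 1) := by
  induction n with
  | zero => linarith
  | succ n ih =>
    rcases lt_or_ge t (θ n) with h | h
    · grind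
    · exact ⟨n, by omega, h, h1⟩

theorem OnAt_ofFn {n : ℕ} (f : Fin n → ℕ × Bool) (a : ℕ) (t s : ℝ) :
    OnAt (List.ofFn f) a t s ↔ ∃ k : Fin n, (f k).1 = a ∧ s = k + tb (f k).2 t := by
  induction n generalizing s with
  | zero => simp [OnAt]
  | succ n ih =>
    rw [List.ofFn_succ, OnAt, ih, Fin.exists_fin_succ]
    refine or_congr (by simp) (exists_congr fun k => and_congr_right fun _ => ?_)
    push_cast [Fin.val_succ]
    constructor <;> intro h <;> linarith

variable {X : Type} [TopologicalSpace X] [T2Space X]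

theorem loop {n : ℕ} (hn : 1 ≤ n) (η : ℕ → ℝ → X) (hc : ∀ k < n, ContinuousOn (η k) (Icc 0 1))
    (hs : ∀ k < n, η k 1 = η (k + 1) 0) : ∃ H : ℝ → X, ContinuousOn H (Icc 0 1) ∧
      ∀ k < n, ∀ t ∈ Icc (0:ℝ) 1, H ((k + t) / n) = η k t := by
  have hn0 : (0:ℝ) < n := by exact_mod_cast hn
  set H : ℝ → X := fun τ => η ⌊n * τ⌋₊ (n * τ - ⌊n * τ⌋₊) with hH
  have hv : ∀ k < n, ∀ t ∈ Icc (0:ℝ) 1, H ((k + t) / n) = η k t := by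
    intro k hk t ht
    have e : n * ((k + t) / n) = k + t := by field_simp
    simp only [hH, e]
    rcases eq_or_lt_of_le ht.2 with rfl | h1
    · rw [show (k:ℝ) + 1 = ((k + 1 : ℕ) : ℝ) by push_cast; rfl, Nat.floor_natCast, sub_self, hs k hk]
    · have : ⌊(k:ℝ) + t⌋₊ = k := (Nat.floor_eq_iff (by linarith [ht.1, (Nat.cast_nonneg k : (0:ℝ) ≤ k)])).2 ⟨by linarith [ht.1], by linarith⟩
      rw [this, add_sub_cancel_left]
  refine ⟨H, ?_, hv⟩
  have hcov : Icc (0:ℝ) 1 ⊆ ⋃ k : Fin n, Icc ((k:ℝ) / n) ((k + 1) / n) := by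
    intro τ hτ
    rcases eq_or_lt_of_le hτ.2 with rfl | h1
    · refine mem_iUnion.2 ⟨⟨n - 1, by omega⟩, ?_⟩
      rw [mem_Icc, div_le_iff₀ hn0, le_div_iff₀ hn0]
      push_cast [Nat.cast_sub hn]
      constructor <;> linarith
    · obtain ⟨k, hk, h2, h3⟩ := locate (fun k => (k:ℝ) / n) n (t := τ) (by simpa using hτ.1) (by simpa [hn0.ne'] using h1)
      refine mem_iUnion.2 ⟨⟨k, hk⟩, h2, ?_⟩
      push_cast at h3; exact h3.le
  refine ContinuousOn.mono ((locallyFinite_of_finite _).continuousOn_iUnion (fun k => isClosed_Icc) fun k => ?_) hcov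
  have hm : MapsTo (fun τ : ℝ => n * τ - k) (Icc ((k:ℝ) / n) ((k + 1) / n)) (Icc 0 1) := by
    intro τ hτ
    rw [mem_Icc, div_le_iff₀ hn0, le_div_iff₀ hn0] at hτ
    constructor <;> linarith
  refine ((hc k k.2).comp (f := fun τ : ℝ => n * τ - k) (by fun_prop) hm).congr fun τ hτ => ?_
  have := hv k k.2 _ (hm hτ)
  rw [show ((k:ℝ) + (n * τ - k)) / n = τ by field_simp; ring] at this
  exact this

/-- reparametrize a face along a prescribed boundary loop -/
theorem repar {F : ℂ → X} {C : Set X} (hF : Face F C) {n : ℕ} (hn : 1 ≤ n) (η : ℕ → ℝ → X)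
    (hc : ∀ k < n, ContinuousOn (η k) (Icc 0 1)) (hs : ∀ k < n, η k 1 = η (k + 1) 0) (hs0 : η n 0 = η 0 0)
    (hi : ∀ k < n, ∀ j < n, ∀ s ∈ Ico (0:ℝ) 1, ∀ t ∈ Ico (0:ℝ) 1, η k s = η j t → k = j ∧ s = t)
    (hr : ∀ x, x ∈ frontier C ↔ ∃ k < n, ∃ t ∈ Ico (0:ℝ) 1, η k t = x) :
    ∃ F', Face F' C ∧ ∀ k < n, ∀ t ∈ Icc (0:ℝ) 1, F' (ee ((k + t) / n)) = η k t := by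
  have hn0 : (0:ℝ) < n := by exact_mod_cast hn
  obtain ⟨H, hHc, hH⟩ := loop hn η hc hs
  have hdec : ∀ τ ∈ Ico (0:ℝ) 1, ∃ k < n, ∃ t ∈ Ico (0:ℝ) 1, τ = (k + t) / n := by
    intro τ hτ
    obtain ⟨k, hk, h2, h3⟩ := locate (fun k => (k:ℝ) / n) n (t := τ) (by simpa using hτ.1) (by simpa [hn0.ne'] using hτ.2)
    rw [div_le_iff₀ hn0] at h2
    rw [lt_div_iff₀ hn0] at h3
    push_cast at h3
    exact ⟨k, hk, n * τ - k, ⟨by linarith, by linarith⟩, by field_simp; ring⟩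
  have hIco : ∀ t ∈ Ico (0:ℝ) 1, t ∈ Icc (0:ℝ) 1 := fun t ht => ⟨ht.1, ht.2.le⟩
  have hH01 : H 0 = H 1 := by
    have h1 := hH 0 (by omega) 0 (by simp)
    have h2 := hH (n - 1) (by omega) 1 (by simp)
    rw [hs (n - 1) (by omega), Nat.sub_add_cancel hn, hs0, ← h1] at h2
    rw [show (((n - 1 : ℕ) : ℝ) + 1) / n = 1 by push_cast [Nat.cast_sub hn]; field_simp; ring] at h2
    rw [h2]; simp
  set g := invFunOn F (closedBall (0:ℂ) 1)
  have hgF : ∀ z ∈ closedBall (0:ℂ) 1, g (F z) = z := fun z hz => hF.inj.leftInvOn_invFunOn hz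
  have hgc : ContinuousOn g (F '' closedBall 0 1) := by
    obtain ⟨Φ0, h1, h2⟩ := descend (isCompact_closedBall (0:ℂ) 1) isClosed_closedBall hF.cont continuousOn_id
      (fun x hx y hy e => hF.inj hx hy e)
    exact h1.congr (by rintro _ ⟨z, hz, rfl⟩; rw [hgF z hz, h2 z hz]; rfl)
  have hHf : ∀ τ ∈ Ico (0:ℝ) 1, H τ ∈ frontier C := by
    intro τ hτ
    obtain ⟨k, hk, t, ht, rfl⟩ := hdec τ hτ
    grind
  have hHf' : ∀ τ ∈ Icc (0:ℝ) 1, H τ ∈ F '' sphere 0 1 := by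
    intro τ hτ
    rw [hF.sphere]
    grind
  have hFg : ∀ x ∈ F '' sphere 0 1, F (g x) = x ∧ g x ∈ sphere (0:ℂ) 1 := by
    rintro _ ⟨z, hz, rfl⟩
    rw [hgF z (sphere_subset_closedBall hz)]; exact ⟨rfl, hz⟩
  obtain ⟨Φ, hΦc, hΦi, hΦ, hΦe⟩ := cone (h := g ∘ H) (K := closedBall 0 1) (x0 := 0)
    (hgc.comp hHc fun τ hτ => image_mono sphere_subset_closedBall (hHf' τ hτ)) (by simp [hH01])
    (by
      intro s hs' t ht' e
      have e := congrArg F e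
      simp only [Function.comp] at e
      rw [(hFg _ (hHf' s (hIco s hs'))).1, (hFg _ (hHf' t (hIco t ht'))).1] at e
      obtain ⟨k, hk, s, hs2, rfl⟩ := hdec s hs'
      obtain ⟨j, hj, t, ht2, rfl⟩ := hdec t ht'
      grind)
    (convex_closedBall 0 1) (isCompact_closedBall 0 1)
    (by
      rw [frontier_closedBall _ one_ne_zero]
      ext z
      constructor
      · rintro ⟨τ, hτ, rfl⟩; exact (hFg _ (hHf' τ (hIco τ hτ))).2
      · intro hz
        have : F z ∈ frontier C := hF.sphere ▸ mem_image_of_mem F hz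
        obtain ⟨k, hk, t, ht, e⟩ := (hr _).1 this
        have hk' : (k:ℝ) + 1 ≤ n := by exact_mod_cast hk
        refine ⟨(k + t) / n, ⟨div_nonneg (by linarith [ht.1, (Nat.cast_nonneg k : (0:ℝ) ≤ k)]) hn0.le, ?_⟩, ?_⟩
        · rw [div_lt_one hn0]; linarith [ht.2]
        · rw [Function.comp, hH k hk t (hIco t ht), e, hgF z (sphere_subset_closedBall hz)])
    (by rw [interior_closedBall _ one_ne_zero]; simp)
  have hΦs : Φ '' sphere 0 1 = sphere 0 1 := by
    ext z
    constructor
    · rintro ⟨y, hy, rfl⟩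
      obtain ⟨τ, hτ, rfl⟩ := ee_surj (mem_sphere_zero_iff_norm.1 hy)
      grind
    · intro hz
      have : F z ∈ frontier C := hF.sphere ▸ mem_image_of_mem F hz
      obtain ⟨k, hk, t, ht, e⟩ := (hr _).1 this
      have hk' : (k:ℝ) + 1 ≤ n := by exact_mod_cast hk
      refine ⟨ee ((k + t) / n), mem_sphere_zero_iff_norm.2 (norm_ee _), ?_⟩
      rw [hΦe, Function.comp, hH k hk t (hIco t ht), e, hgF z (sphere_subset_closedBall hz)]
      refine ⟨div_nonneg (by linarith [ht.1, (Nat.cast_nonneg k : (0:ℝ) ≤ k)]) hn0.le, ?_⟩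
      rw [div_le_one hn0]; linarith [ht.2]
  have hb : (ball (0:ℂ) 1) = closedBall 0 1 \ sphere 0 1 := (closedBall_sdiff_sphere).symm
  have hΦb : Φ '' ball 0 1 = ball 0 1 := by
    rw [hb, hΦi.image_sdiff_subset sphere_subset_closedBall, hΦ, hΦs]
  refine ⟨F ∘ Φ, ⟨hF.cont.comp hΦc fun z hz => hΦ ▸ mem_image_of_mem Φ hz, fun a ha b hb e =>
    hΦi ha hb (hF.inj (hΦ ▸ mem_image_of_mem Φ ha) (hΦ ▸ mem_image_of_mem Φ hb) e), ?_, ?_⟩, ?_⟩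
  · rw [image_comp, hΦb, hF.ball]
  · rw [image_comp, hΦs, hF.sphere]
  · intro k hk t ht
    have hk' : (k:ℝ) + 1 ≤ n := by exact_mod_cast hk
    have hm : ((k:ℝ) + t) / n ∈ Icc (0:ℝ) 1 := by
      refine ⟨div_nonneg (by linarith [ht.1, (Nat.cast_nonneg k : (0:ℝ) ≤ k)]) hn0.le, ?_⟩
      rw [div_le_one hn0]; linarith [ht.2]
    grind
end

section
variable {X : Type} [TopologicalSpace X] [T2Space X] [CompactSpace X] {G V : Set X}

/-- an open edge of the graph with a parametrization -/
structure Arc (V : Set X) (p : ℝ → X) (l : Set X) : Prop where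
  cont : ContinuousOn p (Icc 0 1)
  inj : InjOn p (Icc 0 1)
  img : p '' Ioo 0 1 = l
  v0 : p 0 ∈ V
  v1 : p 1 ∈ V
  nv : ∀ x ∈ l, x ∉ V

theorem Arc.clos {p : ℝ → X} {l : Set X} (h : Arc V p l) : closure l = p '' Icc 0 1 := by
  apply Subset.antisymm
  · refine closure_minimal ?_ (isCompact_Icc.image_of_continuousOn h.cont).isClosed
    rw [← h.img]; exact image_mono Ioo_subset_Icc_self
  · rw [← h.img, ← closure_Ioo (zero_ne_one (α := ℝ))]
    exact ContinuousOn.image_closure (by rw [closure_Ioo (zero_ne_one (α := ℝ))]; exact h.cont)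

theorem Arc.ends {p : ℝ → X} {l : Set X} (h : Arc V p l) {x : X} (hx : x ∈ closure l) (hV : x ∈ V) : x = p 0 ∨ x = p 1 := by
  rw [h.clos] at hx
  obtain ⟨t, ht, rfl⟩ := hx
  rcases eq_or_lt_of_le ht.1 with h0 | h0
  · exact Or.inl (by rw [h0])
  rcases eq_or_lt_of_le ht.2 with h1 | h1
  · exact Or.inr (by rw [h1])
  exact (h.nv _ (h.img ▸ mem_image_of_mem p ⟨h0, h1⟩) hV).elim

theorem Arc.flip {p q : ℝ → X} {l : Set X} (h : Arc V p l) (h' : Arc V q l) : ∃ b, q (tb b 0) = p 0 ∧ q (tb b 1) = p 1 := by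
  have e0 := h'.ends (by rw [h.clos]; exact mem_image_of_mem p (by simp)) h.v0
  have e1 := h'.ends (by rw [h.clos]; exact mem_image_of_mem p (by simp)) h.v1
  have hne : p 0 ≠ p 1 := fun e => zero_ne_one (h.inj (by simp) (by simp) e)
  rcases e0 with e0 | e0 <;> rcases e1 with e1 | e1
  · exact (hne (e0.trans e1.symm)).elim
  · exact ⟨true, by simp [tb, e0], by simp [tb, e1]⟩
  · exact ⟨false, by simp [tb, e0], by simp [tb, e1]⟩
  · exact (hne (e0.trans e1.symm)).elim

theorem Ctx.edge (h : Ctx G V) {C : Set X} (hC : C ∈ Fcs G) {F : ℂ → X} (hF : Face F C) {α β : ℝ} (h1 : α < β) (h2 : β < α + 1)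
    (hα : F (ee α) ∈ V) (hβ : F (ee β) ∈ V) (hn : ∀ t ∈ Ioo α β, F (ee t) ∉ V) {t : ℝ} (ht : t ∈ Ioo α β) :
    connectedComponentIn (G \ V) (F (ee t)) = (fun s => F (ee s)) '' Ioo α β := by
  have hs : ∀ s, ee s ∈ sphere (0:ℂ) 1 := fun s => mem_sphere_zero_iff_norm.2 (norm_ee s)
  have hfr : ∀ s, F (ee s) ∈ frontier C := fun s => hF.sphere ▸ mem_image_of_mem F (hs s)
  have hFe : Continuous fun s => F (ee s) := hF.cont.comp_continuous ee_cont fun s => sphere_subset_closedBall (hs s)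
  have hx : F (ee t) ∈ G \ V := ⟨h.frontG hC (hfr t), hn t ht⟩
  have hsub := connectedComponentIn_subset (G \ V) (F (ee t))
  have hpre := isPreconnected_connectedComponentIn (x := F (ee t)) (F := G \ V)
  have hmem := mem_connectedComponentIn hx
  apply Subset.antisymm
  · have hSC := h.sub_front hC hpre (hsub.trans sdiff_subset) ⟨_, hmem, hfr t⟩ fun x hx _ => (hsub hx).2
    have hcov : connectedComponentIn (G \ V) (F (ee t)) ⊆ (fun s => F (ee s)) '' Icc α β ∪ (fun s => F (ee s)) '' Icc β (α + 1) := by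
      intro y hy
      have := hSC hy
      rw [← hF.sphere] at this
      obtain ⟨z, hz, rfl⟩ := this
      obtain ⟨s, hs', e⟩ := ee_surj (z := z * ee (-α)) (by rw [norm_mul, norm_ee, mem_sphere_zero_iff_norm.1 hz, one_mul])
      have e' : ee (α + s) = z := by
        rw [ee_add, e, mul_comm, mul_assoc, ← ee_add, neg_add_cancel, ee_zero, mul_one]
      grind
    have key : ∀ y ∈ connectedComponentIn (G \ V) (F (ee t)), y ∉ (fun s => F (ee s)) '' Icc β (α + 1) := by
      intro y hy hB
      obtain ⟨x, hxS, ⟨a, ha, rfl⟩, ⟨b, hb, e⟩⟩ := isPreconnected_closed_iff.1 hpre _ _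
        (isCompact_Icc.image hFe).isClosed (isCompact_Icc.image hFe).isClosed hcov
        ⟨_, hmem, t, ⟨ht.1.le, ht.2.le⟩, rfl⟩ ⟨y, hy, hB⟩
      apply (hsub hxS).2
      obtain ⟨k, hk⟩ := ee_eq.1 (hF.inj (sphere_subset_closedBall (hs b)) (sphere_subset_closedBall (hs a)) e)
      have hk1 : (-1:ℝ) < k := by linarith [hb.1, ha.2]
      have hk1' : (-1:ℤ) < k := by exact_mod_cast hk1
      have hk2 : (k:ℝ) ≤ 1 := by linarith [hb.2, ha.1]
      have hk2' : k ≤ 1 := by exact_mod_cast hk2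
      have : k = 0 ∨ k = 1 := by omega
      rcases this with rfl | rfl
      · grind
      · grind
    grind
  · refine (isPreconnected_Ioo.image _ hFe.continuousOn).subset_connectedComponentIn ⟨t, ht, rfl⟩ ?_
    rintro _ ⟨s, hs', rfl⟩
    exact ⟨h.frontG hC (hfr s), hn s hs'⟩

def Lbl (G V : Set X) : Set (Set X) := {l | ∃ x ∈ G \ V, l = connectedComponentIn (G \ V) x}

theorem Ctx.bdry (h : Ctx G V) {C : Set X} (hC : C ∈ Fcs G) : ∃ n : ℕ, 2 ≤ n ∧ ∃ p : ℕ → ℝ → X,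
    (∀ k < n, Arc V (p k) (p k '' Ioo 0 1) ∧ p k '' Ioo 0 1 ∈ Lbl G V) ∧ (∀ k < n, p k 1 = p (k + 1) 0) ∧ p n 0 = p 0 0 ∧
    (∀ k < n, ∀ j < n, ∀ s ∈ Ico (0:ℝ) 1, ∀ t ∈ Ico (0:ℝ) 1, p k s = p j t → k = j ∧ s = t) ∧
    (∀ x, x ∈ frontier C ↔ ∃ k < n, ∃ t ∈ Ico (0:ℝ) 1, p k t = x) := by
  obtain ⟨F, hF⟩ := h.face' hC
  have hs : ∀ s, ee s ∈ sphere (0:ℂ) 1 := fun s => mem_sphere_zero_iff_norm.2 (norm_ee s)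
  have hfr : ∀ s, F (ee s) ∈ frontier C := fun s => hF.sphere ▸ mem_image_of_mem F (hs s)
  have hFe : Continuous fun s => F (ee s) := hF.cont.comp_continuous ee_cont fun s => sphere_subset_closedBall (hs s)
  obtain ⟨n, hn, θ, hθ, hθn, hS⟩ := subdiv (S := {z | z ∈ sphere (0:ℂ) 1 ∧ F z ∈ V})
    (by
      refine Finite.of_finite_image (f := F) (h.good.fin.subset ?_) fun x hx y hy e =>
        hF.inj (sphere_subset_closedBall hx.1) (sphere_subset_closedBall hy.1) e
      rintro _ ⟨z, hz, rfl⟩; exact hz.2)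
    (by
      obtain ⟨v, hv, hvV, -⟩ := h.two_vert hC (F (ee 0))
      obtain ⟨v', hv', hvV', hne⟩ := h.two_vert hC v
      rw [← hF.sphere] at hv hv'
      obtain ⟨z, hz, rfl⟩ := hv
      obtain ⟨z', hz', rfl⟩ := hv'
      exact ⟨z', ⟨hz', hvV'⟩, z, ⟨hz, hvV⟩, fun e => hne (by rw [e])⟩)
    (fun z hz => mem_sphere_zero_iff_norm.1 hz.1)
  have hmono : ∀ j k, k ≤ j → j ≤ n → θ k ≤ θ j := by
    intro j
    induction j with
    | zero => intro k hk _; rw [Nat.le_zero.1 hk]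
    | succ j ih =>
      intro k hk hj
      rcases Nat.lt_or_ge j k with h' | h'
      · rw [show k = j + 1 by omega]
      · exact (ih k h' (by omega)).trans (hθ j (by omega)).le
  have hinj : ∀ s ∈ Ico (θ 0) (θ 0 + 1), ∀ t ∈ Ico (θ 0) (θ 0 + 1), F (ee s) = F (ee t) → s = t := by
    intro s hs1 t ht1 e
    obtain ⟨k, hk⟩ := ee_eq.1 (hF.inj (sphere_subset_closedBall (hs s)) (sphere_subset_closedBall (hs t)) e)
    have h1 : (k:ℝ) < 1 := by linarith [hs1.2, ht1.1]
    have h2 : (-1:ℝ) < k := by linarith [hs1.1, ht1.2]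
    have h1' : k < 1 := by exact_mod_cast h1
    have h2' : -1 < k := by exact_mod_cast h2
    rw [show k = 0 by omega] at hk; simpa using hk
  have hI : ∀ k < n, ∀ t, θ k ≤ t → t < θ (k + 1) → t ∈ Ico (θ 0) (θ 0 + 1) := fun k hk t h1 h2 =>
    ⟨(hmono k 0 (by omega) hk.le).trans h1, hθn ▸ h2.trans_le (hmono n (k + 1) (by omega) le_rfl)⟩
  have huniq : ∀ k < n, ∀ j < n, ∀ t, θ k ≤ t → t < θ (k + 1) → θ j ≤ t → t < θ (j + 1) → k = j := by
    grind
  have hV0 : ∀ k < n, F (ee (θ k)) ∈ V := fun k hk => ((hS _).2 ⟨k, hk, rfl⟩).2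
  have hen : ee (θ n) = ee (θ 0) := by rw [hθn]; exact_mod_cast ee_add_int (θ 0) 1
  have hV : ∀ k ≤ n, F (ee (θ k)) ∈ V := by
    grind
  have hnV : ∀ k < n, ∀ t ∈ Ioo (θ k) (θ (k + 1)), F (ee t) ∉ V := by
    intro k hk t ht hV
    obtain ⟨j, hj, e⟩ := (hS (ee t)).1 ⟨hs t, hV⟩
    grind
  have hd : ∀ k < n, θ (k + 1) < θ k + 1 := by
    grind
  set p : ℕ → ℝ → X := fun k t => F (ee (θ k + t * (θ (k + 1) - θ k))) with hp
  have hIco : ∀ k < n, ∀ t ∈ Ico (0:ℝ) 1, θ k ≤ θ k + t * (θ (k + 1) - θ k) ∧ θ k + t * (θ (k + 1) - θ k) < θ (k + 1) := by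
    intro k hk t ht
    have := hθ k hk
    constructor <;> nlinarith [ht.1, ht.2]
  have himg : ∀ k < n, p k '' Ioo 0 1 = (fun s => F (ee s)) '' Ioo (θ k) (θ (k + 1)) := by
    intro k hk
    have h0 : 0 < θ (k + 1) - θ k := sub_pos.2 (hθ k hk)
    ext x
    constructor
    · rintro ⟨t, ht, rfl⟩
      exact ⟨_, ⟨by nlinarith [ht.1], by nlinarith [ht.2]⟩, rfl⟩
    · rintro ⟨s, hs', rfl⟩
      refine ⟨(s - θ k) / (θ (k + 1) - θ k), ⟨div_pos (by linarith [hs'.1]) h0, (div_lt_one h0).2 (by linarith [hs'.2])⟩, ?_⟩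
      simp only [hp]
      rw [div_mul_cancel₀ _ h0.ne', add_sub_cancel]
  have hi : ∀ k < n, ∀ j < n, ∀ s ∈ Ico (0:ℝ) 1, ∀ t ∈ Ico (0:ℝ) 1, p k s = p j t → k = j ∧ s = t := by
    intro k hk j hj s hs' t ht e
    have a := hIco k hk s hs'
    have b := hIco j hj t ht
    grind
  have h10 : ∀ k, p k 1 = F (ee (θ (k + 1))) := fun k => by simp [hp]
  have h00 : ∀ k, p k 0 = F (ee (θ k)) := fun k => by simp [hp]
  refine ⟨n, hn, p, ?_, ?_, ?_, hi, ?_⟩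
  · intro k hk
    have hm : (θ k + θ (k + 1)) / 2 ∈ Ioo (θ k) (θ (k + 1)) := ⟨by linarith [hθ k hk], by linarith [hθ k hk]⟩
    have hE := h.edge hC hF (hθ k hk) (hd k hk) (hV k hk.le) (hV (k + 1) hk) (hnV k hk) hm
    have hc : Continuous (p k) := hFe.comp (g := fun s => F (ee s)) (f := fun t => θ k + t * (θ (k + 1) - θ k)) (by fun_prop)
    refine ⟨⟨hc.continuousOn, ?_, rfl, by rw [h00]; exact hV k hk.le, by rw [h10]; exact hV (k + 1) hk, ?_⟩,
      ⟨_, ⟨h.frontG hC (hfr _), hnV k hk _ hm⟩, by rw [hE, himg k hk]⟩⟩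
    · intro s hs' t ht e
      obtain ⟨m, hm⟩ := ee_eq.1 (hF.inj (sphere_subset_closedBall (hs _)) (sphere_subset_closedBall (hs _)) e)
      have h1 := hd k hk
      have h2 := hθ k hk
      have a1 : s * (θ (k + 1) - θ k) ≤ θ (k + 1) - θ k := mul_le_of_le_one_left (by linarith) hs'.2
      have a2 : t * (θ (k + 1) - θ k) ≤ θ (k + 1) - θ k := mul_le_of_le_one_left (by linarith) ht.2
      have a3 := mul_nonneg hs'.1 (sub_pos.2 h2).le
      have a4 := mul_nonneg ht.1 (sub_pos.2 h2).le
      have b1 : (m:ℝ) < 1 := by linarith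
      have b2 : (-1:ℝ) < m := by linarith
      have b1' : m < 1 := by exact_mod_cast b1
      have b2' : -1 < m := by exact_mod_cast b2
      rw [show m = 0 by omega] at hm
      grind
    · rw [himg k hk]; rintro _ ⟨s, hs', rfl⟩; exact hnV k hk s hs'
  · intro k _; rw [h10, h00]
  · rw [h00, h00, hen]
  · intro x
    constructor
    · rw [← hF.sphere]
      rintro ⟨z, hz, rfl⟩
      obtain ⟨s, hs', e⟩ := ee_surj (z := z * ee (-θ 0)) (by rw [norm_mul, norm_ee, mem_sphere_zero_iff_norm.1 hz, one_mul])
      have e' : ee (θ 0 + s) = z := by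
        rw [ee_add, e, mul_comm, mul_assoc, ← ee_add, neg_add_cancel, ee_zero, mul_one]
      obtain ⟨k, hk, h1, h2⟩ := locate θ n (t := θ 0 + s) (by linarith [hs'.1]) (by linarith [hs'.2])
      have h0 := sub_pos.2 (hθ k hk)
      refine ⟨k, hk, (θ 0 + s - θ k) / (θ (k + 1) - θ k), ⟨div_nonneg (by linarith) h0.le, (div_lt_one h0).2 (by linarith)⟩, ?_⟩
      simp only [hp]
      rw [div_mul_cancel₀ _ h0.ne', add_sub_cancel, e']
    · rintro ⟨k, hk, t, ht, rfl⟩; exact hfr _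
end

section
variable {X : Type} [TopologicalSpace X] [T2Space X] [CompactSpace X] {G V : Set X}

theorem lbl_eq {l : Set X} (hl : l ∈ Lbl G V) {y : X} (hy : y ∈ l) : l = connectedComponentIn (G \ V) y := by
  obtain ⟨x, -, rfl⟩ := hl
  exact (connectedComponentIn_eq hy)

theorem lbl_sub {l : Set X} (hl : l ∈ Lbl G V) : l ⊆ G \ V := by
  obtain ⟨x, -, rfl⟩ := hl
  exact connectedComponentIn_subset _ _

theorem lbl_front (h : Ctx G V) {l C : Set X} (hl : l ∈ Lbl G V) (hC : C ∈ Fcs G) (hne : (l ∩ frontier C).Nonempty) : l ⊆ frontier C := by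
  refine h.sub_front hC ?_ (fun x hx => (lbl_sub hl hx).1) hne fun x hx _ => (lbl_sub hl hx).2
  obtain ⟨x, -, rfl⟩ := hl
  exact isPreconnected_connectedComponentIn

theorem lbl_ex {C : Set X} {n : ℕ} {p : ℕ → ℝ → X}
    (h1 : ∀ k < n, Arc V (p k) (p k '' Ioo 0 1) ∧ p k '' Ioo 0 1 ∈ Lbl G V)
    (h5 : ∀ x, x ∈ frontier C ↔ ∃ k < n, ∃ t ∈ Ico (0:ℝ) 1, p k t = x) {l : Set X} (hl : l ∈ Lbl G V)
    (hne : (l ∩ frontier C).Nonempty) : ∃ k < n, p k '' Ioo 0 1 = l := by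
  obtain ⟨x, hx, hxC⟩ := hne
  obtain ⟨k, hk, t, ht, rfl⟩ := (h5 _).1 hxC
  have ht0 : t ≠ 0 := by rintro rfl; exact (lbl_sub hl hx).2 (h1 k hk).1.v0
  refine ⟨k, hk, ?_⟩
  rw [lbl_eq hl hx, lbl_eq (h1 k hk).2 (mem_image_of_mem (p k) ⟨lt_of_le_of_ne ht.1 ht0.symm, ht.2⟩)]

theorem lbl_cover (h : Ctx G V) {l : Set X} (hl : l ∈ Lbl G V) : ∃ C ∈ Fcs G, (l ∩ frontier C).Nonempty := by
  obtain ⟨x, hx, rfl⟩ := hl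
  obtain ⟨C, hC, hxC⟩ := h.cover x
  exact ⟨C, hC, x, mem_connectedComponentIn hx, (h.front hC).2 ⟨hxC, hx.1⟩⟩

theorem lbl_arc (h : Ctx G V) {l : Set X} (hl : l ∈ Lbl G V) : ∃ p, Arc V p l := by
  obtain ⟨C, hC, hne⟩ := lbl_cover h hl
  obtain ⟨n, -, p, h1, -, -, -, h5⟩ := h.bdry hC
  obtain ⟨k, hk, rfl⟩ := lbl_ex h1 h5 hl hne
  exact ⟨p k, (h1 k hk).1⟩

theorem lbl_fin (h : Ctx G V) : (Lbl G V).Finite := by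
  refine (h.finF.biUnion (t := fun C => {l | l ∈ Lbl G V ∧ (l ∩ frontier C).Nonempty}) fun C hC => ?_).subset ?_
  · obtain ⟨n, -, p, h1, -, -, -, h5⟩ := h.bdry hC
    refine ((Set.finite_lt_nat n).image fun k => p k '' Ioo 0 1).subset ?_
    rintro l ⟨hl, hne⟩
    obtain ⟨k, hk, e⟩ := lbl_ex h1 h5 hl hne
    exact ⟨k, hk, e⟩
  · intro l hl
    obtain ⟨C, hC, hne⟩ := lbl_cover h hl
    exact mem_iUnion₂.2 ⟨C, hC, hl, hne⟩

theorem face_word (h : Ctx G V) {ψ : Set X → ℝ → X} (hψ : ∀ l ∈ Lbl G V, Arc V (ψ l) l) {nm : Set X → ℕ}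
    (hnm : InjOn nm (Lbl G V)) {C : Set X} (hC : C ∈ Fcs G) : ∃ (u : Word) (F : ℂ → X), Face F C ∧ 2 ≤ u.length ∧
    (lab u).Nodup ∧ (∀ a ∈ lab u, ∃ l ∈ Lbl G V, nm l = a ∧ (l ∩ frontier C).Nonempty) ∧
    (∀ l ∈ Lbl G V, (l ∩ frontier C).Nonempty → nm l ∈ lab u ∧ ∀ t ∈ Icc (0:ℝ) 1, ∃ z, On u (nm l) t z) ∧
    ∀ l ∈ Lbl G V, ∀ t ∈ Icc (0:ℝ) 1, ∀ z, On u (nm l) t z → F z = ψ l t := by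
  obtain ⟨n, hn, p, h1, h2, h3, h4, h5⟩ := h.bdry hC
  have hflip : ∀ k, ∃ b, k < n → ψ (p k '' Ioo 0 1) (tb b 0) = p k 0 ∧ ψ (p k '' Ioo 0 1) (tb b 1) = p k 1 := by
    intro k
    by_cases hk : k < n
    · obtain ⟨b, hb⟩ := (h1 k hk).1.flip (hψ _ (h1 k hk).2)
      exact ⟨b, fun _ => hb⟩
    · exact ⟨true, fun h => (hk h).elim⟩
  choose b hb using hflip
  set η : ℕ → ℝ → X := fun k t => if k = n then p n 0 else ψ (p k '' Ioo 0 1) (tb (b k) t) with hη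
  have hηk : ∀ k < n, ∀ t, η k t = ψ (p k '' Ioo 0 1) (tb (b k) t) := fun k hk t => by simp [hη, hk.ne]
  have hη0 : ∀ k ≤ n, η k 0 = p k 0 := by
    grind
  have htb : ∀ (b : Bool) (t : ℝ), t ∈ Ioo (0:ℝ) 1 → tb b t ∈ Ioo (0:ℝ) 1 := by
    intro b t ht; unfold tb; split_ifs <;> grind
  have hηim : ∀ k < n, η k '' Ioo 0 1 = p k '' Ioo 0 1 := by
    intro k hk
    conv_rhs => rw [← (hψ _ (h1 k hk).2).img]
    ext x
    constructor
    · rintro ⟨t, ht, rfl⟩; exact ⟨tb (b k) t, htb _ _ ht, (hηk k hk t).symm⟩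
    · rintro ⟨t, ht, rfl⟩; exact ⟨tb (b k) t, htb _ _ ht, by rw [hηk k hk, tb_tb]⟩
  have hηI : ∀ k < n, ∀ t ∈ Ico (0:ℝ) 1, ∃ s ∈ Ico (0:ℝ) 1, η k t = p k s := by
    intro k hk t ht
    rcases eq_or_lt_of_le ht.1 with rfl | h0
    · exact ⟨0, by simp, hη0 k hk.le⟩
    · have : η k t ∈ p k '' Ioo 0 1 := hηim k hk ▸ mem_image_of_mem _ ⟨h0, ht.2⟩
      obtain ⟨s, hs, e⟩ := this
      exact ⟨s, ⟨hs.1.le, hs.2⟩, e.symm⟩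
  have hinj : ∀ k < n, InjOn (η k) (Icc 0 1) := by
    intro k hk s hs t ht e
    rw [hηk k hk, hηk k hk] at e
    have := (hψ _ (h1 k hk).2).inj (tb_mem hs) (tb_mem ht) e
    rw [← tb_tb (b k) s, this, tb_tb]
  have hl : ∀ k < n, ∀ j < n, p k '' Ioo 0 1 = p j '' Ioo 0 1 → k = j := by
    intro k hk j hj e
    have : p k (1 / 2) ∈ p j '' Ioo 0 1 := e ▸ mem_image_of_mem _ (by norm_num)
    obtain ⟨s, hs, e'⟩ := this
    exact (h4 k hk j hj (1 / 2) (by norm_num) s ⟨hs.1.le, hs.2⟩ e'.symm).1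
  obtain ⟨F, hF, hFη⟩ := repar (C := C) (h.face' hC).choose_spec (n := n) (by omega) η
    (fun k hk => (((hψ _ (h1 k hk).2).cont.comp (f := tb (b k)) (by unfold tb; split_ifs <;> fun_prop) fun t ht => tb_mem ht)).congr
      fun t _ => hηk k hk t)
    (fun k hk => by rw [hη0 (k + 1) hk, hηk k hk, (hb k hk).2, h2 k hk])
    (by rw [hη0 n le_rfl, hη0 0 (by omega), h3])
    (by
      intro k hk j hj s hs t ht e
      obtain ⟨s', hs', es⟩ := hηI k hk s hs
      obtain ⟨t', ht', et⟩ := hηI j hj t ht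
      obtain ⟨rfl, -⟩ := h4 k hk j hj s' hs' t' ht' (by rw [← es, ← et, e])
      exact ⟨rfl, hinj k hk ⟨hs.1, hs.2.le⟩ ⟨ht.1, ht.2.le⟩ e⟩)
    (by
      intro x
      rw [h5]
      constructor
      · rintro ⟨k, hk, t, ht, rfl⟩
        rcases eq_or_lt_of_le ht.1 with rfl | h0
        · exact ⟨k, hk, 0, by simp, hη0 k hk.le⟩
        · have : p k t ∈ η k '' Ioo 0 1 := hηim k hk ▸ mem_image_of_mem _ ⟨h0, ht.2⟩
          obtain ⟨s, hs, e⟩ := this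
          exact ⟨k, hk, s, ⟨hs.1.le, hs.2⟩, e⟩
      · rintro ⟨k, hk, t, ht, rfl⟩
        obtain ⟨s, hs, e⟩ := hηI k hk t ht
        exact ⟨k, hk, s, hs, e.symm⟩)
  set f : Fin n → ℕ × Bool := fun k => (nm (p k '' Ioo 0 1), b k) with hf
  have hlab : lab (List.ofFn f) = List.ofFn fun k : Fin n => nm (p k '' Ioo 0 1) := by
    rw [lab, List.map_ofFn]; rfl
  have hOn : ∀ k : Fin n, ∀ t, On (List.ofFn f) (nm (p k '' Ioo 0 1)) t (ee ((k + tb (b k) t) / n)) := fun k t =>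
    ⟨k + tb (b k) t, (OnAt_ofFn f _ _ _).2 ⟨k, rfl, rfl⟩, by rw [List.length_ofFn]⟩
  refine ⟨List.ofFn f, F, hF, by rw [List.length_ofFn]; exact hn, ?_, ?_, ?_, ?_⟩
  · rw [hlab, List.nodup_ofFn]
    intro k j e
    exact Fin.ext (hl k k.2 j j.2 (hnm (h1 k k.2).2 (h1 j j.2).2 e))
  · intro a ha
    rw [hlab, List.mem_ofFn] at ha
    obtain ⟨k, rfl⟩ := ha
    exact ⟨_, (h1 k k.2).2, rfl, p k (1 / 2), mem_image_of_mem _ (by norm_num), (h5 _).2 ⟨k, k.2, 1 / 2, by norm_num, rfl⟩⟩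
  · intro l hl' hne
    obtain ⟨k, hk, rfl⟩ := lbl_ex h1 h5 hl' hne
    exact ⟨by rw [hlab, List.mem_ofFn]; exact ⟨⟨k, hk⟩, rfl⟩, fun t _ => ⟨_, hOn ⟨k, hk⟩ t⟩⟩
  · rintro l hl' t ht z ⟨s, hs, rfl⟩
    obtain ⟨k, e, rfl⟩ := (OnAt_ofFn f _ _ _).1 hs
    rw [← hnm (h1 k k.2).2 hl' e, List.length_ofFn, hFη k k.2 _ (tb_mem ht), hηk k k.2, tb_tb]

theorem pres_of (h : Ctx G V) [Nonempty X] : ∃ (ι : Type) (_ : Fintype ι) (w : ι → Word), Nonempty ι ∧ (∀ i, 2 ≤ (w i).length) ∧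
    (∀ a, ∑ i, (lab (w i)).count a = 0 ∨ ∑ i, (lab (w i)).count a = 2) ∧ Pres X w := by
  classical
  have : ∀ l, ∃ p, l ∈ Lbl G V → Arc V p l := by
    intro l
    by_cases hl : l ∈ Lbl G V
    · exact ⟨_, fun _ => (lbl_arc h hl).choose_spec⟩
    · simp_all
  choose ψ hψ using this
  obtain ⟨nm, hnm⟩ := countable_iff_exists_injOn.1 (lbl_fin h).countable
  choose w F hF hw hnd hlab hl hon using fun C : Fcs G => face_word h hψ hnm C.2
  have : Finite (Fcs G) := h.finF
  let hFt : Fintype (Fcs G) := Fintype.ofFinite _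
  have hon' : ∀ (C : Fcs G) l, l ∈ Lbl G V → (l ∩ frontier (C : Set X)).Nonempty → ∀ t ∈ Icc (0:ℝ) 1, ∀ z : D, F C z = ψ l t →
      OnP w (nm l) t ⟨C, z⟩ := by
    intro C l hl' hne t ht z e
    obtain ⟨z', hz'⟩ := (hl C l hl' hne).2 t ht
    have hz1 : z' ∈ closedBall (0:ℂ) 1 := by
      obtain ⟨s, -, rfl⟩ := hz'
      exact sphere_subset_closedBall (mem_sphere_zero_iff_norm.2 (norm_ee _))
    rw [← hon C l hl' t ht z' hz'] at e
    have := (hF C).inj z.2 hz1 e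
    rw [← this] at hz'
    exact hz'
  have hclos : ∀ C : Fcs G, F C '' closedBall 0 1 = closure (C : Set X) := by
    intro C
    rw [closure_eq_self_union_frontier, ← ball_union_sphere, image_union, (hF C).ball, (hF C).sphere]
  have hD : ∀ (C : Fcs G) {x}, x ∈ closure (C : Set X) → ∃ z : D, F C z = x := by
    intro C x hx
    rw [← hclos] at hx
    obtain ⟨z, hz, e⟩ := hx
    exact ⟨⟨z, hz⟩, e⟩
  have hD' : ∀ (C : Fcs G) (z : D), F C z ∈ closure (C : Set X) := fun C z => hclos C ▸ mem_image_of_mem _ z.2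
  have hin : ∀ (C : Fcs G) (z z' : D), F C z = F C z' → z = z' := fun C z z' e => Subtype.ext ((hF C).inj z.2 z'.2 e)
  refine ⟨Fcs G, hFt, w, ?_, hw, ?_, fun p => F p.1 p.2, ?_, ?_⟩
  · obtain ⟨C, hC, -⟩ := h.cover (Classical.arbitrary X)
    exact ⟨⟨C, hC⟩⟩
  · intro a
    by_cases ha : ∃ l ∈ Lbl G V, nm l = a
    · right
      obtain ⟨l, hl', rfl⟩ := ha
      obtain ⟨x, hx, hxl⟩ := id hl'
      have hxm : x ∈ l := hxl ▸ mem_connectedComponentIn hx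
      obtain ⟨C1, hC1, C2, hC2, hne, hp⟩ := h.pair hx.1 hx.2
      have hcnt : ∀ C : Fcs G, (lab (w C)).count (nm l) = if C = ⟨C1, hC1⟩ ∨ C = ⟨C2, hC2⟩ then 1 else 0 := by
        intro C
        rw [(hnd C).count]
        refine if_congr ?_ rfl rfl
        rw [Subtype.ext_iff, Subtype.ext_iff, ← hp C C.2]
        constructor
        · intro hm
          obtain ⟨l', hl1, e, hne'⟩ := hlab C _ hm
          rw [hnm hl1 hl' e] at hne'
          exact frontier_subset_closure (lbl_front h hl' C.2 hne' hxm)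
        · intro hm
          exact (hl C l hl' ⟨x, hxm, (h.front C.2).2 ⟨hm, hx.1⟩⟩).1
      simp only [hcnt]
      rw [Finset.sum_boole, Finset.filter_or, Finset.filter_eq', Finset.filter_eq', if_pos (Finset.mem_univ _), if_pos (Finset.mem_univ _),
        Finset.card_union_of_disjoint (by simpa using hne)]
      simp
    · left
      refine Finset.sum_eq_zero fun C _ => List.count_eq_zero.2 fun hm => ha ?_
      obtain ⟨l, hl', e, -⟩ := hlab C a hm
      exact ⟨l, hl', e⟩
  · refine IsQuotientMap.of_surjective_continuous ?_ ?_
    · intro x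
      obtain ⟨C, hC, hx⟩ := h.cover x
      obtain ⟨z, e⟩ := hD ⟨C, hC⟩ hx
      exact ⟨⟨⟨C, hC⟩, z⟩, e⟩
    · exact continuous_sigma fun C => continuousOn_iff_continuous_domRestrict.1 (hF C).cont
  · rintro p p'
    constructor
    · intro e
      change F p.1 p.2 = F p'.1 p'.2 at e
      obtain ⟨C, z⟩ := p
      obtain ⟨C', z'⟩ := p'
      have hy := hD' C z
      have hy' := hD' C' z'
      simp only at e
      rw [← e] at hy'
      by_cases hG : F C z ∈ G
      swap
      · have : C = C' := Subtype.ext (by rw [fcs_eq C.2 (h.clos C.2 hy hG), fcs_eq C'.2 (h.clos C'.2 hy' hG)])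
        subst this
        rw [hin C z z' e]
        exact .refl _
      by_cases hV : F C z ∈ V
      swap
      · have hlm : connectedComponentIn (G \ V) (F C z) ∈ Lbl G V := ⟨_, ⟨hG, hV⟩, rfl⟩
        have hm := mem_connectedComponentIn (F := G \ V) ⟨hG, hV⟩
        have hm' := hm
        rw [← (hψ _ hlm).img] at hm'
        obtain ⟨t, ht, et⟩ := hm'
        have ht' : t ∈ Icc (0:ℝ) 1 := ⟨ht.1.le, ht.2.le⟩
        exact .rel _ _ ⟨_, t, ht', hon' C _ hlm ⟨_, hm, (h.front C.2).2 ⟨hy, hG⟩⟩ t ht' z et.symm,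
          hon' C' _ hlm ⟨_, hm, (h.front C'.2).2 ⟨hy', hG⟩⟩ t ht' z' (e.symm.trans et.symm)⟩
      set v := F C z with hv
      set A : Set (Fcs G) := {C' | ∃ z' : D, F C' z' = v ∧ EqvGen (RR w) ⟨C, z⟩ ⟨C', z'⟩} with hA
      suffices hCA : C' ∈ A by
        obtain ⟨z1, e1, h1⟩ := hCA
        rwa [hin C' z1 z' (e1.trans e)] at h1
      by_contra hCA
      have hO : ((V \ {v}) ∪ (⋃ C1 ∈ {C1 | C1 ∈ Fcs G ∧ v ∉ closure C1}, closure C1) ∪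
          (⋃ l ∈ {l | l ∈ Lbl G V ∧ v ∉ closure l}, closure l))ᶜ ∈ 𝓝 v := by
        refine IsOpen.mem_nhds (isOpen_compl_iff.2 (((h.good.fin.subset sdiff_subset).isClosed.union ?_).union ?_)) ?_
        · exact (h.finF.subset fun C hC => hC.1).isClosed_biUnion fun _ _ => isClosed_closure
        · exact ((lbl_fin h).subset fun C hC => hC.1).isClosed_biUnion fun _ _ => isClosed_closure
        · rintro ((hx | hx) | hx)
          · exact hx.2 rfl
          · obtain ⟨C1, hC1, hx⟩ := mem_iUnion₂.1 hx
            exact hC1.2 hx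
          · obtain ⟨C1, hC1, hx⟩ := mem_iUnion₂.1 hx
            exact hC1.2 hx
      obtain ⟨c, hc, hc0, hcO⟩ := h.le v _ hO
      have hW : IsPreconnected (c '' {0}ᶜ) :=
        (isConnected_compl_singleton_of_one_lt_rank (by rw [rank_real_complex]; norm_num) 0).isPreconnected.image _ hc.continuous.continuousOn
      have hmeet : ∀ C1 : Fcs G, v ∈ closure (C1 : Set X) → (c '' {0}ᶜ ∩ closure (C1 : Set X)).Nonempty := by
        intro C1 h1
        obtain ⟨y, ⟨a, rfl⟩, hy⟩ := mem_closure_iff.1 h1 _ hc.isOpen_range ⟨0, hc0⟩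
        refine ⟨c a, ⟨a, ?_, rfl⟩, subset_closure hy⟩
        rintro rfl
        rw [hc0] at hy
        exact fcs_notG C1.2 hy hG
      have hcl : ∀ S : Set (Fcs G), IsClosed (⋃ C1 ∈ S, closure (C1 : Set X)) := fun S =>
        S.toFinite.isClosed_biUnion fun _ _ => isClosed_closure
      obtain ⟨_, ⟨a, ha, rfl⟩, hy1, hy2⟩ := isPreconnected_closed_iff.1 hW _ _ (hcl A) (hcl Aᶜ)
        (by
          intro y _
          obtain ⟨C1, hC1, hyC⟩ := h.cover y
          by_cases hm : (⟨C1, hC1⟩ : Fcs G) ∈ A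
          · exact Or.inl (mem_iUnion₂.2 ⟨_, hm, hyC⟩)
          · exact Or.inr (mem_iUnion₂.2 ⟨_, hm, hyC⟩))
        (by
          obtain ⟨y, hy⟩ := hmeet C hy
          exact ⟨y, hy.1, mem_iUnion₂.2 ⟨C, ⟨z, rfl, .refl _⟩, hy.2⟩⟩)
        (by
          obtain ⟨y, hy⟩ := hmeet C' hy'
          exact ⟨y, hy.1, mem_iUnion₂.2 ⟨C', hCA, hy.2⟩⟩)
      obtain ⟨C1, hC1, hy1⟩ := mem_iUnion₂.1 hy1
      obtain ⟨C2, hC2, hy2⟩ := mem_iUnion₂.1 hy2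
      have hyO := hcO (mem_range_self a)
      have hav : c a ≠ v := fun e => ha (hc.injective (e.trans hc0.symm))
      have hyG : c a ∈ G := by
        by_contra hG
        exact hC2 ((Subtype.ext (by rw [fcs_eq C1.2 (h.clos C1.2 hy1 hG), fcs_eq C2.2 (h.clos C2.2 hy2 hG)]) : C1 = C2) ▸ hC1)
      have hyV : c a ∉ V := fun hm => hyO (Or.inl (Or.inl ⟨hm, hav⟩))
      have hlm : connectedComponentIn (G \ V) (c a) ∈ Lbl G V := ⟨_, ⟨hyG, hyV⟩, rfl⟩
      have hm := mem_connectedComponentIn (F := G \ V) ⟨hyG, hyV⟩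
      have hvl : v ∈ closure (connectedComponentIn (G \ V) (c a)) := by
        by_contra hn
        exact hyO (Or.inr (mem_iUnion₂.2 ⟨_, ⟨hlm, hn⟩, subset_closure hm⟩))
      have hv2 : v ∈ closure (C2 : Set X) := by
        by_contra hn
        exact hyO (Or.inl (Or.inr (mem_iUnion₂.2 ⟨_, ⟨C2.2, hn⟩, hy2⟩)))
      rw [(hψ _ hlm).clos] at hvl
      obtain ⟨t, ht, et⟩ := hvl
      obtain ⟨z1, e1, h1⟩ := hC1
      obtain ⟨z2, e2⟩ := hD C2 hv2
      exact hC2 ⟨z2, e2, .trans _ _ _ h1 (.rel _ _ ⟨_, t, ht,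
        hon' C1 _ hlm ⟨_, hm, (h.front C1.2).2 ⟨hy1, hyG⟩⟩ t ht z1 (e1.trans et.symm),
        hon' C2 _ hlm ⟨_, hm, (h.front C2.2).2 ⟨hy2, hyG⟩⟩ t ht z2 (e2.trans et.symm)⟩)⟩
    · intro hE
      induction hE with
      | rel x y hr =>
        obtain ⟨a, t, ht, h1, h2⟩ := hr
        obtain ⟨s, hs, -⟩ := id h1
        obtain ⟨l, hl', rfl, -⟩ := hlab x.1 a hs.mem
        exact (hon x.1 l hl' t ht _ h1).trans (hon y.1 l hl' t ht _ h2).symm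
      | refl x => rfl
      | symm x y _ ih => exact ih.symm
      | trans x y z _ _ ih1 ih2 => exact ih1.trans ih2

theorem final (X : Type) [tX : TopologicalSpace X] (hX : IsSurface X) : Nonempty (X ≃ₜ Sphere2) ∨
    (∃ n : ℕ, 1 ≤ n ∧ IsConnSumOfCopies Torus n X tX) ∨ (∃ n : ℕ, 1 ≤ n ∧ IsConnSumOfCopies RP2 n X tX) := by
  have : T2Space X := hX.1
  have : CompactSpace X := hX.2.1
  have : ConnectedSpace X := hX.2.2.1
  obtain ⟨G, V, hG, hf⟩ := graph_exists hX
  obtain ⟨ι, hι, w, hne, hl, hc, hp⟩ := pres_of ⟨hG, le_of_surface hX, hf⟩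
  obtain ⟨n, hn⟩ := Nat.exists_eq_succ_of_ne_zero (Fintype.card_pos (α := ι)).ne'
  obtain ⟨u, hu, hv, hw⟩ := merge n ι w hn hl hc hp
  exact classify hv hu hw
end

end CS

/-- every compact connected real surface is homeomorphic to the 2-sphere,
a connected sum of finitely many tori, or a connected sum of finitely many real projective
planes. -/
theorem classification_of_surfaces (X : Type) [tX : TopologicalSpace X] (hX : IsSurface X) :
    Nonempty (X ≃ₜ Sphere2) ∨
    (∃ n : ℕ, 1 ≤ n ∧ IsConnSumOfCopies Torus n X tX) ∨
    (∃ n : ℕ, 1 ≤ n ∧ IsConnSumOfCopies RP2 n X tX) := by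
  exact CS.final X hX
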